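/- The unique indecomposable unimodular hermitian 𝓞-lattice of rank 14 without roots has automorphism group of order 2⁸·3⁷·7·13 = 50948352. -/

import Mathlib

noncomputable section
open Matrix Complex
open scoped ComplexOrder

/-- A primitive cube root of unity in `ℂ`. -/
def ω : ℂ := ⟨-1/2, Real.sqrt 3 / 2⟩

/-- The ring of Eisenstein integers `𝓞 = ℤ[ω]`, the ring of integers of `ℚ(√-3)`,
realized as a subalgebra of `ℂ` (so that complex conjugation is available). -/
def 𝓞 : Subalgebra ℤ ℂ := Algebra.adjoin ℤ {ω}

/-- All entries of the matrix are Eisenstein integers. -/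
def EntriesIn {n : ℕ} (H : Matrix (Fin n) (Fin n) ℂ) : Prop := ∀ i j, H i j ∈ 𝓞

/-- `U ∈ GLₙ(𝓞)`: entries in `𝓞`, with a two-sided inverse having entries in `𝓞`. -/
def InGL {n : ℕ} (U : Matrix (Fin n) (Fin n) ℂ) : Prop :=
  EntriesIn U ∧ ∃ V : Matrix (Fin n) (Fin n) ℂ, EntriesIn V ∧ U * V = 1 ∧ V * U = 1

/-- `H` is the Gram matrix of a hermitian `𝓞`-lattice of rank `n`:
entries in `𝓞`, equal to its conjugate transpose, positive definite as a complex matrix. -/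
def IsHermLattice {n : ℕ} (H : Matrix (Fin n) (Fin n) ℂ) : Prop :=
  EntriesIn H ∧ H.IsHermitian ∧ H.PosDef

/-- A unimodular hermitian `𝓞`-lattice: discriminant `det H = 1`. -/
def IsUnimodular {n : ℕ} (H : Matrix (Fin n) (Fin n) ℂ) : Prop :=
  IsHermLattice H ∧ H.det = 1

/-- Isometry of lattices given by Gram matrices: `H' = U * H * U*` for some `U ∈ GLₙ(𝓞)`. -/
def LatIsometric {n : ℕ} (H H' : Matrix (Fin n) (Fin n) ℂ) : Prop :=
  ∃ U : Matrix (Fin n) (Fin n) ℂ, InGL U ∧ H' = U * H * Uᴴ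

/-- A lattice is decomposable if it is isometric to one whose Gram matrix is block
diagonal with two blocks of smaller positive size. -/
def Decomposable {n : ℕ} (H : Matrix (Fin n) (Fin n) ℂ) : Prop :=
  ∃ H' : Matrix (Fin n) (Fin n) ℂ, LatIsometric H H' ∧ ∃ k : ℕ, 0 < k ∧ k < n ∧
    ∀ i j : Fin n, (((i : ℕ) < k ∧ ¬ (j : ℕ) < k) ∨ (¬ (i : ℕ) < k ∧ (j : ℕ) < k)) → H' i j = 0

/-- The norm `x* H x` of a vector. -/
def latNorm {n : ℕ} (H : Matrix (Fin n) (Fin n) ℂ) (x : Fin n → ℂ) : ℂ :=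
  star x ⬝ᵥ H.mulVec x

/-- A vector of `𝓞ⁿ`. -/
def IsLatVec {n : ℕ} (x : Fin n → ℂ) : Prop := ∀ i, x i ∈ 𝓞

/-- A root: a lattice vector of norm 2. -/
def IsRoot {n : ℕ} (H : Matrix (Fin n) (Fin n) ℂ) (x : Fin n → ℂ) : Prop :=
  IsLatVec x ∧ latNorm H x = 2

/-- The lattice contains no roots. -/
def RootFree {n : ℕ} (H : Matrix (Fin n) (Fin n) ℂ) : Prop :=
  ∀ x : Fin n → ℂ, ¬ IsRoot H x

/-- The minimal norm of the lattice is `3`. -/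
def MinNormThree {n : ℕ} (H : Matrix (Fin n) (Fin n) ℂ) : Prop :=
  (∀ x : Fin n → ℂ, IsLatVec x → x ≠ 0 → 3 ≤ (latNorm H x).re) ∧
  (∃ x : Fin n → ℂ, IsLatVec x ∧ latNorm H x = 3)

/-- The order of the automorphism group `{U ∈ GLₙ(𝓞) : U H U* = H}` of the lattice. -/
def autCard {n : ℕ} (H : Matrix (Fin n) (Fin n) ℂ) : ℕ :=
  Nat.card {U : Matrix (Fin n) (Fin n) ℂ // InGL U ∧ U * H * Uᴴ = H}

/-- One-dimensional Gaussian sums with a linear term converge. -/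
lemma summable_exp_neg_sq_add_abs {c : ℝ} (hc : 0 < c) (d : ℝ) :
    Summable fun x : ℤ => Real.exp (-c * (x : ℝ) ^ 2 + d * |(x : ℝ)|) := by
  have h : ∀ e : ℝ, Summable fun x : ℤ => Real.exp (-c * (x : ℝ) ^ 2 + e * (x : ℝ)) := by
    intro e
    have h0 : 0 < (I * (c / Real.pi : ℝ)).im := by
      simp only [mul_im, I_re, I_im, ofReal_re, ofReal_im]
      have := div_pos hc Real.pi_pos
      linarith
    have h1 := (summable_jacobiTheta₂_term_iff (-I * (e / (2 * Real.pi) : ℝ))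
      (I * (c / Real.pi : ℝ))).2 h0
    refine h1.norm.congr fun x => ?_
    rw [jacobiTheta₂_term, norm_exp]
    congr 1
    have : 2 * ↑Real.pi * I * ↑x * (-I * ↑(e / (2 * Real.pi))) +
        ↑Real.pi * I * ↑x ^ 2 * (I * ↑(c / Real.pi)) =
        ((-c * (x : ℝ) ^ 2 + e * (x : ℝ) : ℝ) : ℂ) := by
      have hp : (Real.pi : ℂ) ≠ 0 := by exact_mod_cast Real.pi_ne_zero
      push_cast
      field_simp
      ring_nf
      simp only [I_sq]
      ring
    rw [this, ofReal_re]
  refine Summable.of_nonneg_of_le (fun _ => (Real.exp_pos _).le) (fun x => ?_) ((h d).add (h (-d)))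
  rcases abs_cases (x : ℝ) with ⟨h1, _⟩ | ⟨h1, _⟩ <;> rw [h1]
  · exact le_add_of_nonneg_right (Real.exp_pos _).le
  · refine le_trans (le_of_eq ?_) (le_add_of_nonneg_left (Real.exp_pos _).le)
    ring_nf

/-- Gaussian sums with a linear term over `ℤⁿ` converge. -/
lemma summable_gaussian {c : ℝ} (hc : 0 < c) (d : ℝ) (n : ℕ) :
    Summable fun x : Fin n → ℤ =>
      Real.exp (∑ i, (-c * (x i : ℝ) ^ 2 + d * |(x i : ℝ)|)) := by
  induction n with
  | zero => exact Summable.of_finite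
  | succ n ih =>
    rw [← (Fin.consEquiv fun _ => ℤ).summable_iff]
    have := (summable_exp_neg_sq_add_abs hc d).mul_of_nonneg ih
      (fun _ => (Real.exp_pos _).le) (fun _ => (Real.exp_pos _).le)
    refine this.congr fun x => ?_
    simp [Fin.sum_univ_succ, Real.exp_add]

lemma summable_gaussian' {ι : Type*} [Fintype ι] {c : ℝ} (hc : 0 < c) (d : ℝ) :
    Summable fun x : ι → ℤ =>
      Real.exp (∑ i, (-c * (x i : ℝ) ^ 2 + d * |(x i : ℝ)|)) := by
  rw [← ((Fintype.equivFin ι).symm.arrowCongr (Equiv.refl ℤ)).summable_iff]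
  refine (summable_gaussian hc d (Fintype.card ι)).congr fun x => ?_
  congr 1
  exact (Fintype.sum_equiv (Fintype.equivFin ι) _ _ fun i => by simp).symm

lemma Matrix.PosDef.exists_mul_sum_sq_le {ι : Type*} [Fintype ι] {A : Matrix ι ι ℝ} (hA : A.PosDef) :
    ∃ c > 0, ∀ x : ι → ℝ, c * ∑ i, x i ^ 2 ≤ x ⬝ᵥ A *ᵥ x := by
  classical
  let S : Set (ι → ℝ) := {x | ∑ i, x i ^ 2 = 1}
  have hS : IsCompact S := by
    refine Metric.isCompact_of_isClosed_isBounded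
      (isClosed_eq (by fun_prop) continuous_const) ?_
    refine (Metric.isBounded_closedBall (x := (0 : ι → ℝ)) (r := 1)).subset fun x hx => ?_
    rw [mem_closedBall_zero_iff, pi_norm_le_iff_of_nonneg zero_le_one]
    intro i
    have h1 : x i ^ 2 ≤ ∑ i, x i ^ 2 :=
      Finset.single_le_sum (f := fun i => x i ^ 2) (fun _ _ => sq_nonneg _) (Finset.mem_univ i)
    rw [show ∑ i, x i ^ 2 = 1 from hx] at h1
    rw [Real.norm_eq_abs]
    exact abs_le_one_iff_mul_self_le_one.2 (by nlinarith)
  have hpos : ∀ x : ι → ℝ, x ≠ 0 → 0 < x ⬝ᵥ A *ᵥ x := fun x hx => by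
    simpa using hA.dotProduct_mulVec_pos hx
  rcases S.eq_empty_or_nonempty with he | hne
  · refine ⟨1, one_pos, fun x => ?_⟩
    by_cases hx : ∑ i, x i ^ 2 = 0
    · have : x = 0 := by
        ext i
        simpa using (Finset.sum_eq_zero_iff_of_nonneg (fun i _ => sq_nonneg (x i))).1 hx i
          (Finset.mem_univ i)
      simp [this]
    · exfalso
      have hp : 0 < ∑ i, x i ^ 2 :=
        lt_of_le_of_ne (Finset.sum_nonneg fun _ _ => sq_nonneg _) (Ne.symm hx)
      have : (fun i => x i / √(∑ i, x i ^ 2)) ∈ S := by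
        change ∑ i, (x i / √(∑ i, x i ^ 2)) ^ 2 = 1
        simp only [div_pow, Real.sq_sqrt hp.le]
        rw [← Finset.sum_div, div_self hx]
      simp [he] at this
  · obtain ⟨y, hy, hmin⟩ := hS.exists_isMinOn hne
      (f := fun x => x ⬝ᵥ A *ᵥ x) (by
        apply Continuous.continuousOn
        simp only [dotProduct, mulVec]
        fun_prop)
    have hy0 : y ≠ 0 := by
      rintro rfl
      have : ∑ i : ι, ((0 : ι → ℝ) i) ^ 2 = 1 := hy
      simp at this
    refine ⟨_, hpos y hy0, fun x => ?_⟩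
    by_cases hx : ∑ i, x i ^ 2 = 0
    · rw [hx, mul_zero]
      by_cases hx0 : x = 0
      · simp [hx0]
      · exact (hpos x hx0).le
    · have hp : 0 < ∑ i, x i ^ 2 :=
        lt_of_le_of_ne (Finset.sum_nonneg fun _ _ => sq_nonneg _) (Ne.symm hx)
      set r := √(∑ i, x i ^ 2) with hr
      have hr2 : r ^ 2 = ∑ i, x i ^ 2 := Real.sq_sqrt hp.le
      have hr0 : r ≠ 0 := by rintro h; rw [h] at hr2; simp at hr2; exact hx hr2.symm
      have hz : r⁻¹ • x ∈ S := by
        change ∑ i, (r⁻¹ * x i) ^ 2 = 1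
        simp only [mul_pow]
        rw [← Finset.mul_sum, ← hr2]
        field_simp
      have h2 := hmin hz
      simp only [mulVec_smul, dotProduct_smul, smul_dotProduct, smul_eq_mul, Set.mem_ofPred_eq] at h2
      rw [← hr2]
      calc _ ≤ (r⁻¹ * (r⁻¹ * x ⬝ᵥ A *ᵥ x)) * r ^ 2 := by gcongr
        _ = _ := by field_simp

/-- The complex quadratic form attached to a real matrix. -/
noncomputable def cquad {ι : Type*} [Fintype ι] (A : Matrix ι ι ℝ) (x : ι → ℂ) : ℂ :=
  x ⬝ᵥ (A.map ((↑) : ℝ → ℂ)) *ᵥ x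

lemma cquad_ofReal {ι : Type*} [Fintype ι] (A : Matrix ι ι ℝ) (x : ι → ℝ) :
    cquad A (fun i => (x i : ℂ)) = ((x ⬝ᵥ A *ᵥ x : ℝ) : ℂ) := by
  simp [cquad, dotProduct, mulVec]

lemma norm_gauss_term_le {n : ℕ} {A : Matrix (Fin n) (Fin n) ℝ} {c : ℝ}
    (hA : ∀ x : Fin n → ℝ, c * ∑ i, x i ^ 2 ≤ x ⬝ᵥ A *ᵥ x) {t : ℂ} (ht : 0 < t.re)
    {b : Fin n → ℂ} {d : ℝ} (hd : ∀ i, 2 * Real.pi * ‖b i‖ ≤ d) (x : Fin n → ℤ) :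
    ‖cexp (-Real.pi * t * cquad A (fun i => (x i : ℂ)) + 2 * Real.pi * ∑ i, b i * x i)‖ ≤
      Real.exp (∑ i, (-(Real.pi * t.re * c) * (x i : ℝ) ^ 2 + d * |(x i : ℝ)|)) := by
  rw [norm_exp]
  refine Real.exp_le_exp.2 ?_
  have h1 : cquad A (fun i => (x i : ℂ)) = ((((fun i => (x i : ℝ)) ⬝ᵥ A *ᵥ (fun i => (x i : ℝ))) : ℝ) : ℂ) := by
    rw [← cquad_ofReal]; simp
  rw [h1, add_re, Finset.sum_add_distrib]
  refine add_le_add ?_ ?_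
  · rw [mul_comm _ (ofReal _), re_ofReal_mul, ← Finset.mul_sum]
    have h2 := hA (fun i => (x i : ℝ))
    have h3 : (-(Real.pi : ℂ) * t).re = -(Real.pi * t.re) := by
      rw [neg_mul, neg_re, re_ofReal_mul]
    rw [h3]
    have h4 := mul_le_mul_of_nonneg_left h2 (mul_pos Real.pi_pos ht).le
    linarith
  · refine (re_le_norm _).trans ?_
    rw [Finset.mul_sum]
    refine (norm_sum_le _ _).trans (Finset.sum_le_sum fun i _ => ?_)
    rw [norm_mul, norm_mul, norm_mul, norm_intCast, norm_real, Real.norm_of_nonneg Real.pi_pos.le,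
      ← mul_assoc]
    simp only [Complex.norm_ofNat]
    exact mul_le_mul_of_nonneg_right (hd i) (abs_nonneg _)

lemma summable_gauss {n : ℕ} {A : Matrix (Fin n) (Fin n) ℝ} (hA : A.PosDef) {t : ℂ} (ht : 0 < t.re)
    (b : Fin n → ℂ) :
    Summable fun x : Fin n → ℤ =>
      ‖cexp (-Real.pi * t * cquad A (fun i => (x i : ℂ)) + 2 * Real.pi * ∑ i, b i * x i)‖ := by
  obtain ⟨c, hc, hcA⟩ := hA.exists_mul_sum_sq_le
  refine Summable.of_nonneg_of_le (fun _ => norm_nonneg _)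
    (norm_gauss_term_le hcA ht (d := 2 * Real.pi * ∑ i, ‖b i‖) fun i => ?_)
    (summable_gaussian (by have := Real.pi_pos; positivity) _ n)
  have := Finset.single_le_sum (f := fun i => ‖b i‖) (fun i _ => norm_nonneg (b i)) (Finset.mem_univ i)
  have := Real.pi_pos
  gcongr

lemma posDef_schur {n : ℕ} {A : Matrix (Fin (n + 1)) (Fin (n + 1)) ℝ} (hA : A.PosDef) :
    0 < A 0 0 ∧ (Matrix.of fun i j : Fin n =>
      A i.succ j.succ - A 0 i.succ * A 0 j.succ / A 0 0).PosDef := by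
  have ha : 0 < A 0 0 := hA.diag_pos
  have hs : ∀ i j, A i j = A j i := fun i j => by
    have := hA.isHermitian.apply i j
    simpa using this.symm
  refine ⟨ha, ?_⟩
  refine Matrix.PosDef.of_dotProduct_mulVec_pos ?_ fun x hx => ?_
  · ext i j
    simp [hs i.succ j.succ, mul_comm]
  · let z : Fin (n + 1) → ℝ := Fin.cons (-(∑ j, A 0 j.succ * x j) / A 0 0) x
    have hz : z ≠ 0 := fun h => hx (by
      ext i
      simpa [z] using congrFun h i.succ)
    have h := hA.dotProduct_mulVec_pos hz
    refine lt_of_lt_of_eq h ?_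
    simp only [star_trivial, dotProduct, mulVec, Fin.sum_univ_succ, z, Fin.cons_zero, Fin.cons_succ,
      of_apply]
    simp only [hs (Fin.succ _) 0, mul_add, Finset.sum_add_distrib, sub_mul, Finset.sum_sub_distrib]
    have e1 : ∀ i, x i * (A 0 i.succ * (-(∑ j, A 0 j.succ * x j) / A 0 0)) =
      (A 0 i.succ * x i) * (-(∑ j, A 0 j.succ * x j) / A 0 0) := fun i => by ring
    have e2 : ∀ i, x i * ∑ j, A 0 i.succ * A 0 j.succ / A 0 0 * x j =
      (A 0 i.succ * x i) * ((∑ j, A 0 j.succ * x j) / A 0 0) := fun i => by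
        rw [Finset.mul_sum, Finset.sum_div, Finset.mul_sum]
        exact Finset.sum_congr rfl fun j _ => by ring
    simp only [e1, mul_sub, Finset.sum_sub_distrib, e2, ← Finset.sum_mul]
    field_simp
    ring

lemma cquad_mulVec_inv {ι : Type*} [Fintype ι] [DecidableEq ι] {A : Matrix ι ι ℝ} (hA : A.PosDef) (x : ι → ℂ) :
    cquad A⁻¹ ((A.map ((↑) : ℝ → ℂ)) *ᵥ x) = cquad A x := by
  have h1 : (A⁻¹.map ((↑) : ℝ → ℂ)) * (A.map ((↑) : ℝ → ℂ)) = 1 := by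
    have := congrArg (fun M => M.map (ofRealHom)) (Matrix.nonsing_inv_mul A
      ((Matrix.isUnit_iff_isUnit_det A).1 hA.isUnit))
    rw [Matrix.map_mul, Matrix.map_one _ (by simp) (by simp)] at this
    exact this
  rw [cquad, mulVec_mulVec, h1, one_mulVec, cquad, dotProduct_comm]

lemma exists_mulVec_eq {n : ℕ} {A : Matrix (Fin n) (Fin n) ℝ} (hA : A.PosDef) (y : Fin n → ℂ) :
    ∃ x, (A.map ((↑) : ℝ → ℂ)) *ᵥ x = y := by
  have h1 : (A.map ((↑) : ℝ → ℂ)) * (A⁻¹.map ((↑) : ℝ → ℂ)) = 1 := by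
    have := congrArg (fun M => M.map (ofRealHom)) (Matrix.mul_nonsing_inv A
      ((Matrix.isUnit_iff_isUnit_det A).1 hA.isUnit))
    rw [Matrix.map_mul, Matrix.map_one _ (by simp) (by simp)] at this
    exact this
  exact ⟨(A⁻¹.map ((↑) : ℝ → ℂ)) *ᵥ y, by rw [mulVec_mulVec, h1, one_mulVec]⟩

/-- Schur complement of the top-left entry. -/
noncomputable def schur {n : ℕ} (A : Matrix (Fin (n + 1)) (Fin (n + 1)) ℝ) :
    Matrix (Fin n) (Fin n) ℝ :=
  Matrix.of fun i j => A i.succ j.succ - A 0 i.succ * A 0 j.succ / A 0 0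

lemma cquad_cons {n : ℕ} {A : Matrix (Fin (n + 1)) (Fin (n + 1)) ℝ} (hA : A.PosDef)
    (x₀ : ℂ) (x : Fin n → ℂ) :
    cquad A (Fin.cons x₀ x) =
      A 0 0 * (x₀ + ∑ j, (A 0 j.succ / A 0 0 : ℝ) * x j) ^ 2 + cquad (schur A) x := by
  have ha : (A 0 0 : ℂ) ≠ 0 := by exact_mod_cast (posDef_schur hA).1.ne'
  have hs : ∀ i, A i 0 = A 0 i := fun i => by
    have := hA.isHermitian.apply 0 i
    simpa using this
  simp only [cquad, schur, dotProduct, mulVec, Fin.sum_univ_succ, Fin.cons_zero, Fin.cons_succ,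
    of_apply, map_apply, hs, mul_add, Finset.sum_add_distrib, ofReal_sub, ofReal_div, ofReal_mul,
    sub_mul, Finset.sum_sub_distrib, mul_sub]
  have e1 : ∀ i, x i * (A 0 i.succ * x₀) = (A 0 i.succ * x i) * x₀ := fun i => by ring
  have e2 : ∀ i, x i * ∑ j, (A 0 i.succ : ℂ) * A 0 j.succ / A 0 0 * x j =
      (A 0 i.succ * x i) * ((∑ j, A 0 j.succ * x j) / A 0 0) := fun i => by
    rw [Finset.mul_sum, Finset.sum_div, Finset.mul_sum]
    exact Finset.sum_congr rfl fun j _ => by ring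
  have e3 : ∑ j, (A 0 j.succ : ℂ) / A 0 0 * x j = (∑ j, A 0 j.succ * x j) / A 0 0 := by
    rw [Finset.sum_div]
    exact Finset.sum_congr rfl fun j _ => by ring
  simp only [e1, e2, e3, ← Finset.sum_mul]
  field_simp
  ring

lemma cquad_inv_cons {n : ℕ} {A : Matrix (Fin (n + 1)) (Fin (n + 1)) ℝ} (hA : A.PosDef)
    (y₀ : ℂ) (y : Fin n → ℂ) :
    cquad A⁻¹ (Fin.cons y₀ y) =
      y₀ ^ 2 / A 0 0 + cquad (schur A)⁻¹ (fun i => y i - y₀ * (A 0 i.succ / A 0 0 : ℝ)) := by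
  have ha : (A 0 0 : ℂ) ≠ 0 := by exact_mod_cast (posDef_schur hA).1.ne'
  have hs : ∀ i, A i 0 = A 0 i := fun i => by
    have := hA.isHermitian.apply 0 i
    simpa using this
  obtain ⟨z, hz⟩ := exists_mulVec_eq hA (Fin.cons y₀ y)
  obtain ⟨x₀, x, rfl⟩ : ∃ x₀ x, z = Fin.cons x₀ x := ⟨z 0, Fin.tail z, by simp⟩
  have h0 : y₀ = A 0 0 * (x₀ + ∑ j, (A 0 j.succ / A 0 0 : ℝ) * x j) := by
    have := congrFun hz 0
    simp only [mulVec, dotProduct, Fin.sum_univ_succ, Fin.cons_zero, Fin.cons_succ, map_apply] at this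
    rw [← this, mul_add, Finset.mul_sum]
    congr 1
    refine Finset.sum_congr rfl fun j _ => ?_
    push_cast
    field_simp
  have h1 : (fun i => y i - y₀ * (A 0 i.succ / A 0 0 : ℝ)) =
      ((schur A).map ((↑) : ℝ → ℂ)) *ᵥ x := by
    ext i
    have h2 := congrFun hz i.succ
    simp only [mulVec, dotProduct, Fin.sum_univ_succ, Fin.cons_zero, Fin.cons_succ, map_apply, hs]
      at h2
    simp only [mulVec, dotProduct, schur, of_apply, map_apply]
    rw [← h2, h0, mul_add, add_mul, Finset.mul_sum, Finset.sum_mul, ← sub_sub]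
    have : (A 0 i.succ : ℂ) * x₀ - A 0 0 * x₀ * (A 0 i.succ / A 0 0 : ℝ) = 0 := by
      push_cast; field_simp; ring
    rw [add_comm (_ * x₀), add_sub_assoc, this, add_zero, ← Finset.sum_sub_distrib]
    refine Finset.sum_congr rfl fun j _ => ?_
    push_cast
    field_simp
  rw [← hz, cquad_mulVec_inv hA, cquad_cons hA, h1,
    show cquad (schur A)⁻¹ _ = _ from cquad_mulVec_inv (A := schur A) (posDef_schur hA).2 x, h0]
  field_simp

lemma cquad_add_I {ι : Type*} [Fintype ι] {A : Matrix ι ι ℝ} (hA : A.IsHermitian)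
    (y b : ι → ℂ) (r : ℂ) :
    cquad A (fun i => y i + r * b i) = cquad A y + 2 * r * ∑ i, (A.map ((↑) : ℝ → ℂ) *ᵥ b) i * y i
      + r ^ 2 * cquad A b := by
  have hs : (A.map ((↑) : ℝ → ℂ)).transpose = A.map ((↑) : ℝ → ℂ) := by
    ext i j
    have := hA.apply i j
    simpa using congrArg ((↑) : ℝ → ℂ) this
  have h : (fun i => y i + r * b i) = y + r • b := by ext; simp
  have h2 : ∑ i, (A.map ((↑) : ℝ → ℂ) *ᵥ b) i * y i = y ⬝ᵥ (A.map ((↑) : ℝ → ℂ) *ᵥ b) := by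
    rw [dotProduct_comm]; rfl
  have h3 : b ⬝ᵥ (A.map ((↑) : ℝ → ℂ) *ᵥ y) = y ⬝ᵥ (A.map ((↑) : ℝ → ℂ) *ᵥ b) := by
    rw [dotProduct_mulVec, ← mulVec_transpose, hs, dotProduct_comm]
  rw [h2, h, cquad, cquad, cquad]
  simp only [mulVec_add, mulVec_smul, dotProduct_add, add_dotProduct, smul_dotProduct,
    dotProduct_smul, smul_eq_mul, h3]
  ring

lemma summable_gauss_dual {n : ℕ} {A : Matrix (Fin n) (Fin n) ℝ} (hA : A.PosDef) {t : ℂ}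
    (ht : 0 < t.re) (b : Fin n → ℂ) :
    Summable fun y : Fin n → ℤ =>
      ‖cexp (-Real.pi / t * cquad A (fun i => (y i : ℂ) + I * b i))‖ := by
  have ht' : 0 < (1 / t).re := by
    rw [one_div, inv_re]
    exact div_pos ht (normSq_pos.2 fun h => by simp [h] at ht)
  have := (summable_gauss hA ht' (fun i => -I / t * (A.map ((↑) : ℝ → ℂ) *ᵥ b) i)).mul_left
    ‖cexp (Real.pi / t * cquad A b)‖
  refine this.congr fun y => ?_
  rw [← norm_mul, ← Complex.exp_add, cquad_add_I hA.isHermitian, I_sq]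
  congr 2
  simp only [mul_assoc, ← Finset.mul_sum]
  ring

lemma ofReal_mul_cpow_half {r : ℝ} (hr : 0 < r) {t : ℂ} (ht : t ≠ 0) (s : ℂ) :
    (t * r) ^ s = t ^ s * (r : ℂ) ^ s := by
  have hr' : (r : ℂ) ≠ 0 := by exact_mod_cast hr.ne'
  rw [cpow_def_of_ne_zero (mul_ne_zero ht hr'), cpow_def_of_ne_zero ht, cpow_def_of_ne_zero hr',
    mul_comm t, log_ofReal_mul hr ht, ← Complex.exp_add, ofReal_log hr.le]
  ring_nf

/-- Multidimensional Poisson summation for Gaussians, up to a constant that depends only on the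
quadratic form. -/
theorem tsum_gauss_eq {n : ℕ} {A : Matrix (Fin n) (Fin n) ℝ} (hA : A.PosDef) :
    ∃ C : ℂ, ∀ t : ℂ, 0 < t.re → ∀ b : Fin n → ℂ,
      ∑' x : Fin n → ℤ,
        cexp (-Real.pi * t * cquad A (fun i => (x i : ℂ)) + 2 * Real.pi * ∑ i, b i * x i) =
      C * (1 / t ^ (1 / 2 : ℂ)) ^ n *
        ∑' y : Fin n → ℤ, cexp (-Real.pi / t * cquad A⁻¹ (fun i => (y i : ℂ) + I * b i)) := by
  induction n with
  | zero =>
    refine ⟨1, fun t _ b => ?_⟩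
    simp [cquad, tsum_fintype]
  | succ n ih =>
    obtain ⟨ha, hS⟩ := posDef_schur hA
    change (schur A).PosDef at hS
    obtain ⟨C, hC⟩ := ih hS
    refine ⟨C * (1 / (A 0 0 : ℂ) ^ (1 / 2 : ℂ)), fun t ht b => ?_⟩
    have ht0 : t ≠ 0 := fun h => by simp [h] at ht
    have ha0 : (A 0 0 : ℂ) ≠ 0 := by exact_mod_cast ha.ne'
    obtain ⟨b₀, b, rfl⟩ : ∃ b₀ b', b = Fin.cons b₀ b' := ⟨b 0, Fin.tail b, by simp⟩
    set c : Fin n → ℝ := fun j => A 0 j.succ / A 0 0 with hc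
    let G : ℤ → (Fin n → ℤ) → ℂ := fun y₀ x =>
      cexp (-Real.pi / (t * A 0 0) * (y₀ + I * b₀) ^ 2) *
      cexp (-Real.pi * t * cquad (schur A) (fun i => (x i : ℂ)) + 2 * Real.pi *
        ∑ i, (b i + I * (y₀ + I * b₀) * c i) * x i)
    have hta : 0 < (t * A 0 0).re := by
      rw [mul_comm, re_ofReal_mul]; exact mul_pos ha ht
    have hGs : Summable fun p : ℤ × (Fin n → ℤ) => G p.1 p.2 := by
      have h1 := summable_gauss_dual (n := 1) (A := Matrix.of fun _ _ => (A 0 0)⁻¹)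
        (Matrix.PosDef.of_dotProduct_mulVec_pos (by ext; simp) fun x hx => by
          have : x 0 ≠ 0 := fun h => hx (by ext i; fin_cases i; simpa using h)
          simp only [star_trivial, dotProduct, mulVec, Fin.sum_univ_one, of_apply]
          have := sq_pos_of_ne_zero this
          nlinarith [mul_pos (inv_pos.2 ha) this]) ht (fun _ => b₀)
      rw [← (Equiv.funUnique (Fin 1) ℤ).symm.summable_iff] at h1
      have h1' : Summable fun y : ℤ => ‖cexp (-Real.pi / (t * A 0 0) * (y + I * b₀) ^ 2)‖ := by
        refine h1.congr fun y => ?_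
        simp only [Function.comp, cquad, dotProduct, mulVec, Fin.sum_univ_one, map_apply,
          of_apply, Equiv.funUnique_symm_apply, uniqueElim_const, ofReal_inv]
        congr 2
        field_simp
      have h2 := summable_gauss hS ht (fun i => b i - b₀ * c i)
      have h3 := h1'.mul_of_nonneg h2 (fun _ => norm_nonneg _) (fun _ => norm_nonneg _)
      refine Summable.of_norm (h3.congr fun p => ?_)
      simp only [G]
      rw [norm_mul]
      congr 1
      rw [norm_exp, norm_exp]
      congr 1
      have : -Real.pi * t * cquad (schur A) (fun i => (p.2 i : ℂ)) + 2 * Real.pi *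
          ∑ i, (b i + I * (p.1 + I * b₀) * c i) * p.2 i =
          -Real.pi * t * cquad (schur A) (fun i => (p.2 i : ℂ)) + 2 * Real.pi *
          ∑ i, (b i - b₀ * c i) * p.2 i +
          ((2 * Real.pi * ∑ i, p.1 * c i * p.2 i : ℝ) : ℂ) * I := by
        rw [add_assoc]
        congr 1
        push_cast
        rw [mul_assoc (2 * (Real.pi : ℂ)) _ I, Finset.sum_mul, ← mul_add, ← Finset.sum_add_distrib]
        congr 1
        refine Finset.sum_congr rfl fun i _ => ?_
        linear_combination (b₀ * c i * p.2 i) * I_sq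
      rw [this, add_re (_ + _), re_ofReal_mul, I_re, mul_zero, add_zero]
    calc _ = ∑' p : (Fin n → ℤ) × ℤ, cexp (-Real.pi * t * cquad A (Fin.cons (p.2 : ℂ)
            (fun i => (p.1 i : ℂ))) + 2 * Real.pi * (b₀ * p.2 + ∑ i, b i * p.1 i)) := by
          rw [← ((Equiv.prodComm _ _).trans (Fin.consEquiv fun _ => ℤ)).tsum_eq]
          refine tsum_congr fun p => ?_
          simp only [Fin.sum_univ_succ, Fin.cons_zero, Fin.cons_succ, Equiv.trans_apply,
            Equiv.prodComm_apply, Fin.consEquiv_apply, Prod.fst_swap, Prod.snd_swap]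
          congr 4
          ext i
          refine Fin.cases ?_ (fun j => ?_) i <;> simp
      _ = ∑' x : Fin n → ℤ, ∑' x₀ : ℤ, cexp (-Real.pi * t * cquad A (Fin.cons (x₀ : ℂ)
            (fun i => (x i : ℂ))) + 2 * Real.pi * (b₀ * x₀ + ∑ i, b i * x i)) := by
          refine Summable.tsum_prod ?_
          have h := (summable_gauss hA ht (Fin.cons b₀ b)).of_norm
          rw [← ((Equiv.prodComm _ _).trans (Fin.consEquiv fun _ => ℤ)).summable_iff] at h
          refine h.congr fun p => ?_
          simp only [Function.comp, Fin.sum_univ_succ, Fin.cons_zero, Fin.cons_succ,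
            Equiv.trans_apply,
            Equiv.prodComm_apply, Fin.consEquiv_apply, Prod.fst_swap, Prod.snd_swap]
          congr 4
          ext i
          refine Fin.cases ?_ (fun j => ?_) i <;> simp
      _ = ∑' x : Fin n → ℤ, 1 / (t * A 0 0) ^ (1 / 2 : ℂ) * ∑' y₀ : ℤ, G y₀ x := by
          refine tsum_congr fun x => ?_
          have key := Complex.tsum_exp_neg_quadratic hta (b₀ - t * A 0 0 * ∑ j, (c j : ℂ) * x j)
          calc _ = ∑' x₀ : ℤ, cexp (-Real.pi * t * (A 0 0 * (∑ j, (c j : ℂ) * x j) ^ 2 +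
                    cquad (schur A) (fun i => (x i : ℂ))) + 2 * Real.pi * ∑ i, b i * x i) *
                cexp (-Real.pi * (t * A 0 0) * x₀ ^ 2 +
                  2 * Real.pi * (b₀ - t * A 0 0 * ∑ j, (c j : ℂ) * x j) * x₀) := by
                refine tsum_congr fun x₀ => ?_
                rw [cquad_cons hA, ← Complex.exp_add]
                simp only [hc]
                congr 1
                ring
            _ = _ := by
                rw [tsum_mul_left, key, mul_left_comm, ← tsum_mul_left]
                congr 1
                refine tsum_congr fun y₀ => ?_
                simp only [G]
                rw [← Complex.exp_add, ← Complex.exp_add]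
                congr 1
                have e1 : ∑ i, (b i + I * (y₀ + I * b₀) * c i) * x i =
                    ∑ i, b i * x i + I * (y₀ + I * b₀) * ∑ i, (c i : ℂ) * x i := by
                  rw [Finset.mul_sum, ← Finset.sum_add_distrib]
                  exact Finset.sum_congr rfl fun i _ => by ring
                rw [e1]
                generalize (∑ i, (c i : ℂ) * x i) = s
                field_simp
                ring_nf
                simp only [I_sq]
                ring
      _ = 1 / (t * A 0 0) ^ (1 / 2 : ℂ) * ∑' y₀ : ℤ, ∑' x : Fin n → ℤ, G y₀ x := by
          rw [tsum_mul_left, Summable.tsum_comm]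
          exact hGs
      _ = 1 / (t * A 0 0) ^ (1 / 2 : ℂ) * ∑' y₀ : ℤ, C * (1 / t ^ (1 / 2 : ℂ)) ^ n *
          ∑' y : Fin n → ℤ, cexp (-Real.pi / t * cquad A⁻¹ (Fin.cons (y₀ + I * b₀)
            (fun i => (y i : ℂ) + I * b i))) := by
          congr 1
          refine tsum_congr fun y₀ => ?_
          simp only [G]
          rw [tsum_mul_left, hC t ht, mul_left_comm, ← tsum_mul_left]
          congr 1
          refine tsum_congr fun y => ?_
          rw [← Complex.exp_add, cquad_inv_cons hA]
          congr 1
          have : (fun i => (y i : ℂ) + I * (b i + I * (y₀ + I * b₀) * c i)) =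
              fun i => (y i : ℂ) + I * b i - (y₀ + I * b₀) * (A 0 i.succ / A 0 0 : ℝ) := by
            ext i
            linear_combination ((y₀ + I * b₀) * c i) * I_sq
          rw [this]
          field_simp
          ring
      _ = _ := by
          rw [tsum_mul_left, ofReal_mul_cpow_half ha ht0,
            ← ((Fin.consEquiv fun _ => ℤ)).tsum_eq, Summable.tsum_prod]
          · have : ∀ (y₀ : ℤ) (y : Fin n → ℤ), (fun i => ((Fin.cons y₀ y : Fin (n + 1) → ℤ) i : ℂ) +
                I * (Fin.cons b₀ b : Fin (n + 1) → ℂ) i) =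
                Fin.cons (y₀ + I * b₀) (fun i => (y i : ℂ) + I * b i) := fun y₀ y => by
              ext i
              refine Fin.cases ?_ (fun j => ?_) i <;> simp
            simp only [Fin.consEquiv_apply, this]
            rw [pow_succ]
            field_simp
          · have := (summable_gauss_dual hA.inv ht (Fin.cons b₀ b)).of_norm
            rwa [← (Fin.consEquiv fun _ => ℤ).summable_iff] at this

lemma cquad_reindex {ι κ : Type*} [Fintype ι] [Fintype κ] (e : ι ≃ κ) (A : Matrix ι ι ℝ)
    (x : κ → ℂ) : cquad (A.submatrix e.symm e.symm) x = cquad A (x ∘ e) := by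
  simp only [cquad, dotProduct, mulVec, map_apply, submatrix_apply, Function.comp]
  rw [← e.sum_comp]
  refine Finset.sum_congr rfl fun i _ => ?_
  rw [← e.sum_comp]
  simp

theorem tsum_gauss_eq_fintype {ι : Type*} [Fintype ι] [DecidableEq ι] {A : Matrix ι ι ℝ}
    (hA : A.PosDef) :
    ∃ C : ℂ, ∀ t : ℂ, 0 < t.re → ∀ b : ι → ℂ,
      ∑' x : ι → ℤ,
        cexp (-Real.pi * t * cquad A (fun i => (x i : ℂ)) + 2 * Real.pi * ∑ i, b i * x i) =
      C * (1 / t ^ (1 / 2 : ℂ)) ^ (Fintype.card ι) *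
        ∑' y : ι → ℤ, cexp (-Real.pi / t * cquad A⁻¹ (fun i => (y i : ℂ) + I * b i)) := by
  set e := Fintype.equivFin ι
  have hA' : (A.submatrix e.symm e.symm).PosDef := hA.submatrix e.symm.injective
  obtain ⟨C, hC⟩ := tsum_gauss_eq hA'
  refine ⟨C, fun t ht b => ?_⟩
  have := hC t ht (b ∘ e.symm)
  rw [← (e.arrowCongr (Equiv.refl ℤ)).tsum_eq, ← (e.arrowCongr (Equiv.refl ℤ)).tsum_eq] at this
  rw [Matrix.inv_submatrix_equiv] at this
  simp only [cquad_reindex] at this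
  rw [← tsum_congr fun x => ?_, this]
  · congr 1
    refine tsum_congr fun y => ?_
    congr 3
    ext i
    simp
  · congr 2
    · congr 2; ext i; simp
    · congr 1
      exact (e.sum_comp _).symm.trans (Finset.sum_congr rfl fun i _ => by simp)

lemma ω_re : ω.re = -1 / 2 := rfl
lemma ω_im : ω.im = Real.sqrt 3 / 2 := rfl

lemma sqrt_three_sq : Real.sqrt 3 * Real.sqrt 3 = 3 := Real.mul_self_sqrt (by norm_num)

lemma ω_sq : ω * ω = -1 - ω := by
  have := sqrt_three_sq
  apply Complex.ext
  · simp [ω_re, ω_im]; linarith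
  · simp [ω_re, ω_im]; ring

lemma conj_ω : (starRingEnd ℂ) ω = -1 - ω := by
  apply Complex.ext
  · simp [ω_re]; norm_num
  · simp [ω_im]


lemma mem_𝓞_iff {z : ℂ} : z ∈ 𝓞 ↔ ∃ a b : ℤ, z = a + b * ω := by
  constructor
  · intro h
    induction h using Algebra.adjoin_induction with
    | mem x hx => exact ⟨0, 1, by simp [Set.mem_singleton_iff.1 hx]⟩
    | algebraMap r => exact ⟨r, 0, by simp⟩
    | add x y _ _ hx hy =>
      obtain ⟨a, b, rfl⟩ := hx
      obtain ⟨c, d, rfl⟩ := hy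
      exact ⟨a + c, b + d, by push_cast; ring⟩
    | mul x y _ _ hx hy =>
      obtain ⟨a, b, rfl⟩ := hx
      obtain ⟨c, d, rfl⟩ := hy
      exact ⟨a * c - b * d, a * d + b * c - b * d, by
        push_cast; linear_combination (b * d : ℂ) * ω_sq⟩
  · rintro ⟨a, b, rfl⟩
    have h1 : ω ∈ 𝓞 := Algebra.subset_adjoin rfl
    exact add_mem (intCast_mem _ _) (mul_mem (intCast_mem _ _) h1)

lemma ω_mem : ω ∈ 𝓞 := Algebra.subset_adjoin rfl

lemma star_mem_𝓞 {z : ℂ} (h : z ∈ 𝓞) : (starRingEnd ℂ) z ∈ 𝓞 := by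
  obtain ⟨a, b, rfl⟩ := mem_𝓞_iff.1 h
  refine mem_𝓞_iff.2 ⟨a - b, -b, ?_⟩
  simp [conj_ω]; ring

lemma add_mul_ω_inj {a b c d : ℝ} (h : (a : ℂ) + b * ω = c + d * ω) : a = c ∧ b = d := by
  have h3 : Real.sqrt 3 ≠ 0 := by positivity
  have h1 := congrArg Complex.im h
  have h2 := congrArg Complex.re h
  simp [ω_re, ω_im] at h1 h2
  have h1 : b = d := h1
  subst h1
  exact ⟨by linarith, rfl⟩

/-- Lattice vectors as a type. -/
def LatVec (n : ℕ) : Type := {x : Fin n → ℂ // IsLatVec x}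

noncomputable def upv {n : ℕ} (z : Fin n ⊕ Fin n → ℂ) : Fin n → ℂ := fun i => z (.inl i) + ω * z (.inr i)

noncomputable def umv {n : ℕ} (z : Fin n ⊕ Fin n → ℂ) : Fin n → ℂ :=
  fun i => z (.inl i) + (-1 - ω) * z (.inr i)

lemma umv_ofReal {n : ℕ} (z : Fin n ⊕ Fin n → ℝ) :
    umv (fun k => (z k : ℂ)) = star (upv fun k => (z k : ℂ)) := by
  ext i
  simp [umv, upv, conj_ω]

/-- Integer coordinates of lattice vectors. -/
noncomputable def latEquiv (n : ℕ) : (Fin n ⊕ Fin n → ℤ) ≃ LatVec n :=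
  Equiv.ofBijective (fun z => ⟨upv fun k => (z k : ℂ), fun i => mem_𝓞_iff.2
      ⟨z (.inl i), z (.inr i), by simp [upv, mul_comm]⟩⟩) <| by
    constructor
    · intro z w h
      have h' : ∀ i, z (.inl i) = w (.inl i) ∧ z (.inr i) = w (.inr i) := fun i => by
        have h1 := congrFun (congrArg Subtype.val h) i
        simp only [upv] at h1
        have := @add_mul_ω_inj (z (.inl i)) (z (.inr i)) (w (.inl i)) (w (.inr i))
          (by push_cast; linear_combination h1)
        exact_mod_cast this
      ext k
      rcases k with i | i
      exacts [(h' i).1, (h' i).2]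
    · rintro ⟨x, hx⟩
      choose a b hab using fun i => mem_𝓞_iff.1 (hx i)
      refine ⟨Sum.elim a b, Subtype.ext ?_⟩
      funext i
      simp [upv, hab, mul_comm]

lemma latEquiv_val {n : ℕ} (z : Fin n ⊕ Fin n → ℤ) :
    (latEquiv n z).1 = upv fun k => (z k : ℂ) := rfl

/-- The real Gram matrix of the trace form. -/
noncomputable def realGram {n : ℕ} (H : Matrix (Fin n) (Fin n) ℂ) :
    Matrix (Fin n ⊕ Fin n) (Fin n ⊕ Fin n) ℝ :=
  Matrix.of fun k l => ((starRingEnd ℂ) (Sum.elim (fun _ => (1 : ℂ)) (fun _ => ω) k) *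
    H (Sum.elim id id k) (Sum.elim id id l) * Sum.elim (fun _ => (1 : ℂ)) (fun _ => ω) l).re

lemma realGram_bilin {n : ℕ} {H : Matrix (Fin n) (Fin n) ℂ} (hH : H.IsHermitian)
    (z w : Fin n ⊕ Fin n → ℂ) :
    z ⬝ᵥ ((realGram H).map ((↑) : ℝ → ℂ)) *ᵥ w =
      (umv z ⬝ᵥ H *ᵥ upv w + umv w ⬝ᵥ H *ᵥ upv z) / 2 := by
  have hs : ∀ i j, (starRingEnd ℂ) (H i j) = H j i := fun i j => hH.apply j i
  have hre : ∀ u : ℂ, (u.re : ℂ) = (u + (starRingEnd ℂ) u) / 2 := fun u => by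
    rw [re_eq_add_conj]
  have key : umv w ⬝ᵥ H *ᵥ upv z = ∑ i, ∑ j, umv w j * H j i * upv z i := by
    rw [Finset.sum_comm]
    simp only [dotProduct, mulVec, Finset.mul_sum, mul_assoc]
  rw [key]
  simp only [dotProduct, mulVec, Finset.mul_sum, Fintype.sum_sum_type, map_apply, realGram, of_apply,
    Sum.elim_inl, Sum.elim_inr, hre, map_mul, conj_ω, hs, upv, umv, map_one,
    Complex.conj_conj, id, ← Finset.sum_add_distrib, Finset.sum_div]
  refine Finset.sum_congr rfl fun i _ => ?_
  refine Finset.sum_congr rfl fun j _ => ?_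
  ring

lemma realGram_isHermitian {n : ℕ} {H : Matrix (Fin n) (Fin n) ℂ} (hH : H.IsHermitian) :
    (realGram H).IsHermitian := by
  have hs : ∀ i j, (starRingEnd ℂ) (H i j) = H j i := fun i j => hH.apply j i
  ext k l
  simp only [conjTranspose_apply, realGram, of_apply, star_trivial]
  rw [← conj_re]
  simp only [map_mul, hs, Complex.conj_conj]
  congr 1
  ring

lemma realGram_posDef {n : ℕ} {H : Matrix (Fin n) (Fin n) ℂ} (hH : H.PosDef) :
    (realGram H).PosDef := by
  refine Matrix.PosDef.of_dotProduct_mulVec_pos (realGram_isHermitian hH.isHermitian) fun z hz => ?_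
  have h1 := realGram_bilin hH.isHermitian (fun k => (z k : ℂ)) (fun k => (z k : ℂ))
  have h2 := cquad_ofReal (realGram H) z
  rw [cquad] at h2
  rw [h2, add_self_div_two, umv_ofReal] at h1
  have hne : upv (fun k => (z k : ℂ)) ≠ 0 := by
    intro h0
    apply hz
    have h' : ∀ i, z (.inl i) = 0 ∧ z (.inr i) = 0 := fun i => by
      have h1 := congrFun h0 i
      simp only [upv] at h1
      exact @add_mul_ω_inj (z (.inl i)) (z (.inr i)) 0 0 (by
        simp at h1; push_cast; linear_combination h1)
    ext k
    rcases k with i | i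
    exacts [(h' i).1, (h' i).2]
  have := hH.dotProduct_mulVec_pos hne
  rw [← h1] at this
  simpa using this

lemma IsUnimodular.inv_entriesIn {n : ℕ} {H : Matrix (Fin n) (Fin n) ℂ} (hU : IsUnimodular H) :
    EntriesIn H⁻¹ := by
  intro i j
  let H' : Matrix (Fin n) (Fin n) 𝓞 := Matrix.of fun i j => ⟨H i j, hU.1.1 i j⟩
  have h1 : H = H'.map (algebraMap 𝓞 ℂ) := by ext i j; rfl
  rw [Matrix.inv_def, hU.2, Ring.inverse_one, one_smul, h1]
  have := (algebraMap 𝓞 ℂ).map_adjugate H'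
  rw [RingHom.mapMatrix_apply, RingHom.mapMatrix_apply] at this
  rw [← this]
  exact (H'.adjugate i j).2

lemma IsLatVec.mulVec {n : ℕ} {H : Matrix (Fin n) (Fin n) ℂ} (hH : EntriesIn H) {x : Fin n → ℂ}
    (hx : IsLatVec x) : IsLatVec (H *ᵥ x) := fun i => by
  rw [Matrix.mulVec, dotProduct]
  exact sum_mem fun j _ => mul_mem (hH i j) (hx j)

/-- A unimodular Gram matrix permutes the lattice vectors. -/
noncomputable def mulVecEquiv {n : ℕ} {H : Matrix (Fin n) (Fin n) ℂ} (hU : IsUnimodular H) :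
    LatVec n ≃ LatVec n where
  toFun x := ⟨H *ᵥ x.1, x.2.mulVec hU.1.1⟩
  invFun x := ⟨H⁻¹ *ᵥ x.1, x.2.mulVec hU.inv_entriesIn⟩
  left_inv x := Subtype.ext <| by
    simp [Matrix.mulVec_mulVec, Matrix.nonsing_inv_mul H (by simp [hU.2])]
  right_inv x := Subtype.ext <| by
    simp [Matrix.mulVec_mulVec, Matrix.mul_nonsing_inv H (by simp [hU.2])]

/-- `(a, b) ↦ (-b, a)`. -/
def rotEquiv (n : ℕ) : (Fin n ⊕ Fin n → ℤ) ≃ (Fin n ⊕ Fin n → ℤ) where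
  toFun z := Sum.elim (fun i => -z (.inr i)) (fun i => z (.inl i))
  invFun z := Sum.elim (fun i => z (.inr i)) (fun i => -z (.inl i))
  left_inv z := by ext k; rcases k with i | i <;> simp
  right_inv z := by ext k; rcases k with i | i <;> simp

/-- Coordinates with prescribed images under `upv` and `umv`. -/
noncomputable def coords {n : ℕ} (u v : Fin n → ℂ) : Fin n ⊕ Fin n → ℂ :=
  Sum.elim (fun i => u i - ω * ((u i - v i) / (2 * ω + 1))) (fun i => (u i - v i) / (2 * ω + 1))

lemma two_ω_add_one : 2 * ω + 1 = I * Real.sqrt 3 := by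
  apply Complex.ext <;> simp [ω_re, ω_im]
  all_goals ring

lemma two_ω_add_one_sq : (2 * ω + 1) ^ 2 = -3 := by linear_combination 4 * ω_sq

lemma two_ω_add_one_ne : 2 * ω + 1 ≠ 0 := fun h => by
  have := two_ω_add_one_sq
  rw [h] at this; norm_num at this

lemma upv_coords {n : ℕ} (u v : Fin n → ℂ) : upv (coords u v) = u := by
  ext i; simp [upv, coords]

lemma umv_coords {n : ℕ} (u v : Fin n → ℂ) : umv (coords u v) = v := by
  ext i
  have := two_ω_add_one_ne
  simp only [umv, coords, Sum.elim_inl, Sum.elim_inr]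
  have h : (-1 - ω) * ((u i - v i) / (2 * ω + 1)) - ω * ((u i - v i) / (2 * ω + 1)) =
      -(u i - v i) * ((2 * ω + 1) / (2 * ω + 1)) := by ring
  rw [div_self this] at h
  linear_combination h

lemma sqrt_three_ne : (Real.sqrt 3 : ℂ) ≠ 0 := by
  exact_mod_cast (by positivity : Real.sqrt 3 ≠ 0)

lemma sqrt_three_sq' : (Real.sqrt 3 : ℂ) ^ 2 = 3 := by
  rw [sq]; exact_mod_cast congrArg ofReal sqrt_three_sq

lemma cquad_realGram {n : ℕ} {H : Matrix (Fin n) (Fin n) ℂ} (hH : H.IsHermitian)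
    (z : Fin n ⊕ Fin n → ℂ) : cquad (realGram H) z = umv z ⬝ᵥ H *ᵥ upv z := by
  rw [cquad, realGram_bilin hH, add_self_div_two]

lemma cpow_half_pow {t : ℂ} (n : ℕ) : (1 / t ^ (1 / 2 : ℂ)) ^ (n + n) = (1 / t) ^ n := by
  rw [← two_mul, pow_mul]
  congr 1
  have := Complex.cpow_nat_inv_pow t (n := 2) (by norm_num)
  rw [div_pow, one_pow, one_div (2 : ℂ)]
  push_cast at this
  rw [this]

lemma latNorm_eq_umv {n : ℕ} {H : Matrix (Fin n) (Fin n) ℂ} (hH : H.IsHermitian)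
    (z : Fin n ⊕ Fin n → ℤ) :
    cquad (realGram H) (fun k => (z k : ℂ)) = latNorm H (latEquiv n z).1 := by
  rw [cquad_realGram hH, latNorm, latEquiv_val]
  congr 1
  simpa using umv_ofReal (fun k => (z k : ℝ))

/-- `x ↦ h(a, x)`. -/
noncomputable def hprod {n : ℕ} (H : Matrix (Fin n) (Fin n) ℂ) (a x : Fin n → ℂ) : ℂ :=
  star a ⬝ᵥ H *ᵥ x

lemma gauss_arg {n : ℕ} {H : Matrix (Fin n) (Fin n) ℂ} (hH : H.IsHermitian)
    (z : Fin n ⊕ Fin n → ℂ) (u v : Fin n → ℂ) :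
    ∑ k, (((realGram H).map ((↑) : ℝ → ℂ)) *ᵥ coords u v) k * z k =
      (umv z ⬝ᵥ H *ᵥ u + v ⬝ᵥ H *ᵥ upv z) / 2 := by
  have := realGram_bilin hH z (coords u v)
  rw [upv_coords, umv_coords, dotProduct_comm] at this
  exact this

theorem theta_gen {n : ℕ} {H : Matrix (Fin n) (Fin n) ℂ} (hU : IsUnimodular H) :
    ∃ C : ℂ, ∀ τ : ℂ, 0 < τ.im → ∀ a b : Fin n → ℂ, hprod H a b = 0 → ∀ s t : ℂ,
      ∑' x : LatVec n, cexp (2 * Real.pi * I * τ * latNorm H x.1 +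
        2 * Real.pi * (s * hprod H a x.1 + t * hprod H x.1 b)) =
      C * (1 / (-2 * I * τ)) ^ n * ∑' x : LatVec n,
        cexp (2 * Real.pi * I * (-1 / (3 * τ)) * latNorm H x.1 +
          2 * Real.pi * (I / (Real.sqrt 3 * τ)) * (s * hprod H a x.1 - t * hprod H x.1 b)) := by
  have hH := hU.1.2.1
  have hA := realGram_posDef hU.1.2.2
  obtain ⟨C, hC⟩ := tsum_gauss_eq_fintype hA
  refine ⟨C, fun τ hτ a b hab s t => ?_⟩
  have hτ0 : τ ≠ 0 := fun h => by simp [h] at hτ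
  have h3 := sqrt_three_ne
  have h3' := sqrt_three_sq'
  let B : Fin n ⊕ Fin n → ℂ := coords ((2 * t) • b) ((2 * s) • star a)
  have h := hC (-2 * I * τ) (by simpa using hτ) (((realGram H).map ((↑) : ℝ → ℂ)) *ᵥ B)
  rw [Fintype.card_sum, Fintype.card_fin, cpow_half_pow] at h
  rw [← (latEquiv n).tsum_eq]
  have hum : ∀ z : Fin n ⊕ Fin n → ℤ, umv (fun k => (z k : ℂ)) = star (latEquiv n z).1 := fun z => by
    rw [latEquiv_val]
    simpa using umv_ofReal (fun k => (z k : ℝ))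
  have hB : ∀ z : Fin n ⊕ Fin n → ℂ,
      ∑ k, (((realGram H).map ((↑) : ℝ → ℂ)) *ᵥ B) k * z k =
      s * hprod H a (upv z) + t * (umv z ⬝ᵥ H *ᵥ b) := fun z => by
    rw [gauss_arg hH, hprod]
    simp only [mulVec_smul, dotProduct_smul, smul_dotProduct, smul_eq_mul]
    ring
  refine (tsum_congr fun z => ?_).trans (h.trans ?_)
  · rw [latNorm_eq_umv hH, hB, hum]
    congr 1
    rw [← latEquiv_val, hprod, hprod]
    ring
  congr 1
  let φ : LatVec n ≃ (Fin n ⊕ Fin n → ℤ) :=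
    (mulVecEquiv hU).trans ((latEquiv n).symm.trans (rotEquiv n))
  rw [← φ.tsum_eq]
  refine tsum_congr fun x => ?_
  set δ : ℂ := 2 * I / Real.sqrt 3 with hδ
  let Z : Fin n ⊕ Fin n → ℂ := coords (δ • x.1) (-δ • star x.1)
  have hZ : (fun k => (φ x k : ℂ)) = ((realGram H).map ((↑) : ℝ → ℂ)) *ᵥ Z := by
    set c := (latEquiv n).symm (mulVecEquiv hU x) with hc
    have hx : ∀ i, (H *ᵥ x.1) i = c (.inl i) + ω * c (.inr i) := fun i => by
      have := congrFun (congrArg Subtype.val ((latEquiv n).apply_symm_apply (mulVecEquiv hU x))) i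
      rw [← hc, latEquiv_val] at this
      exact this.symm
    have hx' : ∀ i, (star x.1 ᵥ* H) i = c (.inl i) + (-1 - ω) * c (.inr i) := fun i => by
      have h1 := congrFun (Matrix.star_mulVec H x.1) i
      rw [hH.eq] at h1
      rw [← h1, Pi.star_apply, hx]
      simp [conj_ω]
    have hgen : ∀ k, (((realGram H).map ((↑) : ℝ → ℂ)) *ᵥ Z) k =
        (umv (Pi.single k 1) ⬝ᵥ H *ᵥ (δ • x.1) + (-δ • star x.1) ⬝ᵥ H *ᵥ upv (Pi.single k 1)) / 2 := by
      intro k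
      rw [← gauss_arg hH]
      simp [Pi.single_apply, Z]
    have hδω : δ * (2 * ω + 1) = -2 := by
      rw [two_ω_add_one, hδ]; field_simp; rw [I_sq]
    ext k
    rw [hgen]
    simp only [mulVec_smul, dotProduct_smul, smul_dotProduct, smul_eq_mul, dotProduct_mulVec (star x.1)]
    rcases k with i | i
    · have e1 : umv (Pi.single (Sum.inl i : Fin n ⊕ Fin n) (1 : ℂ)) = Pi.single i 1 := by
        ext j; simp [umv, Pi.single_apply]
      have e2 : upv (Pi.single (Sum.inl i : Fin n ⊕ Fin n) (1 : ℂ)) = Pi.single i 1 := by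
        ext j; simp [upv, Pi.single_apply]
      rw [e1, e2, single_one_dotProduct, dotProduct_single_one, hx, hx']
      have : (φ x (.inl i) : ℂ) = -c (.inr i) := by simp [φ, rotEquiv, hc]
      rw [this]
      linear_combination (-(c (.inr i) : ℂ) / 2) * hδω
    · have e1 : umv (Pi.single (Sum.inr i : Fin n ⊕ Fin n) (1 : ℂ)) = (-1 - ω) • Pi.single i 1 := by
        ext j; simp [umv, Pi.single_apply]
      have e2 : upv (Pi.single (Sum.inr i : Fin n ⊕ Fin n) (1 : ℂ)) = ω • Pi.single i 1 := by
        ext j; simp [upv, Pi.single_apply]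
      rw [e1, e2, smul_dotProduct, dotProduct_smul, single_one_dotProduct, dotProduct_single_one, hx, hx']
      have : (φ x (.inr i) : ℂ) = c (.inl i) := by simp [φ, rotEquiv, hc]
      rw [this, smul_eq_mul, smul_eq_mul]
      linear_combination ((c (.inl i) : ℂ) / 2) * hδω
  have hB0 : cquad (realGram H) B = 0 := by
    rw [cquad_realGram hH, upv_coords, umv_coords]
    simp only [mulVec_smul, dotProduct_smul, smul_dotProduct, smul_eq_mul]
    rw [show star a ⬝ᵥ H *ᵥ b = 0 from hab]
    ring
  have hZ0 : cquad (realGram H) Z = 4 / 3 * latNorm H x.1 := by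
    rw [cquad_realGram hH, upv_coords, umv_coords, latNorm]
    simp only [mulVec_smul, dotProduct_smul, smul_dotProduct, smul_eq_mul, hδ]
    field_simp
    rw [I_sq, h3']
    ring
  have hcq : cquad (realGram H)⁻¹ (fun i => (φ x i : ℂ) +
      I * (((realGram H).map ((↑) : ℝ → ℂ)) *ᵥ B) i) =
      4 / 3 * latNorm H x.1 + 2 * I * δ * (s * hprod H a x.1 - t * hprod H x.1 b) := by
    have h1 : (fun i => (φ x i : ℂ) + I * (((realGram H).map ((↑) : ℝ → ℂ)) *ᵥ B) i) =
        ((realGram H).map ((↑) : ℝ → ℂ)) *ᵥ (fun i => Z i + I * B i) := by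
      have : (fun i => Z i + I * B i) = Z + I • B := by ext; simp
      rw [this, mulVec_add, mulVec_smul, ← hZ]
      rfl
    rw [h1, cquad_mulVec_inv hA, cquad_add_I hA.isHermitian, hB, hB0, hZ0, upv_coords, umv_coords,
      hprod, hprod, hprod]
    simp only [mulVec_smul, dotProduct_smul, smul_dotProduct, smul_eq_mul]
    ring
  rw [hcq]
  congr 1
  rw [hδ]
  have hI := I_ne_zero
  field_simp
  rw [I_sq]
  ring

lemma summable_mul_exp_mul {X : Type*} {w α : X → ℂ}
    (hw : ∀ R : ℝ, Summable fun x => ‖w x‖ * Real.exp (R * ‖α x‖)) (R : ℝ) :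
    Summable fun x => ‖w x * α x‖ * Real.exp (R * ‖α x‖) := by
  refine Summable.of_nonneg_of_le (fun x => by positivity) (fun x => ?_) (hw (R + 1))
  rw [norm_mul, mul_assoc]
  gcongr
  rw [add_mul, Real.exp_add, mul_comm]
  gcongr
  have := Real.add_one_le_exp (‖α x‖)
  rw [one_mul]
  linarith

lemma norm_mul_cexp_le {w α s : ℂ} {R : ℝ} (hs : ‖s‖ ≤ R) :
    ‖w * cexp (s * α)‖ ≤ ‖w‖ * Real.exp (R * ‖α‖) := by
  rw [norm_mul, norm_exp]
  gcongr
  refine (re_le_norm _).trans ?_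
  rw [norm_mul]
  gcongr

lemma hasDerivAt_tsum_exp {X : Type*} {w α : X → ℂ}
    (hw : ∀ R : ℝ, Summable fun x => ‖w x‖ * Real.exp (R * ‖α x‖)) (s : ℂ) :
    HasDerivAt (fun s => ∑' x, w x * cexp (s * α x)) (∑' x, (w x * α x) * cexp (s * α x)) s := by
  have hs : s ∈ Metric.ball (0 : ℂ) (‖s‖ + 1) := by simp
  refine hasDerivAt_tsum_of_isPreconnected (𝕜 := ℂ) (F := ℂ)
    (g := fun x s => w x * cexp (s * α x)) (g' := fun x s => w x * α x * cexp (s * α x))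
    (summable_mul_exp_mul hw (‖s‖ + 1))
    Metric.isOpen_ball (convex_ball (0 : ℂ) _).isPreconnected (fun x y _ => ?_) (fun x y hy => ?_)
    hs ?_ hs
  · have := (((hasDerivAt_id y).mul_const (α x)).cexp).const_mul (w x)
    exact this.congr_deriv (by simp only [id]; ring)
  · exact norm_mul_cexp_le (by simpa using (mem_ball_zero_iff.1 hy).le)
  · exact Summable.of_norm_bounded (hw (‖s‖ + 1)) fun x => norm_mul_cexp_le (by simp)

lemma tsum_mul_pow_eq {X Y : Type*} {α : X → ℂ} {β : Y → ℂ} (p : ℕ) : ∀ {w : X → ℂ} {v : Y → ℂ},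
    (∀ R : ℝ, Summable fun x => ‖w x‖ * Real.exp (R * ‖α x‖)) →
    (∀ R : ℝ, Summable fun x => ‖v x‖ * Real.exp (R * ‖β x‖)) →
    (∀ s : ℂ, ∑' x, w x * cexp (s * α x) = ∑' y, v y * cexp (s * β y)) →
    ∑' x, w x * α x ^ p = ∑' y, v y * β y ^ p := by
  induction p with
  | zero => intro w v _ _ h; simpa using h 0
  | succ p ih =>
    intro w v hw hv h
    simp only [pow_succ', ← mul_assoc]
    refine ih (summable_mul_exp_mul hw) (summable_mul_exp_mul hv) fun s => ?_
    have := hasDerivAt_tsum_exp hw s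
    rw [funext h] at this
    exact this.unique (hasDerivAt_tsum_exp hv s)

/-- The sum of the absolute values of the coordinates. -/
noncomputable def lone {n : ℕ} (x : Fin n → ℂ) : ℝ := ∑ i, ‖x i‖

lemma lone_nonneg {n : ℕ} (x : Fin n → ℂ) : 0 ≤ lone x := Finset.sum_nonneg fun _ _ => norm_nonneg _

lemma exists_hprod_le {n : ℕ} (H : Matrix (Fin n) (Fin n) ℂ) (a : Fin n → ℂ) :
    ∃ M : ℝ, 0 ≤ M ∧ ∀ x, ‖hprod H a x‖ ≤ M * lone x := by
  refine ⟨∑ i, ‖(star a ᵥ* H) i‖, by positivity, fun x => ?_⟩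
  rw [hprod, dotProduct_mulVec, dotProduct, lone, Finset.sum_mul]
  refine (norm_sum_le _ _).trans (Finset.sum_le_sum fun i _ => ?_)
  rw [norm_mul]
  gcongr
  exact Finset.single_le_sum (f := fun i => ‖x i‖) (fun _ _ => norm_nonneg _) (Finset.mem_univ i)

lemma hprod_swap {n : ℕ} {H : Matrix (Fin n) (Fin n) ℂ} (hH : H.IsHermitian) (a b : Fin n → ℂ) :
    hprod H a b = (starRingEnd ℂ) (hprod H b a) := by
  have : star (star b ⬝ᵥ H *ᵥ a) = star a ⬝ᵥ H *ᵥ b := by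
    rw [star_dotProduct, star_mulVec, hH.eq, star_star, ← dotProduct_mulVec]
  exact this.symm

lemma norm_ω : ‖ω‖ = 1 := by
  have : ‖ω‖ ^ 2 = 1 := by
    rw [← Complex.normSq_eq_norm_sq, normSq_apply, ω_re, ω_im]
    have := sqrt_three_sq
    nlinarith
  nlinarith [norm_nonneg ω]

lemma summable_lat {n : ℕ} {H : Matrix (Fin n) (Fin n) ℂ} (hH : H.PosDef) {y : ℝ} (hy : 0 < y)
    (R : ℝ) : Summable fun x : LatVec n =>
      Real.exp (-(2 * Real.pi * y) * (latNorm H x.1).re + R * lone x.1) := by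
  obtain ⟨c, hc, hcA⟩ := (realGram_posDef hH).exists_mul_sum_sq_le
  have hpi := Real.pi_pos
  rw [← (latEquiv n).summable_iff]
  refine Summable.of_nonneg_of_le (fun _ => (Real.exp_pos _).le) (fun z => ?_)
    (summable_gaussian' (ι := Fin n ⊕ Fin n) (c := 2 * Real.pi * y * c) (by positivity) |R|)
  refine Real.exp_le_exp.2 ?_
  have h1 : (latNorm H (latEquiv n z).1).re = _ := congrArg Complex.re
    ((latNorm_eq_umv hH.isHermitian z).symm.trans (cquad_ofReal (realGram H) fun k => (z k : ℝ)))
  rw [ofReal_re] at h1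
  have h2 := hcA fun k => (z k : ℝ)
  have h3 : lone (latEquiv n z).1 ≤ ∑ k, |(z k : ℝ)| := by
    rw [lone, Fintype.sum_sum_type, ← Finset.sum_add_distrib]
    refine Finset.sum_le_sum fun i _ => ?_
    rw [latEquiv_val, upv]
    refine (norm_add_le _ _).trans ?_
    simp [norm_ω]
  have h4 : R * lone (latEquiv n z).1 ≤ |R| * ∑ k, |(z k : ℝ)| :=
    (mul_le_mul_of_nonneg_right (le_abs_self R) (lone_nonneg _)).trans (by gcongr)
  rw [h1, Finset.sum_add_distrib, ← Finset.mul_sum, ← Finset.mul_sum]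
  have h5 : 2 * Real.pi * y * (c * ∑ i, (z i : ℝ) ^ 2) ≤ 2 * Real.pi * y *
    ((fun k => (z k : ℝ)) ⬝ᵥ realGram H *ᵥ fun k => (z k : ℝ)) := by gcongr
  linarith

lemma latNorm_im {n : ℕ} {H : Matrix (Fin n) (Fin n) ℂ} (hH : H.IsHermitian) (x : Fin n → ℂ) :
    (latNorm H x).im = 0 := by
  have := hprod_swap hH x x
  exact Complex.conj_eq_iff_im.1 this.symm

lemma latNorm_eq_re {n : ℕ} {H : Matrix (Fin n) (Fin n) ℂ} (hH : H.IsHermitian) (x : Fin n → ℂ) :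
    latNorm H x = (latNorm H x).re := by
  apply Complex.ext <;> simp [latNorm_im hH]

lemma norm_qexp {n : ℕ} {H : Matrix (Fin n) (Fin n) ℂ} (hH : H.IsHermitian) (τ : ℂ) (x : Fin n → ℂ) :
    ‖cexp (2 * Real.pi * I * τ * latNorm H x)‖ =
      Real.exp (-(2 * Real.pi * τ.im) * (latNorm H x).re) := by
  rw [norm_exp, latNorm_eq_re hH]
  congr 1
  simp

/-- Theta series with spherical coefficient. -/
noncomputable def thetaF {n : ℕ} (H : Matrix (Fin n) (Fin n) ℂ) (p q : ℕ) (a b : Fin n → ℂ)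
    (τ : ℂ) : ℂ :=
  ∑' x : LatVec n, cexp (2 * Real.pi * I * τ * latNorm H x.1) *
    hprod H a x.1 ^ p * hprod H x.1 b ^ q

lemma summable_theta_exp {n : ℕ} {H : Matrix (Fin n) (Fin n) ℂ} (hH : H.PosDef) {τ : ℂ}
    (hτ : 0 < τ.im) (a b : Fin n → ℂ) (R S : ℝ) :
    Summable fun x : LatVec n => ‖cexp (2 * Real.pi * I * τ * latNorm H x.1)‖ *
      Real.exp (R * ‖hprod H a x.1‖) * Real.exp (S * ‖hprod H x.1 b‖) := by
  obtain ⟨M, hM, ha⟩ := exists_hprod_le H a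
  obtain ⟨M', hM', hb⟩ := exists_hprod_le H b
  refine Summable.of_nonneg_of_le (fun _ => by positivity) (fun x => ?_)
    (summable_lat hH hτ (|R| * M + |S| * M'))
  rw [norm_qexp hH.isHermitian, ← Real.exp_add, ← Real.exp_add]
  refine Real.exp_le_exp.2 ?_
  have h1 : R * ‖hprod H a x.1‖ ≤ |R| * (M * lone x.1) :=
    (mul_le_mul_of_nonneg_right (le_abs_self R) (norm_nonneg _)).trans (by gcongr; exact ha _)
  have h2 : S * ‖hprod H x.1 b‖ ≤ |S| * (M' * lone x.1) := by
    rw [hprod_swap hH.isHermitian, RCLike.norm_conj]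
    exact (mul_le_mul_of_nonneg_right (le_abs_self S) (norm_nonneg _)).trans (by gcongr; exact hb _)
  linarith

lemma norm_pow_le_exp (p : ℕ) (u : ℂ) : ‖u ^ p‖ ≤ p.factorial * Real.exp ‖u‖ := by
  have := Real.pow_div_factorial_le_exp ‖u‖ (norm_nonneg _) p
  rw [div_le_iff₀ (by positivity)] at this
  rw [norm_pow]; linarith

lemma summable_theta {n : ℕ} {H : Matrix (Fin n) (Fin n) ℂ} (hH : H.PosDef) {τ : ℂ}
    (hτ : 0 < τ.im) (p : ℕ) (a b : Fin n → ℂ) (S : ℝ) (c d : ℂ) :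
    Summable fun x : LatVec n => ‖c * cexp (2 * Real.pi * I * τ * latNorm H x.1) *
      (d * hprod H a x.1) ^ p‖ * Real.exp (S * ‖hprod H x.1 b‖) := by
  refine Summable.of_nonneg_of_le (fun _ => by positivity) (fun x => ?_)
    ((summable_theta_exp hH hτ a b ‖d‖ S).mul_left (‖c‖ * p.factorial))
  rw [norm_mul, norm_mul]
  have := norm_pow_le_exp p (d * hprod H a x.1)
  rw [norm_mul] at this
  calc _ ≤ ‖c‖ * ‖cexp (2 * Real.pi * I * τ * latNorm H x.1)‖ *
      (p.factorial * Real.exp (‖d‖ * ‖hprod H a x.1‖)) * Real.exp (S * ‖hprod H x.1 b‖) := by gcongr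
    _ = _ := by ring

lemma im_neg_one_div {τ : ℂ} (hτ : 0 < τ.im) : 0 < (-1 / (3 * τ)).im := by
  have h : 0 < normSq (3 * τ) := normSq_pos.2 fun h => by
    have := mul_eq_zero.1 h
    rcases this with h | h
    · norm_num at h
    · simp [h] at hτ
  rw [neg_div, one_div, neg_im, inv_im, neg_div, neg_neg]
  refine div_pos ?_ h
  simpa using hτ

lemma theta_fe_aux {n : ℕ} {H : Matrix (Fin n) (Fin n) ℂ} (hU : IsUnimodular H) :
    ∃ C : ℂ, ∀ τ : ℂ, 0 < τ.im → ∀ (a b : Fin n → ℂ) (p q : ℕ), hprod H a b = 0 →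
      thetaF H p q a b τ = C * (1 / (-2 * I * τ)) ^ n * (I / (Real.sqrt 3 * τ)) ^ p *
        (-(I / (Real.sqrt 3 * τ))) ^ q * thetaF H p q a b (-1 / (3 * τ)) := by
  obtain ⟨C, hC⟩ := theta_gen hU
  refine ⟨C, fun τ hτ a b p q hab => ?_⟩
  have hpi : (2 * Real.pi : ℂ) ≠ 0 := by exact_mod_cast (by positivity : 2 * Real.pi ≠ 0)
  have hτ' := im_neg_one_div hτ
  have hP := hU.1.2.2
  set κ := I / (Real.sqrt 3 * τ) with hκ
  set C' := C * (1 / (-2 * I * τ)) ^ n with hC'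
  have h1 : ∀ t s : ℂ, ∑' x : LatVec n, (cexp (2 * Real.pi * I * τ * latNorm H x.1) *
      cexp (t * (2 * Real.pi * hprod H x.1 b))) * cexp (s * (2 * Real.pi * hprod H a x.1)) =
      ∑' x : LatVec n, (C' * cexp (2 * Real.pi * I * (-1 / (3 * τ)) * latNorm H x.1) *
      cexp (t * (2 * Real.pi * (-κ) * hprod H x.1 b))) *
        cexp (s * (2 * Real.pi * κ * hprod H a x.1)) := fun t s => by
    simp only [mul_assoc C']
    rw [tsum_mul_left]
    refine (tsum_congr fun x => ?_).trans ((hC τ hτ a b hab s t).trans (congrArg _ (tsum_congr fun x => ?_)))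
    · rw [← Complex.exp_add, ← Complex.exp_add]
      congr 1; ring
    · rw [← Complex.exp_add, ← Complex.exp_add]
      congr 1; ring
  have hsum : ∀ (τ : ℂ), 0 < τ.im → ∀ c d e t R : ℂ, ∀ R : ℝ, Summable fun x : LatVec n =>
      ‖c * cexp (2 * Real.pi * I * τ * latNorm H x.1) * cexp (t * (d * hprod H x.1 b))‖ *
        Real.exp (R * ‖e * hprod H a x.1‖) := fun τ hτ c d e t R R => by
    refine Summable.of_nonneg_of_le (fun _ => by positivity) (fun x => ?_)
      ((summable_theta_exp hP hτ a b (R * ‖e‖) (‖t‖ * ‖d‖)).mul_left ‖c‖)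
    have h1 := norm_mul_cexp_le (w := 1) (α := d * hprod H x.1 b) (le_refl ‖t‖)
    rw [one_mul, norm_one, one_mul, norm_mul d, ← mul_assoc ‖t‖] at h1
    rw [norm_mul, norm_mul, norm_mul e, ← mul_assoc R]
    calc _ ≤ ‖c‖ * ‖cexp (2 * Real.pi * I * τ * latNorm H x.1)‖ *
          Real.exp (‖t‖ * ‖d‖ * ‖hprod H x.1 b‖) * Real.exp (R * ‖e‖ * ‖hprod H a x.1‖) := by gcongr
      _ = _ := by ring
  have h2 : ∀ t : ℂ, ∑' x : LatVec n, (cexp (2 * Real.pi * I * τ * latNorm H x.1) *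
      (2 * Real.pi * hprod H a x.1) ^ p) * cexp (t * (2 * Real.pi * hprod H x.1 b)) =
      ∑' x : LatVec n, (C' * cexp (2 * Real.pi * I * (-1 / (3 * τ)) * latNorm H x.1) *
        (2 * Real.pi * κ * hprod H a x.1) ^ p) *
      cexp (t * (2 * Real.pi * (-κ) * hprod H x.1 b)) := fun t => by
    simp only [mul_right_comm _ (_ ^ p)]
    exact tsum_mul_pow_eq p
      (by simpa using hsum τ hτ 1 (2 * Real.pi) (2 * Real.pi) t 0)
      (hsum _ hτ' C' (2 * Real.pi * (-κ)) (2 * Real.pi * κ) t 0) (h1 t)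
  have h3 := tsum_mul_pow_eq q (fun R => by
      simpa [mul_assoc] using summable_theta hP hτ p a b (R * ‖(2 * Real.pi : ℂ)‖) 1 (2 * Real.pi))
    (fun R => by
      simpa [mul_assoc] using summable_theta hP hτ' p a b (R * ‖(2 * Real.pi * κ : ℂ)‖) C' (2 * Real.pi * κ)) h2
  simp only [mul_pow] at h3
  have e1 : thetaF H p q a b τ = ((2 * Real.pi : ℂ) ^ (p + q))⁻¹ *
      ∑' x : LatVec n, (cexp (2 * Real.pi * I * τ * latNorm H x.1) *
      ((2 ^ p * Real.pi ^ p) * hprod H a x.1 ^ p)) * ((2 ^ q * Real.pi ^ q) * hprod H x.1 b ^ q) := by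
    rw [thetaF, ← tsum_mul_left]
    refine tsum_congr fun x => ?_
    rw [inv_mul_eq_div, eq_div_iff (pow_ne_zero _ hpi), mul_pow, pow_add, pow_add]
    ring
  rw [e1, h3, ← tsum_mul_left, thetaF, ← tsum_mul_left]
  refine tsum_congr fun x => ?_
  rw [inv_mul_eq_div, div_eq_iff (pow_ne_zero _ hpi), mul_pow, pow_add, pow_add]
  ring

lemma thetaF_zero_ne {n : ℕ} {H : Matrix (Fin n) (Fin n) ℂ} (hH : H.PosDef) {y : ℝ} (hy : 0 < y) :
    thetaF H 0 0 0 0 (I * y) ≠ 0 := by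
  have h1 : ∀ x : LatVec n, cexp (2 * Real.pi * I * (I * y) * latNorm H x.1) *
      hprod H 0 x.1 ^ 0 * hprod H x.1 0 ^ 0 =
      (Real.exp (-(2 * Real.pi * y) * (latNorm H x.1).re + 0 * lone x.1) : ℝ) := fun x => by
    rw [latNorm_eq_re hH.isHermitian]
    push_cast
    simp only [pow_zero, mul_one, ofReal_re]
    congr 1
    linear_combination (2 * Real.pi * y * (latNorm H x.1).re : ℂ) * I_mul_I
  rw [thetaF, tsum_congr h1, ← Complex.ofReal_tsum]
  have := (summable_lat hH hy 0).tsum_pos (fun _ => (Real.exp_pos _).le) ⟨0, fun i => zero_mem _⟩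
    (Real.exp_pos _)
  exact_mod_cast this.ne'

/-- The functional equation of the theta series of a unimodular Eisenstein lattice. -/
theorem theta_fe {n : ℕ} {H : Matrix (Fin n) (Fin n) ℂ} (hU : IsUnimodular H)
    {τ : ℂ} (hτ : 0 < τ.im) {a b : Fin n → ℂ} (p q : ℕ) (hab : hprod H a b = 0) :
    thetaF H p q a b τ = (-1) ^ q * (I / (Real.sqrt 3 * τ)) ^ (n + p + q) *
      thetaF H p q a b (-1 / (3 * τ)) := by
  obtain ⟨C, hC⟩ := theta_fe_aux hU
  have h3 := sqrt_three_ne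
  have hτ0 : τ ≠ 0 := fun h => by simp [h] at hτ
  have hI := I_ne_zero
  have hy : 0 < 1 / Real.sqrt 3 := by positivity
  have h1 := hC (I * (1 / Real.sqrt 3 : ℝ)) (by simp) 0 0 0 0 (by simp [hprod])
  have e1 : -1 / (3 * (I * (1 / Real.sqrt 3 : ℝ))) = I * (1 / Real.sqrt 3 : ℝ) := by
    rw [div_eq_iff (by simp)]
    push_cast
    field_simp
    rw [sqrt_three_sq', I_sq]; ring
  rw [e1, pow_zero, pow_zero, mul_one, mul_one] at h1
  have h2 := mul_right_cancel₀ (thetaF_zero_ne hU.1.2.2 hy) ((one_mul _).trans h1)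
  have e2 : C * (1 / (-2 * I * τ)) ^ n = (I / (Real.sqrt 3 * τ)) ^ n := by
    have : 1 / (-2 * I * τ) = (1 / (-2 * I * (I * (1 / Real.sqrt 3 : ℝ)))) * (I / (Real.sqrt 3 * τ)) := by
      push_cast
      field_simp
    rw [this, mul_pow, ← mul_assoc, ← h2, one_mul]
  rw [hC τ hτ a b p q hab, e2, neg_pow, pow_add, pow_add]
  ring

section LevelOne

open UpperHalfPlane ModularForm ModularGroup Filter Asymptotics CongruenceSubgroup
open scoped Manifold MatrixGroups Topology

lemma slash_S_eq {F : ℍ → ℂ} {k : ℤ} (h : ∀ z : ℍ, F (ModularGroup.S • z) = (z : ℂ) ^ k * F z) :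
    F ∣[k] ModularGroup.S = F := by
  ext z
  rw [SL_slash_apply, h, ModularGroup.denom_S, mul_right_comm, ← zpow_add₀ (ne_zero z), add_neg_cancel,
    zpow_zero, one_mul]

lemma denom_T (z : ℍ) : denom ModularGroup.T z = 1 := by
  rw [ModularGroup.denom_apply]
  simp [ModularGroup.T]

lemma slash_T_eq {F : ℍ → ℂ} {k : ℤ} (h : ∀ z : ℍ, F (ModularGroup.T • z) = F z) :
    F ∣[k] ModularGroup.T = F := by
  ext z
  rw [SL_slash_apply, h, denom_T, _root_.one_zpow, mul_one]

lemma discriminant_S (z : ℍ) :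
    ModularForm.discriminant (ModularGroup.S • z) = (z : ℂ) ^ 12 * ModularForm.discriminant z := by
  have h := congrFun ModularForm.discriminant_S_invariant z
  rw [SL_slash_apply, ModularGroup.denom_S] at h
  rw [← h, mul_comm, mul_assoc, ← zpow_natCast, ← zpow_add₀ (ne_zero z)]
  simp

lemma discriminant_T (z : ℍ) :
    ModularForm.discriminant (ModularGroup.T • z) = ModularForm.discriminant z := by
  have h := congrFun ModularForm.discriminant_T_invariant z
  rwa [SL_slash_apply, denom_T, _root_.one_zpow, mul_one] at h

/-- Quotient of a function of weight `k` and high vanishing order by the sixth power of the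
discriminant. -/
noncomputable def divDisc {F : ℍ → ℂ} (k : ℤ) (hd : MDiff F)
    (hS : ∀ z : ℍ, F (ModularGroup.S • z) = (z : ℂ) ^ k * F z)
    (hT : ∀ z : ℍ, F (ModularGroup.T • z) = F z)
    (hO : F =O[atImInfty] fun z => Real.exp (-2 * Real.pi * z.im) ^ 6) :
    ModularForm 𝒮ℒ (k - 72) :=
  have hsl : ∀ γ : SL(2, ℤ), (fun z => F z / ModularForm.discriminant z ^ 6) ∣[k - 72] γ =
      fun z => F z / ModularForm.discriminant z ^ 6 :=
    SlashInvariantForm.slash_action_generators_SL2Z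
      (slash_S_eq fun z => by
        rw [hS, discriminant_S, mul_pow, mul_div_mul_comm, ← pow_mul, zpow_sub₀ (ne_zero z)]
        norm_cast)
      (slash_T_eq fun z => by rw [hT, discriminant_T])
  { toFun := fun z => F z / ModularForm.discriminant z ^ 6
    slash_action_eq' := fun _ ⟨γ, hγ⟩ => hγ ▸ hsl γ
    holo' := hd.div (CuspForm.discriminant.holo'.pow 6) fun z => pow_ne_zero _ (discriminant_ne_zero z)
    bdd_at_cusps' := fun {c} hc => by
      rw [Subgroup.IsArithmetic.isCusp_iff_isCusp_SL2Z] at hc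
      rw [OnePoint.isBoundedAt_iff_forall_SL2Z hc]
      intro γ _
      rw [hsl γ, IsBoundedAtImInfty, BoundedAtFilter]
      exact (div_isBoundedUnder_of_isBigO
        (hO.trans (ModularForm.exp_isBigO_discriminant.pow 6))).isBigO_one ℝ }

lemma eq_zero_of_lt {F : ℍ → ℂ} {k : ℤ} (hk : k < 72) (hd : MDiff F)
    (hS : ∀ z : ℍ, F (ModularGroup.S • z) = (z : ℂ) ^ k * F z)
    (hT : ∀ z : ℍ, F (ModularGroup.T • z) = F z)
    (hO : F =O[atImInfty] fun z => Real.exp (-2 * Real.pi * z.im) ^ 6) (z : ℍ) : F z = 0 := by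
  have h := congrFun (ModularFormClass.levelOne_neg_weight_eq_zero (by omega) (divDisc k hd hS hT hO)) z
  have h' : F z / ModularForm.discriminant z ^ 6 = 0 := h
  rcases div_eq_zero_iff.1 h' with h | h
  · exact h
  · exact absurd h (pow_ne_zero _ (discriminant_ne_zero z))

end LevelOne

section Level3

/-- The data of a (holomorphic, level three) form of weight `2 * m` and Fricke sign `ε`. -/
structure Fricke (f : ℂ → ℂ) (m : ℕ) (ε : ℂ) : Prop where
  per : ∀ τ, f (τ + 1) = f τ
  fe : ∀ τ, 0 < τ.im → f (-1 / (3 * τ)) = ε * (-3 * τ ^ 2) ^ m * f τ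
  diff : DifferentiableOn ℂ f {τ | 0 < τ.im}

/-- The norm of a form from level three to level one. -/
noncomputable def levelNorm (f : ℂ → ℂ) (τ : ℂ) : ℂ :=
  f τ * f (τ / 3) * f ((τ + 1) / 3) * f ((τ + 2) / 3)

variable {f : ℂ → ℂ} {m : ℕ} {ε : ℂ}

lemma levelNorm_add_one (hf : Fricke f m ε) (τ : ℂ) : levelNorm f (τ + 1) = levelNorm f τ := by
  have h : f ((τ + 1 + 2) / 3) = f (τ / 3) := by
    rw [← hf.per (τ / 3)]; congr 1; ring
  simp only [levelNorm, hf.per, h]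
  rw [show τ + 1 + 1 = τ + 2 by ring]
  ring

lemma im_neg_inv_pos {τ : ℂ} (hτ : 0 < τ.im) : 0 < (-1 / τ).im := by
  have h0 : τ ≠ 0 := by rintro rfl; simp at hτ
  rw [neg_div, one_div, Complex.neg_im, Complex.inv_im, neg_div, neg_neg]
  exact div_pos hτ (Complex.normSq_pos.2 h0)

lemma im_div_three_pos {τ : ℂ} (hτ : 0 < τ.im) : 0 < (τ / 3).im := by
  have : (τ / 3).im = τ.im / 3 := by
    rw [show (3 : ℂ) = ((3 : ℝ) : ℂ) by norm_num, Complex.div_ofReal_im]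
  rw [this]; positivity

lemma Fricke.neg_inv (hf : Fricke f m ε) {τ : ℂ} (hτ : 0 < τ.im) :
    f (-1 / τ) = ε * (-(τ ^ 2) / 3) ^ m * f (τ / 3) := by
  have h := hf.fe (τ / 3) (im_div_three_pos hτ)
  rw [show 3 * (τ / 3) = τ by ring] at h
  rw [h]; congr 3; ring

lemma Fricke.conj_aux (hf : Fricke f m ε) (hε : ε * ε = 1) {σ ρ : ℂ} (hσ : 0 < σ.im) (hρ : 0 < ρ.im)
    (h : f σ = f (-1 / (3 * ρ))) : f (-1 / (3 * σ)) = (9 * (σ * ρ) ^ 2) ^ m * f ρ := by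
  rw [hf.fe σ hσ, h, hf.fe ρ hρ]
  calc _ = (ε * ε) * ((-3 * σ ^ 2) ^ m * (-3 * ρ ^ 2) ^ m) * f ρ := by ring
    _ = _ := by rw [hε, ← mul_pow, one_mul]; congr 2; ring

lemma levelNorm_neg_inv (hf : Fricke f m ε) (hε : ε * ε = 1) {τ : ℂ} (hτ : 0 < τ.im) :
    levelNorm f (-1 / τ) = τ ^ (8 * m) * levelNorm f τ := by
  have h0 : τ ≠ 0 := by rintro rfl; simp at hτ
  have hm1 : τ - 1 ≠ 0 := by intro h; rw [sub_eq_zero.1 h] at hτ; simp at hτ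
  have hp1 : τ + 1 ≠ 0 := by
    intro h; rw [eq_neg_of_add_eq_zero_left h] at hτ; simp at hτ
  have i1 : 0 < (τ - 1).im := by simpa using hτ
  have i2 : 0 < (τ + 1).im := by simpa using hτ
  have e1 : f (-1 / τ / 3) = ε * (-3 * τ ^ 2) ^ m * f τ := by
    rw [← hf.fe τ hτ]; congr 1; field_simp
  have e2 : f ((-1 / τ + 1) / 3) = (τ ^ 2) ^ m * f ((τ + 2) / 3) := by
    have := hf.conj_aux hε (σ := -1 / (τ - 1) - 1) (ρ := (τ - 1) / 3)
      (by simpa using im_neg_inv_pos i1) (im_div_three_pos i1) (by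
        rw [← hf.per]; congr 1; field_simp; ring)
    rw [← hf.per ((τ - 1) / 3)] at this
    have hne : -1 - (τ - 1) ≠ 0 := by ring_nf; simpa using h0
    convert this using 2
    · field_simp
      ring
    · congr 1; field_simp; ring
    · congr 1; ring
  have e3 : f ((-1 / τ + 2) / 3) = (τ ^ 2) ^ m * f ((τ + 1) / 3) := by
    have := hf.conj_aux hε (σ := -1 / (τ + 1) + 1) (ρ := (τ + 1) / 3)
      (by simpa using im_neg_inv_pos i2) (im_div_three_pos i2) (by
        rw [hf.per]; congr 1; field_simp)
    rw [← hf.per (-1 / (3 * (-1 / (τ + 1) + 1)))] at this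
    have hne : -1 + (τ + 1) ≠ 0 := by simpa using h0
    convert this using 2
    · field_simp
      ring
    · congr 1; field_simp; ring
  rw [levelNorm, hf.neg_inv hτ, e1, e2, e3, levelNorm]
  calc _ = (ε * ε) * ((-(τ ^ 2) / 3) ^ m * (-3 * τ ^ 2) ^ m * (τ ^ 2) ^ m * (τ ^ 2) ^ m) *
        (f τ * f (τ / 3) * f ((τ + 1) / 3) * f ((τ + 2) / 3)) := by ring
    _ = _ := by
      rw [hε, one_mul, ← mul_pow, ← mul_pow, ← mul_pow, pow_mul]; congr 2; ring

lemma differentiableOn_levelNorm (hf : Fricke f m ε) :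
    DifferentiableOn ℂ (levelNorm f) {τ | 0 < τ.im} := by
  have h (c : ℂ) (hc : c.im = 0) : DifferentiableOn ℂ (fun τ => f ((τ + c) / 3)) {τ | 0 < τ.im} :=
    hf.diff.comp (by fun_prop) fun τ hτ => im_div_three_pos (by simpa [hc] using hτ)
  have h0 := h 0 (by simp)
  simp only [add_zero] at h0
  exact ((hf.diff.mul h0).mul (h 1 (by simp))).mul (h 2 (by simp))

end Level3

section QExp

/-- `f` agrees with `a 0 + a 1 q + a 2 q² + a 3 q³` up to `O(q⁴)`, `q = exp (2πiτ)`. -/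
def QApprox (f : ℂ → ℂ) (a₀ a₁ a₂ a₃ : ℂ) : Prop :=
  ∃ C : ℝ, ∀ τ : ℂ, 1 ≤ τ.im →
    ‖f τ - (a₀ + a₁ * cexp (2 * Real.pi * I * τ) + a₂ * cexp (2 * Real.pi * I * τ) ^ 2 +
      a₃ * cexp (2 * Real.pi * I * τ) ^ 3)‖ ≤ C * ‖cexp (2 * Real.pi * I * τ)‖ ^ 4

lemma norm_q (τ : ℂ) : ‖cexp (2 * Real.pi * I * τ)‖ = Real.exp (-(2 * Real.pi * τ.im)) := by
  rw [Complex.norm_exp]; simp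

lemma norm_q_le_one {τ : ℂ} (h : 1 ≤ τ.im) : ‖cexp (2 * Real.pi * I * τ)‖ ≤ 1 := by
  rw [norm_q, Real.exp_le_one_iff]
  have := Real.pi_pos
  nlinarith

variable {f g : ℂ → ℂ} {a₀ a₁ a₂ a₃ b₀ b₁ b₂ b₃ : ℂ}

lemma QApprox.add (hf : QApprox f a₀ a₁ a₂ a₃) (hg : QApprox g b₀ b₁ b₂ b₃) :
    QApprox (fun τ => f τ + g τ) (a₀ + b₀) (a₁ + b₁) (a₂ + b₂) (a₃ + b₃) := by
  obtain ⟨C, hC⟩ := hf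
  obtain ⟨D, hD⟩ := hg
  refine ⟨C + D, fun τ hτ => ?_⟩
  rw [add_mul C D]
  refine le_trans (le_of_eq ?_) ((norm_add_le _ _).trans (add_le_add (hC τ hτ) (hD τ hτ)))
  simp only []
  congr 1; ring

lemma QApprox.const_mul (c : ℂ) (hf : QApprox f a₀ a₁ a₂ a₃) :
    QApprox (fun τ => c * f τ) (c * a₀) (c * a₁) (c * a₂) (c * a₃) := by
  obtain ⟨C, hC⟩ := hf
  refine ⟨‖c‖ * C, fun τ hτ => ?_⟩
  rw [mul_assoc ‖c‖ C]
  refine le_trans (le_of_eq ?_) (mul_le_mul_of_nonneg_left (hC τ hτ) (norm_nonneg c))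
  rw [← norm_mul]; congr 1; ring

lemma QApprox.mul (hf : QApprox f a₀ a₁ a₂ a₃) (hg : QApprox g b₀ b₁ b₂ b₃) :
    QApprox (fun τ => f τ * g τ) (a₀ * b₀) (a₀ * b₁ + a₁ * b₀) (a₀ * b₂ + a₁ * b₁ + a₂ * b₀)
      (a₀ * b₃ + a₁ * b₂ + a₂ * b₁ + a₃ * b₀) := by
  obtain ⟨C, hC⟩ := hf
  obtain ⟨D, hD⟩ := hg
  refine ⟨C * (D + (‖b₀‖ + ‖b₁‖ + ‖b₂‖ + ‖b₃‖)) + (‖a₀‖ + ‖a₁‖ + ‖a₂‖ + ‖a₃‖) * D +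
    (‖a₁ * b₃ + a₂ * b₂ + a₃ * b₁‖ + ‖a₂ * b₃ + a₃ * b₂‖ + ‖a₃ * b₃‖), fun τ hτ => ?_⟩
  have h1 := hC τ hτ
  have h2 := hD τ hτ
  have hq1 := norm_q_le_one hτ
  generalize cexp (2 * Real.pi * I * τ) = q at *
  have hq0 := norm_nonneg q
  have hq2 : ‖q‖ ^ 2 ≤ 1 := pow_le_one₀ hq0 hq1
  have hq3 : ‖q‖ ^ 3 ≤ 1 := pow_le_one₀ hq0 hq1
  have hq4 : ‖q‖ ^ 4 ≤ 1 := pow_le_one₀ hq0 hq1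
  have hC0 : 0 ≤ C * ‖q‖ ^ 4 := (norm_nonneg _).trans h1
  have hD0 : 0 ≤ D * ‖q‖ ^ 4 := (norm_nonneg _).trans h2
  have hpoly (c₀ c₁ c₂ c₃ : ℂ) :
      ‖c₀ + c₁ * q + c₂ * q ^ 2 + c₃ * q ^ 3‖ ≤ ‖c₀‖ + ‖c₁‖ + ‖c₂‖ + ‖c₃‖ := by
    refine (norm_add_le _ _).trans (add_le_add ((norm_add_le _ _).trans (add_le_add
      ((norm_add_le _ _).trans (add_le_add le_rfl ?_)) ?_)) ?_) <;> simp only [norm_mul, norm_pow] <;>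
      exact mul_le_of_le_one_right (norm_nonneg _) (by assumption)
  set P := a₀ + a₁ * q + a₂ * q ^ 2 + a₃ * q ^ 3
  set Q := b₀ + b₁ * q + b₂ * q ^ 2 + b₃ * q ^ 3
  have hD1 : D * ‖q‖ ^ 4 ≤ D ∨ D < 0 := by
    rcases lt_or_ge D 0 with h | h
    · exact Or.inr h
    · exact Or.inl (mul_le_of_le_one_right h hq4)
  have hg' : ‖g τ‖ ≤ D * ‖q‖ ^ 4 + (‖b₀‖ + ‖b₁‖ + ‖b₂‖ + ‖b₃‖) := by
    calc ‖g τ‖ = ‖(g τ - Q) + Q‖ := by ring_nf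
      _ ≤ _ := (norm_add_le _ _).trans (add_le_add h2 (hpoly _ _ _ _))
  have hqpos : 0 < ‖q‖ ^ 4 ∨ ‖q‖ ^ 4 = 0 := by
    rcases (pow_nonneg hq0 4).lt_or_eq with h | h
    · exact Or.inl h
    · exact Or.inr h.symm
  have hgD : (C * ‖q‖ ^ 4) * ‖g τ‖ ≤ (C * ‖q‖ ^ 4) * (D + (‖b₀‖ + ‖b₁‖ + ‖b₂‖ + ‖b₃‖)) := by
    rcases hqpos with h | h
    · have : 0 ≤ D := nonneg_of_mul_nonneg_left hD0 h
      exact mul_le_mul_of_nonneg_left (hg'.trans (add_le_add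
        (mul_le_of_le_one_right this hq4) le_rfl)) hC0
    · simp [h]
  have key : f τ * g τ - (a₀ * b₀ + (a₀ * b₁ + a₁ * b₀) * q + (a₀ * b₂ + a₁ * b₁ + a₂ * b₀) * q ^ 2 +
      (a₀ * b₃ + a₁ * b₂ + a₂ * b₁ + a₃ * b₀) * q ^ 3) =
      (f τ - P) * g τ + P * (g τ - Q) + ((a₁ * b₃ + a₂ * b₂ + a₃ * b₁) + (a₂ * b₃ + a₃ * b₂) * q +
        (a₃ * b₃) * q ^ 2 + 0 * q ^ 3) * q ^ 4 := by
    simp only [P, Q]; ring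
  rw [key]
  have t1 : ‖(f τ - P) * g τ‖ ≤ (C * (D + (‖b₀‖ + ‖b₁‖ + ‖b₂‖ + ‖b₃‖))) * ‖q‖ ^ 4 := by
    rw [norm_mul]
    calc _ ≤ (C * ‖q‖ ^ 4) * ‖g τ‖ := mul_le_mul_of_nonneg_right h1 (norm_nonneg _)
      _ ≤ _ := hgD
      _ = _ := by ring
  have t2 : ‖P * (g τ - Q)‖ ≤ ((‖a₀‖ + ‖a₁‖ + ‖a₂‖ + ‖a₃‖) * D) * ‖q‖ ^ 4 := by
    rw [norm_mul, mul_assoc]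
    exact mul_le_mul (hpoly _ _ _ _) h2 (norm_nonneg _) (by positivity)
  have t3 := mul_le_mul_of_nonneg_right (hpoly (a₁ * b₃ + a₂ * b₂ + a₃ * b₁) (a₂ * b₃ + a₃ * b₂)
    (a₃ * b₃) 0) (pow_nonneg hq0 4)
  rw [← norm_pow, ← norm_mul, norm_pow, norm_zero, add_zero] at t3
  refine (norm_add₃_le).trans ((add_le_add (add_le_add t1 t2) t3).trans (le_of_eq ?_))
  ring

lemma QApprox.sum_zero (hf : QApprox f a₀ a₁ a₂ a₃) (h₀ : a₀ = b₀) (h₁ : a₁ = b₁) (h₂ : a₂ = b₂)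
    (h₃ : a₃ = b₃) : QApprox f b₀ b₁ b₂ b₃ := by
  subst h₀ h₁ h₂ h₃; exact hf

lemma QApprox.bound (hf : QApprox f 0 0 0 a₃) : ∃ C : ℝ, ∀ τ : ℂ, 1 ≤ τ.im →
    ‖f τ‖ ≤ C * ‖cexp (2 * Real.pi * I * τ)‖ ^ 3 := by
  obtain ⟨C, hC⟩ := hf
  refine ⟨|C| + ‖a₃‖, fun τ hτ => ?_⟩
  have h1 := hC τ hτ
  have hq1 := norm_q_le_one hτ
  generalize cexp (2 * Real.pi * I * τ) = q at *
  have hq0 := norm_nonneg q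
  calc ‖f τ‖ = ‖(f τ - (0 + 0 * q + 0 * q ^ 2 + a₃ * q ^ 3)) + a₃ * q ^ 3‖ := by ring_nf
    _ ≤ C * ‖q‖ ^ 4 + ‖a₃‖ * ‖q‖ ^ 3 := by
      refine (norm_add_le _ _).trans (add_le_add h1 ?_); rw [norm_mul, norm_pow]
    _ ≤ |C| * ‖q‖ ^ 3 + ‖a₃‖ * ‖q‖ ^ 3 := by
      exact add_le_add (mul_le_mul (le_abs_self C) (pow_le_pow_of_le_one hq0 hq1 (by norm_num))
        (by positivity) (abs_nonneg C)) le_rfl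
    _ = _ := by ring

lemma QApprox.ne_zero (hf : QApprox f 0 0 0 a₃) (h : a₃ ≠ 0) :
    ∃ Y : ℝ, ∀ τ : ℂ, Y ≤ τ.im → f τ ≠ 0 := by
  obtain ⟨C, hC⟩ := hf
  have ht : Filter.Tendsto (fun y : ℝ => |C| * Real.exp (-(2 * Real.pi * y))) Filter.atTop (nhds 0) := by
    rw [← mul_zero |C|]
    refine (Real.tendsto_exp_neg_atTop_nhds_zero.comp
      (Filter.tendsto_id.const_mul_atTop (by positivity))).const_mul _
  obtain ⟨Y, hY⟩ := Filter.eventually_atTop.1 (ht.eventually_lt_const (norm_pos_iff.2 h))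
  refine ⟨max Y 1, fun τ hτ h0 => ?_⟩
  have h1 := hC τ ((le_max_right _ _).trans hτ)
  have h2 := hY τ.im ((le_max_left _ _).trans hτ)
  rw [← norm_q] at h2
  have hqpos : 0 < ‖cexp (2 * Real.pi * I * τ)‖ := norm_pos_iff.2 (Complex.exp_ne_zero _)
  generalize cexp (2 * Real.pi * I * τ) = q at *
  have : ‖a₃‖ * ‖q‖ ^ 3 ≤ C * ‖q‖ ^ 4 := by
    simpa [h0, norm_mul] using h1
  have h3 : C * ‖q‖ ^ 4 ≤ (|C| * ‖q‖) * ‖q‖ ^ 3 := by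
    calc _ ≤ |C| * ‖q‖ ^ 4 := by gcongr; exact le_abs_self C
      _ = _ := by ring
  have h4 : (|C| * ‖q‖) * ‖q‖ ^ 3 < ‖a₃‖ * ‖q‖ ^ 3 := by gcongr
  linarith

end QExp

section LevelOne

open UpperHalfPlane ModularForm ModularGroup Filter Asymptotics CongruenceSubgroup
open scoped Manifold MatrixGroups Topology ArithmeticFunction.sigma

variable {f : ℂ → ℂ} {m : ℕ} {ε a₃ : ℂ}

lemma mdiff_levelNorm (hf : Fricke f m ε) : MDiff (fun z : ℍ => levelNorm f z) :=
  UpperHalfPlane.mdifferentiable_iff.2 ((differentiableOn_levelNorm hf).congr fun z hz => by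
    simp [ofComplex_apply_of_im_pos hz])

lemma levelNorm_S (hf : Fricke f m ε) (hε : ε * ε = 1) (z : ℍ) :
    levelNorm f (ModularGroup.S • z : ℍ) = (z : ℂ) ^ (8 * m : ℤ) * levelNorm f z := by
  rw [UpperHalfPlane.modular_S_smul]
  have h := levelNorm_neg_inv hf hε z.im_pos
  have e : (-(z : ℂ))⁻¹ = -1 / z := by rw [inv_neg, neg_div, one_div]
  rw [show (8 * m : ℤ) = ((8 * m : ℕ) : ℤ) by push_cast; rfl, zpow_natCast]
  simpa [e] using h

lemma levelNorm_T (hf : Fricke f m ε) (z : ℍ) :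
    levelNorm f (ModularGroup.T • z : ℍ) = levelNorm f z := by
  rw [UpperHalfPlane.modular_T_smul, ← levelNorm_add_one hf (z : ℂ), UpperHalfPlane.coe_vadd,
    add_comm, Complex.ofReal_one]

lemma levelNorm_isBigO (hq : QApprox f 0 0 0 a₃) :
    (fun z : ℍ => levelNorm f z) =O[atImInfty] fun z => Real.exp (-2 * Real.pi * z.im) ^ 6 := by
  obtain ⟨C, hC⟩ := hq.bound
  have him (τ : ℂ) : (τ / 3).im = τ.im / 3 := by
    rw [show (3 : ℂ) = ((3 : ℝ) : ℂ) by norm_num, Complex.div_ofReal_im]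
  refine IsBigO.of_bound (C * C * C * C) ?_
  rw [Filter.Eventually, atImInfty_mem]
  refine ⟨3, fun z hz => ?_⟩
  have hz' : 3 ≤ (z : ℂ).im := hz
  have h0 := hC z (by linarith)
  have h1 := hC (z / 3) (by rw [him]; linarith)
  have h2 := hC ((z + 1) / 3) (by rw [him]; simp; linarith)
  have h3 := hC ((z + 2) / 3) (by rw [him]; simp; linarith)
  rw [norm_q] at h0 h1 h2 h3
  simp only [him, Complex.add_im, Complex.one_im, Complex.im_ofNat, add_zero] at h1 h2 h3
  rw [Set.mem_ofPred_eq, levelNorm, norm_mul, norm_mul, norm_mul]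
  refine (mul_le_mul (mul_le_mul (mul_le_mul h0 h1 (norm_nonneg _) ((norm_nonneg _).trans h0)) h2
    (norm_nonneg _) ?_) h3 (norm_nonneg _) ?_).trans (le_of_eq ?_)
  · exact mul_nonneg ((norm_nonneg _).trans h0) ((norm_nonneg _).trans h1)
  · exact mul_nonneg (mul_nonneg ((norm_nonneg _).trans h0) ((norm_nonneg _).trans h1))
      ((norm_nonneg _).trans h2)
  rw [Real.norm_of_nonneg (by positivity)]
  simp only [← Real.exp_nat_mul]
  have hre (a b c d e : ℝ) (h : a + b + c + d = e) : (C * Real.exp a) * (C * Real.exp b) *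
      (C * Real.exp c) * (C * Real.exp d) = C * C * C * C * Real.exp e := by
    rw [← h, Real.exp_add, Real.exp_add, Real.exp_add]; ring
  apply hre
  push_cast
  rw [show z.im = (z : ℂ).im from rfl]
  ring

lemma QApprox.eq_zero_of_levelNorm (hq : QApprox f 0 0 0 a₃) (h : ∀ z : ℍ, levelNorm f z = 0) :
    a₃ = 0 := by
  by_contra ha
  obtain ⟨Y, hY⟩ := hq.ne_zero ha
  have him (τ : ℂ) : (τ / 3).im = τ.im / 3 := by
    rw [show (3 : ℂ) = ((3 : ℝ) : ℂ) by norm_num, Complex.div_ofReal_im]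
  set y : ℝ := 3 * max Y 1
  have hy : 0 < y := by positivity
  have hy1 : Y ≤ y / 3 := by simp [y]
  have hy2 : Y ≤ y := by
    have := le_max_left Y 1
    have := le_max_right Y 1
    simp only [y]; linarith
  have := h ⟨⟨0, y⟩, hy⟩
  simp only [levelNorm, mul_eq_zero] at this
  rcases this with ((h | h) | h) | h
  · exact hY _ hy2 h
  all_goals
    refine hY _ ?_ h
    rw [him]
    simpa using hy1

theorem Fricke.coef_eq_zero_of_le (hf : Fricke f m ε) (hε : ε * ε = 1) (hm : m ≤ 8)
    (hq : QApprox f 0 0 0 a₃) : a₃ = 0 :=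
  hq.eq_zero_of_levelNorm (eq_zero_of_lt (k := 8 * m) (by omega) (mdiff_levelNorm hf)
    (levelNorm_S hf hε) (levelNorm_T hf) (levelNorm_isBigO hq))

lemma E_eight_ne_zero (z : ℍ) (hz : (z : ℂ).re = 0) :
    E (k := 8) (by norm_num) z ≠ 0 := by
  rw [EisensteinSeries.q_expansion_bernoulli (by norm_num) (by decide)]
  have hb : bernoulli 8 = -1 / 30 := by decide +kernel
  rw [hb]
  have hzz : 2 * Real.pi * Complex.I * (z : ℂ) = ((-(2 * Real.pi * (z : ℂ).im) : ℝ) : ℂ) := by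
    have hz' : z.re = 0 := hz
    apply Complex.ext <;> simp [hz']
  rw [hzz, ← Complex.ofReal_exp]
  set r := Real.exp (-(2 * Real.pi * (z : ℂ).im))
  have hr : 0 < r := Real.exp_pos _
  have h0 : (0 : ℝ) ≤ ∑' n : ℕ+, (σ 7 n : ℝ) * r ^ (n : ℤ) :=
    tsum_nonneg fun n => by positivity
  have h1 : (1 : ℂ) - 2 * (8 : ℕ) / ((-1 / 30 : ℚ) : ℂ) *
      ∑' n : ℕ+, (σ (8 - 1) n : ℂ) * (r : ℂ) ^ (n : ℤ) =
      ((1 + 480 * ∑' n : ℕ+, (σ 7 n : ℝ) * r ^ (n : ℤ) : ℝ) : ℂ) := by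
    push_cast [Complex.ofReal_tsum]
    norm_num
  rw [h1, Ne, Complex.ofReal_eq_zero]
  positivity

theorem Fricke.coef_eq_zero_ten (hf : Fricke f 10 (-1)) (hq : QApprox f 0 0 0 a₃) : a₃ = 0 := by
  have hsq : ((Real.sqrt 3 : ℝ) : ℂ) ^ 2 = 3 := sqrt_three_sq'
  have hs0 : ((Real.sqrt 3 : ℝ) : ℂ) ≠ 0 := sqrt_three_ne
  refine hq.eq_zero_of_levelNorm ?_
  let z : ℍ := ⟨⟨0, Real.sqrt 3⟩, by simp⟩
  have hz : (z : ℂ) = Real.sqrt 3 * Complex.I := by apply Complex.ext <;> simp [z]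
  have h0 : f (z / 3) = 0 := by
    have h := hf.fe (z / 3) (by rw [hz]; simp)
    have e1 : -1 / (3 * ((z : ℂ) / 3)) = z / 3 := by
      rw [hz]; field_simp; rw [hsq, Complex.I_sq]; norm_num
    have e2 : -3 * ((z : ℂ) / 3) ^ 2 = 1 := by
      rw [hz, div_pow, mul_pow, hsq, Complex.I_sq]; norm_num
    rw [e1, e2] at h
    linear_combination h / 2
  have hg0 : levelNorm f z = 0 := by rw [levelNorm, h0]; ring
  have hS := levelNorm_S hf (by norm_num)
  let G : ModularForm 𝒮ℒ ((8 : ℕ) : ℤ) :=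
    divDisc (F := fun z : ℍ => levelNorm f z) 80 (mdiff_levelNorm hf) (by simpa using hS)
      (levelNorm_T hf) (levelNorm_isBigO hq)
  have hG (w : ℍ) : G w = levelNorm f w / ModularForm.discriminant w ^ 6 := rfl
  have hrank : Module.rank ℂ (ModularForm 𝒮ℒ ((8 : ℕ) : ℤ)) = 1 := by
    rw [ModularForm.rank_eq_one_add_rank_cuspForm (by norm_num) (by decide),
      CuspForm.rank_eq_zero_of_weight_lt_twelve (by norm_num), add_zero]
  have hE := E_eight_ne_zero z (by simp [z])
  obtain ⟨c, hc⟩ := (finrank_eq_one_iff_of_nonzero' (E (k := 8) (by norm_num))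
    (DFunLike.ne_iff.2 ⟨z, hE⟩)).1 (Module.rank_eq_one_iff_finrank_eq_one.1 hrank) G
  have hcz (w : ℍ) : c * E (k := 8) (by norm_num) w = G w := by rw [← hc]; rfl
  have hc0 : c = 0 := by
    have := hcz z
    rw [hG, hg0, zero_div] at this
    exact (mul_eq_zero.1 this).resolve_right hE
  intro w
  have := hcz w
  rw [hc0, zero_mul, hG, eq_comm, div_eq_zero_iff] at this
  exact this.resolve_right (pow_ne_zero _ (discriminant_ne_zero w))

end LevelOne

section ThetaSeries

variable {n : ℕ} {H : Matrix (Fin n) (Fin n) ℂ}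

lemma star_dotProduct_mem {x y : Fin n → ℂ} (hx : IsLatVec x) (hy : IsLatVec y) :
    star x ⬝ᵥ y ∈ 𝓞 :=
  sum_mem fun i _ => mul_mem (star_mem_𝓞 (hx i)) (hy i)

lemma hprod_mem (hH : EntriesIn H) {x y : Fin n → ℂ} (hx : IsLatVec x) (hy : IsLatVec y) :
    hprod H x y ∈ 𝓞 :=
  star_dotProduct_mem hx (hy.mulVec hH)

lemma exists_int_of_mem_𝓞 {z : ℂ} (hz : z ∈ 𝓞) (him : z.im = 0) : ∃ k : ℤ, z = k := by
  obtain ⟨a, b, rfl⟩ := mem_𝓞_iff.1 hz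
  simp only [add_im, intCast_im, mul_im, ω_im, intCast_re, zero_mul, add_zero, zero_add] at him
  have h3 : Real.sqrt 3 / 2 ≠ 0 := by positivity
  have hb : (b : ℝ) = 0 := (mul_eq_zero.1 him).resolve_right h3
  exact ⟨a, by rw [show b = 0 by exact_mod_cast hb]; simp⟩

lemma IsHermLattice.latNorm_nat (hH : IsHermLattice H) {x : Fin n → ℂ} (hx : IsLatVec x) :
    ∃ k : ℕ, latNorm H x = k := by
  obtain ⟨k, hk⟩ := exists_int_of_mem_𝓞 (hprod_mem hH.1 hx hx) (latNorm_im hH.2.1 x)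
  have h0 : 0 ≤ latNorm H x := hH.2.2.posSemidef.dotProduct_mulVec_nonneg x
  have hk' : latNorm H x = k := hk
  rw [hk'] at h0
  lift k to ℕ using by exact_mod_cast h0
  exact ⟨k, by rw [hk']; simp⟩

/-- The coefficient function of a theta series. -/
noncomputable def sph (H : Matrix (Fin n) (Fin n) ℂ) (p q : ℕ) (a b x : Fin n → ℂ) : ℂ :=
  hprod H a x ^ p * hprod H x b ^ q

lemma thetaF_eq (p q : ℕ) (a b : Fin n → ℂ) (τ : ℂ) : thetaF H p q a b τ =
    ∑' x : LatVec n, cexp (2 * Real.pi * I * τ * latNorm H x.1) * sph H p q a b x.1 := by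
  simp only [thetaF, sph, mul_assoc]

lemma summable_thetaF (hH : H.PosDef) {y : ℝ} (hy : 0 < y) (p q : ℕ) (a b : Fin n → ℂ) :
    Summable fun x : LatVec n =>
      Real.exp (-(2 * Real.pi * y) * (latNorm H x.1).re) * ‖sph H p q a b x.1‖ := by
  have h := (summable_theta_exp hH (τ := I * y) (by simpa using hy) a b 1 1).mul_left
    ((p.factorial : ℝ) * q.factorial)
  refine Summable.of_nonneg_of_le (fun _ => by positivity) (fun x => ?_) h
  rw [norm_qexp hH.isHermitian, sph, norm_mul, one_mul, one_mul]
  have h1 := norm_pow_le_exp p (hprod H a x.1)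
  have h2 := norm_pow_le_exp q (hprod H x.1 b)
  have h3 := mul_le_mul h1 h2 (norm_nonneg _) (by positivity)
  have h4 := mul_le_mul_of_nonneg_left h3
    (Real.exp_pos (-(2 * Real.pi * y) * (latNorm H x.1).re)).le
  have e : (I * (y : ℂ)).im = y := by simp
  rw [e]
  linarith

lemma thetaF_add_one (hH : IsHermLattice H) (p q : ℕ) (a b : Fin n → ℂ) (τ : ℂ) :
    thetaF H p q a b (τ + 1) = thetaF H p q a b τ := by
  refine tsum_congr fun x => ?_
  obtain ⟨k, hk⟩ := hH.latNorm_nat x.2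
  rw [hk, show 2 * Real.pi * I * (τ + 1) * (k : ℂ) =
    2 * Real.pi * I * τ * k + (k : ℤ) * (2 * Real.pi * I) by push_cast; ring, Complex.exp_add,
    Complex.exp_int_mul_two_pi_mul_I, mul_one]

lemma differentiableOn_thetaF (hH : H.PosDef) (p q : ℕ) (a b : Fin n → ℂ) :
    DifferentiableOn ℂ (thetaF H p q a b) {τ | 0 < τ.im} := by
  have key (c : ℝ) (hc : 0 < c) : DifferentiableOn ℂ (thetaF H p q a b) {τ | c < τ.im} := by
    rw [show thetaF H p q a b = fun τ => _ from funext (thetaF_eq p q a b)]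
    refine differentiableOn_tsum_of_summable_norm (summable_thetaF hH hc p q a b) (fun x => ?_)
      (isOpen_lt continuous_const Complex.continuous_im) fun x τ hτ => ?_
    · fun_prop
    · rw [norm_mul, norm_qexp hH.isHermitian]
      have h0 : 0 ≤ latNorm H x.1 := hH.posSemidef.dotProduct_mulVec_nonneg x.1
      have h1 : 0 ≤ (latNorm H x.1).re := (Complex.le_def.1 h0).1
      have h2 : c ≤ τ.im := le_of_lt hτ
      have := Real.pi_pos
      gcongr
  intro τ hτ
  have hτ' : (0 : ℝ) < τ.im := hτ
  refine ((key (τ.im / 2) (by positivity)).differentiableAt ?_).differentiableWithinAt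
  refine (isOpen_lt continuous_const Complex.continuous_im).mem_nhds ?_
  show τ.im / 2 < τ.im
  linarith

theorem fricke_thetaF (hU : IsUnimodular H) {a b : Fin n → ℂ} {p q m : ℕ} (hm : n + p + q = 2 * m)
    (hab : hprod H a b = 0) : Fricke (thetaF H p q a b) m ((-1) ^ q) where
  per := thetaF_add_one hU.1 p q a b
  diff := differentiableOn_thetaF hU.1.2.2 p q a b
  fe τ hτ := by
    have h3 := sqrt_three_ne
    have hsq : ((Real.sqrt 3 : ℝ) : ℂ) ^ 2 = 3 := sqrt_three_sq'
    have hτ0 : τ ≠ 0 := fun h => by simp [h] at hτ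
    rw [theta_fe hU hτ p q hab, hm, pow_mul _ 2 m]
    have e0 : (I / (Real.sqrt 3 * τ)) ^ 2 = -1 / (3 * τ ^ 2) := by
      rw [div_pow, mul_pow, hsq, I_sq]
    rw [e0]
    have e : (-3 * τ ^ 2) ^ m * (-1 / (3 * τ ^ 2)) ^ m = 1 := by
      rw [← mul_pow]
      have : -3 * τ ^ 2 * (-1 / (3 * τ ^ 2)) = 1 := by field_simp
      rw [this, one_pow]
    have e2 : ((-1 : ℂ) ^ q) * (-1) ^ q = 1 := by rw [← mul_pow]; simp
    linear_combination (-thetaF H p q a b (-1 / (3 * τ))) * (e + (-3 * τ ^ 2) ^ m *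
      (-1 / (3 * τ ^ 2)) ^ m * e2)

open Classical in
/-- The `j`-th Fourier coefficient of a theta series. -/
noncomputable def thetaCoef (H : Matrix (Fin n) (Fin n) ℂ) (p q : ℕ) (a b : Fin n → ℂ) (j : ℕ) : ℂ :=
  ∑' x : LatVec n, if latNorm H x.1 = j then sph H p q a b x.1 else 0

open Classical in
lemma summable_thetaCoef (hH : H.PosDef) (p q : ℕ) (a b : Fin n → ℂ) (j : ℕ) :
    Summable fun x : LatVec n => if latNorm H x.1 = j then sph H p q a b x.1 else 0 := by
  refine Summable.of_norm_bounded ((summable_thetaF hH one_pos p q a b).mul_left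
    (Real.exp (2 * Real.pi * j))) fun x => ?_
  split_ifs with h
  · rw [h, natCast_re, ← mul_assoc, ← Real.exp_add]
    simp
  · rw [norm_zero]; positivity

theorem qApprox_thetaF (hH : IsHermLattice H) (p q : ℕ) (a b : Fin n → ℂ) :
    QApprox (thetaF H p q a b) (thetaCoef H p q a b 0) (thetaCoef H p q a b 1)
      (thetaCoef H p q a b 2) (thetaCoef H p q a b 3) := by
  classical
  have hs1 := summable_thetaF hH.2.2 one_pos p q a b
  refine ⟨Real.exp (8 * Real.pi) * ∑' x : LatVec n,
    Real.exp (-(2 * Real.pi * 1) * (latNorm H x.1).re) * ‖sph H p q a b x.1‖, fun τ hτ => ?_⟩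
  have hτ0 : 0 < τ.im := by linarith
  have hs : Summable fun x : LatVec n =>
      cexp (2 * Real.pi * I * τ * latNorm H x.1) * sph H p q a b x.1 := by
    refine Summable.of_norm ((summable_thetaF hH.2.2 hτ0 p q a b).congr fun x => ?_)
    rw [norm_mul, norm_qexp hH.2.1]
  have hc (j : ℕ) := summable_thetaCoef hH.2.2 p q a b j
  rw [thetaF_eq]
  simp only [thetaCoef]
  set e := cexp (2 * Real.pi * I * τ) with he
  rw [← tsum_mul_right, ← tsum_mul_right, ← tsum_mul_right, ← (hc 0).tsum_add ((hc 1).mul_right _),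
    ← ((hc 0).add ((hc 1).mul_right _)).tsum_add ((hc 2).mul_right _),
    ← (((hc 0).add ((hc 1).mul_right _)).add ((hc 2).mul_right _)).tsum_add ((hc 3).mul_right _),
    ← hs.tsum_sub ((((hc 0).add ((hc 1).mul_right _)).add ((hc 2).mul_right _)).add
      ((hc 3).mul_right _)), ← tsum_mul_left, ← tsum_mul_right]
  refine tsum_of_norm_bounded ((hs1.mul_left _).mul_right _).hasSum fun x => ?_
  obtain ⟨k, hk⟩ := hH.latNorm_nat x.2
  have hexp : cexp (2 * Real.pi * I * τ * (k : ℂ)) = e ^ k := by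
    rw [he, ← Complex.exp_nat_mul]; congr 1; ring
  rw [hk, hexp]
  by_cases h4 : k < 4
  · have : e ^ k * sph H p q a b x.1 - ((if (k : ℂ) = (0 : ℕ) then sph H p q a b x.1 else 0) +
        (if (k : ℂ) = (1 : ℕ) then sph H p q a b x.1 else 0) * e +
        (if (k : ℂ) = (2 : ℕ) then sph H p q a b x.1 else 0) * e ^ 2 +
        (if (k : ℂ) = (3 : ℕ) then sph H p q a b x.1 else 0) * e ^ 3) = 0 := by
      simp only [Nat.cast_inj]
      interval_cases k <;> simp <;> ring
    rw [this, norm_zero]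
    positivity
  · have : e ^ k * sph H p q a b x.1 - ((if (k : ℂ) = (0 : ℕ) then sph H p q a b x.1 else 0) +
        (if (k : ℂ) = (1 : ℕ) then sph H p q a b x.1 else 0) * e +
        (if (k : ℂ) = (2 : ℕ) then sph H p q a b x.1 else 0) * e ^ 2 +
        (if (k : ℂ) = (3 : ℕ) then sph H p q a b x.1 else 0) * e ^ 3) = e ^ k * sph H p q a b x.1 := by
      simp only [Nat.cast_inj]
      rw [if_neg (by omega), if_neg (by omega), if_neg (by omega), if_neg (by omega)]
      ring
    rw [this, norm_mul, norm_pow, he, norm_q, ← Real.exp_nat_mul, ← Real.exp_nat_mul, natCast_re]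
    have hre {A B C D s : ℝ} (hs : 0 ≤ s) (h : A ≤ B * C * D) : A * s ≤ B * (C * s) * D := by
      calc A * s ≤ B * C * D * s := mul_le_mul_of_nonneg_right h hs
        _ = _ := by ring
    refine hre (norm_nonneg _) ?_
    rw [← Real.exp_add, ← Real.exp_add, Real.exp_le_exp]
    have hk4 : (4 : ℝ) ≤ k := by exact_mod_cast not_lt.1 h4
    have := Real.pi_pos
    have h5 : 0 ≤ Real.pi * ((τ.im - 1) * (k - 4)) :=
      mul_nonneg this.le (mul_nonneg (by linarith) (by linarith))
    push_cast
    nlinarith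

end ThetaSeries

section RankOne

lemma isUnimodular_one {n : ℕ} : IsUnimodular (1 : Matrix (Fin n) (Fin n) ℂ) := by
  refine ⟨⟨fun i j => ?_, Matrix.isHermitian_one, Matrix.PosDef.one⟩, Matrix.det_one⟩
  rw [Matrix.one_apply]
  split_ifs
  · exact one_mem _
  · exact zero_mem _

/-- Elements of `𝓞` as vectors of the rank one lattice. -/
noncomputable def eisensteinEquiv : ℤ × ℤ ≃ LatVec 1 :=
  ((((Equiv.funUnique (Fin 1) ℤ).symm.prodCongr (Equiv.funUnique (Fin 1) ℤ).symm).trans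
    (Equiv.sumArrowEquivProdArrow (Fin 1) (Fin 1) ℤ).symm)).trans (latEquiv 1)

lemma eisensteinEquiv_apply (z : ℤ × ℤ) : (eisensteinEquiv z).1 0 = z.1 + z.2 * ω := by
  simp [eisensteinEquiv, latEquiv_val, upv, Equiv.sumArrowEquivProdArrow, mul_comm]

lemma normSq_eisenstein (a b : ℝ) :
    (starRingEnd ℂ) (a + b * ω) * (a + b * ω) = ((a ^ 2 - a * b + b ^ 2 : ℝ) : ℂ) := by
  have h := ω_sq
  rw [map_add, map_mul, conj_ω, conj_ofReal, conj_ofReal]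
  push_cast
  linear_combination (-(b : ℂ) ^ 2) * h

/-- Multiplication of Eisenstein integers in coordinates. -/
def eisMul (z w : ℤ × ℤ) : ℤ × ℤ := (z.1 * w.1 - z.2 * w.2, z.1 * w.2 + z.2 * w.1 - z.2 * w.2)

lemma eisMul_spec (z w : ℤ × ℤ) : ((eisMul z w).1 : ℂ) + (eisMul z w).2 * ω =
    (z.1 + z.2 * ω) * (w.1 + w.2 * ω) := by
  simp only [eisMul]; push_cast
  linear_combination (-(z.2 : ℂ) * w.2) * ω_sq

/-- Powers of Eisenstein integers in coordinates. -/
def eisPow (z : ℤ × ℤ) : ℕ → ℤ × ℤ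
  | 0 => (1, 0)
  | p + 1 => eisMul (eisPow z p) z

lemma eisPow_spec (z : ℤ × ℤ) (p : ℕ) : ((eisPow z p).1 : ℂ) + (eisPow z p).2 * ω =
    (z.1 + z.2 * ω) ^ p := by
  induction p with
  | zero => simp [eisPow]
  | succ p ih => rw [eisPow, eisMul_spec, ih, pow_succ]

/-- Elements of `𝓞` of a given small norm, in coordinates. -/
noncomputable def eisBall (j : ℕ) : Finset (ℤ × ℤ) :=
  (Finset.Icc (-2) 2 ×ˢ Finset.Icc (-2) 2).filter fun z => z.1 ^ 2 - z.1 * z.2 + z.2 ^ 2 = j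

lemma mem_eisBall {j : ℕ} (hj : j ≤ 3) {z : ℤ × ℤ} (h : z.1 ^ 2 - z.1 * z.2 + z.2 ^ 2 = j) :
    z ∈ eisBall j := by
  have hj' : (j : ℤ) ≤ 3 := by exact_mod_cast hj
  rw [eisBall, Finset.mem_filter, Finset.mem_product, Finset.mem_Icc, Finset.mem_Icc]
  refine ⟨⟨⟨?_, ?_⟩, ?_, ?_⟩, h⟩
  all_goals
    by_contra hc
    nlinarith [sq_nonneg (z.1 - 2 * z.2), sq_nonneg (2 * z.1 - z.2)]

lemma latNorm_one_eisenstein (z : ℤ × ℤ) :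
    latNorm (1 : Matrix (Fin 1) (Fin 1) ℂ) (eisensteinEquiv z).1 =
      ((z.1 ^ 2 - z.1 * z.2 + z.2 ^ 2 : ℤ) : ℂ) := by
  have h := normSq_eisenstein z.1 z.2
  simp only [latNorm, Matrix.one_mulVec, dotProduct, Finset.univ_unique, Fin.default_eq_zero,
    Finset.sum_singleton, Pi.star_apply, eisensteinEquiv_apply]
  push_cast at h ⊢
  exact h

lemma thetaCoef_one (p j : ℕ) (hj : j ≤ 3) :
    thetaCoef (1 : Matrix (Fin 1) (Fin 1) ℂ) p 0 1 0 j =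
      ((∑ z ∈ eisBall j, (eisPow z p).1 : ℤ) : ℂ) + ((∑ z ∈ eisBall j, (eisPow z p).2 : ℤ) : ℂ) * ω := by
  classical
  have h1 : ∀ z : ℤ × ℤ, latNorm (1 : Matrix (Fin 1) (Fin 1) ℂ) (eisensteinEquiv z).1 = j ↔
      z ∈ eisBall j := by
    intro z
    rw [latNorm_one_eisenstein]
    constructor
    · intro h
      exact mem_eisBall hj (by exact_mod_cast h)
    · intro h
      exact_mod_cast (Finset.mem_filter.1 h).2
  rw [thetaCoef, ← eisensteinEquiv.tsum_eq, tsum_eq_sum (s := eisBall j)]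
  · push_cast
    rw [Finset.sum_mul, ← Finset.sum_add_distrib]
    refine Finset.sum_congr rfl fun z hz => ?_
    rw [if_pos ((h1 z).2 hz), eisPow_spec, sph, pow_zero, mul_one, hprod, Matrix.one_mulVec]
    simp [dotProduct, eisensteinEquiv_apply]
  · intro z hz
    rw [if_neg (mt (h1 z).1 hz)]

lemma qApprox_one_zero : QApprox (thetaF (1 : Matrix (Fin 1) (Fin 1) ℂ) 0 0 1 0) 1 6 0 6 := by
  have h0 : ∑ z ∈ eisBall 0, (eisPow z 0).1 = 1 ∧ ∑ z ∈ eisBall 0, (eisPow z 0).2 = 0 := by decide +kernel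
  have h1 : ∑ z ∈ eisBall 1, (eisPow z 0).1 = 6 ∧ ∑ z ∈ eisBall 1, (eisPow z 0).2 = 0 := by decide +kernel
  have h2 : ∑ z ∈ eisBall 2, (eisPow z 0).1 = 0 ∧ ∑ z ∈ eisBall 2, (eisPow z 0).2 = 0 := by decide +kernel
  have h3 : ∑ z ∈ eisBall 3, (eisPow z 0).1 = 6 ∧ ∑ z ∈ eisBall 3, (eisPow z 0).2 = 0 := by decide +kernel
  refine (qApprox_thetaF isUnimodular_one.1 0 0 1 0).sum_zero ?_ ?_ ?_ ?_
  · rw [thetaCoef_one _ _ (by norm_num), h0.1, h0.2]; simp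
  · rw [thetaCoef_one _ _ (by norm_num), h1.1, h1.2]; simp
  · rw [thetaCoef_one _ _ (by norm_num), h2.1, h2.2]; simp
  · rw [thetaCoef_one _ _ (by norm_num), h3.1, h3.2]; simp

lemma qApprox_one_six : QApprox (thetaF (1 : Matrix (Fin 1) (Fin 1) ℂ) 6 0 1 0) 0 6 0 (-162) := by
  have h0 : ∑ z ∈ eisBall 0, (eisPow z 6).1 = 0 ∧ ∑ z ∈ eisBall 0, (eisPow z 6).2 = 0 := by decide +kernel
  have h1 : ∑ z ∈ eisBall 1, (eisPow z 6).1 = 6 ∧ ∑ z ∈ eisBall 1, (eisPow z 6).2 = 0 := by decide +kernel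
  have h2 : ∑ z ∈ eisBall 2, (eisPow z 6).1 = 0 ∧ ∑ z ∈ eisBall 2, (eisPow z 6).2 = 0 := by decide +kernel
  have h3 : ∑ z ∈ eisBall 3, (eisPow z 6).1 = -162 ∧ ∑ z ∈ eisBall 3, (eisPow z 6).2 = 0 := by decide +kernel
  refine (qApprox_thetaF isUnimodular_one.1 6 0 1 0).sum_zero ?_ ?_ ?_ ?_
  · rw [thetaCoef_one _ _ (by norm_num), h0.1, h0.2]; simp
  · rw [thetaCoef_one _ _ (by norm_num), h1.1, h1.2]; simp
  · rw [thetaCoef_one _ _ (by norm_num), h2.1, h2.2]; simp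
  · rw [thetaCoef_one _ _ (by norm_num), h3.1, h3.2]; simp

end RankOne

section Weight14

variable {H : Matrix (Fin 14) (Fin 14) ℂ}

lemma Fricke.weight_seven {f : ℂ → ℂ} {p : ℕ}
    (h : f = thetaF (1 : Matrix (Fin 1) (Fin 1) ℂ) p 0 1 0) : (∀ τ, f (τ + 1) = f τ) ∧
    DifferentiableOn ℂ f {τ | 0 < τ.im} ∧ ∀ τ : ℂ, 0 < τ.im →
      f τ = (I / (Real.sqrt 3 * τ)) ^ (1 + p) * f (-1 / (3 * τ)) := by
  subst h
  refine ⟨thetaF_add_one isUnimodular_one.1 _ _ _ _,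
    differentiableOn_thetaF isUnimodular_one.1.2.2 _ _ _ _, fun τ hτ => ?_⟩
  have := theta_fe (isUnimodular_one (n := 1)) hτ (a := 1) (b := 0) p 0 (by simp [hprod])
  rw [pow_zero, one_mul] at this
  exact this

/-- The modular form of weight fourteen measuring the number of vectors of norm three. -/
noncomputable def weight14 (H : Matrix (Fin 14) (Fin 14) ℂ) (τ : ℂ) : ℂ :=
  thetaF H 0 0 0 0 τ + (-1 * thetaF (1 : Matrix (Fin 1) (Fin 1) ℂ) 0 0 1 0 τ ^ 14 +
    (14 * (thetaF (1 : Matrix (Fin 1) (Fin 1) ℂ) 0 0 1 0 τ ^ 7 *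
      thetaF (1 : Matrix (Fin 1) (Fin 1) ℂ) 6 0 1 0 τ) +
    -7 * (thetaF (1 : Matrix (Fin 1) (Fin 1) ℂ) 6 0 1 0 τ *
      thetaF (1 : Matrix (Fin 1) (Fin 1) ℂ) 6 0 1 0 τ)))

lemma fricke_weight14 (hU : IsUnimodular H) : Fricke (weight14 H) 7 1 := by
  obtain ⟨p1, d1, f1⟩ := Fricke.weight_seven (p := 0) rfl
  obtain ⟨p2, d2, f2⟩ := Fricke.weight_seven (p := 6) rfl
  have h := fricke_thetaF hU (a := 0) (b := 0) (p := 0) (q := 0) (m := 7) (by norm_num) (by simp [hprod])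
  refine ⟨fun τ => ?_, fun τ hτ => ?_, ?_⟩
  · simp only [weight14, p1, p2, h.per]
  · have hτ0 : τ ≠ 0 := fun h => by simp [h] at hτ
    have e0 := h.fe τ hτ
    have e1 := f1 τ hτ
    have e2 := f2 τ hτ
    have hsq : ((Real.sqrt 3 : ℝ) : ℂ) ^ 2 = 3 := sqrt_three_sq'
    have hu : (I / (Real.sqrt 3 * τ)) ^ 2 * (-3 * τ ^ 2) = 1 := by
      rw [div_pow, mul_pow, hsq, I_sq]; field_simp
    simp only [weight14, e0, e1, e2]
    generalize I / (Real.sqrt 3 * τ) = u at hu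
    generalize thetaF (1 : Matrix (Fin 1) (Fin 1) ℂ) 0 0 1 0 (-1 / (3 * τ)) = A
    generalize thetaF (1 : Matrix (Fin 1) (Fin 1) ℂ) 6 0 1 0 (-1 / (3 * τ)) = B
    have h7 : (u ^ 2) ^ 7 * (-3 * τ ^ 2) ^ 7 = 1 := by rw [← mul_pow, hu, one_pow]
    linear_combination (A ^ 14 - 14 * (A ^ 7 * B) + 7 * B ^ 2) * h7
  · have := h.diff
    unfold weight14
    exact this.add (((d1.pow 14).const_mul _).add
      ((((d1.pow 7).mul d2).const_mul _).add ((d2.mul d2).const_mul _)))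

lemma thetaCoef_zero_of_forall {p q : ℕ} {a b : Fin 14 → ℂ} {j : ℕ}
    (h : ∀ x : Fin 14 → ℂ, IsLatVec x → latNorm H x ≠ j) : thetaCoef H p q a b j = 0 := by
  classical
  exact (tsum_congr fun x : LatVec 14 => if_neg (h x.1 x.2)).trans tsum_zero

lemma latNorm_eq_zero_iff (hH : H.PosDef) {x : Fin 14 → ℂ} : latNorm H x = 0 ↔ x = 0 := by
  constructor
  · intro h
    by_contra hx
    exact (hH.dotProduct_mulVec_pos hx).ne' h
  · rintro rfl; simp [latNorm]

lemma thetaCoef_zero (hH : H.PosDef) {p q : ℕ} {a b : Fin 14 → ℂ} :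
    thetaCoef H p q a b 0 = sph H p q a b 0 := by
  classical
  let z : LatVec 14 := ⟨0, fun _ => zero_mem _⟩
  rw [thetaCoef, tsum_eq_single z]
  · simp [z, latNorm]
  · intro x hx
    rw [if_neg]
    rw [Nat.cast_zero, latNorm_eq_zero_iff hH]
    exact fun h => hx (Subtype.ext h)

theorem thetaCoef_three (hU : IsUnimodular H)
    (h1 : ∀ x : Fin 14 → ℂ, IsLatVec x → latNorm H x ≠ (1 : ℕ))
    (h2 : ∀ x : Fin 14 → ℂ, IsLatVec x → latNorm H x ≠ (2 : ℕ)) :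
    thetaCoef H 0 0 0 0 3 = 17472 := by
  have q := (qApprox_thetaF hU.1 0 0 0 0).sum_zero (thetaCoef_zero hU.1.2.2)
    (thetaCoef_zero_of_forall h1) (thetaCoef_zero_of_forall h2) rfl
  have q1 := qApprox_one_zero
  have q2 := qApprox_one_six
  have q7 := (((q1.mul q1).mul q1).mul ((q1.mul q1).mul q1)).mul q1
  have Q := q.add (((q7.mul q7).const_mul (-1)).add (((q7.mul q2).const_mul 14).add
    ((q2.mul q2).const_mul (-7))))
  have Q' : QApprox (weight14 H) 0 0 0 (thetaCoef H 0 0 0 0 3 - 17472) := by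
    have Q'' := Q.sum_zero (b₀ := 0) (b₁ := 0) (b₂ := 0) (b₃ := thetaCoef H 0 0 0 0 3 - 17472)
      (by norm_num [sph]) (by norm_num) (by norm_num) (by ring)
    convert Q'' using 1
    funext τ; simp only [weight14]; ring
  exact sub_eq_zero.1 ((fricke_weight14 hU).coef_eq_zero_of_le (by norm_num) (by norm_num) Q')

theorem thetaCoef_design (hU : IsUnimodular H)
    (h1 : ∀ x : Fin 14 → ℂ, IsLatVec x → latNorm H x ≠ (1 : ℕ))
    (h2 : ∀ x : Fin 14 → ℂ, IsLatVec x → latNorm H x ≠ (2 : ℕ)) {a b : Fin 14 → ℂ}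
    (hab : hprod H a b = 0) : thetaCoef H 1 1 a b 3 = 0 ∧ thetaCoef H 3 3 a b 3 = 0 := by
  have q (p : ℕ) (hp : p ≠ 0) := (qApprox_thetaF hU.1 p p a b).sum_zero (b₀ := 0)
    (by rw [thetaCoef_zero hU.1.2.2]; simp [sph, hprod, hp])
    (thetaCoef_zero_of_forall h1) (thetaCoef_zero_of_forall h2) rfl
  refine ⟨?_, ?_⟩
  · exact (fricke_thetaF hU (m := 8) (by norm_num) hab).coef_eq_zero_of_le (by norm_num) le_rfl
      (q 1 (by norm_num))
  · have := fricke_thetaF hU (p := 3) (q := 3) (m := 10) (by norm_num) hab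
    rw [show ((-1 : ℂ) ^ 3) = -1 by norm_num] at this
    exact this.coef_eq_zero_ten (q 3 (by norm_num))

end Weight14

section Transfer

/-- The ambient hermitian space. -/
abbrev E14 := EuclideanSpace ℂ (Fin 14)

/-- A self-dual lattice of minimum three in a fourteen-dimensional hermitian space, together with
its set of minimal vectors and the design properties of the latter. -/
structure GoodLat (L : AddSubgroup E14) (X : Finset E14) : Prop where
  smul_mem : ∀ c ∈ 𝓞, ∀ x ∈ L, c • x ∈ L
  dual : ∀ x, x ∈ L ↔ ∀ y ∈ L, inner ℂ x y ∈ 𝓞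
  min : ∀ x ∈ L, x ≠ 0 → 3 ≤ ‖x‖ ^ 2
  mem_X : ∀ x, x ∈ X ↔ x ∈ L ∧ ‖x‖ ^ 2 = 3
  card_X : X.card = 17472
  design_one : ∀ a b, inner ℂ a b = 0 → ∑ x ∈ X, inner ℂ a x * inner ℂ x b = 0
  design_three : ∀ a b, inner ℂ a b = 0 → ∑ x ∈ X, (inner ℂ a x * inner ℂ x b) ^ 3 = 0

variable {H P : Matrix (Fin 14) (Fin 14) ℂ}

/-- The embedding of coordinate vectors given by a factorisation of the Gram matrix. -/
noncomputable def toE (P : Matrix (Fin 14) (Fin 14) ℂ) (x : Fin 14 → ℂ) : E14 :=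
  WithLp.toLp 2 (P *ᵥ x)

lemma inner_toE (hP : H = Pᴴ * P) (x y : Fin 14 → ℂ) :
    inner ℂ (toE P x) (toE P y) = hprod H x y := by
  rw [EuclideanSpace.inner_eq_star_dotProduct, hprod, hP, ← Matrix.mulVec_mulVec,
    Matrix.dotProduct_mulVec (star x), ← Matrix.star_mulVec, dotProduct_comm]
  rfl

lemma norm_toE_sq (hP : H = Pᴴ * P) (x : Fin 14 → ℂ) : ((‖toE P x‖ ^ 2 : ℝ) : ℂ) = latNorm H x := by
  have := inner_self_eq_norm_sq_to_K (𝕜 := ℂ) (toE P x)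
  rw [inner_toE hP] at this
  push_cast
  exact this.symm

/-- The image of `𝓞ⁿ` in the ambient space. -/
noncomputable def latOf (P : Matrix (Fin 14) (Fin 14) ℂ) : AddSubgroup E14 where
  carrier := {v | ∃ x, IsLatVec x ∧ toE P x = v}
  zero_mem' := ⟨0, fun _ => zero_mem _, by simp [toE]⟩
  add_mem' := by
    rintro _ _ ⟨x, hx, rfl⟩ ⟨y, hy, rfl⟩
    exact ⟨x + y, fun i => add_mem (hx i) (hy i), by simp [toE, Matrix.mulVec_add]⟩
  neg_mem' := by
    rintro _ ⟨x, hx, rfl⟩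
    exact ⟨-x, fun i => neg_mem (hx i), by simp [toE, Matrix.mulVec_neg]⟩

lemma toE_injective (hd : IsUnit P.det) : Function.Injective (toE P) := fun x y h => by
  have h' : P *ᵥ x = P *ᵥ y := (WithLp.toLp_injective 2) h
  have := congrArg (fun v => P⁻¹ *ᵥ v) h'
  simpa [Matrix.mulVec_mulVec, Matrix.nonsing_inv_mul _ hd] using this

lemma toE_surjective (hd : IsUnit P.det) : Function.Surjective (toE P) := fun v =>
  ⟨P⁻¹ *ᵥ WithLp.ofLp v, by simp [toE, Matrix.mulVec_mulVec, Matrix.mul_nonsing_inv _ hd]⟩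

lemma isUnit_det_of_factor (hU : IsUnimodular H) (hP : H = Pᴴ * P) : IsUnit P.det := by
  have h := hU.2
  rw [hP, Matrix.det_mul] at h
  exact IsUnit.of_mul_eq_one_right _ h

open scoped MatrixOrder in
lemma exists_factor (hU : IsUnimodular H) : ∃ P : Matrix (Fin 14) (Fin 14) ℂ, H = Pᴴ * P :=
  CStarAlgebra.nonneg_iff_eq_star_mul_self.1 hU.1.2.2.posSemidef.nonneg

lemma isLatVec_of_hprod_mem (hU : IsUnimodular H) {x : Fin 14 → ℂ}
    (h : ∀ y, IsLatVec y → hprod H x y ∈ 𝓞) : IsLatVec x := by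
  have h1 : IsLatVec (H *ᵥ x) := by
    intro i
    have hi := h (Pi.single i 1) fun j => by
      rw [Pi.single_apply]; split_ifs
      · exact one_mem _
      · exact zero_mem _
    rw [hprod_swap hU.1.2.1] at hi
    have := star_mem_𝓞 hi
    simpa [hprod] using this
  have h2 := h1.mulVec hU.inv_entriesIn
  have hdet : IsUnit H.det := by rw [hU.2]; exact isUnit_one
  rwa [Matrix.mulVec_mulVec, Matrix.nonsing_inv_mul _ hdet, Matrix.one_mulVec] at h2

lemma finite_latNorm_eq (hU : IsUnimodular H) (j : ℕ) :
    {x : LatVec 14 | latNorm H x.1 = j}.Finite := by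
  classical
  have hs := summable_thetaCoef hU.1.2.2 0 0 (0 : Fin 14 → ℂ) 0 j
  have h := hs.tendsto_cofinite_zero.eventually (Metric.ball_mem_nhds (0 : ℂ) one_pos)
  rw [Filter.eventually_cofinite] at h
  refine h.subset fun x hx => ?_
  have hx' : latNorm H x.1 = j := hx
  simp [hx', sph]

theorem exists_goodLat (hU : IsUnimodular H) (hP : H = Pᴴ * P)
    (h1 : ∀ x : Fin 14 → ℂ, IsLatVec x → latNorm H x ≠ (1 : ℕ))
    (h2 : ∀ x : Fin 14 → ℂ, IsLatVec x → latNorm H x ≠ (2 : ℕ)) :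
    ∃ X, GoodLat (latOf P) X := by
  classical
  have hd := isUnit_det_of_factor hU hP
  let F := (finite_latNorm_eq hU 3).toFinset
  have hF (x : LatVec 14) : x ∈ F ↔ latNorm H x.1 = (3 : ℕ) := by simp [F]
  have hinj : Set.InjOn (fun x : LatVec 14 => toE P x.1) F := fun x _ y _ h =>
    Subtype.ext (toE_injective hd h)
  have hsum (p q : ℕ) (a b : Fin 14 → ℂ) : thetaCoef H p q a b 3 =
      ∑ x ∈ F.image (fun x : LatVec 14 => toE P x.1),
        inner ℂ (toE P a) x ^ p * inner ℂ x (toE P b) ^ q := by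
    rw [Finset.sum_image hinj, thetaCoef, tsum_eq_sum (s := F)]
    · refine Finset.sum_congr rfl fun x hx => ?_
      rw [if_pos ((hF x).1 hx), inner_toE hP, inner_toE hP]
      rfl
    · intro x hx
      exact if_neg (mt (hF x).2 hx)
  refine ⟨F.image fun x => toE P x.1, ?_, ?_, ?_, ?_, ?_, ?_, ?_⟩
  · rintro c hc _ ⟨x, hx, rfl⟩
    exact ⟨c • x, fun i => mul_mem hc (hx i), by simp [toE, Matrix.mulVec_smul]⟩
  · intro v
    obtain ⟨x, rfl⟩ := toE_surjective hd v
    constructor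
    · rintro ⟨x', hx', hxx⟩ _ ⟨y, hy, rfl⟩
      rw [← hxx, inner_toE hP]
      exact hprod_mem hU.1.1 hx' hy
    · intro h
      exact ⟨x, isLatVec_of_hprod_mem hU fun y hy => by
        rw [← inner_toE hP]; exact h _ ⟨y, hy, rfl⟩, rfl⟩
  · rintro _ ⟨x, hx, rfl⟩ hx0
    have hn := norm_toE_sq hP x
    obtain ⟨k, hk⟩ := hU.1.latNorm_nat hx
    rw [hk] at hn
    have hn' : ‖toE P x‖ ^ 2 = k := by exact_mod_cast hn
    have k0 : k ≠ 0 := by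
      rintro rfl
      simp at hn'
      exact hx0 hn'
    have k1 : k ≠ 1 := by rintro rfl; exact h1 x hx hk
    have k2 : k ≠ 2 := by rintro rfl; exact h2 x hx hk
    rw [hn']
    exact_mod_cast (by omega : 3 ≤ k)
  · intro v
    rw [Finset.mem_image]
    constructor
    · rintro ⟨x, hx, rfl⟩
      refine ⟨⟨x.1, x.2, rfl⟩, ?_⟩
      have hn := norm_toE_sq hP x.1
      rw [(hF x).1 hx] at hn
      exact_mod_cast hn
    · rintro ⟨⟨x, hx, rfl⟩, hn⟩
      refine ⟨⟨x, hx⟩, (hF _).2 ?_, rfl⟩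
      rw [← norm_toE_sq hP, hn]; norm_num
  · have := hsum 0 0 0 0
    rw [thetaCoef_three hU h1 h2] at this
    simp only [pow_zero, mul_one, Finset.sum_const, nsmul_eq_mul] at this
    exact_mod_cast this.symm
  · intro a b hab
    obtain ⟨a, rfl⟩ := toE_surjective hd a
    obtain ⟨b, rfl⟩ := toE_surjective hd b
    rw [inner_toE hP] at hab
    have := hsum 1 1 a b
    rw [(thetaCoef_design hU h1 h2 hab).1] at this
    simpa using this.symm
  · intro a b hab
    obtain ⟨a, rfl⟩ := toE_surjective hd a
    obtain ⟨b, rfl⟩ := toE_surjective hd b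
    rw [inner_toE hP] at hab
    have := hsum 3 3 a b
    rw [(thetaCoef_design hU h1 h2 hab).2] at this
    simpa [mul_pow] using this.symm

end Transfer

section Zonal

/-- The fourth roots of unity. -/
noncomputable def fourthRoot : Fin 4 → ℂ := ![1, I, -1, -I]

lemma normSq_fourthRoot (k : Fin 4) : (starRingEnd ℂ) (fourthRoot k) * fourthRoot k = 1 := by
  fin_cases k <;> simp [fourthRoot]

lemma norm_sq_eq_re_im (z : ℂ) : ‖z‖ ^ 2 = z.re ^ 2 + z.im ^ 2 := by
  rw [← normSq_eq_norm_sq, normSq_apply]; ring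

lemma sum_fourthRoot (y z : ℂ) :
    ∑ k, ‖fourthRoot k * y + z‖ ^ 2 = 4 * (‖z‖ ^ 2 + ‖y‖ ^ 2) ∧
    ∑ k, (‖fourthRoot k * y + z‖ ^ 2) ^ 2 =
      4 * ((‖z‖ ^ 2) ^ 2 + 4 * ‖z‖ ^ 2 * ‖y‖ ^ 2 + (‖y‖ ^ 2) ^ 2) ∧
    ∑ k, (‖fourthRoot k * y + z‖ ^ 2) ^ 3 =
      4 * ((‖z‖ ^ 2) ^ 3 + 9 * (‖z‖ ^ 2) ^ 2 * ‖y‖ ^ 2 + 9 * ‖z‖ ^ 2 * (‖y‖ ^ 2) ^ 2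
        + (‖y‖ ^ 2) ^ 3) := by
  simp only [norm_sq_eq_re_im, Fin.sum_univ_four, fourthRoot]
  simp
  refine ⟨?_, ?_, ?_⟩ <;> ring

lemma sum_torus {m : ℕ} (y : Fin m → ℂ) :
    ∑ k : Fin m → Fin 4, ‖∑ j, fourthRoot (k j) * y j‖ ^ 2 = 4 ^ m * ∑ j, ‖y j‖ ^ 2 ∧
    ∑ k : Fin m → Fin 4, (‖∑ j, fourthRoot (k j) * y j‖ ^ 2) ^ 2 =
      4 ^ m * (2 * (∑ j, ‖y j‖ ^ 2) ^ 2 - ∑ j, (‖y j‖ ^ 2) ^ 2) ∧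
    ∑ k : Fin m → Fin 4, (‖∑ j, fourthRoot (k j) * y j‖ ^ 2) ^ 3 =
      4 ^ m * (6 * (∑ j, ‖y j‖ ^ 2) ^ 3 - 9 * (∑ j, ‖y j‖ ^ 2) * ∑ j, (‖y j‖ ^ 2) ^ 2
        + 4 * ∑ j, (‖y j‖ ^ 2) ^ 3) := by
  induction m with
  | zero => simp
  | succ m ih =>
    obtain ⟨h1, h2, h3⟩ := ih fun j => y j.succ
    have hs (F : ℂ → ℝ) : ∑ k : Fin (m + 1) → Fin 4, F (∑ j, fourthRoot (k j) * y j) =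
        ∑ k : Fin m → Fin 4, ∑ l, F (fourthRoot l * y 0 + ∑ j, fourthRoot (k j) * y j.succ) := by
      rw [← (Fin.consEquiv fun _ => Fin 4).sum_comp, Fintype.sum_prod_type_right]
      simp [Fin.consEquiv, Fin.sum_univ_succ (n := m)]
    rw [hs fun z => ‖z‖ ^ 2, hs fun z => (‖z‖ ^ 2) ^ 2, hs fun z => (‖z‖ ^ 2) ^ 3]
    simp only [(sum_fourthRoot _ _).1, (sum_fourthRoot _ _).2.1, (sum_fourthRoot _ _).2.2,
      ← Finset.mul_sum, Finset.sum_add_distrib, ← Finset.sum_mul, h1, h2, h3,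
      Fin.sum_univ_succ (n := m), Finset.sum_const, Finset.card_univ, Fintype.card_pi,
      Fintype.card_fin, Finset.prod_const, nsmul_eq_mul]
    push_cast
    refine ⟨?_, ?_, ?_⟩ <;> ring

/-- The harmonic expression attached to a pair of orthogonal vectors of norms `1` and `n`, in terms
of the squared absolute values of the inner products with them. -/
def harm (n A B : ℝ) : ℝ := n ^ 3 * A ^ 3 - 9 * n ^ 2 * A ^ 2 * B + 9 * n * A * B ^ 2 - B ^ 3

lemma sum_cubes_fourthRoot (n : ℝ) (p q : ℂ) :
    ∑ k, ((p + (starRingEnd ℂ) (fourthRoot k) * q) *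
      (n * (starRingEnd ℂ) p - fourthRoot k * (starRingEnd ℂ) q)) ^ 3 =
      ((4 * harm n (‖p‖ ^ 2) (‖q‖ ^ 2) : ℝ) : ℂ) := by
  simp only [harm, ofReal_mul, ofReal_sub, ofReal_add, ofReal_pow]
  rw [← mul_conj' p, ← mul_conj' q]
  generalize (starRingEnd ℂ) p = P
  generalize (starRingEnd ℂ) q = Q
  simp only [fourthRoot, Fin.sum_univ_four]
  simp
  have h1 : (p - I * q) * (n * P - I * Q) = (n * p * P - q * Q) - I * (p * Q + n * q * P) := by
    linear_combination q * Q * I_sq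
  have h2 : (p + I * q) * (n * P + I * Q) = (n * p * P - q * Q) + I * (p * Q + n * q * P) := by
    linear_combination q * Q * I_sq
  have h3 (R D : ℂ) : (R - I * D) ^ 3 + (R + I * D) ^ 3 = 2 * R ^ 3 - 6 * R * D ^ 2 := by
    linear_combination 6 * R * D ^ 2 * I_sq
  have h4 := h3 (n * p * P - q * Q) (p * Q + n * q * P)
  rw [← h1, ← h2] at h4
  simp only [← sub_eq_add_neg]
  linear_combination h4

variable {L : AddSubgroup E14} {X : Finset E14}

lemma GoodLat.sum_harm (h : GoodLat L X) {u w : E14} (hu : ‖u‖ = 1) (huw : inner ℂ u w = 0)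
    {n : ℝ} (hw : ‖w‖ ^ 2 = n) :
    ∑ x ∈ X, harm n (‖inner ℂ u x‖ ^ 2) (‖inner ℂ w x‖ ^ 2) = 0 := by
  have hwu : inner ℂ w u = 0 := by rw [← inner_conj_symm, huw, map_zero]
  have key (k : Fin 4) : ∑ x ∈ X, ((inner ℂ u x + (starRingEnd ℂ) (fourthRoot k) * inner ℂ w x) *
      (n * (starRingEnd ℂ) (inner ℂ u x) - fourthRoot k * (starRingEnd ℂ) (inner ℂ w x))) ^ 3
      = 0 := by
    rw [← h.design_three (u + fourthRoot k • w) ((n : ℂ) • u - fourthRoot k • w)]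
    · refine Finset.sum_congr rfl fun x _ => ?_
      rw [inner_add_left, inner_sub_right, inner_smul_left, inner_smul_right, inner_smul_right,
        inner_conj_symm, inner_conj_symm]
    · simp only [inner_add_left, inner_sub_right, inner_smul_left, inner_smul_right, huw, hwu,
        inner_self_eq_norm_sq_to_K, hu, ← hw]
      push_cast
      simp only [coe_algebraMap]
      linear_combination (-(‖w‖ : ℂ) ^ 2) * normSq_fourthRoot k
  have h4 : ∑ x ∈ X, ((4 * harm n (‖inner ℂ u x‖ ^ 2) (‖inner ℂ w x‖ ^ 2) : ℝ) : ℂ) = 0 := by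
    simp only [← sum_cubes_fourthRoot]
    rw [Finset.sum_comm]
    exact Finset.sum_eq_zero fun k _ => key k
  rw [← ofReal_sum, ← Finset.mul_sum] at h4
  have := ofReal_eq_zero.1 h4
  linarith

lemma exists_basis_zero {u : E14} (hu : ‖u‖ = 1) :
    ∃ b : OrthonormalBasis (Fin 14) ℂ E14, b 0 = u := by
  have ho : Orthonormal ℂ (({0} : Set (Fin 14)).domRestrict fun _ => u) := by
    constructor
    · intro i; exact hu
    · intro i j hij; exact absurd (Subsingleton.elim i j) hij
  obtain ⟨b, hb⟩ := ho.exists_orthonormalBasis_extension_of_card_eq (by simp)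
  exact ⟨b, hb 0 rfl⟩

/-- The sum of `harm` over the four pair vectors, in terms of the squared coordinates. -/
def pairPoly (A s t : ℝ) : ℝ := 4 * (8 * A ^ 3 - 36 * A ^ 2 * (s + t) +
  18 * A * (s ^ 2 + 4 * s * t + t ^ 2) - (s ^ 3 + 9 * s ^ 2 * t + 9 * s * t ^ 2 + t ^ 3))

lemma sum_pairPoly {m : ℕ} (A : ℝ) (t : Fin m → ℝ) : ∑ i, ∑ j, pairPoly A (t i) (t j) =
    4 * (m ^ 2 * (8 * A ^ 3) - 72 * m * A ^ 2 * ∑ i, t i +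
      36 * A * (m * ∑ i, t i ^ 2 + 2 * (∑ i, t i) ^ 2) -
      (2 * m * ∑ i, t i ^ 3 + 18 * (∑ i, t i) * ∑ i, t i ^ 2)) := by
  simp only [pairPoly, ← Finset.mul_sum, Finset.sum_sub_distrib, Finset.sum_add_distrib,
    Finset.sum_const, Finset.card_univ, Fintype.card_fin, nsmul_eq_mul, ← Finset.sum_mul]
  ring

lemma sum_pairPoly_diag {m : ℕ} (A : ℝ) (t : Fin m → ℝ) : ∑ i, pairPoly A (t i) (t i) =
    4 * (m * (8 * A ^ 3) - 72 * A ^ 2 * ∑ i, t i + 108 * A * ∑ i, t i ^ 2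
      - 20 * ∑ i, t i ^ 3) := by
  have hp (s : ℝ) : pairPoly A s s = 4 * (8 * A ^ 3 - 72 * A ^ 2 * s + 108 * A * s ^ 2
      - 20 * s ^ 3) := by
    unfold pairPoly; ring
  simp only [hp, ← Finset.mul_sum, Finset.sum_sub_distrib, Finset.sum_add_distrib,
    Finset.sum_const, Finset.card_univ, Fintype.card_fin, nsmul_eq_mul]
  ring

/-- The zonal harmonic polynomial of degree three, on vectors of norm three. -/
def zonal (A : ℝ) : ℝ :=
  455 * A ^ 3 - 315 * A ^ 2 * (3 - A) + 45 * A * (3 - A) ^ 2 - (3 - A) ^ 3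

lemma GoodLat.sum_zonal (h : GoodLat L X) {u : E14} (hu : ‖u‖ = 1) :
    ∑ x ∈ X, zonal (‖inner ℂ u x‖ ^ 2) = 0 := by
  obtain ⟨b, rfl⟩ := exists_basis_zero hu
  have hb (i j : Fin 14) : inner ℂ (b i) (b j) = if i = j then (1 : ℂ) else 0 :=
    orthonormal_iff_ite.1 b.orthonormal i j
  have norm_sum (c : Fin 13 → ℂ) : ‖∑ j, c j • b j.succ‖ ^ 2 = ∑ j, ‖c j‖ ^ 2 := by
    have := inner_self_eq_norm_sq_to_K (𝕜 := ℂ) (∑ j, c j • b j.succ)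
    have hc := (b.orthonormal.comp _ (Fin.succ_injective 13)).inner_sum c c Finset.univ
    simp only [Function.comp_apply] at hc
    rw [hc] at this
    simp only [conj_mul'] at this
    simp only [coe_algebraMap] at this
    exact_mod_cast this.symm
  have orth (c : Fin 13 → ℂ) : inner ℂ (b 0) (∑ j, c j • b j.succ) = 0 := by
    simp [hb, (Fin.succ_ne_zero _).symm]
  have inner_comb (c : Fin 13 → ℂ) (x : E14) : inner ℂ (∑ j, c j • b j.succ) x =
      ∑ j, (starRingEnd ℂ) (c j) * inner ℂ (b j.succ) x := by
    simp [mul_comm]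
  have single (i : Fin 13) : ∑ x ∈ X,
      harm 1 (‖inner ℂ (b 0) x‖ ^ 2) (‖inner ℂ (b i.succ) x‖ ^ 2) = 0 :=
    h.sum_harm hu (by rw [hb, if_neg (Fin.succ_ne_zero _).symm]) (by simp)
  have conj_root (k : Fin 4) : ‖(starRingEnd ℂ) (fourthRoot k)‖ ^ 2 = 1 := by
    fin_cases k <;> simp [fourthRoot]
  have torus (k : Fin 13 → Fin 4) : ∑ x ∈ X, harm 13 (‖inner ℂ (b 0) x‖ ^ 2)
      (‖∑ j, fourthRoot (k j) * inner ℂ (b j.succ) x‖ ^ 2) = 0 := by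
    rw [← h.sum_harm hu (orth fun j => (starRingEnd ℂ) (fourthRoot (k j))) (n := 13)]
    · simp only [inner_comb, Complex.conj_conj]
    · rw [norm_sum]; simp only [conj_root]; norm_num
  have pair (i j : Fin 13) (hij : i ≠ j) (k : Fin 4) : ∑ x ∈ X, harm 2 (‖inner ℂ (b 0) x‖ ^ 2)
      (‖fourthRoot k * inner ℂ (b i.succ) x + inner ℂ (b j.succ) x‖ ^ 2) = 0 := by
    have hij' : j ≠ i := hij.symm
    rw [← h.sum_harm hu (orth fun l => if l = i then (starRingEnd ℂ) (fourthRoot k) else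
      if l = j then 1 else 0) (n := 2)]
    · refine Finset.sum_congr rfl fun x _ => ?_
      rw [inner_comb]
      congr 3
      rw [Finset.sum_eq_add i j hij]
      · simp [hij']
      · rintro c _ ⟨h1, h2⟩; simp [h1, h2]
      · simp
      · simp
    · rw [norm_sum, Finset.sum_eq_add i j hij]
      · simp only [if_pos, conj_root, if_neg hij']; norm_num
      · rintro c _ ⟨h1, h2⟩; simp [h1, h2]
      · simp
      · simp
  have T := Finset.sum_congr rfl (fun k (_ : k ∈ (Finset.univ : Finset (Fin 13 → Fin 4))) => torus k)
  rw [Finset.sum_comm, Finset.sum_const_zero] at T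
  have S := Finset.sum_congr rfl (fun k (_ : k ∈ (Finset.univ : Finset (Fin 13))) => single k)
  rw [Finset.sum_comm, Finset.sum_const_zero] at S
  have P : ∑ x ∈ X, ∑ i : Fin 13, ∑ j : Fin 13, (if i = j then 0 else ∑ k,
      harm 2 (‖inner ℂ (b 0) x‖ ^ 2)
        (‖fourthRoot k * inner ℂ (b i.succ) x + inner ℂ (b j.succ) x‖ ^ 2)) = 0 := by
    rw [Finset.sum_comm]
    refine Finset.sum_eq_zero fun i _ => ?_
    rw [Finset.sum_comm]
    refine Finset.sum_eq_zero fun j _ => ?_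
    by_cases hij : i = j
    · simp [hij]
    · simp only [if_neg hij]
      rw [Finset.sum_comm]
      exact Finset.sum_eq_zero fun k _ => pair i j hij k
  have comb : ∀ x ∈ X, 48 * zonal (‖inner ℂ (b 0) x‖ ^ 2) =
      8 / 4 ^ 13 * (∑ k : Fin 13 → Fin 4, harm 13 (‖inner ℂ (b 0) x‖ ^ 2)
        (‖∑ j, fourthRoot (k j) * inner ℂ (b j.succ) x‖ ^ 2)) +
      (∑ i : Fin 13, ∑ j : Fin 13, (if i = j then 0 else ∑ k, harm 2 (‖inner ℂ (b 0) x‖ ^ 2)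
        (‖fourthRoot k * inner ℂ (b i.succ) x + inner ℂ (b j.succ) x‖ ^ 2))) -
      56 * ∑ i : Fin 13, harm 1 (‖inner ℂ (b 0) x‖ ^ 2) (‖inner ℂ (b i.succ) x‖ ^ 2) := by
    intro x hx
    have hN := b.sum_sq_norm_inner_right x
    rw [((h.mem_X x).1 hx).2, Fin.sum_univ_succ] at hN
    obtain ⟨h1, h2, h3⟩ := sum_torus fun j : Fin 13 => inner ℂ (b j.succ) x
    have hdiag (F : Fin 13 → Fin 13 → ℝ) : ∑ i, ∑ j, (if i = j then 0 else F i j) =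
        ∑ i, ∑ j, F i j - ∑ i, F i i := by
      rw [← Finset.sum_sub_distrib]
      refine Finset.sum_congr rfl fun i _ => ?_
      have hd : F i i = ∑ j, if i = j then F i j else 0 := by simp
      rw [hd, ← Finset.sum_sub_distrib]
      refine Finset.sum_congr rfl fun j _ => ?_
      by_cases hij : i = j <;> simp [hij]
    have hpair (i j : Fin 13) := sum_fourthRoot (inner ℂ (b i.succ) x) (inner ℂ (b j.succ) x)
    rw [hdiag]
    set A := ‖inner ℂ (b 0) x‖ ^ 2
    have hp (i j : Fin 13) : ∑ k, harm 2 A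
        (‖fourthRoot k * inner ℂ (b i.succ) x + inner ℂ (b j.succ) x‖ ^ 2) =
        pairPoly A (‖inner ℂ (b i.succ) x‖ ^ 2) (‖inner ℂ (b j.succ) x‖ ^ 2) := by
      simp only [harm, Finset.sum_sub_distrib, Finset.sum_add_distrib, ← Finset.mul_sum,
        (hpair _ _).1, (hpair _ _).2.1, (hpair _ _).2.2, Finset.sum_const, Finset.card_univ,
        Fintype.card_fin, nsmul_eq_mul, pairPoly]
      push_cast
      ring
    simp only [hp, sum_pairPoly, sum_pairPoly_diag]
    simp only [harm, Finset.sum_sub_distrib, Finset.sum_add_distrib, ← Finset.mul_sum, h1, h2, h3,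
      Finset.sum_const, Finset.card_univ, Fintype.card_pi, Finset.prod_const, Fintype.card_fin,
      nsmul_eq_mul, zonal]
    rw [← hN]
    push_cast
    ring
  have := Finset.sum_congr rfl comb
  rw [← Finset.mul_sum, Finset.sum_sub_distrib, Finset.sum_add_distrib, ← Finset.mul_sum,
    ← Finset.mul_sum, T, P, S] at this
  linarith

end Zonal

section Counts

/-- The square root `√-3` of the Eisenstein integers. -/
noncomputable def θ : ℂ := 2 * ω + 1

lemma θ_sq : θ ^ 2 = -3 := two_ω_add_one_sq
lemma θ_ne : θ ≠ 0 := two_ω_add_one_ne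
lemma θ_mem : θ ∈ 𝓞 := mem_𝓞_iff.2 ⟨1, 2, by simp [θ]; ring⟩
lemma conj_θ : (starRingEnd ℂ) θ = -θ := by
  simp only [θ, map_add, map_mul, map_ofNat, map_one, conj_ω]; ring
lemma intCast_mem_𝓞 (k : ℤ) : (k : ℂ) ∈ 𝓞 := mem_𝓞_iff.2 ⟨k, 0, by simp⟩
lemma norm_θ_sq : ‖θ‖ ^ 2 = 3 := by
  have : ((‖θ‖ ^ 2 : ℝ) : ℂ) = 3 := by
    push_cast; rw [← conj_mul', conj_θ]; linear_combination -θ_sq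
  exact_mod_cast this

lemma norm_sq_add_mul_ω (a b : ℤ) :
    ‖(a + b * ω : ℂ)‖ ^ 2 = ((a ^ 2 - a * b + b ^ 2 : ℤ) : ℝ) := by
  have : ((‖(a + b * ω : ℂ)‖ ^ 2 : ℝ) : ℂ) = ((a ^ 2 - a * b + b ^ 2 : ℤ) : ℝ) := by
    push_cast
    rw [← conj_mul']
    simp only [map_add, map_mul, map_intCast, conj_ω]
    linear_combination (-(b : ℂ) ^ 2) * ω_sq
  exact_mod_cast this

lemma re_add_mul_ω (a b : ℤ) : (a + b * ω : ℂ).re = ((2 * a - b : ℤ) : ℝ) / 2 := by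
  simp [ω_re, ω_im]; ring

/-- The units of the Eisenstein integers. -/
noncomputable def units6 : Finset ℂ := {1, ω, -1 - ω, -1, -ω, 1 + ω}

lemma bounded_of_form_le {a b : ℤ} (h : a ^ 2 - a * b + b ^ 2 ≤ 3) :
    -2 ≤ a ∧ a ≤ 2 ∧ -2 ≤ b ∧ b ≤ 2 := by
  refine ⟨?_, ?_, ?_, ?_⟩ <;> nlinarith [sq_nonneg (2 * a - b), sq_nonneg (2 * b - a)]

lemma mem_units6 {c : ℂ} : c ∈ units6 ↔ c ∈ 𝓞 ∧ ‖c‖ ^ 2 = 1 := by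
  constructor
  · intro h
    have : ∃ a b : ℤ, c = a + b * ω ∧ a ^ 2 - a * b + b ^ 2 = 1 := by
      simp only [units6, Finset.mem_insert, Finset.mem_singleton] at h
      rcases h with rfl | rfl | rfl | rfl | rfl | rfl
      · exact ⟨1, 0, by simp, by norm_num⟩
      · exact ⟨0, 1, by simp, by norm_num⟩
      · exact ⟨-1, -1, by push_cast; ring, by norm_num⟩
      · exact ⟨-1, 0, by simp, by norm_num⟩
      · exact ⟨0, -1, by simp, by norm_num⟩
      · exact ⟨1, 1, by simp, by norm_num⟩
    obtain ⟨a, b, rfl, hab⟩ := this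
    exact ⟨mem_𝓞_iff.2 ⟨a, b, rfl⟩, by rw [norm_sq_add_mul_ω, hab]; norm_num⟩
  · rintro ⟨h, h1⟩
    obtain ⟨a, b, rfl⟩ := mem_𝓞_iff.1 h
    rw [norm_sq_add_mul_ω] at h1
    have hab : a ^ 2 - a * b + b ^ 2 = 1 := by exact_mod_cast h1
    obtain ⟨h1, h2, h3, h4⟩ := bounded_of_form_le (hab.le.trans (by norm_num))
    simp only [units6, Finset.mem_insert, Finset.mem_singleton]
    interval_cases a <;> interval_cases b <;> first | (exfalso; revert hab; norm_num; done) | skip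
    · right; right; left; push_cast; ring
    · simp
    · simp
    · simp
    · simp
    · simp

lemma card_units6 : units6.card = 6 := by
  have hi : (Finset.univ.image fun k : Fin 6 => ((![1, 0, -1, -1, 0, 1] k : ℤ) : ℂ) +
      ((![0, 1, -1, 0, -1, 1] k : ℤ) : ℂ) * ω) = units6 := by
    ext c
    simp only [Finset.mem_image, Finset.mem_univ, true_and, Fin.exists_fin_succ, units6,
      Finset.mem_insert, Finset.mem_singleton]
    simp [eq_comm, sub_eq_add_neg]
  rw [← hi, Finset.card_image_of_injective]
  · simp
  · intro k l hkl
    have := add_mul_ω_inj (a := ((![1, 0, -1, -1, 0, 1] k : ℤ) : ℝ))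
      (b := ((![0, 1, -1, 0, -1, 1] k : ℤ) : ℝ)) (c := ((![1, 0, -1, -1, 0, 1] l : ℤ) : ℝ))
      (d := ((![0, 1, -1, 0, -1, 1] l : ℤ) : ℝ)) (by exact_mod_cast hkl)
    have h1 : ![(1 : ℤ), 0, -1, -1, 0, 1] k = ![1, 0, -1, -1, 0, 1] l := by exact_mod_cast this.1
    have h2 : ![(0 : ℤ), 1, -1, 0, -1, 1] k = ![0, 1, -1, 0, -1, 1] l := by exact_mod_cast this.2
    clear this hkl
    revert k l
    decide

lemma norm_sq_cases {z : ℂ} (hz : z ∈ 𝓞) (h : ‖z‖ ^ 2 ≤ 3) :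
    z = 0 ∨ z ∈ units6 ∨ ∃ c ∈ units6, z = c * θ := by
  obtain ⟨a, b, rfl⟩ := mem_𝓞_iff.1 hz
  have hn := norm_sq_add_mul_ω a b
  have hab : a ^ 2 - a * b + b ^ 2 ≤ 3 := by rw [hn] at h; exact_mod_cast h
  obtain ⟨h1, h2, h3, h4⟩ := bounded_of_form_le hab
  have h0 : 0 ≤ a ^ 2 - a * b + b ^ 2 := by nlinarith [sq_nonneg (2 * a - b), sq_nonneg b]
  have hc : a ^ 2 - a * b + b ^ 2 = 0 ∨ a ^ 2 - a * b + b ^ 2 = 1 ∨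
      a ^ 2 - a * b + b ^ 2 = 3 := by
    revert hab h0
    interval_cases a <;> interval_cases b <;> norm_num
  rcases hc with hc | hc | hc
  · left
    rw [hc] at hn
    simpa using hn
  · right; left
    exact mem_units6.2 ⟨hz, by rw [hn, hc]; norm_num⟩
  · right; right
    refine ⟨(a + b * ω) / θ, mem_units6.2 ⟨?_, ?_⟩, by field_simp [θ_ne]⟩
    · have h3 : ∃ k : ℤ, a + b = 3 * k := by
        revert hc
        interval_cases a <;> interval_cases b <;>
          first | (norm_num; done) | (intro _; norm_num; done) | (intro _; exact ⟨-1, by norm_num⟩)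
      obtain ⟨k, hk⟩ := h3
      refine mem_𝓞_iff.2 ⟨2 * k - a, k - a, ?_⟩
      rw [div_eq_iff θ_ne, θ]
      have hk' : (b : ℂ) = 3 * k - a := by
        rw [eq_sub_iff_add_eq, add_comm]; exact_mod_cast hk
      push_cast
      linear_combination (ω : ℂ) * hk' - 2 * (k - a) * ω_sq
    · rw [norm_div, div_pow, hn, hc, norm_θ_sq]; norm_num

lemma exists_unit_re {z : ℂ} (hz : z ∈ 𝓞) (h : 3 < ‖z‖ ^ 2) : ∃ c ∈ units6, 3 / 2 < (c * z).re := by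
  obtain ⟨a, b, rfl⟩ := mem_𝓞_iff.1 hz
  rw [norm_sq_add_mul_ω] at h
  have hab : 3 < a ^ 2 - a * b + b ^ 2 := by exact_mod_cast h
  have key : 3 < 2 * a - b ∨ 3 < 2 * b - a ∨ 3 < a + b ∨ 3 < -(2 * a - b) ∨ 3 < -(2 * b - a) ∨
      3 < -(a + b) := by
    by_contra! hcon
    obtain ⟨h1, h2, h3, h4, h5, h6⟩ := hcon
    have : -2 ≤ a := by omega
    have : a ≤ 2 := by omega
    have : -2 ≤ b := by omega
    have : b ≤ 2 := by omega
    revert hab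
    interval_cases a <;> interval_cases b <;> first | (norm_num; done) | omega
  have fin {c : ℂ} (hc : c ∈ units6) (p q : ℤ) (hpq : c * (a + b * ω) = p + q * ω)
      (h3 : 3 < 2 * p - q) : ∃ c ∈ units6, 3 / 2 < (c * (a + b * ω) : ℂ).re := by
    refine ⟨c, hc, ?_⟩
    rw [hpq, re_add_mul_ω]
    have : (3 : ℝ) < ((2 * p - q : ℤ) : ℝ) := by exact_mod_cast h3
    linarith
  rcases key with h | h | h | h | h | h
  · exact fin (c := 1) (by simp [units6]) a b (by ring) h
  · exact fin (c := -1 - ω) (by simp [units6]) (b - a) (-a)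
      (by push_cast; linear_combination (-(b : ℂ)) * ω_sq) (by omega)
  · exact fin (c := -ω) (by simp [units6]) b (b - a)
      (by push_cast; linear_combination (-(b : ℂ)) * ω_sq) (by omega)
  · exact fin (c := -1) (by simp [units6]) (-a) (-b) (by push_cast; ring) (by omega)
  · exact fin (c := 1 + ω) (by simp [units6]) (a - b) a
      (by push_cast; linear_combination (b : ℂ) * ω_sq) (by omega)
  · exact fin (c := ω) (by simp [units6]) (-b) (a - b)
      (by push_cast; linear_combination (b : ℂ) * ω_sq) (by omega)

end Counts

namespace GoodLat

variable {L : AddSubgroup E14} {X : Finset E14}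

lemma inner_mem (h : GoodLat L X) {x y : E14} (hx : x ∈ L) (hy : y ∈ L) : inner ℂ x y ∈ 𝓞 :=
  (h.dual x).1 hx y hy

lemma mem_of_X (h : GoodLat L X) {x : E14} (hx : x ∈ X) : x ∈ L := ((h.mem_X x).1 hx).1

lemma norm_X (h : GoodLat L X) {x : E14} (hx : x ∈ X) : ‖x‖ ^ 2 = 3 := ((h.mem_X x).1 hx).2

lemma ne_zero_X (h : GoodLat L X) {x : E14} (hx : x ∈ X) : x ≠ 0 := by
  rintro rfl
  have := h.norm_X hx
  norm_num at this

lemma smul_mem_X (h : GoodLat L X) {c : ℂ} (hc : c ∈ units6) {x : E14} (hx : x ∈ X) :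
    c • x ∈ X := by
  obtain ⟨h1, h2⟩ := mem_units6.1 hc
  exact (h.mem_X _).2 ⟨h.smul_mem c h1 x (h.mem_of_X hx),
    by rw [norm_smul, mul_pow, h2, h.norm_X hx, one_mul]⟩

lemma sum_norm_inner (h : GoodLat L X) {u : E14} (hu : ‖u‖ = 1) :
    ∑ x ∈ X, ‖inner ℂ u x‖ ^ 2 = 3744 := by
  obtain ⟨b, rfl⟩ := exists_basis_zero hu
  have key (i : Fin 14) : ∑ x ∈ X, ‖inner ℂ (b i) x‖ ^ 2 = ∑ x ∈ X, ‖inner ℂ (b 0) x‖ ^ 2 := by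
    have h0 : inner ℂ (b i + b 0) (b i - b 0) = 0 := by
      simp only [inner_add_left, inner_sub_right, orthonormal_iff_ite.1 b.orthonormal]
      rcases eq_or_ne i 0 with rfl | hi
      · simp
      · simp [hi, hi.symm]
    have h1 := congrArg re (h.design_one _ _ h0)
    rw [← sub_eq_zero, ← Finset.sum_sub_distrib, ← zero_re, ← h1, re_sum]
    refine Finset.sum_congr rfl fun x _ => ?_
    rw [inner_add_left, inner_sub_right, ← inner_conj_symm x (b i), ← inner_conj_symm x (b 0),
      norm_sq_eq_re_im, norm_sq_eq_re_im]
    simp only [mul_re, add_re, add_im, sub_re, sub_im, conj_re, conj_im]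
    ring
  have h3 : ∑ i, ∑ x ∈ X, ‖inner ℂ (b i) x‖ ^ 2 = 3 * 17472 := by
    rw [Finset.sum_comm]
    rw [Finset.sum_congr rfl fun x hx => (b.sum_sq_norm_inner_right x).trans (h.norm_X hx)]
    rw [Finset.sum_const, h.card_X]; norm_num
  simp only [key, Finset.sum_const, Finset.card_univ, Fintype.card_fin] at h3
  rw [nsmul_eq_mul] at h3
  norm_num at h3
  linarith

lemma norm_inner_smul_self (h : GoodLat L X) {v : E14} (hv : v ∈ X) {c : ℂ} (hc : c ∈ units6) :
    ‖inner ℂ v (c • v)‖ ^ 2 = 9 := by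
  have : inner ℂ v v = ((‖v‖ ^ 2 : ℝ) : ℂ) := by
    rw [inner_self_eq_norm_sq_to_K]; norm_num
  rw [inner_smul_right, this, h.norm_X hv, norm_mul, mul_pow, (mem_units6.1 hc).2]
  norm_num

lemma norm_sub_sq_re (x y : E14) : ‖x - y‖ ^ 2 = ‖x‖ ^ 2 - 2 * (inner ℂ x y).re + ‖y‖ ^ 2 :=
  norm_sub_sq (𝕜 := ℂ) x y

lemma eq_of_re_inner (h : GoodLat L X) {x v : E14} (hx : x ∈ X) (hv : v ∈ X)
    (hr : 3 / 2 < (inner ℂ v x).re) : v = x := by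
  by_contra hne
  have := h.min (v - x) (L.sub_mem (h.mem_of_X hv) (h.mem_of_X hx)) (sub_ne_zero.2 hne)
  rw [norm_sub_sq_re, h.norm_X hv, h.norm_X hx] at this
  linarith

lemma inner_cases (h : GoodLat L X) {x v : E14} (hx : x ∈ X) (hv : v ∈ X) :
    inner ℂ v x = 0 ∨ inner ℂ v x ∈ units6 ∨ (∃ c ∈ units6, inner ℂ v x = c * θ) ∨
      ∃ c ∈ units6, x = c • v := by
  have hm := h.inner_mem (h.mem_of_X hv) (h.mem_of_X hx)
  rcases le_or_gt (‖inner ℂ v x‖ ^ 2) 3 with hle | hlt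
  · rcases norm_sq_cases hm hle with h1 | h1 | h1
    · exact Or.inl h1
    · exact Or.inr (Or.inl h1)
    · exact Or.inr (Or.inr (Or.inl h1))
  · obtain ⟨c, hc, hr⟩ := exists_unit_re hm hlt
    rw [← inner_smul_right] at hr
    have := h.eq_of_re_inner (h.smul_mem_X hc hx) hv hr
    refine Or.inr (Or.inr (Or.inr ⟨(starRingEnd ℂ) c, ?_, ?_⟩))
    · obtain ⟨h1, h2⟩ := mem_units6.1 hc
      exact mem_units6.2 ⟨star_mem_𝓞 h1, by rw [RCLike.norm_conj]; exact h2⟩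
    · rw [this, smul_smul, conj_mul', ← ofReal_pow, (mem_units6.1 hc).2]; simp

lemma norm_inner_cases (h : GoodLat L X) {x v : E14} (hx : x ∈ X) (hv : v ∈ X) :
    ‖inner ℂ v x‖ ^ 2 = 0 ∨ ‖inner ℂ v x‖ ^ 2 = 1 ∨ ‖inner ℂ v x‖ ^ 2 = 3 ∨
      ‖inner ℂ v x‖ ^ 2 = 9 := by
  rcases h.inner_cases hx hv with h1 | h1 | ⟨c, hc, h1⟩ | ⟨c, hc, rfl⟩
  · simp [h1]
  · exact Or.inr (Or.inl (mem_units6.1 h1).2)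
  · refine Or.inr (Or.inr (Or.inl ?_))
    rw [h1, norm_mul, mul_pow, (mem_units6.1 hc).2, norm_θ_sq, one_mul]
  · exact Or.inr (Or.inr (Or.inr (h.norm_inner_smul_self hv hc)))

lemma exists_smul_of_norm_inner (h : GoodLat L X) {x v : E14} (hx : x ∈ X) (hv : v ∈ X)
    (h9 : ‖inner ℂ v x‖ ^ 2 = 9) : ∃ c ∈ units6, x = c • v := by
  rcases h.inner_cases hx hv with h1 | h1 | ⟨c, hc, h1⟩ | h1
  · simp [h1] at h9
  · rw [(mem_units6.1 h1).2] at h9; norm_num at h9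
  · rw [h1, norm_mul, mul_pow, (mem_units6.1 hc).2, norm_θ_sq] at h9; norm_num at h9
  · exact h1

/-- The minimal vectors making a prescribed angle with `v`. -/
noncomputable def shell (X : Finset E14) (v : E14) (n : ℝ) : Finset E14 :=
  open Classical in X.filter fun x => ‖inner ℂ v x‖ ^ 2 = n

lemma mem_shell {v x : E14} {n : ℝ} : x ∈ shell X v n ↔ x ∈ X ∧ ‖inner ℂ v x‖ ^ 2 = n := by
  simp [shell]

lemma card_shell_nine (h : GoodLat L X) {v : E14} (hv : v ∈ X) : (shell X v 9).card = 6 := by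
  classical
  have : shell X v 9 = units6.image (· • v) := by
    ext x
    rw [mem_shell, Finset.mem_image]
    constructor
    · rintro ⟨hx, h9⟩
      obtain ⟨c, hc, rfl⟩ := h.exists_smul_of_norm_inner hx hv h9
      exact ⟨c, hc, rfl⟩
    · rintro ⟨c, hc, rfl⟩
      exact ⟨h.smul_mem_X hc hv, h.norm_inner_smul_self hv hc⟩
  rw [this, Finset.card_image_of_injective _ (smul_left_injective ℂ (h.ne_zero_X hv)), card_units6]

lemma sum_eq_shells (h : GoodLat L X) {v : E14} (hv : v ∈ X) (f : ℝ → ℝ) :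
    ∑ x ∈ X, f (‖inner ℂ v x‖ ^ 2) = (shell X v 0).card * f 0 + (shell X v 1).card * f 1 +
      (shell X v 3).card * f 3 + (shell X v 9).card * f 9 := by
  classical
  have hs : ∑ x ∈ X, f (‖inner ℂ v x‖ ^ 2) =
      ∑ n ∈ ({0, 1, 3, 9} : Finset ℝ), ∑ x ∈ shell X v n, f n := by
    rw [← Finset.sum_fiberwise_of_maps_to (g := fun x => ‖inner ℂ v x‖ ^ 2)
      (t := ({0, 1, 3, 9} : Finset ℝ))]
    · refine Finset.sum_congr rfl fun n _ => ?_
      refine Finset.sum_congr ?_ fun x hx => by rw [(mem_shell.1 hx).2]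
      ext x; simp [mem_shell]
    · intro x hx
      simpa using h.norm_inner_cases hx hv
  rw [hs, Finset.sum_insert (by norm_num), Finset.sum_insert (by norm_num),
    Finset.sum_insert (by norm_num), Finset.sum_singleton]
  simp only [Finset.sum_const, nsmul_eq_mul]
  ring

lemma card_shells (h : GoodLat L X) {v : E14} (hv : v ∈ X) :
    (shell X v 0).card = 6936 ∧ (shell X v 1).card = 10206 ∧ (shell X v 3).card = 324 := by
  have h9 := h.card_shell_nine hv
  have hu : ‖(((Real.sqrt 3)⁻¹ : ℝ) : ℂ) • v‖ = 1 := by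
    rw [norm_smul, norm_real, Real.norm_of_nonneg (by positivity)]
    have : ‖v‖ = Real.sqrt 3 := by rw [← h.norm_X hv, Real.sqrt_sq (norm_nonneg _)]
    rw [this, inv_mul_cancel₀ (by positivity)]
  have hi (x : E14) : ‖inner ℂ ((((Real.sqrt 3)⁻¹ : ℝ) : ℂ) • v) x‖ ^ 2 =
      ‖inner ℂ v x‖ ^ 2 / 3 := by
    rw [inner_smul_left, norm_mul, mul_pow, conj_ofReal, norm_real, Real.norm_eq_abs, sq_abs,
      inv_pow, Real.sq_sqrt (by norm_num)]
    ring
  have e0 := h.sum_eq_shells hv fun _ => 1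
  have e1 := h.sum_norm_inner hu
  have e2 := h.sum_zonal hu
  simp only [hi] at e1 e2
  rw [h.sum_eq_shells hv fun t => t / 3] at e1
  rw [h.sum_eq_shells hv fun t => zonal (t / 3)] at e2
  rw [Finset.sum_const, h.card_X] at e0
  rw [h9] at e0 e1 e2
  simp only [zonal] at e2
  norm_num at e0 e1 e2
  refine ⟨?_, ?_, ?_⟩
  · have : ((shell X v 0).card : ℝ) = 6936 := by linarith
    exact_mod_cast this
  · have : ((shell X v 1).card : ℝ) = 10206 := by linarith
    exact_mod_cast this
  · have : ((shell X v 3).card : ℝ) = 324 := by linarith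
    exact_mod_cast this

/-- The minimal vectors with a prescribed inner product with `v`. -/
noncomputable def fiberAt (X : Finset E14) (v : E14) (z : ℂ) : Finset E14 :=
  open Classical in X.filter fun x => inner ℂ v x = z

lemma mem_fiberAt {v x : E14} {z : ℂ} : x ∈ fiberAt X v z ↔ x ∈ X ∧ inner ℂ v x = z := by
  simp [fiberAt]

/-- Multiplication by units: a set of minimal vectors that is stable under units has six times as
many elements as there are elements with a fixed phase. -/
lemma card_eq_six_mul {v : E14} {z : ℂ} (hz : z ≠ 0) (Y : Finset E14)
    (hs : ∀ c ∈ units6, ∀ x ∈ Y, c • x ∈ Y)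
    (hph : ∀ x ∈ Y, ∃ c ∈ units6, inner ℂ v x = c * z) :
    open Classical in Y.card = 6 * (Y.filter fun x => inner ℂ v x = z).card := by
  classical
  have hmap : ∀ x ∈ Y, inner ℂ v x / z ∈ units6 := fun x hx => by
    obtain ⟨c, hc, he⟩ := hph x hx
    rwa [he, mul_div_cancel_right₀ _ hz]
  rw [Finset.card_eq_sum_card_fiberwise hmap, ← card_units6, ← smul_eq_mul, ← Finset.sum_const]
  refine Finset.sum_congr rfl fun c hc => ?_
  have hcc : (starRingEnd ℂ) c * c = 1 := by
    rw [conj_mul', ← ofReal_pow, (mem_units6.1 hc).2]; simp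
  have hc' : (starRingEnd ℂ) c ∈ units6 := mem_units6.2 ⟨star_mem_𝓞 (mem_units6.1 hc).1,
    by rw [RCLike.norm_conj]; exact (mem_units6.1 hc).2⟩
  refine Finset.card_bij' (fun x _ => (starRingEnd ℂ) c • x) (fun x _ => c • x) ?_ ?_ ?_ ?_
  · intro x hx
    simp only [Finset.mem_filter] at hx ⊢
    refine ⟨hs _ hc' _ hx.1, ?_⟩
    rw [inner_smul_right, ← mul_one z, ← hcc, ← hx.2]; field_simp
  · intro x hx
    simp only [Finset.mem_filter] at hx ⊢
    refine ⟨hs _ hc _ hx.1, ?_⟩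
    rw [inner_smul_right, hx.2]; field_simp
  · intro x _
    rw [smul_smul, mul_comm, hcc, one_smul]
  · intro x _
    rw [smul_smul, hcc, one_smul]

end GoodLat

section Tetrahedra

variable {L : AddSubgroup E14} {X : Finset E14}

/-- Orthogonal vectors `e`, `s` of norm one and two spanning four lines of minimal vectors. -/
structure Tet (X : Finset E14) (e s : E14) : Prop where
  orth : inner ℂ e s = 0
  norm_e : ‖e‖ ^ 2 = 1
  norm_s : ‖s‖ ^ 2 = 2
  mem_zero : θ • e ∈ X
  mem_one : e + ω • s ∈ X
  mem_two : e + ω ^ 2 • s ∈ X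
  mem_three : e + s ∈ X

/-- The number of minimal vectors orthogonal to `a` with `3` for the others. -/
noncomputable def tetCount (X : Finset E14) (a b c d : E14) : ℕ :=
  open Classical in (X.filter fun x => ‖inner ℂ a x‖ ^ 2 = 0 ∧ ‖inner ℂ b x‖ ^ 2 = 3 ∧
    ‖inner ℂ c x‖ ^ 2 = 3 ∧ ‖inner ℂ d x‖ ^ 2 = 3).card

lemma tetCount_rotate (a b c d : E14) : tetCount X a b c d = tetCount X a c d b := by
  classical
  unfold tetCount
  congr 1
  exact Finset.filter_congr fun x _ => by tauto

lemma tetCount_swap (a b c d : E14) : tetCount X a b c d = tetCount X a c b d := by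
  classical
  unfold tetCount
  congr 1
  exact Finset.filter_congr fun x _ => by tauto

lemma ω_pow_three : ω ^ 3 = 1 := by linear_combination (ω - 1) * ω_sq

lemma ω_mem_units6 : ω ∈ units6 := by simp [units6]

lemma one_mem_units6 : (1 : ℂ) ∈ units6 := by simp [units6]

lemma conj_ω_mul : (starRingEnd ℂ) ω * ω = 1 := by
  rw [conj_ω]; linear_combination -ω_sq

lemma conj_ω' : (starRingEnd ℂ) ω = ω ^ 2 := by rw [conj_ω]; linear_combination -ω_sq

lemma inner_self_ofReal (x : E14) : inner ℂ x x = ((‖x‖ ^ 2 : ℝ) : ℂ) := by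
  rw [inner_self_eq_norm_sq_to_K]; norm_num

namespace Tet

variable {e s : E14}

lemma rot (T : Tet X e s) : Tet X e (ω • s) where
  orth := by rw [inner_smul_right, T.orth, mul_zero]
  norm_e := T.norm_e
  norm_s := by rw [norm_smul, norm_ω, one_mul, T.norm_s]
  mem_zero := T.mem_zero
  mem_one := by rw [smul_smul, ← sq]; exact T.mem_two
  mem_two := by rw [smul_smul, ← pow_succ, ω_pow_three, one_smul]; exact T.mem_three
  mem_three := T.mem_one

lemma inner_ee (T : Tet X e s) : inner ℂ e e = 1 := by
  rw [inner_self_ofReal, T.norm_e, ofReal_one]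

lemma inner_ss (T : Tet X e s) : inner ℂ s s = 2 := by
  rw [inner_self_ofReal, T.norm_s, ofReal_ofNat]

lemma orth' (T : Tet X e s) : inner ℂ s e = 0 := inner_eq_zero_symm.1 T.orth

lemma norm_comb (T : Tet X e s) (a b : ℂ) : ‖a • e + b • s‖ ^ 2 = ‖a‖ ^ 2 + 2 * ‖b‖ ^ 2 := by
  have h : inner ℂ (a • e) (b • s) = 0 := by
    rw [inner_smul_left, inner_smul_right, T.orth]; simp
  have := norm_add_sq (𝕜 := ℂ) (a • e) (b • s)
  rw [h, norm_smul, norm_smul, mul_pow, mul_pow, T.norm_e, T.norm_s] at this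
  rw [this]; simp; ring

lemma recenter (h : GoodLat L X) (T : Tet X e s) :
    Tet X (θ⁻¹ • (e + s)) (θ⁻¹ • (2 • e - s)) := by
  have hθ := θ_ne
  have hn : ‖θ⁻¹‖ ^ 2 = 1 / 3 := by rw [norm_inv, inv_pow, norm_θ_sq]; norm_num
  have hneg : (-1 : ℂ) ∈ units6 := by simp [units6]
  refine ⟨?_, ?_, ?_, ?_, ?_, ?_, ?_⟩
  · simp only [inner_smul_left, inner_smul_right, inner_add_left, inner_sub_right, two_smul,
      inner_add_right, T.inner_ee, T.inner_ss, T.orth, T.orth']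
    ring
  · rw [norm_smul, mul_pow, hn]
    have := T.norm_comb 1 1
    rw [one_smul, one_smul] at this
    rw [this]; norm_num
  · rw [norm_smul, mul_pow, hn]
    have := T.norm_comb 2 (-1)
    rw [neg_one_smul, ← sub_eq_add_neg, ofNat_smul_eq_nsmul] at this
    rw [this]; norm_num
  · rw [smul_smul, mul_inv_cancel₀ hθ, one_smul]; exact T.mem_three
  · convert T.mem_two using 1
    rw [← smul_right_inj hθ]
    simp only [smul_add, smul_smul, smul_sub, two_smul]
    rw [mul_left_comm, mul_inv_cancel₀ hθ]
    simp only [mul_one, one_smul, θ]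
    match_scalars <;> grind [ω_sq]
  · convert h.smul_mem_X hneg T.mem_one using 1
    rw [← smul_right_inj hθ]
    simp only [smul_add, smul_smul, smul_sub, two_smul]
    rw [mul_left_comm, mul_inv_cancel₀ hθ]
    simp only [mul_one, one_smul, θ]
    match_scalars <;> grind [ω_sq]
  · convert h.smul_mem_X hneg T.mem_zero using 1
    rw [← smul_right_inj hθ]
    simp only [smul_add, smul_smul, smul_sub, two_smul]
    rw [mul_inv_cancel₀ hθ]
    simp only [one_smul]
    match_scalars <;> grind [θ_sq]

/-- The four squared absolute values in terms of two inner products. -/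
lemma values (_T : Tet X e s) (x : E14) :
    ‖inner ℂ (θ • e) x‖ ^ 2 = 3 * ‖inner ℂ e x‖ ^ 2 ∧
    ‖inner ℂ (e + ω • s) x‖ ^ 2 = ‖inner ℂ e x‖ ^ 2 + ‖inner ℂ s x‖ ^ 2 -
      (inner ℂ e x * inner ℂ x s).re - Real.sqrt 3 * (inner ℂ e x * inner ℂ x s).im ∧
    ‖inner ℂ (e + ω ^ 2 • s) x‖ ^ 2 = ‖inner ℂ e x‖ ^ 2 + ‖inner ℂ s x‖ ^ 2 -
      (inner ℂ e x * inner ℂ x s).re + Real.sqrt 3 * (inner ℂ e x * inner ℂ x s).im ∧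
    ‖inner ℂ (e + s) x‖ ^ 2 = ‖inner ℂ e x‖ ^ 2 + ‖inner ℂ s x‖ ^ 2 +
      2 * (inner ℂ e x * inner ℂ x s).re := by
  have h2 : ω ^ 2 = -1 - ω := by linear_combination ω_sq
  have hr3 : Real.sqrt 3 ^ 2 = 3 := Real.sq_sqrt (by norm_num)
  rw [← inner_conj_symm x s]
  refine ⟨?_, ?_, ?_, ?_⟩
  · rw [inner_smul_left, norm_mul, mul_pow, RCLike.norm_conj, norm_θ_sq]
  · rw [inner_add_left, inner_smul_left, conj_ω]
    simp only [norm_sq_eq_re_im, add_re, add_im, mul_re, mul_im, sub_re, sub_im, neg_re, neg_im,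
      one_re, one_im, ω_re, ω_im, conj_re, conj_im]
    linear_combination ((inner ℂ s x).re ^ 2 + (inner ℂ s x).im ^ 2) / 4 * hr3
  · rw [inner_add_left, inner_smul_left, h2, map_sub, map_neg, map_one, conj_ω]
    simp only [norm_sq_eq_re_im, add_re, add_im, mul_re, mul_im, sub_re, sub_im, neg_re, neg_im,
      one_re, one_im, ω_re, ω_im, conj_re, conj_im]
    linear_combination ((inner ℂ s x).re ^ 2 + (inner ℂ s x).im ^ 2) / 4 * hr3
  · rw [inner_add_left]
    simp only [norm_sq_eq_re_im, add_re, add_im, mul_re, conj_re, conj_im]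
    ring

end Tet

lemma pattern_identity {t₀ t₁ t₂ t₃ : ℝ} (h₀ : t₀ = 0 ∨ t₀ = 1 ∨ t₀ = 3 ∨ t₀ = 9)
    (h₁ : t₁ = 0 ∨ t₁ = 1 ∨ t₁ = 3 ∨ t₁ = 9) (h₂ : t₂ = 0 ∨ t₂ = 1 ∨ t₂ = 3 ∨ t₂ = 9)
    (h₃ : t₃ = 0 ∨ t₃ = 1 ∨ t₃ = 3 ∨ t₃ = 9) (h03 : t₀ = 9 → t₃ = 3) (h30 : t₃ = 9 → t₀ = 3)
    (hq : (t₀ + t₁ + t₂ + t₃) ^ 2 = 3 * (t₀ ^ 2 + t₁ ^ 2 + t₂ ^ 2 + t₃ ^ 2)) :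
    (3 * (if t₀ = 0 ∧ t₁ = 3 ∧ t₂ = 3 ∧ t₃ = 3 then 1 else 0) +
      5 * (if t₁ = 0 ∧ t₀ = 3 ∧ t₂ = 3 ∧ t₃ = 3 then 1 else 0) +
      5 * (if t₂ = 0 ∧ t₀ = 3 ∧ t₁ = 3 ∧ t₃ = 3 then 1 else 0) +
      5 * (if t₃ = 0 ∧ t₀ = 3 ∧ t₁ = 3 ∧ t₂ = 3 then 1 else 0) : ℝ) =
    -1 / 18 * ((2 * t₁ - t₂ - t₃) * (2 * t₂ - t₁ - t₃) * (2 * t₃ - t₁ - t₂)) -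
      1 / 9 * (if t₀ = 1 then 1 else 0) - 3 * (if t₀ = 9 then 1 else 0) +
      (if t₁ = 3 then 1 else 0) + (if t₂ = 3 then 1 else 0) + (if t₃ = 3 then 1 else 0) +
      22 * (if t₁ = 9 then 1 else 0) + 22 * (if t₂ = 9 then 1 else 0) +
      22 * (if t₃ = 9 then 1 else 0) := by
  rcases h₀ with rfl | rfl | rfl | rfl <;> rcases h₃ with rfl | rfl | rfl | rfl <;>
    rcases h₁ with rfl | rfl | rfl | rfl <;> rcases h₂ with rfl | rfl | rfl | rfl <;>
    first | (exfalso; norm_num at hq; done) | (exfalso; norm_num at h03; done) |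
      (exfalso; norm_num at h30; done) | norm_num

namespace Tet

variable {e s : E14}

lemma quadratic (T : Tet X e s) (x : E14) :
    (‖inner ℂ (θ • e) x‖ ^ 2 + ‖inner ℂ (e + ω • s) x‖ ^ 2 + ‖inner ℂ (e + ω ^ 2 • s) x‖ ^ 2 +
      ‖inner ℂ (e + s) x‖ ^ 2) ^ 2 = 3 * ((‖inner ℂ (θ • e) x‖ ^ 2) ^ 2 +
      (‖inner ℂ (e + ω • s) x‖ ^ 2) ^ 2 + (‖inner ℂ (e + ω ^ 2 • s) x‖ ^ 2) ^ 2 +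
      (‖inner ℂ (e + s) x‖ ^ 2) ^ 2) := by
  have hr3 : Real.sqrt 3 ^ 2 = 3 := Real.sq_sqrt (by norm_num)
  obtain ⟨e0, e1, e2, e3⟩ := T.values x
  have hn : ‖inner ℂ e x‖ ^ 2 * ‖inner ℂ s x‖ ^ 2 =
      (inner ℂ e x * inner ℂ x s).re ^ 2 + (inner ℂ e x * inner ℂ x s).im ^ 2 := by
    rw [← norm_sq_eq_re_im, norm_mul, mul_pow, norm_inner_symm x s]
  rw [e0, e1, e2, e3]
  linear_combination 18 * hn - 6 * (inner ℂ e x * inner ℂ x s).im ^ 2 * hr3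

lemma count_relation (h : GoodLat L X) (T : Tet X e s) :
    3 * tetCount X (θ • e) (e + ω • s) (e + ω ^ 2 • s) (e + s) +
      5 * tetCount X (e + ω • s) (θ • e) (e + ω ^ 2 • s) (e + s) +
      5 * tetCount X (e + ω ^ 2 • s) (θ • e) (e + ω • s) (e + s) +
      5 * tetCount X (e + s) (θ • e) (e + ω • s) (e + ω ^ 2 • s) = 216 := by
  classical
  have hr3 : Real.sqrt 3 ^ 2 = 3 := Real.sq_sqrt (by norm_num)
  have hcube : ∑ x ∈ X, (inner ℂ e x * inner ℂ x s).re *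
      ((inner ℂ e x * inner ℂ x s).re ^ 2 - 3 * (inner ℂ e x * inner ℂ x s).im ^ 2) = 0 := by
    rw [← zero_re, ← h.design_three e s T.orth, re_sum]
    refine Finset.sum_congr rfl fun x _ => ?_
    generalize inner ℂ e x * inner ℂ x s = w
    simp only [pow_succ, pow_zero, one_mul, mul_re, mul_im]
    ring
  have h3 : ‖inner ℂ (θ • e) (e + s)‖ ^ 2 = 3 := by
    rw [inner_smul_left, inner_add_right, T.orth, T.inner_ee, norm_mul, mul_pow, RCLike.norm_conj,
      norm_θ_sq]; norm_num
  have hpt := fun x (hx : x ∈ X) => pattern_identity (h.norm_inner_cases hx T.mem_zero)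
    (h.norm_inner_cases hx T.mem_one) (h.norm_inner_cases hx T.mem_two)
    (h.norm_inner_cases hx T.mem_three)
    (fun h9 => by
      obtain ⟨c, hc, rfl⟩ := h.exists_smul_of_norm_inner hx T.mem_zero h9
      rw [inner_smul_right, norm_mul, mul_pow, (mem_units6.1 hc).2, norm_inner_symm, h3, one_mul])
    (fun h9 => by
      obtain ⟨c, hc, rfl⟩ := h.exists_smul_of_norm_inner hx T.mem_three h9
      rw [inner_smul_right, norm_mul, mul_pow, (mem_units6.1 hc).2, h3, one_mul])
    (T.quadratic x)
  have hsum := Finset.sum_congr rfl hpt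
  simp only [Finset.sum_add_distrib, Finset.sum_sub_distrib, ← Finset.mul_sum,
    Finset.sum_boole] at hsum
  have hz : ∑ x ∈ X, (2 * ‖inner ℂ (e + ω • s) x‖ ^ 2 - ‖inner ℂ (e + ω ^ 2 • s) x‖ ^ 2 -
      ‖inner ℂ (e + s) x‖ ^ 2) * (2 * ‖inner ℂ (e + ω ^ 2 • s) x‖ ^ 2 -
      ‖inner ℂ (e + ω • s) x‖ ^ 2 - ‖inner ℂ (e + s) x‖ ^ 2) *
      (2 * ‖inner ℂ (e + s) x‖ ^ 2 - ‖inner ℂ (e + ω • s) x‖ ^ 2 -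
        ‖inner ℂ (e + ω ^ 2 • s) x‖ ^ 2) = 0 := by
    have h54 := congrArg (54 * ·) hcube
    simp only [mul_zero, Finset.mul_sum] at h54
    refine Eq.trans (Finset.sum_congr rfl fun x _ => ?_) h54
    obtain ⟨-, e1, e2, e3⟩ := T.values x
    rw [e1, e2, e3]
    linear_combination (-54) * (inner ℂ e x * inner ℂ x s).re *
      (inner ℂ e x * inner ℂ x s).im ^ 2 * hr3
  have hsh (v : E14) (n : ℝ) : (X.filter fun x => ‖inner ℂ v x‖ ^ 2 = n) = GoodLat.shell X v n := by
    ext x; simp [GoodLat.mem_shell]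
  rw [hz] at hsum
  simp only [hsh, (h.card_shells T.mem_zero).2.1, h.card_shell_nine T.mem_zero,
    h.card_shell_nine T.mem_one, h.card_shell_nine T.mem_two, h.card_shell_nine T.mem_three,
    (h.card_shells T.mem_one).2.2, (h.card_shells T.mem_two).2.2,
    (h.card_shells T.mem_three).2.2] at hsum
  push_cast at hsum
  rify
  unfold tetCount
  linarith

end Tet

end Tetrahedra

section Tetrahedra

variable {L : AddSubgroup E14} {X : Finset E14}

lemma tetCount_smul {c₀ c₁ c₂ c₃ : ℂ} (h₀ : ‖c₀‖ = 1) (h₁ : ‖c₁‖ = 1) (h₂ : ‖c₂‖ = 1)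
    (h₃ : ‖c₃‖ = 1) (a b c d : E14) :
    tetCount X (c₀ • a) (c₁ • b) (c₂ • c) (c₃ • d) = tetCount X a b c d := by
  simp only [tetCount, inner_smul_left, norm_mul, RCLike.norm_conj, h₀, h₁, h₂, h₃, one_mul]

namespace Tet

variable {e s : E14}

lemma recenter_zero (e s : E14) : θ • θ⁻¹ • (e + s) = e + s := by
  rw [smul_smul, mul_inv_cancel₀ θ_ne, one_smul]

lemma recenter_one (e s : E14) :
    θ⁻¹ • (e + s) + ω • θ⁻¹ • (2 • e - s) = (1 : ℂ) • (e + ω ^ 2 • s) := by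
  rw [← smul_right_inj θ_ne]
  simp only [smul_add, smul_smul, smul_sub, two_smul]
  rw [mul_left_comm, mul_inv_cancel₀ θ_ne]
  simp only [mul_one, one_smul, θ]
  match_scalars <;> grind [ω_sq]

lemma recenter_two (e s : E14) :
    θ⁻¹ • (e + s) + ω ^ 2 • θ⁻¹ • (2 • e - s) = (-1 : ℂ) • (e + ω • s) := by
  rw [← smul_right_inj θ_ne]
  simp only [smul_add, smul_smul, smul_sub, two_smul]
  rw [mul_left_comm, mul_inv_cancel₀ θ_ne]
  simp only [mul_one, one_smul, θ]
  match_scalars <;> grind [ω_sq]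

lemma recenter_three (e s : E14) :
    θ⁻¹ • (e + s) + θ⁻¹ • (2 • e - s) = (-1 : ℂ) • (θ • e) := by
  rw [← smul_right_inj θ_ne]
  simp only [smul_add, smul_smul, smul_sub, two_smul]
  rw [mul_inv_cancel₀ θ_ne]
  simp only [one_smul]
  match_scalars <;> grind [θ_sq]

lemma count_relation_three (h : GoodLat L X) (T : Tet X e s) :
    3 * tetCount X (e + s) (θ • e) (e + ω • s) (e + ω ^ 2 • s) +
      5 * tetCount X (e + ω • s) (θ • e) (e + ω ^ 2 • s) (e + s) +
      5 * tetCount X (e + ω ^ 2 • s) (θ • e) (e + ω • s) (e + s) +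
      5 * tetCount X (θ • e) (e + ω • s) (e + ω ^ 2 • s) (e + s) = 216 := by
  have hr := (T.recenter h).count_relation h
  have h1 : ‖(-1 : ℂ)‖ = 1 := by simp
  rw [recenter_zero, recenter_one, recenter_two, recenter_three, ← one_smul ℂ (e + s),
    tetCount_smul (by simp) (by simp) h1 h1, tetCount_smul (by simp) (by simp) h1 h1,
    tetCount_smul h1 (by simp) (by simp) h1, tetCount_smul h1 (by simp) (by simp) h1] at hr
  have q0 : tetCount X (e + s) (θ • e) (e + ω • s) (e + ω ^ 2 • s) =
      tetCount X (e + s) (e + ω ^ 2 • s) (e + ω • s) (θ • e) := by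
    rw [tetCount_rotate, tetCount_swap]
  have q1 : tetCount X (e + ω • s) (θ • e) (e + ω ^ 2 • s) (e + s) =
      tetCount X (e + ω • s) (e + s) (e + ω ^ 2 • s) (θ • e) := by
    rw [tetCount_rotate, tetCount_swap]
  have q2 : tetCount X (e + ω ^ 2 • s) (θ • e) (e + ω • s) (e + s) =
      tetCount X (e + ω ^ 2 • s) (e + s) (e + ω • s) (θ • e) := by
    rw [tetCount_rotate, tetCount_swap]
  have q3 : tetCount X (θ • e) (e + ω • s) (e + ω ^ 2 • s) (e + s) =
      tetCount X (θ • e) (e + s) (e + ω ^ 2 • s) (e + ω • s) := by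
    rw [tetCount_rotate, tetCount_swap]
  rw [q0, q1, q2, q3]
  linarith

lemma tetCount_eq (h : GoodLat L X) (T : Tet X e s) :
    tetCount X (e + s) (θ • e) (e + ω • s) (e + ω ^ 2 • s) = 12 := by
  have r0 := T.count_relation h
  have r3 := T.count_relation_three h
  have r1 := T.rot.count_relation_three h
  have r2 := T.rot.rot.count_relation_three h
  have h4 : ω * ω = ω ^ 2 := (sq ω).symm
  have h5 : ω ^ 2 * ω = 1 := by rw [← pow_succ, ω_pow_three]
  have h6 : ω ^ 2 * ω ^ 2 = ω := by rw [← pow_add, pow_succ, ω_pow_three, one_mul]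
  have h7 : ω * ω ^ 2 = 1 := by rw [mul_comm, h5]
  simp only [smul_smul, h4, h5, h6, h7, one_smul] at r1 r2
  have sr (a b c d : E14) : tetCount X a b c d = tetCount X a b d c := by
    rw [tetCount_swap, tetCount_rotate, tetCount_rotate, tetCount_swap, tetCount_rotate]
  rw [sr (e + ω ^ 2 • s), sr (e + s) _ (e + ω ^ 2 • s),
    tetCount_rotate (θ • e), tetCount_rotate (θ • e)] at r1
  rw [sr (e + ω ^ 2 • s), sr (e + ω • s), tetCount_rotate (θ • e)] at r2
  omega

end Tet
end Tetrahedra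

section ShortVectors

variable {L : AddSubgroup E14} {X : Finset E14} {e s s' : E14}

lemma θ_eq : θ = ω - ω ^ 2 := by rw [θ]; linear_combination ω_sq

lemma ω_pow_mem_units6 (i : ℕ) : ω ^ i ∈ units6 :=
  mem_units6.2 ⟨pow_mem ω_mem i, by rw [norm_pow, norm_ω, one_pow, one_pow]⟩

lemma ω_pow_ne (i : ℕ) : ω ^ i ≠ 0 := pow_ne_zero _ fun h => by
  have := norm_ω; rw [h] at this; simp at this

lemma conj_ω_pow_mul (i : ℕ) : (starRingEnd ℂ) (ω ^ i) * ω ^ i = 1 := by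
  rw [map_pow, ← mul_pow, conj_ω_mul, one_pow]

namespace Tet

lemma rot_pow (T : Tet X e s) (i : ℕ) : Tet X e (ω ^ i • s) := by
  induction i with
  | zero => simpa using T
  | succ i ih => rw [pow_succ', mul_smul]; exact ih.rot

/-- A minimal vector with the same inner product with `e` completes to a tetrahedron. -/
lemma of_mem (h : GoodLat L X) (he : ‖e‖ ^ 2 = 1) (hv : θ • e ∈ X) (horth : inner ℂ e s = 0)
    (hs : e + s ∈ X) : Tet X e s := by
  have hns : ‖s‖ ^ 2 = 2 := by
    have := norm_add_sq (𝕜 := ℂ) e s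
    rw [horth, h.norm_X hs, he] at this
    simp at this
    linarith
  have hL := h.mem_of_X hs
  have hvL := h.mem_of_X hv
  have hT : ∀ c ∈ units6, e + c • s ∈ L → e + c • s ∈ X := fun c hc hcL => by
    refine (h.mem_X _).2 ⟨hcL, ?_⟩
    have h0 : inner ℂ e (c • s) = 0 := by rw [inner_smul_right, horth, mul_zero]
    have := norm_add_sq (𝕜 := ℂ) e (c • s)
    rw [h0, norm_smul, mul_pow, (mem_units6.1 hc).2, he, hns] at this
    simp at this
    rw [this]; norm_num
  refine ⟨horth, he, hns, hv, hT _ ω_mem_units6 ?_, hT _ (ω_pow_mem_units6 2) ?_, hs⟩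
  · have : e + ω • s = ω • (e + s) + ω ^ 2 • θ • e := by
      rw [θ_eq]; match_scalars <;> grind [ω_sq]
    rw [this]
    exact add_mem (h.smul_mem _ ω_mem _ hL) (h.smul_mem _ (pow_mem ω_mem 2) _ hvL)
  · have : e + ω ^ 2 • s = ω ^ 2 • (e + s) + (-ω) • θ • e := by
      rw [θ_eq]; match_scalars <;> grind [ω_sq]
    rw [this]
    exact add_mem (h.smul_mem _ (pow_mem ω_mem 2) _ hL) (h.smul_mem _ (neg_mem ω_mem) _ hvL)

lemma inner_vertex (T : Tet X e s) (T' : Tet X e s') (c : ℂ) :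
    inner ℂ (e + c • s) (e + s') = 1 + (starRingEnd ℂ) c * inner ℂ s s' := by
  rw [inner_add_left, inner_add_right, inner_add_right, inner_smul_left, inner_smul_left,
    T.inner_ee, T'.orth, T.orth']
  ring

lemma eq_rot_of_nine (h : GoodLat L X) (T : Tet X e s) (T' : Tet X e s') {i : ℕ}
    (h9 : ‖inner ℂ (e + ω ^ i • s) (e + s')‖ ^ 2 = 9) : s' = ω ^ i • s := by
  obtain ⟨c, -, hc⟩ := h.exists_smul_of_norm_inner T'.mem_three (T.rot_pow i).mem_three h9
  have := congrArg (inner ℂ e) hc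
  rw [inner_smul_right, inner_add_right, inner_add_right, T.inner_ee, T'.orth,
    (T.rot_pow i).orth] at this
  simp only [add_zero, mul_one] at this
  rw [← this, one_smul] at hc
  exact add_left_cancel hc

lemma inner_eq_of_zero (T : Tet X e s) (T' : Tet X e s') {i : ℕ}
    (h0 : ‖inner ℂ (e + ω ^ i • s) (e + s')‖ ^ 2 = 0) : inner ℂ s s' = -ω ^ i := by
  rw [sq_eq_zero_iff, norm_eq_zero, T.inner_vertex T'] at h0
  linear_combination ω ^ i * h0 - inner ℂ s s' * conj_ω_pow_mul i

lemma trichotomy (h : GoodLat L X) (T : Tet X e s) (T' : Tet X e s') :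
    inner ℂ s s' = 0 ∨ (∃ i : ℕ, inner ℂ s s' = -ω ^ i) ∨ ∃ i : ℕ, s' = ω ^ i • s := by
  have hq := T.quadratic (e + s')
  have h0 : ‖inner ℂ (θ • e) (e + s')‖ ^ 2 = 3 := by
    rw [inner_smul_left, inner_add_right, T'.orth, T.inner_ee, norm_mul, mul_pow, RCLike.norm_conj,
      norm_θ_sq]; norm_num
  have e3 : e + s = e + ω ^ 0 • s := by simp
  have e1 : e + ω • s = e + ω ^ 1 • s := by simp
  obtain ⟨-, v1, v2, v3⟩ := T.values (e + s')
  have hsum : ‖inner ℂ (e + ω • s) (e + s')‖ ^ 2 + ‖inner ℂ (e + ω ^ 2 • s) (e + s')‖ ^ 2 +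
      ‖inner ℂ (e + s) (e + s')‖ ^ 2 = 3 + 3 * ‖inner ℂ s s'‖ ^ 2 := by
    rw [v1, v2, v3, inner_add_right, inner_add_right, T.inner_ee, T'.orth, T.orth']
    norm_num; ring
  have c1 := h.norm_inner_cases T'.mem_three T.mem_one
  have c2 := h.norm_inner_cases T'.mem_three T.mem_two
  have c3 := h.norm_inner_cases T'.mem_three T.mem_three
  rw [e3, e1, h0] at hq
  rw [e3, e1] at hsum
  rw [e1] at c1
  rw [e3] at c3
  have z {i : ℕ} (h0 : ‖inner ℂ (e + ω ^ i • s) (e + s')‖ ^ 2 = 0) := T.inner_eq_of_zero T' h0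
  have n {i : ℕ} (h0 : ‖inner ℂ (e + ω ^ i • s) (e + s')‖ ^ 2 = 9) := T.eq_rot_of_nine h T' h0
  rcases c1 with c1 | c1 | c1 | c1
  · exact Or.inr (Or.inl ⟨_, z c1⟩)
  · rcases c2 with c2 | c2 | c2 | c2
    · exact Or.inr (Or.inl ⟨_, z c2⟩)
    · rcases c3 with c3 | c3 | c3 | c3
      · exact Or.inr (Or.inl ⟨_, z c3⟩)
      · left
        rw [c1, c2, c3] at hsum
        have : ‖inner ℂ s s'‖ ^ 2 = 0 := by linarith
        simpa using this
      · rw [c1, c2, c3] at hq; norm_num at hq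
      · exact Or.inr (Or.inr ⟨_, n c3⟩)
    · rcases c3 with c3 | c3 | c3 | c3
      · exact Or.inr (Or.inl ⟨_, z c3⟩)
      · rw [c1, c2, c3] at hq; norm_num at hq
      · rw [c1, c2, c3] at hq; norm_num at hq
      · exact Or.inr (Or.inr ⟨_, n c3⟩)
    · exact Or.inr (Or.inr ⟨_, n c2⟩)
  · rcases c2 with c2 | c2 | c2 | c2
    · exact Or.inr (Or.inl ⟨_, z c2⟩)
    · rcases c3 with c3 | c3 | c3 | c3
      · exact Or.inr (Or.inl ⟨_, z c3⟩)
      · rw [c1, c2, c3] at hq; norm_num at hq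
      · rw [c1, c2, c3] at hq; norm_num at hq
      · exact Or.inr (Or.inr ⟨_, n c3⟩)
    · rcases c3 with c3 | c3 | c3 | c3
      · exact Or.inr (Or.inl ⟨_, z c3⟩)
      · rw [c1, c2, c3] at hq; norm_num at hq
      · rw [c1, c2, c3] at hq; norm_num at hq
      · exact Or.inr (Or.inr ⟨_, n c3⟩)
    · exact Or.inr (Or.inr ⟨_, n c2⟩)
  · exact Or.inr (Or.inr ⟨_, n c1⟩)

end Tet

namespace GoodLat

/-- The short vectors: differences of `e` with the minimal vectors having inner product one
with `e`. -/
noncomputable def short (X : Finset E14) (e : E14) : Finset E14 :=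
  open Classical in (fiberAt X e 1).image (· - e)

lemma mem_short (h : GoodLat L X) (he : ‖e‖ ^ 2 = 1) (hv : θ • e ∈ X) :
    s ∈ short X e ↔ Tet X e s := by
  classical
  simp only [short, Finset.mem_image, mem_fiberAt]
  constructor
  · rintro ⟨x, ⟨hx, h1⟩, rfl⟩
    refine Tet.of_mem h he hv ?_ (by simpa using hx)
    rw [inner_sub_right, h1, inner_self_ofReal, he, ofReal_one, sub_self]
  · intro T
    exact ⟨e + s, ⟨T.mem_three, by rw [inner_add_right, T.inner_ee, T.orth, add_zero]⟩, by simp⟩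

lemma inner_θ_smul_eq (e x : E14) (z : ℂ) : inner ℂ (θ • e) x = -θ * z ↔ inner ℂ e x = z := by
  rw [inner_smul_left, conj_θ]
  exact ⟨fun h => mul_left_cancel₀ (neg_ne_zero.2 θ_ne) h, fun h => by rw [h]⟩

lemma phase_of_three (h : GoodLat L X) {v x : E14} (hx : x ∈ X) (hv : v ∈ X)
    (h3 : ‖inner ℂ v x‖ ^ 2 = 3) : ∃ c ∈ units6, inner ℂ v x = c * (-θ * 1) := by
  rcases h.inner_cases hx hv with h1 | h1 | ⟨c, hc, h1⟩ | ⟨c, hc, rfl⟩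
  · simp [h1] at h3
  · rw [(mem_units6.1 h1).2] at h3; norm_num at h3
  · refine ⟨-c, mem_units6.2 ⟨neg_mem (mem_units6.1 hc).1, ?_⟩, by rw [h1]; ring⟩
    rw [norm_neg]; exact (mem_units6.1 hc).2
  · rw [h.norm_inner_smul_self hv hc] at h3; norm_num at h3

lemma norm_inner_unit_smul {c : ℂ} (hc : c ∈ units6) (v x : E14) :
    ‖inner ℂ v (c • x)‖ ^ 2 = ‖inner ℂ v x‖ ^ 2 := by
  rw [inner_smul_right, norm_mul, mul_pow, (mem_units6.1 hc).2, one_mul]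

lemma card_short (h : GoodLat L X) (hv : θ • e ∈ X) : (short X e).card = 54 := by
  classical
  rw [short, Finset.card_image_of_injective _ sub_left_injective]
  have h6 := GoodLat.card_eq_six_mul (v := θ • e) (z := -θ * 1) (by simp [θ_ne]) (shell X (θ • e) 3)
    (fun c hc x hx => mem_shell.2 ⟨h.smul_mem_X hc (mem_shell.1 hx).1, by
      rw [norm_inner_unit_smul hc]; exact (mem_shell.1 hx).2⟩)
    (fun x hx => h.phase_of_three (mem_shell.1 hx).1 hv (mem_shell.1 hx).2)
  rw [(h.card_shells hv).2.2] at h6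
  have : (shell X (θ • e) 3).filter (fun x => inner ℂ (θ • e) x = -θ * 1) = fiberAt X e 1 := by
    ext x
    rw [Finset.mem_filter, mem_shell, mem_fiberAt, inner_θ_smul_eq]
    constructor
    · rintro ⟨⟨h1, -⟩, h2⟩; exact ⟨h1, h2⟩
    · rintro ⟨h1, h2⟩
      refine ⟨⟨h1, ?_⟩, h2⟩
      rw [inner_smul_left, h2, norm_mul, mul_pow, RCLike.norm_conj, norm_θ_sq]; norm_num
  rw [this] at h6
  omega

lemma card_neighbours (h : GoodLat L X) (T : Tet X e s) :
    open Classical in ((short X e).filter fun u => inner ℂ s u = -1).card = 2 := by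
  classical
  have hv := T.mem_zero
  set Y := X.filter fun x => ‖inner ℂ (e + s) x‖ ^ 2 = 0 ∧ ‖inner ℂ (θ • e) x‖ ^ 2 = 3 ∧
    ‖inner ℂ (e + ω • s) x‖ ^ 2 = 3 ∧ ‖inner ℂ (e + ω ^ 2 • s) x‖ ^ 2 = 3 with hY
  have h12 : Y.card = 12 := T.tetCount_eq h
  have h6 := GoodLat.card_eq_six_mul (v := θ • e) (z := -θ * 1) (by simp [θ_ne]) Y
    (fun c hc x hx => by
      simp only [hY, Finset.mem_filter, norm_inner_unit_smul hc] at hx ⊢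
      exact ⟨h.smul_mem_X hc hx.1, hx.2⟩)
    (fun x hx => by
      simp only [hY, Finset.mem_filter] at hx
      exact h.phase_of_three hx.1 hv hx.2.2.1)
  have h2 : (Y.filter fun x => inner ℂ (θ • e) x = -θ * 1).card = 2 := by omega
  rw [← h2]
  refine Finset.card_bij' (fun u _ => e + u) (fun x _ => x - e) ?_ ?_ ?_ ?_
  · intro u hu
    simp only [Finset.mem_filter, h.mem_short T.norm_e hv] at hu
    obtain ⟨Tu, hu⟩ := hu
    have hi := fun c : ℂ => T.inner_vertex Tu c
    have h0 : ‖inner ℂ (θ • e) (e + u)‖ ^ 2 = 3 := by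
      rw [inner_smul_left, inner_add_right, Tu.orth, T.inner_ee, norm_mul, mul_pow,
        RCLike.norm_conj, norm_θ_sq]; norm_num
    simp only [Finset.mem_filter, hY, inner_θ_smul_eq]
    refine ⟨⟨Tu.mem_three, ?_, h0, ?_, ?_⟩, ?_⟩
    · have := hi 1
      rw [one_smul, hu] at this
      rw [this]; simp
    · rw [hi, hu, conj_ω, ← norm_θ_sq, θ]
      have : 1 + (-1 - ω) * (-1) = -ω * (2 * ω + 1) := by linear_combination 2 * ω_sq
      rw [this, norm_mul, norm_neg, norm_ω, one_mul]
    · rw [hi, hu, map_pow, conj_ω, ← norm_θ_sq, θ]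
      have : 1 + (-1 - ω) ^ 2 * (-1) = ω ^ 2 * (2 * ω + 1) := by
        linear_combination (-2 * ω) * ω_sq
      rw [this, norm_mul, norm_pow, norm_ω, one_pow, one_mul]
    · rw [inner_add_right, T.inner_ee, Tu.orth, add_zero]
  · intro x hx
    simp only [Finset.mem_filter, hY, inner_θ_smul_eq] at hx
    obtain ⟨⟨hx, h1, -⟩, h5⟩ := hx
    have h3 : inner ℂ s e = 0 := T.orth'
    rw [sq_eq_zero_iff, norm_eq_zero, inner_add_left, h5] at h1
    simp only [Finset.mem_filter, h.mem_short T.norm_e hv]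
    refine ⟨Tet.of_mem h T.norm_e hv ?_ (by simpa using hx), ?_⟩
    · rw [inner_sub_right, h5, T.inner_ee, sub_self]
    · rw [inner_sub_right, h3]; linear_combination h1
  · intro u _; simp
  · intro x _; simp

end GoodLat
end ShortVectors

section PairSystems

variable {L : AddSubgroup E14} {X : Finset E14} {e s s' : E14}

lemma ω_pow_mod (n : ℕ) : ω ^ n = ω ^ (n % 3) := by
  conv_lhs => rw [← Nat.div_add_mod n 3, pow_add, pow_mul, ω_pow_three, one_pow, one_mul]

lemma ω_pow_congr {m n : ℕ} (h : m % 3 = n % 3) : ω ^ m = ω ^ n := by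
  rw [ω_pow_mod, h, ← ω_pow_mod]

lemma ω_pow_injective : Function.Injective fun i : Fin 3 => ω ^ (i : ℕ) := by
  have h1 : ω ≠ 1 := fun h => by
    have := congrArg re h; rw [ω_re] at this; norm_num at this
  have h2 : ω ^ 2 ≠ 1 := fun h => h1 (by
    have := ω_pow_three
    rw [pow_succ, h, one_mul] at this; exact this)
  have h3 : ω ^ 2 ≠ ω := fun h => h1 (by
    have h0 := ω_pow_ne 1
    rw [pow_one] at h0
    exact mul_left_cancel₀ h0 (by rw [← sq, h, mul_one]))
  intro i j h
  fin_cases i <;> fin_cases j <;> first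
    | rfl
    | exact absurd (by simpa using h) h1
    | exact absurd (by simpa using h.symm) h1
    | exact absurd (by simpa using h) h2
    | exact absurd (by simpa using h.symm) h2
    | exact absurd (by simpa using h) h3
    | exact absurd (by simpa using h.symm) h3

lemma add_ω_pow_ne_zero (i j : ℕ) : ω ^ i + ω ^ j ≠ 0 := fun h => by
  have h1 := congrArg (· ^ 3) (eq_neg_of_add_eq_zero_left h)
  simp only [← pow_mul, mul_comm _ 3, neg_pow (ω ^ j)] at h1
  rw [pow_mul, pow_mul, ω_pow_three, one_pow, one_pow] at h1
  norm_num at h1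

/-- The vectors glued from a pair. -/
noncomputable def gluePair (p q : E14) (j k : ℕ) : E14 := θ⁻¹ • (ω ^ j • p + ω ^ k • q)

lemma gluePair_congr (p q : E14) {j k j' k' : ℕ} (hj : j % 3 = j' % 3) (hk : k % 3 = k' % 3) :
    gluePair p q j k = gluePair p q j' k' := by
  rw [gluePair, gluePair, ω_pow_congr hj, ω_pow_congr hk]

lemma gluePair_zero (s s' : E14) (j : ℕ) :
    gluePair (s - ω ^ 2 • s') (ω • s' - s) j j = ω ^ j • s' := by
  rw [gluePair, inv_smul_eq_iff₀ θ_ne, θ_eq]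
  module

lemma gluePair_one (s s' : E14) (j : ℕ) :
    gluePair (s - ω ^ 2 • s') (ω • s' - s) j (j + 1) = ω ^ (j + 2) • s := by
  rw [gluePair, inv_smul_eq_iff₀ θ_ne, θ_eq]
  match_scalars <;> grind [ω_sq]

lemma gluePair_two (s s' : E14) (j : ℕ) :
    gluePair (s - ω ^ 2 • s') (ω • s' - s) j (j + 2) = ω ^ (j + 1) • (-s - s') := by
  rw [gluePair, inv_smul_eq_iff₀ θ_ne, θ_eq]
  match_scalars <;> grind [ω_sq]

lemma inner_gluePair {p q : E14} (hp : inner ℂ p p = (3 : ℂ)) (hq : inner ℂ q q = (3 : ℂ))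
    (hpq : inner ℂ p q = (0 : ℂ)) (j k j' k' : ℕ) :
    inner ℂ (gluePair p q j k) (gluePair p q j' k') = ω ^ (2 * j + j') + ω ^ (2 * k + k') := by
  have hc : (starRingEnd ℂ) θ⁻¹ * θ⁻¹ = 1 / 3 := by
    rw [map_inv₀, conj_θ, ← mul_inv, neg_mul, ← sq, θ_sq]; norm_num
  simp only [gluePair, inner_smul_left, inner_smul_right, inner_add_left, inner_add_right, hp, hq,
    hpq, inner_eq_zero_symm.1 hpq, map_pow, conj_ω']
  linear_combination (3 * (ω ^ 2) ^ j * ω ^ j' + 3 * (ω ^ 2) ^ k * ω ^ k') * hc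

namespace Tet

lemma exists_partner (h : GoodLat L X) (T : Tet X e s) : ∃ s', Tet X e s' ∧ inner ℂ s s' = -1 ∧
    Tet X e (-s - s') ∧ ∀ u, Tet X e u → inner ℂ s u = -1 → u = s' ∨ u = -s - s' := by
  classical
  have hc := h.card_neighbours T
  have hmem (u : E14) : u ∈ (GoodLat.short X e).filter (fun u => inner ℂ s u = -1) ↔
      Tet X e u ∧ inner ℂ s u = -1 := by
    rw [Finset.mem_filter, h.mem_short T.norm_e T.mem_zero]
  obtain ⟨s', hs'⟩ := Finset.card_pos.1 (hc ▸ two_pos)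
  obtain ⟨T', h1⟩ := (hmem _).1 hs'
  have T'' : Tet X e (-s - s') := by
    have h1' : inner ℂ s' s = -1 := by rw [← inner_conj_symm, h1]; simp
    refine Tet.of_mem h T.norm_e T.mem_zero ?_ ((h.mem_X _).2 ⟨?_, ?_⟩)
    · rw [inner_sub_right, inner_neg_right, T.orth, T'.orth]; simp
    · have : e + (-s - s') = -(e + s) - (e + s') + (-θ) • θ • e := by
        match_scalars <;> grind [θ_sq]
      rw [this]
      exact add_mem (sub_mem (neg_mem (h.mem_of_X T.mem_three)) (h.mem_of_X T'.mem_three))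
        (h.smul_mem _ (neg_mem θ_mem) _ (h.mem_of_X T.mem_zero))
    · have h3 : inner ℂ (e + (-s - s')) (e + (-s - s')) = (3 : ℂ) := by
        simp only [inner_add_left, inner_add_right, inner_sub_left, inner_sub_right,
          inner_neg_left, inner_neg_right, T.inner_ee, T.inner_ss, T'.inner_ss, T.orth, T'.orth,
          T.orth', T'.orth', h1, h1']
        norm_num
      rw [inner_self_ofReal] at h3
      exact_mod_cast h3
  have h2 : inner ℂ s (-s - s') = -1 := by
    rw [inner_sub_right, inner_neg_right, T.inner_ss, h1]; norm_num
  have hne : s' ≠ -s - s' := fun heq => by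
    have h4 : inner ℂ s' s' = (-1 : ℂ) := by
      have h5 := congrArg (inner ℂ s') heq
      rw [inner_sub_right, inner_neg_right, T'.inner_ss, ← inner_conj_symm, h1] at h5
      norm_num at h5
    rw [T'.inner_ss] at h4
    norm_num at h4
  refine ⟨s', T', h1, T'', fun u Tu hu => ?_⟩
  have hpair : (GoodLat.short X e).filter (fun u => inner ℂ s u = -1) = {s', -s - s'} := by
    refine (Finset.eq_of_subset_of_card_le ?_ ?_).symm
    · intro x hx
      simp only [Finset.mem_insert, Finset.mem_singleton] at hx
      rcases hx with rfl | rfl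
      · exact hs'
      · exact (hmem _).2 ⟨T'', h2⟩
    · rw [hc, Finset.card_pair hne]
  have := (hmem u).2 ⟨Tu, hu⟩
  rw [hpair] at this
  simpa using this

/-- The short vectors not orthogonal to a given one are glued from an orthogonal pair. -/
lemma exists_pair (h : GoodLat L X) (T : Tet X e s) : ∃ s', Tet X e s' ∧ inner ℂ s s' = -1 ∧
    ∀ u, (Tet X e u ∧ inner ℂ s u ≠ 0) ↔
      ∃ j k, u = gluePair (s - ω ^ 2 • s') (ω • s' - s) j k := by
  obtain ⟨s', T', h1, T'', hall⟩ := T.exists_partner h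
  refine ⟨s', T', h1, fun u => ⟨?_, ?_⟩⟩
  · rintro ⟨Tu, hu⟩
    rcases T.trichotomy h Tu with h0 | ⟨i, hi⟩ | ⟨i, rfl⟩
    · exact absurd h0 hu
    · have h3 : ω ^ i * ω ^ (2 * i) = 1 := by
        rw [← pow_add, show i + 2 * i = 3 * i by ring, pow_mul, ω_pow_three, one_pow]
      have h4 := hall (ω ^ (2 * i) • u) (Tu.rot_pow _) (by
        rw [inner_smul_right, hi]; linear_combination -h3)
      have h5 : u = ω ^ i • ω ^ (2 * i) • u := by rw [smul_smul, h3, one_smul]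
      rcases h4 with h4 | h4
      · exact ⟨i, i, by rw [gluePair_zero, ← h4, ← h5]⟩
      · refine ⟨i + 2, i + 2 + 2, ?_⟩
        rw [gluePair_two, ← h4, ω_pow_congr (show (i + 2 + 1) % 3 = i % 3 by omega), ← h5]
    · exact ⟨i + 1, i + 1 + 1, by
        rw [gluePair_one, ω_pow_congr (show (i + 1 + 2) % 3 = i % 3 by omega)]⟩
  · rintro ⟨j, k, rfl⟩
    have hr : (k + 2 * j) % 3 = 0 ∨ (k + 2 * j) % 3 = 1 ∨ (k + 2 * j) % 3 = 2 := by omega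
    rcases hr with hr | hr | hr
    · rw [gluePair_congr _ _ rfl (show k % 3 = j % 3 by omega), gluePair_zero, inner_smul_right, h1]
      exact ⟨T'.rot_pow j, mul_ne_zero (ω_pow_ne _) (by norm_num)⟩
    · rw [gluePair_congr _ _ rfl (show k % 3 = (j + 1) % 3 by omega), gluePair_one,
        inner_smul_right, T.inner_ss]
      exact ⟨T.rot_pow _, mul_ne_zero (ω_pow_ne _) two_ne_zero⟩
    · rw [gluePair_congr _ _ rfl (show k % 3 = (j + 2) % 3 by omega), gluePair_two,
        inner_smul_right, inner_sub_right, inner_neg_right, T.inner_ss, h1]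
      exact ⟨T''.rot_pow _, mul_ne_zero (ω_pow_ne _) (by norm_num)⟩

section Pair

variable (T : Tet X e s) (T' : Tet X e s') (h1 : inner ℂ s s' = -1)
include T T' h1

lemma inner_pair : inner ℂ (s - ω ^ 2 • s') (s - ω ^ 2 • s') = (3 : ℂ) ∧
    inner ℂ (ω • s' - s) (ω • s' - s) = (3 : ℂ) ∧
    inner ℂ (s - ω ^ 2 • s') (ω • s' - s) = (0 : ℂ) := by
  have h1' : inner ℂ s' s = -1 := by rw [← inner_conj_symm, h1]; simp
  simp only [inner_sub_left, inner_sub_right, inner_smul_left, inner_smul_right, T.inner_ss,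
    T'.inner_ss, h1, h1', map_pow, conj_ω']
  refine ⟨?_, ?_, ?_⟩ <;> grind [ω_sq]

lemma card_nonorth (h : GoodLat L X) (hall : ∀ u, (Tet X e u ∧ inner ℂ s u ≠ 0) ↔
      ∃ j k, u = gluePair (s - ω ^ 2 • s') (ω • s' - s) j k) :
    open Classical in ((GoodLat.short X e).filter fun u => inner ℂ s u ≠ 0).card = 9 := by
  classical
  obtain ⟨hp, hq, hpq⟩ := inner_pair T T' h1
  have : ((GoodLat.short X e).filter fun u => inner ℂ s u ≠ 0) =
      (Finset.univ : Finset (Fin 3 × Fin 3)).image fun jk =>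
        gluePair (s - ω ^ 2 • s') (ω • s' - s) jk.1 jk.2 := by
    ext u
    rw [Finset.mem_filter, h.mem_short T.norm_e T.mem_zero, hall]
    simp only [Finset.mem_image, Finset.mem_univ, true_and, Prod.exists]
    constructor
    · rintro ⟨j, k, rfl⟩
      exact ⟨⟨j % 3, Nat.mod_lt _ (by norm_num)⟩, ⟨k % 3, Nat.mod_lt _ (by norm_num)⟩,
        gluePair_congr _ _ (by simp) (by simp)⟩
    · rintro ⟨j, k, rfl⟩
      exact ⟨j, k, rfl⟩
  rw [this, Finset.card_image_of_injective]
  · simp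
  · rintro ⟨j, k⟩ ⟨j', k'⟩ heq
    simp only [gluePair] at heq
    have heq := smul_right_injective E14 (inv_ne_zero θ_ne) heq
    have e1 := congrArg (inner ℂ (s - ω ^ 2 • s')) heq
    have e2 := congrArg (inner ℂ (ω • s' - s)) heq
    simp only [inner_add_right, inner_smul_right, hp, hq, hpq, inner_eq_zero_symm.1 hpq] at e1 e2
    have h3 : (3 : ℂ) ≠ 0 := by norm_num
    refine Prod.ext (ω_pow_injective ?_) (ω_pow_injective ?_)
    · exact mul_right_cancel₀ h3 (by linear_combination e1)
    · exact mul_right_cancel₀ h3 (by linear_combination e2)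

end Pair

lemma nonorth_trans (h : GoodLat L X) {u t : E14} (T : Tet X e s) (Tu : Tet X e u)
    (Tt : Tet X e t) (hu : inner ℂ s u ≠ 0) (ht : inner ℂ s t ≠ 0) : inner ℂ u t ≠ 0 := by
  obtain ⟨s', T', h1, hall⟩ := T.exists_pair h
  obtain ⟨hp, hq, hpq⟩ := inner_pair T T' h1
  obtain ⟨j, k, rfl⟩ := (hall u).1 ⟨Tu, hu⟩
  obtain ⟨j', k', rfl⟩ := (hall t).1 ⟨Tt, ht⟩
  rw [inner_gluePair hp hq hpq]
  exact add_ω_pow_ne_zero _ _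

end Tet

lemma GoodLat.exists_reps (h : GoodLat L X) (he : ‖e‖ ^ 2 = 1) (hv : θ • e ∈ X) :
    ∃ r : Fin 6 → E14, (∀ i, Tet X e (r i)) ∧ (∀ i j, i ≠ j → ∀ u t, Tet X e u → Tet X e t →
      inner ℂ (r i) u ≠ 0 → inner ℂ (r j) t ≠ 0 → inner ℂ u t = 0) ∧
      ∀ u, Tet X e u → ∃ i, inner ℂ (r i) u ≠ 0 := by
  classical
  have hm (a : ↥(GoodLat.short X e)) : Tet X e a := (h.mem_short he hv).1 a.2
  have symm' {a b : E14} (hab : inner ℂ a b ≠ 0) : inner ℂ b a ≠ 0 := fun h0 =>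
    hab (inner_eq_zero_symm.1 h0)
  let S : Setoid ↥(GoodLat.short X e) :=
    { r := fun a b => inner ℂ (a : E14) (b : E14) ≠ 0
      iseqv := ⟨fun a => by rw [(hm a).inner_ss]; norm_num, symm',
        fun {a b c} hab hbc => (hm b).nonorth_trans h (hm a) (hm c) (symm' hab) hbc⟩ }
  have hfib (a : ↥(GoodLat.short X e)) :
      (Finset.univ.filter fun b => (Quotient.mk S b) = Quotient.mk S a).card = 9 := by
    obtain ⟨s', T', h1, hall⟩ := (hm a).exists_pair h
    rw [← Tet.card_nonorth (hm a) T' h1 h hall]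
    refine Finset.card_bij (fun b _ => (b : E14)) ?_ ?_ ?_
    · intro b hb
      rw [Finset.mem_filter] at hb ⊢
      exact ⟨b.2, symm' (Quotient.exact hb.2)⟩
    · intro b _ c _ hbc
      exact Subtype.ext hbc
    · intro b hb
      rw [Finset.mem_filter] at hb
      exact ⟨⟨b, hb.1⟩, by
        rw [Finset.mem_filter]
        exact ⟨Finset.mem_univ _, Quotient.sound (symm' hb.2)⟩, rfl⟩
  have hcard : Fintype.card (Quotient S) = 6 := by
    have h54 : (Finset.univ : Finset ↥(GoodLat.short X e)).card = 54 := by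
      rw [Finset.card_univ, Fintype.card_coe, h.card_short hv]
    rw [Finset.card_eq_sum_card_fiberwise (f := Quotient.mk S) (t := Finset.univ)
      (fun _ _ => Finset.mem_coe.2 (Finset.mem_univ _)), Finset.sum_congr rfl (g := fun _ => 9),
      Finset.sum_const, Finset.card_univ] at h54
    · rw [smul_eq_mul] at h54; omega
    · intro q _
      induction q using Quotient.inductionOn with
      | h a => exact hfib a
  let φ := (Fintype.equivFinOfCardEq hcard).symm
  refine ⟨fun i => ((φ i).out : E14), fun i => hm _, ?_, ?_⟩
  · intro i j hij u t Tu Tt hu ht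
    by_contra hne
    have h1 : Quotient.mk S (φ i).out = Quotient.mk S ⟨u, (h.mem_short he hv).2 Tu⟩ :=
      Quotient.sound hu
    have h2 : Quotient.mk S (φ j).out = Quotient.mk S ⟨t, (h.mem_short he hv).2 Tt⟩ :=
      Quotient.sound ht
    have h3 : Quotient.mk S ⟨u, (h.mem_short he hv).2 Tu⟩ =
        Quotient.mk S ⟨t, (h.mem_short he hv).2 Tt⟩ := Quotient.sound hne
    rw [Quotient.out_eq] at h1 h2
    exact hij (φ.injective (by rw [h1, h2, h3]))
  · intro u Tu
    refine ⟨φ.symm (Quotient.mk S ⟨u, (h.mem_short he hv).2 Tu⟩), ?_⟩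
    simp only [Equiv.apply_symm_apply]
    exact Quotient.exact (s := S) (Quotient.out_eq _)

end PairSystems

section PairSystems

variable {L : AddSubgroup E14} {X : Finset E14} {e s s' v : E14}

/-- The labels of the six pairs of a frame. -/
abbrev Pr := Bool × ZMod 3

/-- Six orthogonal pairs of minimal vectors accounting for all minimal vectors having inner
product `-θ` with `v`. -/
structure PairSystem (L : AddSubgroup E14) (X : Finset E14) (v : E14)
    (w : Pr → Bool → E14) : Prop where
  mem : ∀ i b, w i b ∈ L
  orth : ∀ i b j c, inner ℂ (w i b) (w j c) = if i = j ∧ b = c then (3 : ℂ) else 0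
  orth_v : ∀ i b, inner ℂ v (w i b) = 0
  glue : ∀ i j k, θ⁻¹ • (v + ω ^ j • w i false + ω ^ k • w i true) ∈ L
  cover : ∀ x ∈ X, inner ℂ v x = -θ →
    ∃ i j k, x = θ⁻¹ • (v + ω ^ j • w i false + ω ^ k • w i true)

lemma Tet.sub_mem (h : GoodLat L X) (T : Tet X e s) (T' : Tet X e s') (i j : ℕ) :
    ω ^ i • s - ω ^ j • s' ∈ L := by
  have := _root_.sub_mem (h.mem_of_X (T.rot_pow i).mem_three) (h.mem_of_X (T'.rot_pow j).mem_three)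
  rwa [add_sub_add_left_eq_sub] at this

lemma GoodLat.exists_pairSystem (h : GoodLat L X) (hv : v ∈ X) :
    ∃ w, PairSystem L X v w := by
  obtain ⟨e, rfl⟩ : ∃ e, v = θ • e := ⟨θ⁻¹ • v, by rw [smul_inv_smul₀ θ_ne]⟩
  have he : ‖e‖ ^ 2 = 1 := by
    have := h.norm_X hv
    rw [norm_smul, mul_pow, norm_θ_sq] at this
    linarith
  obtain ⟨r₀, hr₀, hd₀, hc₀⟩ := h.exists_reps he hv
  let φ : Pr ≃ Fin 6 := Fintype.equivFinOfCardEq (by decide)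
  obtain ⟨r, hr, hd, hc⟩ : ∃ r : Pr → E14, (∀ i, Tet X e (r i)) ∧ (∀ i j, i ≠ j → ∀ u t, Tet X e u →
      Tet X e t → inner ℂ (r i) u ≠ 0 → inner ℂ (r j) t ≠ 0 → inner ℂ u t = 0) ∧
      ∀ u, Tet X e u → ∃ i, inner ℂ (r i) u ≠ 0 :=
    ⟨r₀ ∘ φ, fun i => hr₀ _, fun i j hij => hd₀ _ _ (φ.injective.ne hij), fun u hu => by
      obtain ⟨i, hi⟩ := hc₀ u hu
      exact ⟨φ.symm i, by simpa using hi⟩⟩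
  choose r' hr' h1 hall using fun i => (hr i).exists_pair h
  have hns (i : Pr) : inner ℂ (r i) (r i) ≠ 0 := by rw [(hr i).inner_ss]; norm_num
  have hns' (i : Pr) : inner ℂ (r i) (r' i) ≠ 0 := by rw [h1]; norm_num
  refine ⟨fun i b => bif b then ω • r' i - r i else r i - ω ^ 2 • r' i, ?_, ?_, ?_, ?_, ?_⟩
  · rintro i (_ | _)
    · simpa using (hr i).sub_mem h (hr' i) 0 2
    · simpa using (hr' i).sub_mem h (hr i) 1 0
  · intro i b j c
    obtain ⟨hp, hq, hpq⟩ := Tet.inner_pair (hr i) (hr' i) (h1 i)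
    have hqp := inner_eq_zero_symm.1 hpq
    by_cases hij : i = j
    · subst hij
      cases b <;> cases c <;> simp only [cond_true, cond_false, hp, hq, hpq, hqp] <;> simp
    · rw [if_neg (fun h => hij h.1)]
      have e1 := hd i j hij _ _ (hr i) (hr j) (hns i) (hns j)
      have e2 := hd i j hij _ _ (hr i) (hr' j) (hns i) (hns' j)
      have e3 := hd i j hij _ _ (hr' i) (hr j) (hns' i) (hns j)
      have e4 := hd i j hij _ _ (hr' i) (hr' j) (hns' i) (hns' j)
      cases b <;> cases c <;>
        simp [e1, e2, e3, e4]
  · intro i b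
    cases b <;>
      simp [(hr i).orth, (hr' i).orth]
  · intro i j k
    have := ((hall i _).2 ⟨j, k, rfl⟩).1.mem_three
    rw [gluePair] at this
    convert h.mem_of_X this using 1
    simp only [cond_true, cond_false, add_assoc]
    rw [smul_add, inv_smul_smul₀ θ_ne]
  · intro x hx hvx
    obtain ⟨u, rfl⟩ : ∃ u, x = e + u := ⟨x - e, by abel⟩
    have hee : inner ℂ e e = (1 : ℂ) := by rw [inner_self_ofReal, he]; norm_num
    have hu : inner ℂ e u = 0 := by
      rw [inner_smul_left, conj_θ, inner_add_right, hee] at hvx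
      have := mul_left_cancel₀ (neg_ne_zero.2 θ_ne) (hvx.trans (mul_one (-θ)).symm)
      linear_combination this
    have T := Tet.of_mem h he hv hu hx
    obtain ⟨i, hi⟩ := hc u T
    obtain ⟨j, k, hjk⟩ := (hall i u).1 ⟨T, hi⟩
    refine ⟨i, j, k, ?_⟩
    rw [hjk, gluePair]
    simp only [cond_true, cond_false, add_assoc]
    rw [smul_add _ (θ • e), inv_smul_smul₀ θ_ne]

end PairSystems

section Frames

variable {L : AddSubgroup E14} {X : Finset E14}

/-- The labels of the vectors of a frame. -/
abbrev J := Option (Option (Pr × Bool))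

/-- The label of a member of a pair. -/
abbrev pl (p : Pr) (b : Bool) : J := some (some (p, b))

/-- Fourteen orthogonal minimal vectors. -/
structure OFrame (L : AddSubgroup E14) (v : J → E14) : Prop where
  mem : ∀ j, v j ∈ L
  orth : ∀ j k, inner ℂ (v j) (v k) = if j = k then (3 : ℂ) else 0

/-- Fourteen orthogonal minimal vectors extending a system of pairs. -/
structure PreFrame (L : AddSubgroup E14) (X : Finset E14) (v : J → E14) : Prop
    extends OFrame L v where
  glue : ∀ p j k, θ⁻¹ • (v none + ω ^ j • v (pl p false) + ω ^ k • v (pl p true)) ∈ L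
  cover : ∀ x ∈ X, inner ℂ (v none) x = -θ →
    ∃ p j k, x = θ⁻¹ • (v none + ω ^ j • v (pl p false) + ω ^ k • v (pl p true))

lemma exists_mem_𝓞_norm_sub_lt (z : ℂ) : ∃ q ∈ 𝓞, ‖z - q‖ ^ 2 < 1 := by
  have h3 : Real.sqrt 3 ≠ 0 := by positivity
  obtain ⟨a, b, rfl⟩ : ∃ a b : ℝ, z = a + b * ω := by
    refine ⟨z.re + z.im / Real.sqrt 3, 2 * z.im / Real.sqrt 3, Complex.ext ?_ ?_⟩
    · rw [add_re, ofReal_re, re_ofReal_mul, ω_re]; ring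
    · rw [add_im, ofReal_im, im_ofReal_mul, ω_im]; field_simp; ring
  refine ⟨round a + round b * ω, mem_𝓞_iff.2 ⟨_, _, rfl⟩, ?_⟩
  have hn (x y : ℝ) : ‖(x + y * ω : ℂ)‖ ^ 2 = x ^ 2 - x * y + y ^ 2 := by
    have : ((‖(x + y * ω : ℂ)‖ ^ 2 : ℝ) : ℂ) = ((x ^ 2 - x * y + y ^ 2 : ℝ) : ℂ) := by
      rw [← normSq_eisenstein, conj_mul']; push_cast; rfl
    exact_mod_cast this
  have h1 := abs_sub_round a
  have h2 := abs_sub_round b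
  have : (a + b * ω - (round a + round b * ω) : ℂ) =
      ((a - round a : ℝ) : ℂ) + ((b - round b : ℝ) : ℂ) * ω := by push_cast; ring
  rw [this, hn]
  rw [abs_le] at h1 h2
  nlinarith [mul_nonneg (sub_nonneg.2 h1.1) (sub_nonneg.2 h2.1), mul_nonneg (sub_nonneg.2 h1.2)
    (sub_nonneg.2 h2.2), sq_nonneg (a - round a), sq_nonneg (b - round b),
    sq_nonneg (a - round a + (b - round b)), sq_nonneg (a - round a - (b - round b))]

end Frames

section FrameExpansion

variable {v : J → E14}

lemma card_J : Fintype.card J = 14 := by decide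

lemma exists_orthonormalBasis_of_gram
    (hv : ∀ j k, inner ℂ (v j) (v k) = if j = k then (3 : ℂ) else 0) :
    ∃ b : OrthonormalBasis J ℂ E14, ∀ j, v j = (Real.sqrt 3 : ℂ) • b j := by
  have h3 : (Real.sqrt 3 : ℂ) ≠ 0 := by
    rw [ofReal_ne_zero]; positivity
  have hon : Orthonormal ℂ fun j => (Real.sqrt 3 : ℂ)⁻¹ • v j := by
    rw [orthonormal_iff_ite]
    intro i j
    rw [inner_smul_left, inner_smul_right, hv, map_inv₀, conj_ofReal]
    split_ifs
    · field_simp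
      rw [sqrt_three_sq']
    · simp
  have hspan := hon.linearIndependent.span_eq_top_of_card_eq_finrank (by
    rw [card_J, finrank_euclideanSpace_fin])
  refine ⟨OrthonormalBasis.mk hon hspan.ge, fun j => ?_⟩
  rw [OrthonormalBasis.coe_mk, smul_inv_smul₀ h3]

variable (hv : ∀ j k, inner ℂ (v j) (v k) = if j = k then (3 : ℂ) else 0)
include hv

lemma inner_eq_sum_of_gram (x y : E14) :
    inner ℂ x y = (∑ j, (starRingEnd ℂ) (inner ℂ (v j) x) * inner ℂ (v j) y) / 3 := by
  obtain ⟨b, hb⟩ := exists_orthonormalBasis_of_gram hv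
  rw [← b.sum_inner_mul_inner, Finset.sum_div]
  refine Finset.sum_congr rfl fun j _ => ?_
  have h3 := sqrt_three_sq'
  rw [hb, inner_smul_left, inner_smul_left, map_mul, conj_ofReal, conj_ofReal, inner_conj_symm]
  linear_combination (-inner ℂ x (b j) * inner ℂ (b j) y / 3) * h3

lemma eq_sum_of_gram (x : E14) : x = ∑ j, (inner ℂ (v j) x / 3) • v j := by
  refine ext_inner_right ℂ fun y => ?_
  rw [inner_eq_sum_of_gram hv, sum_inner, Finset.sum_div]
  refine Finset.sum_congr rfl fun j _ => ?_
  rw [inner_smul_left, map_div₀, map_ofNat]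
  ring

end FrameExpansion

section Complement

variable {L : AddSubgroup E14} {X : Finset E14} {v : E14} {w : Pr → Bool → E14}

lemma exists_preFrame (h : GoodLat L X) (hvX : v ∈ X) (hw : PairSystem L X v w) :
    ∃ f : E14, PreFrame L X (fun j => j.elim v fun k => k.elim f fun p => w p.1 p.2) := by
  obtain ⟨u, hu, hvu, hwu⟩ : ∃ u : E14, ‖u‖ = 1 ∧ inner ℂ v u = 0 ∧ ∀ p b, inner ℂ (w p b) u = 0 := by
    let φ : E14 →ₗ[ℂ] (Option (Pr × Bool) → ℂ) := LinearMap.pi fun j =>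
      (innerSL ℂ (j.elim v fun p => w p.1 p.2)).toLinearMap
    have hk : LinearMap.ker φ ≠ ⊥ := LinearMap.ker_ne_bot_of_finrank_lt (by
      rw [finrank_euclideanSpace_fin, Module.finrank_fintype_fun_eq_card]
      decide)
    obtain ⟨u, hu, hu0⟩ := Submodule.exists_mem_ne_zero_of_ne_bot hk
    have hφ (j : Option (Pr × Bool)) : inner ℂ (j.elim v fun p => w p.1 p.2) u = 0 := congrFun (LinearMap.mem_ker.1 hu) j
    refine ⟨((‖u‖ : ℂ)⁻¹) • u, norm_smul_inv_norm hu0, ?_, fun p b => ?_⟩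
    · rw [inner_smul_right, show inner ℂ v u = 0 from hφ none, mul_zero]
    · rw [inner_smul_right, show inner ℂ (w p b) u = 0 from hφ (some (p, b)), mul_zero]
  have huu : inner ℂ u u = (1 : ℂ) := by rw [inner_self_ofReal, hu]; norm_num
  have hvv : inner ℂ v v = (3 : ℂ) := by rw [inner_self_ofReal, h.norm_X hvX]; norm_num
  have hvL := h.mem_of_X hvX
  have gram {g : E14} (hg : ∃ c : ℂ, ‖c‖ ^ 2 = 3 ∧ g = c • u) (j k : J) :
      inner ℂ (j.elim v fun k => k.elim g fun p => w p.1 p.2 : E14)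
        (k.elim v fun k => k.elim g fun p => w p.1 p.2 : E14) = if j = k then (3 : ℂ) else 0 := by
    obtain ⟨c, hc, rfl⟩ := hg
    have hcc : c * (starRingEnd ℂ) c = 3 := by rw [mul_comm, conj_mul', ← ofReal_pow, hc]; norm_num
    rcases j with _ | _ | ⟨p, b⟩ <;> rcases k with _ | _ | ⟨q, b'⟩ <;>
      simp only [Option.elim_none, Option.elim_some, inner_smul_left, inner_smul_right, hvu, hwu,
        inner_eq_zero_symm.1 hvu, inner_eq_zero_symm.1 (hwu _ _), hvv, huu, hw.orth, hw.orth_v,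
        inner_eq_zero_symm.1 (hw.orth_v _ _), mul_zero, mul_one, hcc] <;> simp
  have hsqrt : ‖(Real.sqrt 3 : ℂ)‖ ^ 2 = 3 := by
    rw [norm_real, Real.norm_eq_abs, sq_abs, Real.sq_sqrt (by norm_num)]
  have hproj (x : E14) (hx : x ∈ L) : (3 * inner ℂ u x) • u ∈ L := by
    have h1 := eq_sum_of_gram (gram ⟨_, hsqrt, rfl⟩) x
    rw [Fintype.sum_option, Fintype.sum_option] at h1
    simp only [Option.elim_none, Option.elim_some] at h1
    have h3 := congrArg ((3 : ℂ) • ·) h1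
    simp only [smul_add, Finset.smul_sum, smul_smul, mul_div_cancel₀ _ (three_ne_zero' ℂ),
      inner_smul_left, conj_ofReal] at h3
    have h4 : (3 * inner ℂ u x) • u = (3 : ℂ) • x - (inner ℂ v x) • v -
        ∑ p : Pr × Bool, (inner ℂ (w p.1 p.2) x) • w p.1 p.2 := by
      rw [h3, show (3 * (Real.sqrt 3 * inner ℂ u x / 3 * Real.sqrt 3) : ℂ) = 3 * inner ℂ u x by
        linear_combination inner ℂ u x * sqrt_three_sq']
      abel
    rw [h4]
    refine _root_.sub_mem (_root_.sub_mem (h.smul_mem 3 (by exact_mod_cast intCast_mem_𝓞 3) _ hx)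
      (h.smul_mem _ (h.inner_mem hvL hx) _ hvL)) (sum_mem fun p _ => ?_)
    exact h.smul_mem _ (h.inner_mem (hw.mem _ _) hx) _ (hw.mem _ _)
  have hnorm (c : ℂ) : ‖c • u‖ ^ 2 = ‖c‖ ^ 2 := by rw [norm_smul, hu, mul_one]
  have hne : u ≠ 0 := fun h0 => by rw [h0, norm_zero] at hu; norm_num at hu
  obtain ⟨x₀, hx₀, hux₀⟩ : ∃ x ∈ L, inner ℂ u x ≠ 0 := by
    by_contra! hall
    have hL : (1 / 2 : ℂ) • u ∈ L := (h.dual _).2 fun y hy => by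
      rw [inner_smul_left, hall y hy, mul_zero]; exact zero_mem _
    have := h.min _ hL (smul_ne_zero (by norm_num) hne)
    rw [hnorm] at this
    norm_num at this
  have hex : ∃ n : ℕ, ∃ c : ℂ, c ≠ 0 ∧ c • u ∈ L ∧ ‖c‖ ^ 2 = n := by
    have hL := hproj x₀ hx₀
    obtain ⟨k, hk⟩ := exists_int_of_mem_𝓞 (h.inner_mem hL hL) (by
      rw [inner_self_ofReal, ofReal_im])
    rw [inner_self_ofReal, hnorm] at hk
    have hk' : ‖(3 * inner ℂ u x₀ : ℂ)‖ ^ 2 = k := by exact_mod_cast hk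
    have hk0 : 0 ≤ k := by
      have : (0 : ℝ) ≤ k := hk' ▸ sq_nonneg _
      exact_mod_cast this
    lift k to ℕ using hk0
    exact ⟨k, _, mul_ne_zero three_ne_zero hux₀, hL, by rw [hk']; simp⟩
  classical
  obtain ⟨c₀, hc₀, hcL, hcn⟩ := Nat.find_spec hex
  have hmin (c : ℂ) (hc : c • u ∈ L) (hlt : ‖c‖ ^ 2 < ‖c₀‖ ^ 2) : c = 0 := by
    by_contra hc0
    obtain ⟨k, hk⟩ := exists_int_of_mem_𝓞 (h.inner_mem hc hc) (by
      rw [inner_self_ofReal, ofReal_im])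
    rw [inner_self_ofReal, hnorm] at hk
    have hk' : ‖c‖ ^ 2 = k := by exact_mod_cast hk
    have hk0 : 0 ≤ k := by
      have : (0 : ℝ) ≤ k := hk' ▸ sq_nonneg _
      exact_mod_cast this
    lift k to ℕ using hk0
    rw [Int.cast_natCast] at hk'
    rw [hcn, hk'] at hlt
    exact Nat.find_min hex (by exact_mod_cast hlt) ⟨c, hc0, hc, hk'⟩
  have hpos : 0 < ‖c₀‖ ^ 2 := by positivity
  have hge := h.min _ hcL (smul_ne_zero hc₀ hne)
  rw [hnorm] at hge
  have hgen (c : ℂ) (hc : c • u ∈ L) : ∃ z ∈ 𝓞, c = z * c₀ := by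
    obtain ⟨q, hq, hlt⟩ := exists_mem_𝓞_norm_sub_lt (c / c₀)
    refine ⟨q, hq, ?_⟩
    have h1 : c - q * c₀ = (c / c₀ - q) * c₀ := by field_simp
    have := hmin (c - q * c₀) (by
      rw [sub_smul, mul_smul]
      exact _root_.sub_mem hc (h.smul_mem q hq _ hcL)) (by
        rw [h1, norm_mul, mul_pow]; nlinarith)
    linear_combination this
  have hcc : (starRingEnd ℂ) c₀ * c₀ = ((‖c₀‖ ^ 2 : ℝ) : ℂ) := by rw [conj_mul']; push_cast; rfl
  have hdual : ((3 / ‖c₀‖ ^ 2 : ℝ) * c₀ : ℂ) • u ∈ L := (h.dual _).2 fun x hx => by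
    obtain ⟨z, hz, hzc⟩ := hgen _ (hproj x hx)
    convert hz using 1
    have h0 : ((‖c₀‖ ^ 2 : ℝ) : ℂ) ≠ 0 := by exact_mod_cast hpos.ne'
    rw [inner_smul_left, map_mul, conj_ofReal, ofReal_div]
    field_simp
    rw [← hcc]
    push_cast
    linear_combination (starRingEnd ℂ) c₀ * hzc
  have hle := h.min _ hdual (smul_ne_zero (mul_ne_zero (by
    rw [ofReal_ne_zero]; positivity) hc₀) hne)
  rw [hnorm, norm_mul, mul_pow, norm_real, Real.norm_eq_abs, sq_abs] at hle
  have h3 : ‖c₀‖ ^ 2 = 3 := by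
    refine le_antisymm ?_ hge
    have : (3 / ‖c₀‖ ^ 2) ^ 2 * ‖c₀‖ ^ 2 = 9 / ‖c₀‖ ^ 2 := by field_simp; norm_num
    rw [this, le_div_iff₀ hpos] at hle
    linarith
  refine ⟨c₀ • u, ⟨?_, gram ⟨c₀, h3, rfl⟩⟩, fun p j k => hw.glue p j k, fun x hx hvx => hw.cover x hx hvx⟩
  rintro (_ | _ | p)
  exacts [hvL, hcL, hw.mem _ _]

end Complement

section Residues

lemma sum_mem_𝓞 {ι : Type*} {s : Finset ι} {f : ι → ℂ} (h : ∀ i ∈ s, f i ∈ 𝓞) : ∑ i ∈ s, f i ∈ 𝓞 :=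
  sum_mem h

/-- The coordinate at `ω` of an Eisenstein integer. -/
noncomputable def ωCoord (z : ℂ) : ℤ := ⌊2 * z.im / Real.sqrt 3⌋

/-- The coordinate at `1` of an Eisenstein integer. -/
noncomputable def oneCoord (z : ℂ) : ℤ := ⌊z.re + z.im / Real.sqrt 3⌋

/-- The residue modulo `θ` of an Eisenstein integer. -/
noncomputable def cc (z : ℂ) : ZMod 3 := ((oneCoord z + ωCoord z : ℤ) : ZMod 3)

/-- The coordinate at `θ` modulo `3` of an Eisenstein integer. -/
noncomputable def uu (z : ℂ) : ZMod 3 := ((-ωCoord z : ℤ) : ZMod 3)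

lemma ωCoord_add_mul_ω (a b : ℤ) : ωCoord (a + b * ω) = b := by
  have h3 : Real.sqrt 3 ≠ 0 := by positivity
  rw [ωCoord, add_im, intCast_im, mul_im, intCast_im, intCast_re, zero_mul, add_zero, ω_im,
    zero_add, show 2 * ((b : ℝ) * (Real.sqrt 3 / 2)) / Real.sqrt 3 = b by field_simp, Int.floor_intCast]

lemma oneCoord_add_mul_ω (a b : ℤ) : oneCoord (a + b * ω) = a := by
  have h3 : Real.sqrt 3 ≠ 0 := by positivity
  rw [oneCoord, add_im, add_re, intCast_im, intCast_re, mul_im, mul_re, intCast_im, intCast_re, ω_im,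
    ω_re, show (a : ℝ) + (b * (-1 / 2) - 0 * (Real.sqrt 3 / 2)) +
      (0 + (b * (Real.sqrt 3 / 2) + 0 * (-1 / 2))) / Real.sqrt 3 = a by field_simp; ring,
    Int.floor_intCast]

lemma cc_add_mul_ω (a b : ℤ) : cc (a + b * ω) = a + b := by
  rw [cc, oneCoord_add_mul_ω, ωCoord_add_mul_ω]; push_cast; rfl

lemma uu_add_mul_ω (a b : ℤ) : uu (a + b * ω) = -b := by
  rw [uu, ωCoord_add_mul_ω]; push_cast; rfl

variable {z w : ℂ}

lemma cc_add (hz : z ∈ 𝓞) (hw : w ∈ 𝓞) : cc (z + w) = cc z + cc w := by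
  obtain ⟨a, b, rfl⟩ := mem_𝓞_iff.1 hz
  obtain ⟨c, d, rfl⟩ := mem_𝓞_iff.1 hw
  rw [show (a + b * ω + (c + d * ω) : ℂ) = ((a + c : ℤ) : ℂ) + ((b + d : ℤ) : ℂ) * ω by
    push_cast; ring, cc_add_mul_ω, cc_add_mul_ω, cc_add_mul_ω]
  push_cast; ring

lemma uu_add (hz : z ∈ 𝓞) (hw : w ∈ 𝓞) : uu (z + w) = uu z + uu w := by
  obtain ⟨a, b, rfl⟩ := mem_𝓞_iff.1 hz
  obtain ⟨c, d, rfl⟩ := mem_𝓞_iff.1 hw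
  rw [show (a + b * ω + (c + d * ω) : ℂ) = ((a + c : ℤ) : ℂ) + ((b + d : ℤ) : ℂ) * ω by
    push_cast; ring, uu_add_mul_ω, uu_add_mul_ω, uu_add_mul_ω]
  push_cast; ring

lemma mul_add_mul_ω (a b c d : ℤ) : ((a + b * ω) * (c + d * ω) : ℂ) =
    ((a * c - b * d : ℤ) : ℂ) + ((a * d + b * c - b * d : ℤ) : ℂ) * ω := by
  push_cast; linear_combination (b * d : ℂ) * ω_sq

lemma three_eq_zero : (3 : ZMod 3) = 0 := by decide

lemma cc_mul (hz : z ∈ 𝓞) (hw : w ∈ 𝓞) : cc (z * w) = cc z * cc w := by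
  obtain ⟨a, b, rfl⟩ := mem_𝓞_iff.1 hz
  obtain ⟨c, d, rfl⟩ := mem_𝓞_iff.1 hw
  rw [mul_add_mul_ω, cc_add_mul_ω, cc_add_mul_ω, cc_add_mul_ω]
  push_cast
  linear_combination (-b * d : ZMod 3) * three_eq_zero

lemma uu_mul (hz : z ∈ 𝓞) (hw : w ∈ 𝓞) : uu (z * w) = cc z * uu w + uu z * cc w := by
  obtain ⟨a, b, rfl⟩ := mem_𝓞_iff.1 hz
  obtain ⟨c, d, rfl⟩ := mem_𝓞_iff.1 hw
  rw [mul_add_mul_ω, cc_add_mul_ω, cc_add_mul_ω, uu_add_mul_ω, uu_add_mul_ω, uu_add_mul_ω]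
  push_cast
  linear_combination (b * d : ZMod 3) * three_eq_zero

lemma conj_add_mul_ω (a b : ℤ) :
    (starRingEnd ℂ) (a + b * ω) = ((a - b : ℤ) : ℂ) + ((-b : ℤ) : ℂ) * ω := by
  rw [map_add, map_mul, conj_ω]; simp; ring

lemma cc_conj (hz : z ∈ 𝓞) : cc ((starRingEnd ℂ) z) = cc z := by
  obtain ⟨a, b, rfl⟩ := mem_𝓞_iff.1 hz
  rw [conj_add_mul_ω, cc_add_mul_ω, cc_add_mul_ω]
  push_cast
  linear_combination (-b : ZMod 3) * three_eq_zero

lemma uu_conj (hz : z ∈ 𝓞) : uu ((starRingEnd ℂ) z) = -uu z := by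
  obtain ⟨a, b, rfl⟩ := mem_𝓞_iff.1 hz
  rw [conj_add_mul_ω, uu_add_mul_ω, uu_add_mul_ω]
  push_cast; ring

lemma cc_intCast (k : ℤ) : cc k = k := by simpa using cc_add_mul_ω k 0
lemma uu_intCast (k : ℤ) : uu k = 0 := by simpa using uu_add_mul_ω k 0
lemma cc_zero : cc 0 = 0 := by simpa using cc_intCast 0
lemma uu_zero : uu 0 = 0 := by simpa using uu_intCast 0
lemma cc_one : cc 1 = 1 := by simpa using cc_intCast 1
lemma uu_one : uu 1 = 0 := by simpa using uu_intCast 1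
lemma cc_ω : cc ω = 1 := by simpa using cc_add_mul_ω 0 1
lemma uu_ω : uu ω = -1 := by simpa using uu_add_mul_ω 0 1
lemma cc_θ : cc θ = 0 := by
  rw [show θ = ((1 : ℤ) : ℂ) + ((2 : ℤ) : ℂ) * ω by rw [θ]; push_cast; ring, cc_add_mul_ω]; decide
lemma uu_θ : uu θ = 1 := by
  rw [show θ = ((1 : ℤ) : ℂ) + ((2 : ℤ) : ℂ) * ω by rw [θ]; push_cast; ring, uu_add_mul_ω]; decide

lemma neg_eq_neg_one_mul' (z : ℂ) : -z = ((-1 : ℤ) : ℂ) * z := by push_cast; ring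

lemma cc_neg (hz : z ∈ 𝓞) : cc (-z) = -cc z := by
  rw [neg_eq_neg_one_mul', cc_mul (intCast_mem_𝓞 _) hz, cc_intCast]; push_cast; ring

lemma uu_neg (hz : z ∈ 𝓞) : uu (-z) = -uu z := by
  rw [neg_eq_neg_one_mul', uu_mul (intCast_mem_𝓞 _) hz, cc_intCast, uu_intCast]; push_cast; ring

lemma ω_pow_mem (n : ℕ) : ω ^ n ∈ 𝓞 := pow_mem ω_mem n

lemma cc_ω_pow (n : ℕ) : cc (ω ^ n) = 1 := by
  induction n with
  | zero => rw [pow_zero, cc_one]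
  | succ n ih => rw [pow_succ, cc_mul (ω_pow_mem n) ω_mem, ih, cc_ω, mul_one]

lemma uu_ω_pow (n : ℕ) : uu (ω ^ n) = -n := by
  induction n with
  | zero => rw [pow_zero, uu_one]; simp
  | succ n ih =>
    rw [pow_succ, uu_mul (ω_pow_mem n) ω_mem, ih, cc_ω, cc_ω_pow, uu_ω]; push_cast; ring

lemma cc_sum {ι : Type*} {s : Finset ι} {f : ι → ℂ} (h : ∀ i ∈ s, f i ∈ 𝓞) :
    cc (∑ i ∈ s, f i) = ∑ i ∈ s, cc (f i) := by
  classical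
  induction s using Finset.induction_on with
  | empty => simp [cc_zero]
  | insert a s ha ih =>
    have hs : ∀ i ∈ s, f i ∈ 𝓞 := fun i hi => h i (Finset.mem_insert_of_mem hi)
    rw [Finset.sum_insert ha, Finset.sum_insert ha,
      cc_add (h a (Finset.mem_insert_self _ _)) (sum_mem_𝓞 hs), ih hs]

lemma uu_sum {ι : Type*} {s : Finset ι} {f : ι → ℂ} (h : ∀ i ∈ s, f i ∈ 𝓞) :
    uu (∑ i ∈ s, f i) = ∑ i ∈ s, uu (f i) := by
  classical
  induction s using Finset.induction_on with
  | empty => simp [uu_zero]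
  | insert a s ha ih =>
    have hs : ∀ i ∈ s, f i ∈ 𝓞 := fun i hi => h i (Finset.mem_insert_of_mem hi)
    rw [Finset.sum_insert ha, Finset.sum_insert ha,
      uu_add (h a (Finset.mem_insert_self _ _)) (sum_mem_𝓞 hs), ih hs]

lemma div_three_mem (hz : z ∈ 𝓞) (hc : cc z = 0) (hu : uu z = 0) : z / 3 ∈ 𝓞 := by
  obtain ⟨a, b, rfl⟩ := mem_𝓞_iff.1 hz
  rw [cc_add_mul_ω] at hc
  rw [uu_add_mul_ω] at hu
  have hb : ((b : ℤ) : ZMod 3) = 0 := neg_eq_zero.1 hu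
  have ha : ((a : ℤ) : ZMod 3) = 0 := by rwa [hb, add_zero] at hc
  obtain ⟨a', rfl⟩ := (ZMod.intCast_zmod_eq_zero_iff_dvd a 3).1 ha
  obtain ⟨b', rfl⟩ := (ZMod.intCast_zmod_eq_zero_iff_dvd b 3).1 hb
  refine mem_𝓞_iff.2 ⟨a', b', ?_⟩
  push_cast; ring

lemma cc_three_mul (hz : z ∈ 𝓞) : cc (3 * z) = 0 := by
  have : (3 : ℂ) = ((3 : ℤ) : ℂ) := by norm_num
  rw [this, cc_mul (intCast_mem_𝓞 3) hz, cc_intCast]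
  simp [three_eq_zero]

lemma uu_three_mul (hz : z ∈ 𝓞) : uu (3 * z) = 0 := by
  have : (3 : ℂ) = ((3 : ℤ) : ℂ) := by norm_num
  rw [this, uu_mul (intCast_mem_𝓞 3) hz, cc_intCast, uu_intCast]
  simp [three_eq_zero]

/-- The shortest Eisenstein integers with prescribed residues modulo `3`. -/
noncomputable def mlift (c u : ZMod 3) : ℂ :=
  if c = 0 then (if u = 0 then 0 else if u = 1 then θ else -θ) else
    if c = 1 then ω ^ (-u).val else -ω ^ u.val

lemma mlift_mem (c u : ZMod 3) : mlift c u ∈ 𝓞 := by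
  unfold mlift
  split_ifs
  exacts [zero_mem _, θ_mem, neg_mem θ_mem, ω_pow_mem _, neg_mem (ω_pow_mem _)]

lemma zmod3_cases (u : ZMod 3) : u = 0 ∨ u = 1 ∨ u = 2 := by revert u; decide

lemma cc_mlift (c u : ZMod 3) : cc (mlift c u) = c := by
  unfold mlift
  split_ifs with h1 h2 h3 h4
  · rw [cc_zero, h1]
  · rw [cc_θ, h1]
  · rw [cc_neg θ_mem, cc_θ, h1, neg_zero]
  · rw [cc_ω_pow, h4]
  · rw [cc_neg (ω_pow_mem _), cc_ω_pow]
    rcases zmod3_cases c with h | h | h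
    exacts [absurd h h1, absurd h h4, h ▸ by decide]

lemma uu_mlift (c u : ZMod 3) : uu (mlift c u) = u := by
  unfold mlift
  split_ifs with h1 h2 h3 h4
  · rw [uu_zero, h2]
  · rw [uu_θ, h3]
  · rw [uu_neg θ_mem, uu_θ]
    rcases zmod3_cases u with h | h | h
    exacts [absurd h h2, absurd h h3, h ▸ by decide]
  · rw [uu_ω_pow, ZMod.natCast_zmod_val, neg_neg]
  · rw [uu_neg (ω_pow_mem _), uu_ω_pow, ZMod.natCast_zmod_val, neg_neg]

/-- Three times the norm of `mlift`. -/
def mnorm (c u : ZMod 3) : ℕ := if c = 0 then (if u = 0 then 0 else 3) else 1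

lemma norm_mlift_sq (c u : ZMod 3) : ‖mlift c u‖ ^ 2 = mnorm c u := by
  have h (n : ℕ) : ‖ω ^ n‖ ^ 2 = 1 := (mem_units6.1 (ω_pow_mem_units6 n)).2
  unfold mlift mnorm
  split_ifs <;> simp only [norm_neg, norm_zero, norm_θ_sq, h] <;> norm_num

end Residues

section Code

/-- A pair of words is the reduction modulo `3` of the inner products with a lattice vector. -/
def InCode (L : AddSubgroup E14) (v : J → E14) (c u : J → ZMod 3) : Prop :=
  ∃ x ∈ L, ∀ j, cc (inner ℂ (v j) x) = c j ∧ uu (inner ℂ (v j) x) = u j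

variable {L : AddSubgroup E14} {X : Finset E14} {v : J → E14} {c u c' u' : J → ZMod 3}

namespace OFrame

variable (h : GoodLat L X) (F : OFrame L v)

section

include h F

lemma inner_mem {x : E14} (hx : x ∈ L) (j : J) : inner ℂ (v j) x ∈ 𝓞 := h.inner_mem (F.mem j) hx

lemma inCode_zero : InCode L v 0 0 := ⟨0, zero_mem _, fun j => by simp [cc_zero, uu_zero]⟩

lemma inCode_add (h1 : InCode L v c u) (h2 : InCode L v c' u') : InCode L v (c + c') (u + u') := by
  obtain ⟨x, hx, hxc⟩ := h1
  obtain ⟨y, hy, hyc⟩ := h2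
  refine ⟨x + y, add_mem hx hy, fun j => ?_⟩
  rw [inner_add_right, cc_add (F.inner_mem h hx j) (F.inner_mem h hy j),
    uu_add (F.inner_mem h hx j) (F.inner_mem h hy j), (hxc j).1, (hxc j).2, (hyc j).1, (hyc j).2]
  exact ⟨rfl, rfl⟩

lemma inCode_smul (a : ZMod 3) (h1 : InCode L v c u) : InCode L v (a • c) (a • u) := by
  have hn : InCode L v (-c) (-u) := by
    obtain ⟨x, hx, hxc⟩ := h1
    refine ⟨-x, neg_mem hx, fun j => ?_⟩
    rw [inner_neg_right, cc_neg (F.inner_mem h hx j), uu_neg (F.inner_mem h hx j), (hxc j).1,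
      (hxc j).2]
    exact ⟨rfl, rfl⟩
  rcases zmod3_cases a with rfl | rfl | rfl
  · simpa using F.inCode_zero h
  · simpa using h1
  · simpa [show (2 : ZMod 3) = -1 by decide] using hn

omit h in
lemma exists_inner_eq (y : J → ℂ) : ∃ x, ∀ j, inner ℂ (v j) x = y j := by
  refine ⟨∑ j, (y j / 3) • v j, fun j => ?_⟩
  simp only [inner_sum, inner_smul_right, F.orth]
  simp

lemma inner_mem_iff {x x' : E14} (hx : ∀ j, inner ℂ (v j) x ∈ 𝓞) (hx' : ∀ j, inner ℂ (v j) x' ∈ 𝓞) :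
    inner ℂ x x' ∈ 𝓞 ↔ ∑ j, cc (inner ℂ (v j) x) * cc (inner ℂ (v j) x') = 0 ∧
      ∑ j, (cc (inner ℂ (v j) x) * uu (inner ℂ (v j) x') -
        uu (inner ℂ (v j) x) * cc (inner ℂ (v j) x')) = 0 := by
  have hm : ∀ j ∈ Finset.univ, (starRingEnd ℂ) (inner ℂ (v j) x) * inner ℂ (v j) x' ∈ 𝓞 :=
    fun j _ => mul_mem (star_mem_𝓞 (hx j)) (hx' j)
  have e1 := cc_sum hm
  have e2 := uu_sum hm
  simp only [cc_mul (star_mem_𝓞 (hx _)) (hx' _), uu_mul (star_mem_𝓞 (hx _)) (hx' _), cc_conj (hx _),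
    uu_conj (hx _), neg_mul, ← sub_eq_add_neg] at e1 e2
  rw [inner_eq_sum_of_gram F.orth, ← e1, ← e2]
  constructor
  · intro hmem
    rw [← mul_div_cancel₀ (∑ j, (starRingEnd ℂ) (inner ℂ (v j) x) * inner ℂ (v j) x')
      (three_ne_zero' ℂ)]
    exact ⟨cc_three_mul hmem, uu_three_mul hmem⟩
  · rintro ⟨h1, h2⟩
    exact div_three_mem (sum_mem_𝓞 hm) h1 h2

lemma inCode_dual : InCode L v c u ↔ ∀ c' u', InCode L v c' u' →
    ∑ j, c j * c' j = 0 ∧ ∑ j, (c j * u' j - u j * c' j) = 0 := by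
  constructor
  · rintro ⟨x, hx, hxc⟩ c' u' ⟨x', hx', hxc'⟩
    have := (F.inner_mem_iff h (F.inner_mem h hx) (F.inner_mem h hx')).1 (h.inner_mem hx hx')
    simpa only [hxc, hxc'] using this
  · intro hd
    obtain ⟨x, hx⟩ := F.exists_inner_eq fun j => mlift (c j) (u j)
    have hx𝓞 (j) : inner ℂ (v j) x ∈ 𝓞 := hx j ▸ mlift_mem _ _
    refine ⟨x, (h.dual x).2 fun x' hx' => ?_, fun j => by rw [hx, cc_mlift, uu_mlift]; simp⟩
    rw [F.inner_mem_iff h hx𝓞 (F.inner_mem h hx')]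
    have := hd _ _ ⟨x', hx', fun j => ⟨rfl, rfl⟩⟩
    simpa only [hx, cc_mlift, uu_mlift] using this

lemma mem_iff {x : E14} : x ∈ L ↔ (∀ j, inner ℂ (v j) x ∈ 𝓞) ∧
    InCode L v (fun j => cc (inner ℂ (v j) x)) (fun j => uu (inner ℂ (v j) x)) := by
  refine ⟨fun hx => ⟨F.inner_mem h hx, x, hx, fun j => ⟨rfl, rfl⟩⟩, fun ⟨hx, hc⟩ => ?_⟩
  refine (h.dual x).2 fun x' hx' => ?_
  rw [F.inner_mem_iff h hx (F.inner_mem h hx')]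
  exact (F.inCode_dual h).1 hc _ _ ⟨x', hx', fun j => ⟨rfl, rfl⟩⟩

lemma exists_mlift (h1 : InCode L v c u) : ∃ x ∈ L, ∀ j, inner ℂ (v j) x = mlift (c j) (u j) := by
  obtain ⟨x, hx⟩ := F.exists_inner_eq fun j => mlift (c j) (u j)
  refine ⟨x, (F.mem_iff h).2 ⟨fun j => hx j ▸ mlift_mem _ _, ?_⟩, hx⟩
  simpa only [hx, cc_mlift, uu_mlift] using h1

omit h in
lemma norm_of_mlift {x : E14} (hx : ∀ j, inner ℂ (v j) x = mlift (c j) (u j)) :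
    ‖x‖ ^ 2 = ((∑ j, mnorm (c j) (u j) : ℕ) : ℝ) / 3 := by
  have h1 := inner_eq_sum_of_gram F.orth x x
  simp only [hx, conj_mul', ← ofReal_pow, norm_mlift_sq] at h1
  rw [inner_self_ofReal] at h1
  have : ((‖x‖ ^ 2 : ℝ) : ℂ) = (((∑ j, mnorm (c j) (u j) : ℕ) : ℝ) / 3 : ℝ) := by
    rw [h1]; push_cast; rfl
  exact_mod_cast this

lemma nine_le (h1 : InCode L v c u) (hne : ¬ (c = 0 ∧ u = 0)) : 9 ≤ ∑ j, mnorm (c j) (u j) := by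
  obtain ⟨x, hx, hxm⟩ := F.exists_mlift h h1
  have hx0 : x ≠ 0 := by
    rintro rfl
    simp only [inner_zero_right] at hxm
    exact hne ⟨funext fun j => by rw [← cc_mlift (c j) (u j), ← hxm, cc_zero]; rfl,
      funext fun j => by rw [← uu_mlift (c j) (u j), ← hxm, uu_zero]; rfl⟩
  have := h.min x hx hx0
  rw [F.norm_of_mlift hxm, le_div_iff₀ (by norm_num)] at this
  norm_num at this
  exact_mod_cast this

end

end OFrame

end Code

section CodeOfFrame

variable {L : AddSubgroup E14} {X : Finset E14} {v : J → E14} {c u t : J → ZMod 3}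

lemma sum_J {M : Type*} [AddCommMonoid M] (f : J → M) : ∑ j, f j =
    f none + f (some none) + ∑ p : Pr, (f (pl p false) + f (pl p true)) := by
  rw [Fintype.sum_option, Fintype.sum_option, Fintype.sum_prod_type, add_assoc]
  simp only [Fintype.sum_bool]
  refine congrArg _ (congrArg _ (Finset.sum_congr rfl fun p _ => add_comm _ _))

/-- The label of the other member of a pair. -/
def mate : J → J
  | some (some (p, b)) => pl p (!b)
  | j => j

namespace PreFrame

variable (h : GoodLat L X) (F : PreFrame L X v)
include h F

lemma inCode_triple (p : Pr) : InCode L v 0 fun j =>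
    if j = none ∨ j = pl p false ∨ j = pl p true then 1 else 0 := by
  refine ⟨-(θ⁻¹ • (v none + v (pl p false) + v (pl p true))), neg_mem ?_, fun j => ?_⟩
  · simpa using F.glue p 0 0
  · have h1 : inner ℂ (v j) (-(θ⁻¹ • (v none + v (pl p false) + v (pl p true)))) =
        if j = none ∨ j = pl p false ∨ j = pl p true then θ else 0 := by
      have hθ : θ⁻¹ * 3 = -θ := by
        rw [inv_mul_eq_iff_eq_mul₀ θ_ne]; linear_combination θ_sq
      simp only [inner_neg_right, inner_smul_right, inner_add_right, F.orth]
      rcases j with _ | _ | ⟨q, _ | _⟩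
      · simp [hθ]
      · simp
      · by_cases hq : q = p <;> simp [hq, hθ]
      · by_cases hq : q = p <;> simp [hq, hθ]
    rw [h1]
    by_cases hj : j = none ∨ j = pl p false ∨ j = pl p true
    · simp only [if_pos hj]
      exact ⟨cc_θ, uu_θ⟩
    · simp only [if_neg hj]
      exact ⟨cc_zero, uu_zero⟩

lemma pair_sum (hc : InCode L v c u) (p : Pr) : c none + c (pl p false) + c (pl p true) = 0 := by
  have h1 := ((F.inCode_dual h).1 hc _ _ (F.inCode_triple h p)).2
  rw [sum_J] at h1
  simp only [Pi.zero_apply, mul_zero, sub_zero, mul_ite, mul_one] at h1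
  simp [Finset.sum_add_distrib] at h1
  linear_combination h1

lemma inCode_zero_iff : InCode L v 0 t ↔ ∀ c u, InCode L v c u → ∑ j, c j * t j = 0 := by
  rw [F.inCode_dual h]
  refine forall₃_congr fun c u hc => ?_
  simp only [Pi.zero_apply, mul_zero, Finset.sum_const_zero, true_and, zero_sub,
    Finset.sum_neg_distrib, neg_eq_zero, mul_comm]

/-- Words of weight three through the base point come from pairs. -/
lemma eq_mate_of_weight (ht : InCode L v 0 t) (h9 : ∑ j, mnorm 0 (t j) = 9) (h0 : t none ≠ 0)
    {j k : J} (hj : t j ≠ 0) (hk : t k ≠ 0) (hj0 : j ≠ none) (hk0 : k ≠ none) (hjk : j ≠ k) :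
    k = mate j := by
  wlog h2 : t none = 2 generalizing t
  · have h1 : t none = 1 := by
      rcases zmod3_cases (t none) with h | h | h
      exacts [absurd h h0, h, absurd h h2]
    have hz (x : ZMod 3) : 2 * x = 0 ↔ x = 0 := by revert x; decide
    refine this (t := (2 : ZMod 3) • t) ?_ ?_ ?_ ?_ ?_ ?_
    · simpa using F.inCode_smul h 2 ht
    · rw [← h9]
      exact Finset.sum_congr rfl fun j _ => by
        simp only [mnorm, Pi.smul_apply, smul_eq_mul, hz]
    · simpa [hz]
    · simpa [hz]
    · simpa [hz]
    · rw [Pi.smul_apply, h1]; rfl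
  obtain ⟨x, hx, hxm⟩ := F.exists_mlift h ht
  have hn := F.norm_of_mlift hxm
  simp only [Pi.zero_apply, h9] at hn
  have hxX : x ∈ X := (h.mem_X x).2 ⟨hx, by rw [hn]; norm_num⟩
  obtain ⟨p, a, b, rfl⟩ := F.cover x hxX (by rw [hxm, h2]; simp [mlift, show (2 : ZMod 3) ≠ 0 by decide, show (2 : ZMod 3) ≠ 1 by decide])
  have key (i : J) (hi : t i ≠ 0) (hi0 : i ≠ none) : i = pl p false ∨ i = pl p true := by
    by_contra! hne
    have := hxm i
    simp only [inner_smul_right, inner_add_right, F.orth, if_neg hne.1, if_neg hne.2,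
      if_neg hi0, mul_zero, add_zero] at this
    exact hi (by rw [← uu_mlift ((0 : J → ZMod 3) i) (t i), ← this, uu_zero])
  rcases key j hj hj0 with rfl | rfl <;> rcases key k hk hk0 with rfl | rfl
  exacts [absurd rfl hjk, rfl, rfl, absurd rfl hjk]

lemma not_prop {j k : J} (hj0 : j ≠ none) (hk0 : k ≠ none) (hjk : j ≠ k) (hm : k ≠ mate j)
    (μ l : ZMod 3) : ∃ c u, InCode L v c u ∧ c j + μ * c k + l * c none ≠ 0 := by
  by_contra! hall
  let t : J → ZMod 3 := fun i =>
    (if i = j then 1 else 0) + (if i = k then μ else 0) + (if i = none then l else 0)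
  have ht : InCode L v 0 t := (F.inCode_zero_iff h).2 fun c u hc => by
    rw [← hall c u hc]
    simp only [t, mul_add, mul_ite, mul_one, mul_zero, Finset.sum_add_distrib, Finset.sum_ite_eq',
      Finset.mem_univ, if_true]
    ring
  have tj : t j = 1 := by simp [t, hj0, hjk]
  have tk : t k = μ := by simp [t, hk0, hjk.symm]
  have t0 : t none = l := by simp [t, hj0.symm, hk0.symm]
  have hsum : ∑ i, mnorm 0 (t i) = 3 + mnorm 0 μ + mnorm 0 l := by
    have (i : J) : mnorm 0 (t i) = (if i = j then 3 else 0) + (if i = k then mnorm 0 μ else 0) +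
        (if i = none then mnorm 0 l else 0) := by
      by_cases h1 : i = j
      · subst h1; rw [tj]; simp [hj0, hjk, mnorm]
      by_cases h2 : i = k
      · subst h2; rw [tk]; simp [hk0, hjk.symm]
      by_cases h3 : i = none
      · subst h3; rw [t0]; simp [hj0.symm, hk0.symm]
      simp [t, h1, h2, h3, mnorm]
    simp only [this, Finset.sum_add_distrib, Finset.sum_ite_eq', Finset.mem_univ, if_true]
  have h9 := F.nine_le h ht (fun h0 => by
    have := congrFun h0.2 j
    rw [tj, Pi.zero_apply] at this
    exact one_ne_zero this)
  have hle : ∀ x : ZMod 3, mnorm 0 x ≤ 3 ∧ (x = 0 → mnorm 0 x = 0) := by decide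
  simp only [Pi.zero_apply] at h9
  rw [hsum] at h9
  have hμ : μ ≠ 0 := fun h0 => by have := (hle μ).2 h0; have := (hle l).1; omega
  have hl : l ≠ 0 := fun h0 => by have := (hle l).2 h0; have := (hle μ).1; omega
  refine hm (F.eq_mate_of_weight h ht ?_ (t0 ▸ hl) (by rw [tj]; decide) (tk ▸ hμ) hj0 hk0 hjk)
  rw [hsum]
  have := (hle l).1
  have := (hle μ).1
  omega

lemma exists_none_eq_one : ∃ c u, InCode L v c u ∧ c none = 1 := by
  by_contra! hall
  have hall' : ∀ c u, InCode L v c u → c none = 0 := fun c u hc => by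
    rcases zmod3_cases (c none) with h0 | h0 | h0
    · exact h0
    · exact absurd h0 (hall c u hc)
    · exact absurd (by rw [Pi.smul_apply, h0]; decide) (hall _ _ (F.inCode_smul h 2 hc))
  have ht : InCode L v 0 (fun j => if j = none then 1 else 0) :=
    (F.inCode_zero_iff h).2 fun c u hc => by simpa using hall' c u hc
  have h9 := F.nine_le h ht (fun h0 => absurd (congrFun h0.2 none) (by simp))
  have (j : J) : mnorm ((0 : J → ZMod 3) j) (if j = none then 1 else 0) = if j = none then 3 else 0 := by
    split_ifs <;> simp [mnorm]
  simp only [this, Finset.sum_ite_eq', Finset.mem_univ, if_true] at h9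
  omega

omit h in
lemma relabel (π : Equiv.Perm Pr) (s : Pr → Bool) : PreFrame L X
    fun j => v (j.map fun k => k.map fun p => (π p.1, xor (s p.1) p.2)) := by
  refine ⟨⟨fun j => F.mem _, fun j k => ?_⟩, fun p j k => ?_, fun x hx hvx => ?_⟩
  · have hinj : Function.Injective fun p : Pr × Bool => (π p.1, xor (s p.1) p.2) := by
      rintro ⟨p, b⟩ ⟨q, c⟩ hpq
      obtain ⟨h1, h2⟩ := Prod.ext_iff.1 hpq
      obtain rfl := π.injective h1
      exact Prod.ext rfl (by revert h2; cases s p <;> cases b <;> cases c <;> simp)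
    rw [F.orth]
    exact if_congr (Option.map_injective (Option.map_injective hinj)).eq_iff rfl rfl
  · simp only [Option.map_none, Option.map_some]
    cases s p
    · simpa using F.glue (π p) j k
    · simpa [add_right_comm] using F.glue (π p) k j
  · obtain ⟨p, j, k, rfl⟩ := F.cover x hx hvx
    refine ⟨π.symm p, ?_⟩
    simp only [Option.map_none, Option.map_some, Equiv.apply_symm_apply]
    cases s (π.symm p)
    · exact ⟨j, k, by simp⟩
    · exact ⟨k, j, by simp [add_right_comm]⟩

end PreFrame

end CodeOfFrame

section TernaryCodes

lemma ZMod.one_sub_sq_three (x : ZMod 3) : 1 - x * x = ((if x = 0 then 1 else 0 : ℕ) : ZMod 3) := by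
  revert x; decide

/-- A self-orthogonal word on six coordinates has a number of zeros divisible by three. -/
lemma three_dvd_card_zeros (l : Pr → ZMod 3) (hl : ∑ i, l i * l i = 0) :
    3 ∣ (Finset.univ.filter fun i => l i = 0).card := by
  rw [← ZMod.natCast_eq_zero_iff, Finset.card_filter, Nat.cast_sum]
  simp_rw [← ZMod.one_sub_sq_three]
  rw [Finset.sum_sub_distrib, hl]
  decide

lemma card_zeros_le (l m g : Pr → ZMod 3) (hm : ∀ i, l i = 0 → m i ≠ 0)
    (hinj : ∀ i j, i ≠ j → ∀ s, ¬ (l i = s * l j ∧ m i = s * m j ∧ g i = s * g j)) :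
    (Finset.univ.filter fun i => l i = 0).card ≤ 3 := by
  refine (Finset.card_le_card_of_injOn (t := Finset.univ) (fun i => m i * g i)
    (fun _ _ => Finset.mem_coe.2 (Finset.mem_univ _)) fun i hi j hj hij => ?_).trans_eq (by decide)
  by_contra hne
  simp only [Finset.coe_filter, Finset.mem_univ, true_and, Set.mem_ofPred_eq] at hi hj hij
  have key : ∀ a b x y : ZMod 3, a ≠ 0 → b ≠ 0 → a * x = b * y →
      a = a * b * b ∧ x = a * b * y := by decide
  exact hinj i j hne (m i * m j) ⟨by rw [hi, hj, mul_zero], key _ _ _ _ (hm i hi) (hm j hj) hij⟩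

/-- Two self-orthogonal words of a projective ternary code can be replaced by words without
zeros. -/
lemma exists_nonvanishing (p q g : Pr → ZMod 3) (hp : ∑ i, p i * p i = 0) (hq : ∑ i, q i * q i = 0)
    (hpq : ∑ i, p i * q i = 0) (hne : ∀ i, p i = 0 → q i ≠ 0)
    (hinj : ∀ i j, i ≠ j → ∀ s, ¬ (p i = s * p j ∧ q i = s * q j ∧ g i = s * g j)) :
    ∃ a b c d : ZMod 3, a * d - b * c ≠ 0 ∧
      ∀ i, a * p i + b * q i ≠ 0 ∧ c * p i + d * q i ≠ 0 := by
  have d0 := three_dvd_card_zeros p hp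
  have d1 := three_dvd_card_zeros q hq
  have d2 := three_dvd_card_zeros (fun i => p i + q i) (by
    simp only [add_mul, mul_add, Finset.sum_add_distrib, hp, hq, hpq, mul_comm (q _) (p _)]; rfl)
  have d3 := three_dvd_card_zeros (fun i => p i - q i) (by
    simp only [sub_mul, mul_sub, Finset.sum_sub_distrib, hp, hq, hpq, mul_comm (q _) (p _)]; rfl)
  have c0 := card_zeros_le p q g hne hinj
  have c1 := card_zeros_le q p g (fun i h0 h1 => hne i h1 h0)
    (fun i j hij s h => hinj i j hij s ⟨h.2.1, h.1, h.2.2⟩)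
  have c2 := card_zeros_le (fun i => p i + q i) p g
    (fun i h0 h1 => hne i h1 (by simpa [h1] using h0))
    (fun i j hij s h => hinj i j hij s ⟨h.2.1, by linear_combination h.1 - h.2.1, h.2.2⟩)
  have c3 := card_zeros_le (fun i => p i - q i) p g
    (fun i h0 h1 => hne i h1 (by simpa [h1] using h0))
    (fun i j hij s h => hinj i j hij s ⟨h.2.1, by linear_combination h.2.1 - h.1, h.2.2⟩)
  have hsum : (Finset.univ.filter fun i => p i = 0).card + (Finset.univ.filter fun i => q i = 0).card
      + (Finset.univ.filter fun i => p i + q i = 0).card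
      + (Finset.univ.filter fun i => p i - q i = 0).card = 6 := by
    simp only [Finset.card_filter, ← Finset.sum_add_distrib]
    have key : ∀ x y : ZMod 3, (x = 0 → y ≠ 0) → (if x = 0 then 1 else 0) + (if y = 0 then 1 else 0)
        + (if x + y = 0 then 1 else 0) + (if x - y = 0 then 1 else 0) = 1 := by decide
    rw [Finset.sum_congr rfl fun i _ => key (p i) (q i) (hne i)]
    decide
  have hz (l : Pr → ZMod 3) (h0 : (Finset.univ.filter fun i => l i = 0).card = 0) (i : Pr) :
      l i ≠ 0 := fun hi => by
    have := Finset.card_eq_zero.1 h0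
    exact absurd hi ((Finset.filter_eq_empty_iff.1 this) (Finset.mem_univ i))
  set n0 := (Finset.univ.filter fun i => p i = 0).card with hn0
  set n1 := (Finset.univ.filter fun i => q i = 0).card with hn1
  set n2 := (Finset.univ.filter fun i => p i + q i = 0).card with hn2
  set n3 := (Finset.univ.filter fun i => p i - q i = 0).card with hn3
  have hcases : (n0 = 0 ∧ n1 = 0) ∨ (n0 = 0 ∧ n2 = 0) ∨ (n0 = 0 ∧ n3 = 0) ∨ (n1 = 0 ∧ n2 = 0) ∨
      (n1 = 0 ∧ n3 = 0) ∨ (n2 = 0 ∧ n3 = 0) := by omega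
  have w0 := hz p
  have w1 := hz q
  have w2 := hz fun i => p i + q i
  have w3 := hz fun i => p i - q i
  rcases hcases with ⟨h, h'⟩ | ⟨h, h'⟩ | ⟨h, h'⟩ | ⟨h, h'⟩ | ⟨h, h'⟩ | ⟨h, h'⟩
  · exact ⟨1, 0, 0, 1, by decide, fun i => ⟨by simpa using w0 h i, by simpa using w1 h' i⟩⟩
  · exact ⟨1, 0, 1, 1, by decide, fun i => ⟨by simpa using w0 h i, by simpa using w2 h' i⟩⟩
  · exact ⟨1, 0, 1, -1, by decide, fun i => ⟨by simpa using w0 h i,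
      by simpa [sub_eq_add_neg] using w3 h' i⟩⟩
  · exact ⟨0, 1, 1, 1, by decide, fun i => ⟨by simpa using w1 h i, by simpa using w2 h' i⟩⟩
  · exact ⟨0, 1, 1, -1, by decide, fun i => ⟨by simpa using w1 h i,
      by simpa [sub_eq_add_neg] using w3 h' i⟩⟩
  · exact ⟨1, 1, 1, -1, by decide, fun i => ⟨by simpa using w2 h i,
      by simpa [sub_eq_add_neg] using w3 ‹_› i⟩⟩

/-- The signs of the quadratic form on the seven coordinates. -/
def sgn7 : Option Pr → ZMod 3
  | none => -1
  | some _ => 1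

lemma sgn7_ne (i : Option Pr) : sgn7 i ≠ 0 := by cases i <;> simp [sgn7]

/-- The form of signature six minus one. -/
noncomputable def form7 : LinearMap.BilinForm (ZMod 3) (Option Pr → ZMod 3) :=
  Matrix.toBilin' (Matrix.diagonal sgn7)

lemma form7_apply (x y : Option Pr → ZMod 3) :
    form7 x y = ∑ i : Pr, x (some i) * y (some i) - x none * y none := by
  rw [form7, Matrix.toBilin'_apply', dotProduct, Fintype.sum_option]
  simp only [Matrix.mulVec_diagonal, sgn7, one_mul]
  ring

lemma form7_nondegenerate : form7.Nondegenerate := by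
  refine LinearMap.BilinForm.nondegenerate_toBilin'_iff_det_ne_zero.2 ?_
  rw [Matrix.det_diagonal]
  exact Finset.prod_ne_zero_iff.2 fun i _ => sgn7_ne i

lemma finrank_le_three (D : Submodule (ZMod 3) (Option Pr → ZMod 3))
    (iso : ∀ x ∈ D, ∀ y ∈ D, ∑ i : Pr, x (some i) * y (some i) = x none * y none) :
    Module.finrank (ZMod 3) D ≤ 3 := by
  have h1 := LinearMap.BilinForm.finrank_orthogonal form7_nondegenerate D
  have h2 : D ≤ form7.orthogonal D := fun x hx => by
    rw [LinearMap.BilinForm.mem_orthogonal_iff]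
    intro y hy
    change form7 y x = 0
    rw [form7_apply, iso y hy x hx, sub_self]
  have h3 := Submodule.finrank_mono h2
  have h4 : Module.finrank (ZMod 3) (Option Pr → ZMod 3) = 7 := by
    rw [Module.finrank_fintype_fun_eq_card]; rfl
  rw [h4] at h1
  omega

lemma exists_span_pair {V : Type*} [AddCommGroup V] [Module (ZMod 3) V] [Module.Finite (ZMod 3) V]
    (h : Module.finrank (ZMod 3) V ≤ 2) : ∃ p q : V, ∀ x, ∃ a b : ZMod 3, x = a • p + b • q := by
  obtain ⟨n, hn⟩ : ∃ n, Module.finrank (ZMod 3) V = n := ⟨_, rfl⟩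
  let b := Module.finBasisOfFinrankEq (ZMod 3) V hn
  rw [hn] at h
  interval_cases n
  · exact ⟨0, 0, fun x => ⟨0, 0, by simpa using (b.sum_repr x).symm⟩⟩
  · exact ⟨b 0, 0, fun x => ⟨b.repr x 0, 0, by simpa using (b.sum_repr x).symm⟩⟩
  · exact ⟨b 0, b 1, fun x => ⟨b.repr x 0, b.repr x 1, by
      rw [← Fin.sum_univ_two fun i => b.repr x i • b i, b.sum_repr]⟩⟩

lemma code_structure (D : Submodule (ZMod 3) (Option Pr → ZMod 3))
    (iso : ∀ x ∈ D, ∀ y ∈ D, ∑ i : Pr, x (some i) * y (some i) = x none * y none)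
    (np : ∀ i j, i ≠ j → ∀ s, ∃ x ∈ D, x i ≠ s * x j) :
    ∃ p ∈ D, ∃ q ∈ D, ∃ g ∈ D, p none = 0 ∧ q none = 0 ∧ g none = 1 ∧
      (∀ i : Pr, p (some i) ≠ 0 ∧ q (some i) ≠ 0) ∧
      Function.Injective fun i : Pr => (p (some i) * q (some i), p (some i) * g (some i)) := by
  obtain ⟨g, hg, hg1⟩ : ∃ g ∈ D, g none = 1 := by
    obtain ⟨x, hx, hx0⟩ := np none (some (false, 0)) (by simp) 0
    refine ⟨x none • x, D.smul_mem _ hx, ?_⟩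
    have : ∀ a : ZMod 3, a ≠ 0 * 0 → a * a = 1 := by decide
    exact this _ (by simpa using hx0)
  let P : Submodule (ZMod 3) (Option Pr → ZMod 3) := D ⊓ LinearMap.ker (LinearMap.proj none)
  have hP : Module.finrank (ZMod 3) P ≤ 2 := by
    have h1 : P < D := by
      refine lt_of_le_of_ne inf_le_left fun h => ?_
      have : g ∈ P := h ▸ hg
      have h0 : g none = 0 := this.2
      rw [hg1] at h0
      exact one_ne_zero h0
    have := Submodule.finrank_lt_finrank_of_lt h1
    have := finrank_le_three D iso
    omega
  obtain ⟨⟨p', hp', hp0⟩, ⟨q', hq', hq0⟩, hspan⟩ := exists_span_pair hP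
  replace hp0 : p' none = 0 := hp0
  replace hq0 : q' none = 0 := hq0
  have hD (x) (hx : x ∈ D) : ∃ a b : ZMod 3, x = a • p' + b • q' + x none • g := by
    obtain ⟨a, b, hab⟩ := hspan ⟨x - x none • g, D.sub_mem hx (D.smul_mem _ hg), by
      simp [hg1]⟩
    exact ⟨a, b, by rw [← sub_eq_iff_eq_add]; exact congrArg Subtype.val hab⟩
  have hinj (i j : Pr) (hij : i ≠ j) (s) : ¬ (p' (some i) = s * p' (some j) ∧
      q' (some i) = s * q' (some j) ∧ g (some i) = s * g (some j)) := by
    rintro ⟨h1, h2, h3⟩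
    obtain ⟨x, hx, hne⟩ := np (some i) (some j) (by simpa using hij) s
    obtain ⟨a, b, hab⟩ := hD x hx
    apply hne
    rw [hab]
    simp only [Pi.add_apply, Pi.smul_apply, smul_eq_mul, h1, h2, h3]
    ring
  have hne (i : Pr) : p' (some i) = 0 → q' (some i) ≠ 0 := fun h1 h2 => by
    obtain ⟨x, hx, hne⟩ := np (some i) none (by simp) (g (some i))
    obtain ⟨a, b, hab⟩ := hD x hx
    apply hne
    rw [hab]
    simp [h1, h2, hp0, hq0, hg1, mul_comm]
  obtain ⟨a, b, c, d, hdet, hnz⟩ := exists_nonvanishing (fun i => p' (some i)) (fun i => q' (some i))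
    (fun i => g (some i)) (by simpa [hp0] using iso p' hp' p' hp')
    (by simpa [hq0] using iso q' hq' q' hq') (by simpa [hp0] using iso p' hp' q' hq') hne hinj
  refine ⟨a • p' + b • q', D.add_mem (D.smul_mem _ hp') (D.smul_mem _ hq'), c • p' + d • q',
    D.add_mem (D.smul_mem _ hp') (D.smul_mem _ hq'), g, hg, by simp [hp0, hq0], by simp [hp0, hq0],
    hg1, hnz, fun i j hij => ?_⟩
  by_contra hne'
  obtain ⟨h1, h2⟩ := Prod.ext_iff.1 hij
  simp only [Pi.add_apply, Pi.smul_apply, smul_eq_mul] at h1 h2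
  have key : ∀ x y x' y' u u' : ZMod 3, x ≠ 0 → y ≠ 0 → x' ≠ 0 → y' ≠ 0 → x * y = x' * y' →
      x * u = x' * u' → x = x * x' * x' ∧ y = x * x' * y' ∧ u = x * x' * u' := by decide
  obtain ⟨k1, k2, k3⟩ := key _ _ _ _ _ _ (hnz i).1 (hnz i).2 (hnz j).1 (hnz j).2 h1 h2
  set s := (a * p' (some i) + b * q' (some i)) * (a * p' (some j) + b * q' (some j))
  have hunit : (a * d - b * c) * (a * d - b * c) = 1 := by
    have : ∀ x : ZMod 3, x ≠ 0 → x * x = 1 := by decide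
    exact this _ hdet
  refine hinj i j hne' s ⟨?_, ?_, k3⟩
  · linear_combination (a * d - b * c) * (d * k1 - b * k2) -
      (p' (some i) - s * p' (some j)) * hunit
  · linear_combination (a * d - b * c) * (a * k2 - c * k1) -
      (q' (some i) - s * q' (some j)) * hunit

end TernaryCodes

section StandardWords

/-- The sign attached to a member of a pair. -/
def sg (b : Bool) : ZMod 3 := bif b then -1 else 1

/-- The columns of the generator matrix of the standard code. -/
def gcol : J → Fin 4 → ZMod 3
  | none => ![1, 0, 0, 0]
  | some none => ![0, 0, 0, 1]
  | some (some ((false, t), b)) => ![1 - sg b * t, sg b, 0, sg b * t]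
  | some (some ((true, t), b)) => ![1 + sg b * t, 0, sg b, sg b * t]

/-- The words of the standard code. -/
def word (z : Fin 4 → ZMod 3) (j : J) : ZMod 3 := z ⬝ᵥ gcol j

lemma word_add (z z' : Fin 4 → ZMod 3) : word (z + z') = word z + word z' :=
  funext fun _ => add_dotProduct _ _ _

lemma word_smul (a : ZMod 3) (z : Fin 4 → ZMod 3) : word (a • z) = a • word z :=
  funext fun _ => smul_dotProduct _ _ _

lemma dotProduct_four (z w : Fin 4 → ZMod 3) :
    z ⬝ᵥ w = z 0 * w 0 + z 1 * w 1 + z 2 * w 2 + z 3 * w 3 := by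
  rw [dotProduct, Fin.sum_univ_four]

lemma word_none (z : Fin 4 → ZMod 3) : word z none = z 0 := by
  rw [word, dotProduct_four]; simp [gcol]
lemma word_last (z : Fin 4 → ZMod 3) : word z (some none) = z 3 := by
  rw [word, dotProduct_four]; simp [gcol]
lemma word_false (z : Fin 4 → ZMod 3) (t : ZMod 3) (b : Bool) :
    word z (pl (false, t) b) = z 0 + sg b * (z 1 + t * (z 3 - z 0)) := by
  rw [word, dotProduct_four]; simp [gcol]; ring
lemma word_true (z : Fin 4 → ZMod 3) (t : ZMod 3) (b : Bool) :
    word z (pl (true, t) b) = z 0 + sg b * (z 2 + t * (z 3 + z 0)) := by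
  rw [word, dotProduct_four]; simp [gcol]; ring

lemma sum_Pr {M : Type*} [AddCommMonoid M] (f : Pr → M) : ∑ p, f p =
    f (false, 0) + f (false, 1) + f (false, 2) + (f (true, 0) + f (true, 1) + f (true, 2)) := by
  rw [Fintype.sum_prod_type, Fintype.sum_bool, add_comm]
  exact congrArg₂ _ (Fin.sum_univ_three fun t : Fin 3 => f (false, t))
    (Fin.sum_univ_three fun t : Fin 3 => f (true, t))

variable {L : AddSubgroup E14} {X : Finset E14} {v : J → E14} {c c' u t : J → ZMod 3}

/-- The residue words modulo `θ` of a frame. -/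
def InC (L : AddSubgroup E14) (v : J → E14) (c : J → ZMod 3) : Prop := ∃ u, InCode L v c u

lemma InC.comp (hc : InC L v c) (r : J → J) : InC L (fun j => v (r j)) (fun j => c (r j)) := by
  obtain ⟨u, x, hx, hu⟩ := hc
  exact ⟨fun j => u (r j), x, hx, fun j => hu (r j)⟩

namespace PreFrame

variable (h : GoodLat L X) (F : PreFrame L X v)
include h F

lemma inC_add (hc : InC L v c) (hc' : InC L v c') : InC L v (c + c') := by
  obtain ⟨u, hu⟩ := hc
  obtain ⟨u', hu'⟩ := hc'
  exact ⟨_, F.inCode_add h hu hu'⟩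

lemma inC_smul (a : ZMod 3) (hc : InC L v c) : InC L v (a • c) := by
  obtain ⟨u, hu⟩ := hc
  exact ⟨_, F.inCode_smul h a hu⟩

lemma inC_zero : InC L v 0 := ⟨0, F.inCode_zero h⟩

lemma inC_true (hc : InC L v c) (p : Pr) : c (pl p true) = -c none - c (pl p false) := by
  obtain ⟨u, hu⟩ := hc
  linear_combination F.pair_sum h hu p

lemma inC_iso (hc : InC L v c) (hc' : InC L v c') :
    ∑ p : Pr, (c (pl p false) - c none) * (c' (pl p false) - c' none) =
      c none * c' none + c (some none) * c' (some none) := by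
  obtain ⟨u, hu⟩ := id hc
  obtain ⟨u', hu'⟩ := id hc'
  have h1 := ((F.inCode_dual h).1 hu _ _ hu').1
  rw [sum_J] at h1
  simp only [F.inC_true h hc, F.inC_true h hc'] at h1
  have h2 : ∀ a b x y : ZMod 3, x * y + (-a - x) * (-b - y) =
      - ((x - a) * (y - b)) - a * b := fun a b x y => by
    linear_combination (x * y + a * b) * three_eq_zero
  simp only [h2, Finset.sum_sub_distrib, Finset.sum_neg_distrib, Finset.sum_const] at h1
  rw [show (Finset.univ : Finset Pr).card = 6 by decide, nsmul_eq_mul] at h1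
  push_cast at h1
  linear_combination -h1 - 2 * (c none * c' none) * three_eq_zero

lemma exists_words : ∃ (π : Equiv.Perm Pr) (s : Pr → Bool), ∀ z1 z2 z3,
    InC L (fun j => v (j.map fun k => k.map fun p => (π p.1, xor (s p.1) p.2)))
      (word ![0, z1, z2, z3]) := by
  let D : Submodule (ZMod 3) (Option Pr → ZMod 3) :=
    { carrier := {x | ∃ c, InC L v c ∧ c none = 0 ∧ x none = c (some none) ∧
        ∀ p, x (some p) = c (pl p false)}
      zero_mem' := ⟨0, F.inC_zero h, rfl, rfl, fun _ => rfl⟩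
      add_mem' := by
        rintro x y ⟨c, hc, h0, h1, h2⟩ ⟨c', hc', h0', h1', h2'⟩
        exact ⟨c + c', F.inC_add h hc hc', by simp [h0, h0'], by simp [h1, h1'],
          fun p => by simp [h2, h2']⟩
      smul_mem' := by
        rintro a x ⟨c, hc, h0, h1, h2⟩
        exact ⟨a • c, F.inC_smul h a hc, by simp [h0], by simp [h1], fun p => by simp [h2]⟩ }
  obtain ⟨p, ⟨P, hP, hP0, hP1, hP2⟩, q, ⟨Q, hQ, hQ0, hQ1, hQ2⟩, g, ⟨G, hG, hG0, hG1, hG2⟩,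
      hp, hq, hg, hpq, hinj⟩ := code_structure D (by
    rintro x ⟨c, hc, h0, h1, h2⟩ y ⟨c', hc', h0', h1', h2'⟩
    have := F.inC_iso h hc hc'
    simpa [h0, h0', ← h1, ← h1', ← h2, ← h2'] using this) (by
    intro i j hij s
    by_contra! hall
    let e : Option Pr → J := fun k => some (k.map fun p => (p, false))
    have he : Function.Injective e :=
      (Option.some_injective _).comp (Option.map_injective fun _ _ hab => (Prod.ext_iff.1 hab).1)
    have hD (c) (hc : InC L v c) (h0 : c none = 0) : c (e i) = s * c (e j) := by
      refine hall (fun k => c (e k)) ⟨c, hc, h0, rfl, fun _ => rfl⟩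
    obtain ⟨c₁, u₁, hc₁, h1⟩ := F.exists_none_eq_one h
    obtain ⟨c, u, hc, hne⟩ := F.not_prop h (j := e i) (k := e j) (by simp [e]) (by simp [e])
      (he.ne hij) (by
        intro hm
        rcases i with _ | i <;> rcases j with _ | j <;> simp [e, mate] at hm
        exact hij rfl) (-s) (s * c₁ (e j) - c₁ (e i))
    have := hD _ (F.inC_add h ⟨u, hc⟩ (F.inC_smul h (-c none) ⟨u₁, hc₁⟩)) (by simp [h1])
    apply hne
    simp only [Pi.add_apply, Pi.smul_apply, smul_eq_mul] at this
    linear_combination this)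
  let e : Pr → Pr := fun i => (decide (p (some i) * q (some i) = -1), p (some i) * g (some i))
  have he : Function.Injective e := fun i j hij => by
    obtain ⟨h1, h2⟩ := Prod.ext_iff.1 hij
    refine hinj (Prod.ext ?_ h2)
    have key : ∀ a b a' b' : ZMod 3, a ≠ 0 → b ≠ 0 → a' ≠ 0 → b' ≠ 0 →
      decide (a * b = -1) = decide (a' * b' = -1) → a * b = a' * b' := by decide
    exact key _ _ _ _ (hpq i).1 (hpq i).2 (hpq j).1 (hpq j).2 h1
  let φ : Equiv.Perm Pr := Equiv.ofBijective e (Finite.injective_iff_bijective.1 he)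
  refine ⟨φ.symm, fun l => decide (p (some (φ.symm l)) = -1), fun z1 z2 z3 => ?_⟩
  have hval (l : Pr) : (p (some (φ.symm l)) * q (some (φ.symm l)) = if l.1 then -1 else 1) ∧
      p (some (φ.symm l)) * g (some (φ.symm l)) = l.2 := by
    obtain ⟨i, rfl⟩ := φ.surjective l
    rw [φ.symm_apply_apply]
    refine ⟨?_, rfl⟩
    have key : ∀ a b : ZMod 3, a ≠ 0 → b ≠ 0 →
      a * b = if decide (a * b = -1) = true then -1 else 1 := by decide
    exact key _ _ (hpq i).1 (hpq i).2
  have hcomb := (F.inC_add h (F.inC_add h (F.inC_smul h (-(z1 + z2)) hP)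
    (F.inC_smul h (z2 - z1) hQ)) (F.inC_smul h z3 hG)).comp
      fun j => j.map fun k => k.map fun m =>
        (φ.symm m.1, xor (decide (p (some (φ.symm m.1)) = -1)) m.2)
  convert hcomb using 1
  funext j
  rcases j with _ | _ | ⟨l, b⟩
  · simp [word_none, hP0, hQ0, hG0]
  · simp [word_last, ← hP1, ← hQ1, ← hG1, hp, hq, hg]
  · have hv (c : J → ZMod 3) (hc : InC L v c) (h0 : c none = 0) :
        c (pl (φ.symm l) (xor (decide (p (some (φ.symm l)) = -1)) b)) =
          sg b * (p (some (φ.symm l)) * c (pl (φ.symm l) false)) := by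
      have h1 := F.inC_true h hc (φ.symm l)
      rw [h0, neg_zero, zero_sub] at h1
      have h2 : p (some (φ.symm l)) = 1 ∨ p (some (φ.symm l)) = -1 := by
        rcases zmod3_cases (p (some (φ.symm l))) with h2 | h2 | h2
        exacts [absurd h2 (hpq _).1, Or.inl h2, Or.inr h2]
      rcases h2 with h2 | h2 <;> rw [h2]
      · rw [show decide ((1 : ZMod 3) = -1) = false by decide]
        cases b <;> simp [sg, h1]
      · cases b <;> simp [sg, h1]
    simp only [Option.map_some, Pi.add_apply, Pi.smul_apply, smul_eq_mul, hv P hP hP0,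
      hv Q hQ hQ0, hv G hG hG0, ← hP2, ← hQ2, ← hG2, (hval l).1, (hval l).2]
    have h1 : ∀ x : ZMod 3, x ≠ 0 → x * x = 1 := by decide
    rw [h1 _ (hpq _).1]
    obtain ⟨β, t⟩ := l
    cases β
    · rw [word_false]
      simp
      linear_combination sg b * z1 * three_eq_zero
    · rw [word_true]
      simp
      linear_combination sg b * z2 * three_eq_zero

lemma reduced_word (hw : ∀ z1 z2 z3, InC L v (word ![0, z1, z2, z3])) (hc : InC L v c)
    (h1 : c (some none) = 0) (h2 : c (pl (false, 0) false) = c none)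
    (h3 : c (pl (true, 0) false) = c none) : ∃ a, a * a = c none * c none ∧
      ∀ t, c (pl (false, t) false) = c none + a * t ∧ c (pl (true, t) false) = c none - a * t := by
  have i1 := F.inC_iso h hc (hw 1 0 0)
  have i2 := F.inC_iso h hc (hw 0 1 0)
  have i3 := F.inC_iso h hc (hw 0 0 1)
  have i4 := F.inC_iso h hc hc
  simp only [sum_Pr, word_none, word_last, word_false, word_true, sg] at i1 i2 i3 i4
  simp [h1, h2, h3, show (2 : ZMod 3) = -1 by decide] at i1 i2 i3 i4
  have k2 : c (pl (false, -1) false) = c none - (c (pl (false, 1) false) - c none) := by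
    linear_combination i1
  have k3 : c (pl (true, 1) false) = c none - (c (pl (false, 1) false) - c none) := by
    linear_combination (c (pl (false, 1) false) - c none + (c (pl (true, 1) false) - c none)) *
      three_eq_zero - i1 - i2 - i3
  have k4 : c (pl (true, -1) false) = c none + (c (pl (false, 1) false) - c none) := by
    linear_combination i2 - k3
  refine ⟨c (pl (false, 1) false) - c none, ?_, fun t => ?_⟩
  · rw [k2, k3, k4] at i4
    linear_combination i4 - (c (pl (false, 1) false) - c none) ^ 2 * three_eq_zero
  · rcases zmod3_cases t with rfl | rfl | rfl
    · simp [h2, h3]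
    · rw [k3]; exact ⟨by ring, by ring⟩
    · rw [show (2 : ZMod 3) = -1 by decide, k2, k4]
      exact ⟨by ring, by ring⟩

lemma exists_reduction (hw : ∀ z1 z2 z3, InC L v (word ![0, z1, z2, z3])) (hc : InC L v c) :
    ∃ z1 z2 z3 c', InC L v c' ∧ c = c' + word ![0, z1, z2, z3] ∧ c' (some none) = 0 ∧
      c' (pl (false, 0) false) = c' none ∧ c' (pl (true, 0) false) = c' none := by
  refine ⟨c (pl (false, 0) false) - c none, c (pl (true, 0) false) - c none, c (some none),
    c + (-1 : ZMod 3) • word ![0, c (pl (false, 0) false) - c none,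
      c (pl (true, 0) false) - c none, c (some none)],
    F.inC_add h hc (F.inC_smul h _ (hw _ _ _)), by simp, ?_, ?_, ?_⟩ <;>
  simp [word_none, word_last, word_false, word_true, sg]

lemma eq_of_eq_false (hc : InC L v c) (hc' : InC L v c') (h0 : c none = c' none)
    (h1 : c (some none) = c' (some none)) (h2 : ∀ p, c (pl p false) = c' (pl p false)) :
    c = c' := by
  funext j
  rcases j with _ | _ | ⟨p, _ | _⟩
  exacts [h0, h1, h2 p, by rw [F.inC_true h hc, F.inC_true h hc', h0, h2 p]]

/-- In suitable coordinates the residue code of a frame is the standard code. -/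
lemma exists_standard : ∃ v', PreFrame L X v' ∧ v' none = v none ∧
    ∀ c, InC L v' c ↔ ∃ z, c = word z := by
  obtain ⟨π, s, hw⟩ := F.exists_words h
  obtain ⟨v₁, F₁, h₁, hw₁⟩ : ∃ v₁, PreFrame L X v₁ ∧ v₁ none = v none ∧
      ∀ z1 z2 z3, InC L v₁ (word ![0, z1, z2, z3]) := ⟨_, F.relabel π s, rfl, hw⟩
  obtain ⟨v₂, F₂, h₂, hw₂, c₂, hc₂, e1, e2, e3, e4⟩ : ∃ v₂, PreFrame L X v₂ ∧ v₂ none = v none ∧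
      (∀ z1 z2 z3, InC L v₂ (word ![0, z1, z2, z3])) ∧ ∃ c, InC L v₂ c ∧ c none = 1 ∧
      c (some none) = 0 ∧ (∀ t, c (pl (false, t) false) = 1 - t) ∧
      ∀ t, c (pl (true, t) false) = 1 + t := by
    obtain ⟨c₁, u₁, hu₁, h1⟩ := F₁.exists_none_eq_one h
    obtain ⟨z1, z2, z3, c, hc, rfl, e1, e2, e3⟩ := F₁.exists_reduction h hw₁ ⟨u₁, hu₁⟩
    have e0 : c none = 1 := by simpa [word_none] using h1
    obtain ⟨a, ha, ht⟩ := F₁.reduced_word h hw₁ hc e1 e2 e3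
    rw [e0] at ha ht
    rcases zmod3_cases a with rfl | rfl | rfl
    · simp at ha
    · refine ⟨_, F₁.relabel ((Equiv.boolNot).prodCongr (Equiv.refl _)) (fun _ => false), h₁,
        fun z1 z2 z3 => ?_, _, hc.comp _, e0, e1, fun t => ?_, fun t => ?_⟩
      · convert (hw₁ z2 z1 z3).comp _ using 1
        funext j
        rcases j with _ | _ | ⟨⟨_ | _, t⟩, b⟩ <;>
        simp [word_none, word_last, word_false, word_true]
      · simp [(ht t).2]
      · simp [(ht t).1]
    · exact ⟨v₁, F₁, h₁, hw₁, c, hc, e0, e1, fun t => by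
        rw [(ht t).1]; linear_combination t * three_eq_zero, fun t => by
        rw [(ht t).2]; linear_combination -t * three_eq_zero⟩
  have hw0 : InC L v₂ (word ![1, 0, 0, 0]) := by
    have h2 (t : ZMod 3) : c₂ (pl (false, t) true) = 1 + t ∧ c₂ (pl (true, t) true) = 1 - t := by
      rw [F₂.inC_true h hc₂, F₂.inC_true h hc₂, e1, e3, e4]
      exact ⟨by linear_combination -three_eq_zero, by linear_combination -three_eq_zero⟩
    convert hc₂ using 1
    funext j
    rcases j with _ | _ | ⟨⟨_ | _, t⟩, _ | _⟩ <;>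
    simp [word_none, word_last, word_false, word_true, e1, e2, e3, e4, h2, sg, sub_eq_add_neg]
  refine ⟨v₂, F₂, h₂, fun c => ⟨fun hc => ?_, ?_⟩⟩
  · obtain ⟨z1, z2, z3, c', hc', hcc, f1, f2, f3⟩ := F₂.exists_reduction h hw₂
      (F₂.inC_add h hc (F₂.inC_smul h (-c none) hw0))
    have f0 : c' none = 0 := by
      have := congrFun hcc none
      simpa [word_none] using this.symm
    obtain ⟨a, ha, ht⟩ := F₂.reduced_word h hw₂ hc' f1 f2 f3
    rw [f0, mul_zero, mul_self_eq_zero] at ha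
    have hz : c' = 0 := F₂.eq_of_eq_false h hc' (F₂.inC_zero h) f0 f1 fun p => by
      obtain ⟨_ | _, t⟩ := p
      exacts [by simp [(ht t).1, ha, f0], by simp [(ht t).2, ha, f0]]
    refine ⟨c none • ![1, 0, 0, 0] + ![0, z1, z2, z3], ?_⟩
    rw [word_add, word_smul]
    rw [hz, zero_add] at hcc
    rw [← hcc]
    simp
  · rintro ⟨z, rfl⟩
    have : z = z 0 • ![1, 0, 0, 0] + ![0, z 1, z 2, z 3] := by
      ext k; fin_cases k <;> simp
    rw [this, word_add, word_smul]
    exact F₂.inC_add h (F₂.inC_smul h _ hw0) (hw₂ _ _ _)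

end PreFrame

end StandardWords

section GlueMatrix

/-- The syndrome of a word with respect to the standard code. -/
def ksum (u : J → ZMod 3) : Fin 4 → ZMod 3 := ∑ j, u j • gcol j

lemma ksum_add (u u' : J → ZMod 3) : ksum (u + u') = ksum u + ksum u' := by
  simp only [ksum, Pi.add_apply, add_smul, Finset.sum_add_distrib]

lemma ksum_smul (a : ZMod 3) (u : J → ZMod 3) : ksum (a • u) = a • ksum u := by
  simp only [ksum, Pi.smul_apply, smul_eq_mul, mul_smul, Finset.smul_sum]

lemma ksum_zero : ksum 0 = 0 := by simp [ksum]

lemma sum_word_mul (z : Fin 4 → ZMod 3) (t : J → ZMod 3) : ∑ j, word z j * t j = z ⬝ᵥ ksum t := by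
  simp only [ksum, dotProduct_sum, dotProduct_smul, word, smul_eq_mul, mul_comm (t _)]

lemma ksum_surjective (y : Fin 4 → ZMod 3) : ∃ u, ksum u = y := by
  refine ⟨fun j => match j with
    | none => y 0 - y 1 - y 2
    | some none => y 3
    | some (some ((β, t), b)) => if t = 0 ∧ b = false then (bif β then y 2 else y 1) else 0, ?_⟩
  rw [ksum, sum_J, sum_Pr]
  ext k
  fin_cases k <;> simp [gcol, sg, show (2 : ZMod 3) ≠ 0 by decide]

lemma word_injective : Function.Injective word := fun z z' hz => by
  have h0 := congrFun hz none
  have h3 := congrFun hz (some none)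
  have h1 := congrFun hz (pl (false, 0) false)
  have h2 := congrFun hz (pl (true, 0) false)
  simp only [word_none, word_last, word_false, word_true, sg] at h0 h1 h2 h3
  ext k
  fin_cases k
  · exact h0
  · simpa [h0] using h1
  · simpa [h0] using h2
  · exact h3

/-- The code of `L` with respect to `v` is the standard one with glue matrix `B`. -/
def HasB (L : AddSubgroup E14) (v : J → E14) (B : Matrix (Fin 4) (Fin 4) (ZMod 3)) : Prop :=
  ∀ c u, InCode L v c u ↔ ∃ z, c = word z ∧ ksum u = B *ᵥ z

variable {L : AddSubgroup E14} {X : Finset E14} {v w : J → E14} {c c' u t : J → ZMod 3}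
  {B B' M N : Matrix (Fin 4) (Fin 4) (ZMod 3)}

lemma HasB.unique (hB : HasB L v B) (hB' : HasB L v B') : B = B' := by
  refine Matrix.ext_of_mulVec_single fun k => ?_
  obtain ⟨u, hu⟩ := ksum_surjective (B *ᵥ Pi.single k 1)
  obtain ⟨z, hz, hz'⟩ := (hB' _ _).1 ((hB _ _).2 ⟨Pi.single k 1, rfl, hu⟩)
  rw [← hu, hz', word_injective hz]

lemma PreFrame.exists_hasB (h : GoodLat L X) (F : PreFrame L X v)
    (hstd : ∀ c, InC L v c ↔ ∃ z, c = word z) : ∃ B, Bᵀ = B ∧ HasB L v B := by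
  have h0 (t : J → ZMod 3) : InCode L v 0 t ↔ ksum t = 0 := by
    rw [F.inCode_zero_iff h]
    constructor
    · intro hall
      ext k
      obtain ⟨u, hu⟩ := (hstd (word (Pi.single k 1))).2 ⟨_, rfl⟩
      have := hall _ _ hu
      rw [sum_word_mul] at this
      simpa using this
    · intro ht c u hc
      obtain ⟨z, rfl⟩ := (hstd c).1 ⟨u, hc⟩
      rw [sum_word_mul, ht, dotProduct_zero]
  choose u hu using fun k : Fin 4 => (hstd (word (Pi.single k 1))).2 ⟨_, rfl⟩
  let B : Matrix (Fin 4) (Fin 4) (ZMod 3) := Matrix.of fun k l => ksum (u l) k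
  have hsum (z : Fin 4 → ZMod 3) : InCode L v (word z) (∑ k, z k • u k) := by
    have hz : z = ∑ k, z k • Pi.single k (1 : ZMod 3) := by
      ext l; simp [Finset.sum_apply, Pi.single_apply]
    have (s : Finset (Fin 4)) : InCode L v (word (∑ k ∈ s, z k • Pi.single k (1 : ZMod 3)))
        (∑ k ∈ s, z k • u k) := by
      induction s using Finset.induction_on with
      | empty =>
        simp only [Finset.sum_empty]
        have : word 0 = 0 := funext fun j => zero_dotProduct _
        rw [this]; exact F.inCode_zero h
      | insert a s ha ih =>
        rw [Finset.sum_insert ha, Finset.sum_insert ha, word_add, word_smul]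
        exact F.inCode_add h (F.inCode_smul h _ (hu a)) ih
    have h1 := this Finset.univ
    rwa [← hz] at h1
  have hk (z : Fin 4 → ZMod 3) : ksum (∑ k, z k • u k) = B *ᵥ z := by
    ext l
    simp only [Fin.sum_univ_four, ksum_add, ksum_smul, mulVec, dotProduct_four, B, of_apply,
      Pi.add_apply, Pi.smul_apply, smul_eq_mul, mul_comm]
  refine ⟨B, ?_, fun c u' => ⟨fun hc => ?_, ?_⟩⟩
  · ext k l
    have := ((F.inCode_dual h).1 (hu k) _ _ (hu l)).2
    simp only [Finset.sum_sub_distrib, sum_word_mul, mul_comm (u k _)] at this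
    simpa [sub_eq_zero, B, eq_comm] using this
  · obtain ⟨z, rfl⟩ := (hstd c).1 ⟨u', hc⟩
    refine ⟨z, rfl, ?_⟩
    have h1 := F.inCode_add h hc (F.inCode_smul h (-1) (hsum z))
    rw [neg_one_smul, neg_one_smul, add_neg_cancel, h0, ksum_add, ← neg_one_smul (ZMod 3),
      ksum_smul, neg_one_smul, hk] at h1
    exact add_neg_eq_zero.1 h1
  · rintro ⟨z, rfl, hz⟩
    have h1 : InCode L v 0 (u' + (-1 : ZMod 3) • ∑ k, z k • u k) := by
      rw [h0, ksum_add, ksum_smul, hk, hz, neg_one_smul, add_neg_cancel]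
    simpa using F.inCode_add h h1 (hsum z)

lemma cc_mul_self_of_unit {e : ℂ} (he : e ∈ units6) : cc e * cc e = 1 := by
  obtain ⟨h1, h2⟩ := mem_units6.1 he
  have := cc_mul (star_mem_𝓞 h1) h1
  rw [cc_conj h1, conj_mul', ← ofReal_pow, h2, ofReal_one, cc_one] at this
  exact this.symm

lemma inCode_monomial (hw : ∀ x ∈ L, ∀ j, inner ℂ (w j) x ∈ 𝓞) (r : Equiv.Perm J) {e : J → ℂ}
    (he : ∀ j, e j ∈ units6) (hv : ∀ j, v j = e j • w (r j)) :
    InCode L v c u ↔ InCode L w (fun i => cc (e (r.symm i)) * c (r.symm i))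
      (fun i => cc (e (r.symm i)) * u (r.symm i) + uu (e (r.symm i)) * c (r.symm i)) := by
  refine exists_congr fun x => and_congr_right fun hx => ?_
  rw [← r.forall_congr_right (q := fun i => cc (inner ℂ (w i) x) = _ ∧ uu (inner ℂ (w i) x) = _)]
  refine forall_congr' fun j => ?_
  have he𝓞 := (mem_units6.1 (he j)).1
  have hcc := cc_mul_self_of_unit (he j)
  rw [hv, inner_smul_left, cc_mul (star_mem_𝓞 he𝓞) (hw x hx _), uu_mul (star_mem_𝓞 he𝓞) (hw x hx _),
    cc_conj he𝓞, uu_conj he𝓞, r.symm_apply_apply]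
  generalize cc (e j) = a at hcc
  generalize uu (e j) = b
  generalize cc (inner ℂ (w (r j)) x) = s
  generalize uu (inner ℂ (w (r j)) x) = t
  constructor
  · rintro ⟨h1, h2⟩
    exact ⟨by linear_combination -s * hcc + a * h1,
      by linear_combination (-t) * hcc + a * h2 + b * h1⟩
  · rintro ⟨h1, h2⟩
    exact ⟨by linear_combination c j * hcc + a * h1,
      by linear_combination u j * hcc + a * h2 - b * h1⟩

lemma HasB.monomial (hB : HasB L w B) (hw : ∀ x ∈ L, ∀ j, inner ℂ (w j) x ∈ 𝓞) (r : Equiv.Perm J)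
    {e : J → ℂ} (he : ∀ j, e j ∈ units6) (hv : ∀ j, v j = e j • w (r j)) (hNM : N * M = 1)
    (hM : ∀ j, cc (e j) • gcol (r j) = M *ᵥ gcol j) :
    HasB L v (N * B * Nᵀ - ∑ j, (cc (e j) * uu (e j)) • vecMulVec (gcol j) (gcol j)) := by
  have hMN : M * N = 1 := mul_eq_one_comm.1 hNM
  have hMN' : Mᵀ * Nᵀ = 1 := by rw [← transpose_mul, hNM, transpose_one]
  have hNM' : Nᵀ * Mᵀ = 1 := by rw [← transpose_mul, hMN, transpose_one]
  intro c u
  rw [inCode_monomial hw r he hv, hB]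
  have hword (z : Fin 4 → ZMod 3) : ((fun i => cc (e (r.symm i)) * c (r.symm i)) = word z) ↔
      c = word (Mᵀ *ᵥ z) := by
    simp only [funext_iff]
    rw [← r.forall_congr_right]
    refine forall_congr' fun j => ?_
    rw [r.symm_apply_apply]
    have h1 : word (Mᵀ *ᵥ z) j = cc (e j) * word z (r j) := by
      rw [word, word, mulVec_transpose, ← dotProduct_mulVec, ← hM, dotProduct_smul, smul_eq_mul]
    rw [h1]
    have hcc := cc_mul_self_of_unit (he j)
    constructor
    · intro h2
      linear_combination cc (e j) * h2 - c j * hcc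
    · intro h2
      linear_combination cc (e j) * h2 + word z (r j) * hcc
  have hks (z : Fin 4 → ZMod 3) (hc : c = word z) :
      ksum (fun i => cc (e (r.symm i)) * u (r.symm i) + uu (e (r.symm i)) * c (r.symm i)) =
      M *ᵥ (ksum u + (∑ j, (cc (e j) * uu (e j)) • vecMulVec (gcol j) (gcol j)) *ᵥ z) := by
    rw [ksum, ← Equiv.sum_comp r]
    simp only [r.symm_apply_apply, ksum, mulVec_add, mulVec_sum, Matrix.sum_mulVec, mulVec_smul,
      ← hM, smul_mulVec, vecMulVec_mulVec, ← Finset.sum_add_distrib]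
    refine Finset.sum_congr rfl fun j _ => ?_
    rw [hc, word, dotProduct_comm]
    have hcc := cc_mul_self_of_unit (he j)
    ext k
    simp
    linear_combination (-uu (e j) * (gcol j ⬝ᵥ z) * gcol (r j) k) * hcc
  constructor
  · rintro ⟨z, hz, hz'⟩
    rw [hword] at hz
    refine ⟨_, hz, ?_⟩
    rw [hks _ hz] at hz'
    have := congrArg (N *ᵥ ·) hz'
    simp only [mulVec_mulVec, hNM, one_mulVec] at this
    rw [sub_mulVec, ← mulVec_mulVec _ (N * B), mulVec_mulVec _ Nᵀ, hNM', one_mulVec, ← this]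
    simp
  · rintro ⟨z, hz, hz'⟩
    refine ⟨Nᵀ *ᵥ z, (hword _).2 (by rw [mulVec_mulVec, hMN', one_mulVec]; exact hz), ?_⟩
    rw [hks z hz, hz', sub_mulVec, sub_add_cancel, mulVec_mulVec, mulVec_mulVec, ← mul_assoc,
      ← mul_assoc, hMN, one_mul]

end GlueMatrix

section NormalForm

/-- The glue matrix of the standard code. -/
def B₀ : Matrix (Fin 4) (Fin 4) (ZMod 3) := !![0, 0, 0, 0; 0, 0, 1, 0; 0, 1, 0, 0; 0, 0, 0, 0]

/-- The quadratic moments of a phase vector. -/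
def qmom (a : J → ZMod 3) : Matrix (Fin 4) (Fin 4) (ZMod 3) :=
  ∑ j, a j • vecMulVec (gcol j) (gcol j)

lemma qmom_apply (a : J → ZMod 3) (k l : Fin 4) :
    qmom a k l = ∑ j, a j * (gcol j k * gcol j l) := by
  simp [qmom, Matrix.sum_apply, vecMulVec_apply]

lemma qmom_add (a b : J → ZMod 3) : qmom (a + b) = qmom a + qmom b := by
  simp [qmom, add_smul, Finset.sum_add_distrib]

lemma qmom_transpose (a : J → ZMod 3) : (qmom a)ᵀ = qmom a := by
  ext k l
  simp only [transpose_apply, qmom_apply, mul_comm]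

lemma qmom_one_two (a : J → ZMod 3) : qmom a 1 2 = 0 := by
  rw [qmom_apply]
  refine Finset.sum_eq_zero fun j _ => ?_
  have : ∀ j, gcol j 1 * gcol j 2 = 0 := by decide
  rw [this, mul_zero]

/-- The coefficients of the phases that correct the entry `(k, l)` of a symmetric matrix. -/
def clearCoef (k l : Fin 4) : J → ZMod 3 :=
  let e (k' l' : Fin 4) : ZMod 3 := if k = k' ∧ l = l' then 1 else 0
  fun
  | none => 0
  | some none => e 0 3 - e 0 0 + e 1 1 + e 2 2 - e 3 3
  | some (some ((false, t), b)) =>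
    if t = 0 then e 0 0 - e 0 3 + sg b * e 0 1
    else if t = sg b then e 1 1 - e 0 0 + t * e 1 3 else e 0 3
  | some (some ((true, t), b)) =>
    if t = 0 then sg b * e 0 2 else if t = sg b then 0 else e 2 2 + t * e 2 3

lemma sum_clearCoef : ∀ k l m n : Fin 4, ∑ j, clearCoef k l j * (gcol j m * gcol j n) =
    if k ≤ l ∧ ¬(k = 1 ∧ l = 2) ∧ (m = k ∧ n = l ∨ m = l ∧ n = k) then -1 else 0 := by
  decide +kernel

/-- The phases removing all entries of a symmetric glue matrix apart from the one in position
`(1, 2)`. -/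
def clearPhase (B : Matrix (Fin 4) (Fin 4) (ZMod 3)) (j : J) : ZMod 3 :=
  ∑ k, ∑ l, B k l * clearCoef k l j

lemma clearPhase_none (B : Matrix (Fin 4) (Fin 4) (ZMod 3)) : clearPhase B none = 0 := by
  simp [clearPhase, clearCoef]

lemma qmom_clearPhase (B : Matrix (Fin 4) (Fin 4) (ZMod 3)) (hB : Bᵀ = B) :
    B + qmom (clearPhase B) = B 1 2 • B₀ := by
  have hs (i j) : B i j = B j i := congrFun (congrFun hB j) i
  ext m n
  have : qmom (clearPhase B) m n = ∑ k, ∑ l, B k l *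
      if k ≤ l ∧ ¬(k = 1 ∧ l = 2) ∧ (m = k ∧ n = l ∨ m = l ∧ n = k) then -1 else 0 := by
    simp only [qmom_apply, clearPhase, ← sum_clearCoef, Finset.sum_mul, Finset.mul_sum]
    rw [Finset.sum_comm]
    refine Finset.sum_congr rfl fun k _ => ?_
    rw [Finset.sum_comm]
    simp only [mul_assoc]
  rw [Matrix.add_apply, this]
  simp only [Fin.sum_univ_four]
  fin_cases m <;> fin_cases n <;> simp [B₀, hs 1 0, hs 2 0, hs 3 0, hs 2 1, hs 3 1, hs 3 2]

end NormalForm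

section StandardFrame

variable {L : AddSubgroup E14} {X : Finset E14} {v w : J → E14}
  {B : Matrix (Fin 4) (Fin 4) (ZMod 3)}

namespace PreFrame

lemma phase (F : PreFrame L X v) (h : GoodLat L X) (a : J → ℕ) (ha : a none = 0) :
    PreFrame L X fun j => ω ^ a j • v j := by
  refine ⟨⟨fun j => h.smul_mem _ (ω_pow_mem _) _ (F.mem j), fun j k => ?_⟩, fun p j k => ?_,
    fun x hx hvx => ?_⟩
  · rw [inner_smul_left, inner_smul_right, F.orth]
    split_ifs with hjk
    · subst hjk
      linear_combination 3 * conj_ω_pow_mul (a j)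
    · simp
  · simpa [ha, smul_smul, ← pow_add] using F.glue p (j + a (pl p false)) (k + a (pl p true))
  · simp only [ha, pow_zero, one_smul] at hvx ⊢
    obtain ⟨p, j, k, rfl⟩ := F.cover x hx hvx
    refine ⟨p, j + 2 * a (pl p false), k + 2 * a (pl p true), ?_⟩
    rw [smul_smul, smul_smul, ← pow_add, ← pow_add, ω_pow_congr (m := j + 2 * _ + _) (n := j)
      (by omega), ω_pow_congr (m := k + 2 * _ + _) (n := k) (by omega)]

/-- A permutation of the coordinates exchanging the two nontrivial fibres of the first block and
the two signs of the second one. -/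
def flip : Equiv.Perm J :=
  Function.Involutive.toPerm (fun j => j.map fun k => k.map fun p =>
    ((p.1.1, if p.1.1 then p.1.2 else -p.1.2), xor (!p.1.1) p.2)) (by unfold Function.Involutive; decide +kernel)

lemma exists_hasB₀_of_hasB (h : GoodLat L X) (F : PreFrame L X v) (hs : Bᵀ = B)
    (hB : HasB L v B) : ∃ v', PreFrame L X v' ∧ v' none = v none ∧ HasB L v' B₀ := by
  set a : J → ℕ := fun j => (clearPhase B j).val with ha
  have ha0 : a none = 0 := by simp [ha, clearPhase_none]
  have F1 := F.phase h a ha0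
  have hB1 : HasB L (fun j => ω ^ a j • v j) (B 1 2 • B₀) := by
    have := hB.monomial (e := fun j => ω ^ a j) (M := 1) (N := 1) (fun x hx j => F.inner_mem h hx j)
      1 (fun j => ω_pow_mem_units6 _) (fun j => rfl) (one_mul _) (fun j => by simp [cc_ω_pow])
    have he : ∑ j, (cc (ω ^ a j) * uu (ω ^ a j)) • vecMulVec (gcol j) (gcol j) =
        -qmom (clearPhase B) := by
      simp [cc_ω_pow, uu_ω_pow, qmom, ha]
    rwa [he, one_mul, transpose_one, mul_one, sub_neg_eq_add, qmom_clearPhase B hs] at this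
  have hv1 : ω ^ a none • v none = v none := by simp [ha0]
  rcases zmod3_cases (B 1 2) with hb | hb | hb
  · rw [hb, zero_smul] at hB1
    have h1 := F1.nine_le h ((hB1 (word ![0, 1, 0, 0]) 0).2 ⟨_, rfl, by simp [ksum_zero]⟩)
      (fun h0 => absurd (congrFun h0.1 (pl (false, 0) false)) (by decide))
    exact absurd h1 (by decide +kernel)
  · rw [hb, one_smul] at hB1
    exact ⟨_, F1, hv1, hB1⟩
  · rw [hb] at hB1
    have F2 := F1.relabel ⟨fun p => (p.1, if p.1 then p.2 else -p.2),
      fun p => (p.1, if p.1 then p.2 else -p.2), by decide, by decide⟩ (fun p => !p.1)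
    refine ⟨_, F2, hv1, ?_⟩
    have := hB1.monomial (e := fun _ => 1) (M := diagonal ![1, -1, 1, 1])
      (N := diagonal ![1, -1, 1, 1]) (fun x hx j => F1.inner_mem h hx j) flip
      (fun j => by simpa using ω_pow_mem_units6 0) (fun j => (one_smul _ _).symm)
      (by decide) (fun j => by rw [cc_one, one_smul]; revert j; decide +kernel)
    simp only [uu_one, mul_zero, zero_smul, Finset.sum_const_zero, sub_zero] at this
    rwa [show diagonal ![1, -1, 1, 1] * ((2 : ZMod 3) • B₀) * (diagonal ![1, -1, 1, 1])ᵀ = B₀ by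
      decide +kernel] at this

end PreFrame

lemma GoodLat.exists_frame (h : GoodLat L X) {v₀ : E14} (hv : v₀ ∈ X) :
    ∃ v, PreFrame L X v ∧ v none = v₀ ∧ HasB L v B₀ := by
  obtain ⟨w, hw⟩ := h.exists_pairSystem hv
  obtain ⟨f, hf⟩ := exists_preFrame h hv hw
  obtain ⟨v, F, hv0, hstd⟩ := hf.exists_standard h
  obtain ⟨B, hs, hB⟩ := F.exists_hasB h hstd
  obtain ⟨v', F', hv', hB'⟩ := F.exists_hasB₀_of_hasB h hs hB
  exact ⟨v', F', by rw [hv', hv0]; rfl, hB'⟩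

end StandardFrame

section Phases

/-- Extension by zero at `none`. -/
def extZero (a : Option (Pr × Bool) → ZMod 3) (j : J) : ZMod 3 := j.elim 0 a

/-- The positions of the entries of a quadratic moment that can be prescribed. -/
def momentPos : Fin 9 → Fin 4 × Fin 4 :=
  ![(0, 0), (0, 1), (0, 2), (0, 3), (1, 1), (1, 3), (2, 2), (2, 3), (3, 3)]

/-- The independent entries of the quadratic moments. -/
def momentHom : (Option (Pr × Bool) → ZMod 3) →+ (Fin 9 → ZMod 3) where
  toFun a i := qmom (extZero a) (momentPos i).1 (momentPos i).2
  map_zero' := by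
    ext i
    have : extZero 0 = 0 := by ext (_ | _) <;> rfl
    simp [this, qmom]
  map_add' a b := by
    ext i
    have : extZero (a + b) = extZero a + extZero b := by ext (_ | _) <;> simp [extZero]
    simp [this, qmom_add]

lemma momentHom_surjective : Function.Surjective momentHom := fun y => by
  refine ⟨fun k => -∑ i, y i * clearCoef (momentPos i).1 (momentPos i).2 (some k), ?_⟩
  ext i
  have h1 : ∀ j, extZero (fun k => -∑ i, y i * clearCoef (momentPos i).1 (momentPos i).2 (some k)) j
      = -∑ i, y i * clearCoef (momentPos i).1 (momentPos i).2 j := by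
    rintro (_ | k)
    · simp [extZero, clearCoef]
    · rfl
  change qmom _ _ _ = _
  simp only [qmom_apply, h1, neg_mul, Finset.sum_neg_distrib, Finset.sum_mul]
  rw [Finset.sum_comm]
  simp only [mul_assoc, ← Finset.mul_sum, sum_clearCoef]
  rw [Finset.sum_eq_single i]
  · have : ∀ i, (momentPos i).1 ≤ (momentPos i).2 ∧ ¬((momentPos i).1 = 1 ∧ (momentPos i).2 = 2) := by
      decide
    simp [this i]
  · intro k _ hk
    have : ∀ k i, k ≠ i → ¬((momentPos k).1 ≤ (momentPos k).2 ∧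
        ¬((momentPos k).1 = 1 ∧ (momentPos k).2 = 2) ∧
        ((momentPos i).1 = (momentPos k).1 ∧ (momentPos i).2 = (momentPos k).2 ∨
        (momentPos i).1 = (momentPos k).2 ∧ (momentPos i).2 = (momentPos k).1)) := by decide +kernel
    rw [if_neg (this k i hk), mul_zero]
  · simp

lemma card_momentHom (y : Fin 9 → ZMod 3) :
    (Finset.univ.filter fun a => momentHom a = y).card = 81 := by
  have h := Finset.card_eq_sum_card_fiberwise (f := momentHom) (s := Finset.univ)
    (t := Finset.univ) (fun _ _ => Finset.mem_coe.2 (Finset.mem_univ _))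
  rw [Finset.sum_congr rfl fun z _ => AddMonoidHom.card_fiber_eq_of_mem_range momentHom
    (momentHom_surjective z) (momentHom_surjective y)] at h
  simp only [Finset.sum_const, Finset.card_univ, Fintype.card_fun, ZMod.card, Fintype.card_option,
    Fintype.card_prod, Fintype.card_bool, Fintype.card_fin, smul_eq_mul] at h
  omega

lemma momentHom_eq_iff {C : Matrix (Fin 4) (Fin 4) (ZMod 3)} (hC : Cᵀ = C) (h12 : C 1 2 = 0)
    (a : Option (Pr × Bool) → ZMod 3) :
    momentHom a = (fun i => C (momentPos i).1 (momentPos i).2) ↔ qmom (extZero a) = C := by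
  refine ⟨fun h => ?_, fun h => by rw [← h]; rfl⟩
  have hs (i j) : C i j = C j i := congrFun (congrFun hC j) i
  have hq (i j) : qmom (extZero a) i j = qmom (extZero a) j i :=
    congrFun (congrFun (qmom_transpose _) j) i
  have h' (i) : qmom (extZero a) (momentPos i).1 (momentPos i).2 = _ := congrFun h i
  have key : ∀ i j : Fin 4, (i = 1 ∧ j = 2) ∨ (i = 2 ∧ j = 1) ∨ (∃ k, momentPos k = (i, j)) ∨
      ∃ k, momentPos k = (j, i) := by decide
  ext i j
  rcases key i j with ⟨rfl, rfl⟩ | ⟨rfl, rfl⟩ | ⟨k, hk⟩ | ⟨k, hk⟩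
  · rw [qmom_one_two, h12]
  · rw [hq, hs, qmom_one_two, h12]
  · simpa [hk] using h' k
  · rw [hq, hs]
    simpa [hk] using h' k

end Phases

section FrameMatrices

/-- The sign pattern of a frame change. -/
def frameSign (η : Bool) (j : J) : ZMod 3 := if j = some none then sg η else 1

/-- The matrix with prescribed action on the columns of the generator matrix of the standard
code. -/
def frameMat (d : (Pr × Bool) × (Pr × Bool) × Bool) : Matrix (Fin 4) (Fin 4) (ZMod 3) :=
  of fun i => ![gcol none i, gcol (some (some d.1)) i - gcol none i,
    gcol (some (some d.2.1)) i - gcol none i, sg d.2.2 * gcol (some none) i]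

/-- The position of a column of the generator matrix. -/
def colIdx (c : Fin 4 → ZMod 3) : J :=
  if c 1 ≠ 0 then pl (false, c 3 * c 1) (c 1 ≠ 1)
  else if c 2 ≠ 0 then pl (true, c 3 * c 2) (c 2 ≠ 1)
  else if c 3 ≠ 0 then some none else none

/-- The action of a frame matrix on positions. -/
def frameMap (d : (Pr × Bool) × (Pr × Bool) × Bool) (j : J) : J := colIdx (frameMat d *ᵥ gcol j)

/-- The parameters of the frames with a given first vector. -/
def ValidFrame (d : (Pr × Bool) × (Pr × Bool) × Bool) : Prop :=
  frameMat d 1 1 * frameMat d 2 2 + frameMat d 1 2 * frameMat d 2 1 = 1 ∧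
  ∀ j, frameMat d *ᵥ gcol j = frameSign d.2.2 j • gcol (frameMap d j)

instance : DecidablePred ValidFrame := fun _ => by unfold ValidFrame; infer_instance

lemma card_validFrame : (Finset.univ.filter ValidFrame).card = 36 := by decide +kernel

lemma colIdx_gcol : ∀ (η : Bool) (j : J), colIdx (frameSign η j • gcol j) = j := by decide +kernel

lemma frameMat_mul_apply (d : (Pr × Bool) × (Pr × Bool) × Bool) :
    (frameMat d * B₀ * (frameMat d)ᵀ) 1 2 =
      frameMat d 1 1 * frameMat d 2 2 + frameMat d 1 2 * frameMat d 2 1 := by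
  simp [Matrix.mul_apply, Fin.sum_univ_four, B₀]
  ring

lemma isUnit_frameMat {d : (Pr × Bool) × (Pr × Bool) × Bool} (hd : ValidFrame d) :
    IsUnit (frameMat d) := by
  rw [← Matrix.mulVec_injective_iff_isUnit]
  refine (injective_iff_map_eq_zero (frameMat d).mulVecLin).2 fun z hz => ?_
  have h12 : ∀ j, gcol j 1 * gcol j 2 = 0 := by decide
  have h1 : frameMat d 1 1 * frameMat d 2 1 = 0 := by
    simpa [frameMat, gcol] using h12 (some (some d.1))
  have h0 (i : Fin 4) := congrFun hz i
  simp only [mulVecLin_apply, mulVec, dotProduct_four, Pi.zero_apply] at h0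
  have e0 (i : Fin 4) : frameMat d i 0 = ![1, 0, 0, 0] i := rfl
  have e3 (i : Fin 4) : frameMat d i 3 = sg d.2.2 * ![0, 0, 0, 1] i := rfl
  have r0 := h0 0
  have r1 := h0 1
  have r2 := h0 2
  have r3 := h0 3
  simp only [e0, e3] at r0 r1 r2 r3
  simp at r0 r1 r2 r3
  have hd1 := hd.1
  generalize frameMat d 1 1 = p at *
  generalize frameMat d 1 2 = q at *
  generalize frameMat d 2 1 = r at *
  generalize frameMat d 2 2 = s at *
  have hdet : (p * s - q * r) * (p * s - q * r) = 1 := by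
    linear_combination (p * s + q * r + 1) * hd1 - 4 * q * s * h1
  have z1 : z 1 = 0 := by
    linear_combination -(z 1) * hdet + (p * s - q * r) * (s * r1 - q * r2)
  have z2 : z 2 = 0 := by
    linear_combination -(z 2) * hdet + (p * s - q * r) * (p * r2 - r * r1)
  have hsg : sg d.2.2 ≠ 0 := by
    have : ∀ b, sg b ≠ 0 := by decide
    exact this _
  ext i
  fin_cases i
  · simpa [z1, z2] using r0
  · exact z1
  · exact z2
  · simpa [z1, z2, hsg] using r3

lemma frameMap_injective {d : (Pr × Bool) × (Pr × Bool) × Bool} (hd : ValidFrame d) :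
    Function.Injective (frameMap d) := fun j k h => by
  have hj := hd.2 j
  have hk := hd.2 k
  rw [h] at hj
  have hinj := (Matrix.mulVec_injective_iff_isUnit.2 (isUnit_frameMat hd))
  have hs : ∀ (η : Bool) (i : J), frameSign η i * frameSign η i = 1 := by decide
  have : frameSign d.2.2 j • gcol j = frameSign d.2.2 k • gcol k := by
    apply hinj
    rw [mulVec_smul, mulVec_smul, hj, hk, smul_smul, smul_smul, hs, hs]
  rw [← colIdx_gcol d.2.2 j, this, colIdx_gcol]

end FrameMatrices

section FrameChange

lemma units6_eq {c : ℂ} (hc : c ∈ units6) : ∃ n : ℕ, c = ω ^ n ∨ c = -ω ^ n := by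
  simp only [units6, Finset.mem_insert, Finset.mem_singleton] at hc
  rcases hc with rfl | rfl | rfl | rfl | rfl | rfl
  · exact ⟨0, .inl (pow_zero _).symm⟩
  · exact ⟨1, .inl (pow_one _).symm⟩
  · exact ⟨2, .inl (by linear_combination -ω_sq)⟩
  · exact ⟨0, .inr (by rw [pow_zero])⟩
  · exact ⟨1, .inr (by rw [pow_one])⟩
  · exact ⟨2, .inr (by linear_combination ω_sq)⟩

lemma ω_pow_re (n : ℕ) : -1 / 2 ≤ (ω ^ n).re := by
  rw [ω_pow_mod]
  have := Nat.mod_lt n (show 0 < 3 by norm_num)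
  interval_cases n % 3
  · norm_num
  · rw [pow_one, ω_re]
  · rw [pow_two, ω_sq]; simp [ω_re]; norm_num

lemma three_mul_ne_sum_ω_pow (n : ℕ) (g : Fin 3 → ℕ) : -ω ^ n * 3 ≠ ∑ i, ω ^ g i := fun h => by
  have h1 : (-3 : ℂ) = ∑ i, ω ^ (g i + 2 * n) := by
    simp only [pow_add, ← Finset.sum_mul, ← h]
    have : ω ^ n * ω ^ (2 * n) = 1 := by
      rw [← pow_add, show n + 2 * n = 3 * n by ring, pow_mul, ω_pow_three, one_pow]
    linear_combination 3 * this
  have h2 := congrArg re h1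
  rw [Fin.sum_univ_three] at h2
  simp only [add_re, neg_re, re_ofNat] at h2
  linarith [ω_pow_re (g 0 + 2 * n), ω_pow_re (g 1 + 2 * n), ω_pow_re (g 2 + 2 * n)]

lemma norm_sq_eq_sum_of_gram {v : J → E14}
    (hv : ∀ j k, inner ℂ (v j) (v k) = if j = k then 3 else 0) (x : E14) :
    3 * ‖x‖ ^ 2 = ∑ j, ‖inner ℂ (v j) x‖ ^ 2 := by
  have h := inner_eq_sum_of_gram hv x x
  rw [inner_self_ofReal, eq_div_iff (by norm_num)] at h
  simp only [← normSq_eq_conj_mul_self, normSq_eq_norm_sq] at h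
  rw [mul_comm]
  exact_mod_cast h

variable {L : AddSubgroup E14} {X : Finset E14} {v w : J → E14}

lemma OFrame.mem_X (F : OFrame L v) (h : GoodLat L X) (j : J) : v j ∈ X := by
  refine (h.mem_X _).2 ⟨F.mem j, ?_⟩
  have := F.orth j j
  rw [if_pos rfl, inner_self_ofReal] at this
  exact_mod_cast this

lemma OFrame.glue_of_hasB (F : OFrame L v) (h : GoodLat L X)
    {B : Matrix (Fin 4) (Fin 4) (ZMod 3)} (hB : HasB L v B) (p : Pr) (m n : ℕ) :
    θ⁻¹ • (v none + ω ^ m • v (pl p false) + ω ^ n • v (pl p true)) ∈ L := by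
  set e : J → ℂ := fun j => if j = none then 1 else if j = pl p false then ω ^ m else
    if j = pl p true then ω ^ n else 0 with he
  have hi (j : J) : inner ℂ (v j)
      (θ⁻¹ • (v none + ω ^ m • v (pl p false) + ω ^ n • v (pl p true))) = -(e j * θ) := by
    have hθ : θ⁻¹ * 3 = -θ := by
      rw [inv_mul_eq_iff_eq_mul₀ θ_ne]; linear_combination θ_sq
    simp only [inner_smul_right, inner_add_right, F.orth, he]
    rcases j with _ | _ | ⟨q, _ | _⟩
    · simp [hθ]
    · simp
    · by_cases hq : q = p <;> simp [hq]
      linear_combination ω ^ m * hθ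
    · by_cases hq : q = p <;> simp [hq]
      linear_combination ω ^ n * hθ
  have hm (j : J) : e j ∈ 𝓞 := by
    simp only [he]
    split_ifs
    exacts [one_mem _, ω_pow_mem m, ω_pow_mem n, zero_mem _]
  rw [F.mem_iff h]
  simp only [hi]
  refine ⟨fun j => neg_mem (mul_mem (hm j) θ_mem), ?_⟩
  simp only [cc_neg (mul_mem (hm _) θ_mem), uu_neg (mul_mem (hm _) θ_mem), cc_mul (hm _) θ_mem,
    uu_mul (hm _) θ_mem, cc_θ, uu_θ, mul_zero, mul_one, add_zero, neg_zero]
  refine (hB _ _).2 ⟨0, by ext j; simp [word], ?_⟩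
  have h3 : ∀ p : Pr, gcol none + gcol (pl p false) + gcol (pl p true) = 0 := by decide
  rw [mulVec_zero, ← neg_eq_zero, ← h3 p, ksum]
  have hsum : ∀ j, -cc (e j) • gcol j = -((if j = none then gcol j else 0) +
      (if j = pl p false then gcol j else 0) + (if j = pl p true then gcol j else 0)) := by
    rintro (_ | _ | ⟨q, _ | _⟩)
    · simp [he, cc_one]
    · simp [he, cc_zero]
    · by_cases hq : q = p <;> simp [he, hq, cc_zero, cc_ω_pow]
    · by_cases hq : q = p <;> simp [he, hq, cc_zero, cc_ω_pow]
  simp only [hsum, Finset.sum_neg_distrib, neg_neg, Finset.sum_add_distrib, Finset.sum_ite_eq',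
    Finset.mem_univ, if_true]

lemma PreFrame.eq_ω_pow_smul (F : PreFrame L X w) (h : GoodLat L X) {x y : E14} (hy : y ∈ X)
    (h0 : inner ℂ (w none) y = 0) {q : Fin 3 → Pr} {g : Bool → Fin 3 → ℕ}
    (hS : ∀ i : Fin 3, ω ^ (i : ℕ) • x + y =
      ω ^ g false i • w (pl (q i) false) + ω ^ g true i • w (pl (q i) true)) :
    ∃ p b n, y = ω ^ n • w (pl p b) := by
  have hsum : (3 : ℂ) • y = ∑ i : Fin 3,
      (ω ^ g false i • w (pl (q i) false) + ω ^ g true i • w (pl (q i) true)) := by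
    simp only [← hS, Fin.sum_univ_three]
    have : (1 : ℂ) + ω + ω ^ 2 = 0 := by linear_combination ω_sq
    have h1 : (ω ^ 2 : ℂ) = -1 - ω := by linear_combination this
    simp only [Fin.val_zero, Fin.val_one, Fin.val_two, h1, pow_zero, pow_one]
    module
  have hi (j : J) : 3 * inner ℂ (w j) y = ∑ i : Fin 3,
      (ω ^ g false i * (if j = pl (q i) false then 3 else 0) +
        ω ^ g true i * (if j = pl (q i) true then 3 else 0)) := by
    rw [← inner_smul_right, hsum, inner_sum]
    simp only [inner_add_right, inner_smul_right, F.orth]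
  have hf : inner ℂ (w (some none)) y = 0 := by simpa using hi (some none)
  have hp (p : Pr) (b : Bool) :
      inner ℂ (w (pl p b)) y = ∑ i : Fin 3, if p = q i then ω ^ g b i else 0 := by
    have := hi (pl p b)
    rw [← mul_right_inj' (show (3 : ℂ) ≠ 0 by norm_num), this, Finset.mul_sum]
    refine Finset.sum_congr rfl fun i _ => ?_
    cases b <;> by_cases hq : p = q i <;> simp [hq, mul_comm]
  have hc (p : Pr) (b : Bool) :
      cc (inner ℂ (w (pl p b)) y) = ∑ i : Fin 3, if p = q i then 1 else 0 := by
    rw [hp, cc_sum]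
    · refine Finset.sum_congr rfl fun i _ => ?_
      split_ifs
      exacts [cc_ω_pow _, cc_zero]
    · intro i _
      split_ifs
      exacts [ω_pow_mem _, zero_mem _]
  have hq : q 1 = q 0 ∧ q 2 = q 0 := by
    have := F.pair_sum h (c := fun j => cc (inner ℂ (w j) y))
      (u := fun j => uu (inner ℂ (w j) y)) ⟨y, h.mem_of_X hy, fun j => ⟨rfl, rfl⟩⟩ (q 0)
    simp only [h0, cc_zero, hc, Fin.sum_univ_three, if_true, eq_comm (a := q 0)] at this
    by_cases h1 : q 1 = q 0 <;> by_cases h2 : q 2 = q 0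
    · exact ⟨h1, h2⟩
    all_goals
      simp only [h1, h2, if_true, if_false] at this
      exact absurd this (by decide)
  have hq' : ∀ i, q i = q 0 := fun i => by fin_cases i; exacts [rfl, hq.1, hq.2]
  have hn := norm_sq_eq_sum_of_gram F.orth y
  rw [sum_J, h0, hf, Finset.sum_eq_single (q 0)] at hn
  · have key : ∃ b, ‖inner ℂ (w (pl (q 0) b)) y‖ ^ 2 = 9 := by
      rw [h.norm_X hy] at hn
      simp only [norm_zero] at hn
      rcases h.norm_inner_cases hy (F.mem_X h (pl (q 0) false)) with h1 | h1 | h1 | h1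
      · exact ⟨true, by linarith⟩
      · rcases h.norm_inner_cases hy (F.mem_X h (pl (q 0) true)) with h2 | h2 | h2 | h2
        · linarith
        · linarith
        · linarith
        · exact ⟨true, h2⟩
      · rcases h.norm_inner_cases hy (F.mem_X h (pl (q 0) true)) with h2 | h2 | h2 | h2
        · linarith
        · linarith
        · linarith
        · exact ⟨true, h2⟩
      · exact ⟨false, h1⟩
    obtain ⟨b, hb⟩ := key
    obtain ⟨c, hc6, hyc⟩ := h.exists_smul_of_norm_inner hy (F.mem_X h _) hb
    obtain ⟨n, rfl | rfl⟩ := units6_eq hc6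
    · exact ⟨q 0, b, n, hyc⟩
    · have h3 := hp (q 0) b
      rw [hyc, inner_smul_right, F.orth, if_pos rfl] at h3
      simp only [hq', if_true] at h3
      exact absurd h3 (three_mul_ne_sum_ω_pow _ _)
  · intro p _ hpq
    rw [hp, hp]
    simp [hq', hpq]
  · simp

end FrameChange

section FrameMonomial

variable {L : AddSubgroup E14} {X : Finset E14} {v w : J → E14}

lemma OFrame.norm_glue (F : OFrame L v) (p : Pr) (m n : ℕ) :
    ‖θ⁻¹ • (v none + ω ^ m • v (pl p false) + ω ^ n • v (pl p true))‖ ^ 2 = 3 := by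
  have h1 : ‖v none + ω ^ m • v (pl p false) + ω ^ n • v (pl p true)‖ ^ 2 = 9 := by
    have := inner_self_ofReal (v none + ω ^ m • v (pl p false) + ω ^ n • v (pl p true))
    simp only [inner_add_left, inner_add_right, inner_smul_left, inner_smul_right, F.orth] at this
    simp at this
    have h9 : ((‖v none + ω ^ m • v (pl p false) + ω ^ n • v (pl p true)‖ ^ 2 : ℝ) : ℂ) =
        ((9 : ℝ) : ℂ) := by
      have h2 := conj_ω_pow_mul m
      have h3 := conj_ω_pow_mul n
      rw [map_pow] at h2 h3
      push_cast
      rw [← this]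
      linear_combination 3 * h2 + 3 * h3
    exact_mod_cast h9
  rw [norm_smul, mul_pow, h1, norm_inv, inv_pow, norm_θ_sq]
  norm_num

lemma OFrame.exists_pair_image (F' : OFrame L v) (h : GoodLat L X) (F : PreFrame L X w)
    {B : Matrix (Fin 4) (Fin 4) (ZMod 3)} (hB : HasB L v B) (h0 : v none = w none)
    (k : Pr × Bool) : ∃ k' n, v (some (some k)) = ω ^ n • w (some (some k')) := by
  obtain ⟨p, b⟩ := k
  have hg (m n : ℕ) : ∃ q a c, ω ^ m • v (pl p false) + ω ^ n • v (pl p true) =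
      ω ^ a • w (pl q false) + ω ^ c • w (pl q true) := by
    obtain ⟨q, a, c, hq⟩ := F.cover _ ((h.mem_X _).2 ⟨F'.glue_of_hasB h hB p m n,
      F'.norm_glue p m n⟩) (by
        rw [← h0]
        simp only [inner_smul_right, inner_add_right, F'.orth]
        simp
        rw [inv_mul_eq_iff_eq_mul₀ θ_ne]; linear_combination θ_sq)
    refine ⟨q, a, c, ?_⟩
    have := smul_right_injective E14 (inv_ne_zero θ_ne) hq
    rw [h0, add_assoc, add_assoc] at this
    exact add_left_cancel this
  have hw : inner ℂ (w none) (v (pl p b)) = 0 := by rw [← h0, F'.orth]; simp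
  cases b
  · choose q a c hq using fun i : Fin 3 => hg 0 i
    obtain ⟨p', b', n, h1⟩ := F.eq_ω_pow_smul h (x := v (pl p true)) (F'.mem_X h (pl p false)) hw
      (q := q) (g := fun b i => bif b then c i else a i) fun i => by
        rw [add_comm]; simpa using hq i
    exact ⟨(p', b'), n, h1⟩
  · choose q a c hq using fun i : Fin 3 => hg i 0
    obtain ⟨p', b', n, h1⟩ := F.eq_ω_pow_smul h (x := v (pl p false)) (F'.mem_X h (pl p true)) hw
      (q := q) (g := fun b i => bif b then c i else a i) fun i => by simpa using hq i
    exact ⟨(p', b'), n, h1⟩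

lemma OFrame.exists_monomial (F' : OFrame L v) (h : GoodLat L X) (F : PreFrame L X w)
    {B : Matrix (Fin 4) (Fin 4) (ZMod 3)} (hB : HasB L v B) (h0 : v none = w none) :
    ∃ (e : J → ℂ) (r : Equiv.Perm J), (∀ j, e j ∈ units6) ∧ e none = 1 ∧
      (∀ k, ∃ n : ℕ, e (some (some k)) = ω ^ n) ∧ r none = none ∧ r (some none) = some none ∧
      ∀ j, v j = e j • w (r j) := by
  choose r₀ n hr₀ using F'.exists_pair_image h F hB h0
  have hinj : Function.Injective r₀ := fun k k' hk => by
    by_contra hne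
    have h1 := F'.orth (some (some k)) (some (some k'))
    rw [if_neg (by simpa using hne), hr₀, hr₀, hk, inner_smul_left, inner_smul_right, F.orth,
      if_pos rfl] at h1
    simp [(pow_ne_zero_iff _).1 (ω_pow_ne 1)] at h1
  have hbij := Finite.injective_iff_bijective.1 hinj
  have hz (j : J) (hj : j ≠ some none) : inner ℂ (w j) (v (some none)) = 0 := by
    rcases j with _ | _ | k
    · rw [← h0, F'.orth]; simp
    · exact absurd rfl hj
    · obtain ⟨k, rfl⟩ := hbij.2 k
      have h1 := F'.orth (some (some k)) (some none)
      rw [hr₀, inner_smul_left] at h1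
      simpa [ω_pow_ne, (pow_ne_zero_iff _).1 (ω_pow_ne 1)] using h1
  have hn := norm_sq_eq_sum_of_gram F.orth (v (some none))
  rw [Finset.sum_eq_single (some none) (fun j _ hj => by rw [hz j hj]; simp) (by simp),
    h.norm_X (F'.mem_X h _)] at hn
  obtain ⟨c, hc, hvc⟩ := h.exists_smul_of_norm_inner (F'.mem_X h (some none)) (F.mem_X h (some none))
    (by rw [← hn]; norm_num)
  refine ⟨fun j => j.elim 1 fun j' => j'.elim c fun k => ω ^ n k,
    Equiv.optionCongr (Equiv.optionCongr (Equiv.ofBijective r₀ hbij)), ?_, rfl,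
    fun k => ⟨n k, rfl⟩, rfl, rfl, ?_⟩
  · rintro (_ | _ | k)
    exacts [one_mem_units6, hc, ω_pow_mem_units6 _]
  · rintro (_ | _ | k)
    exacts [by simpa using h0, hvc, hr₀ k]

end FrameMonomial

section FrameCount

variable {L : AddSubgroup E14} {X : Finset E14} {v w : J → E14}

/-- Orthogonal frames with the standard glue code. -/
def IsFrame (L : AddSubgroup E14) (v : J → E14) : Prop := OFrame L v ∧ HasB L v B₀

lemma HasB.monomial_of_mulVec {B N : Matrix (Fin 4) (Fin 4) (ZMod 3)} {e : J → ℂ} (hB : HasB L w B)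
    (hw : ∀ x ∈ L, ∀ j, inner ℂ (w j) x ∈ 𝓞) (r : Equiv.Perm J) (he : ∀ j, e j ∈ units6)
    (hv : ∀ j, v j = e j • w (r j)) (hN : ∀ j, N *ᵥ gcol (r j) = cc (e j) • gcol j) :
    HasB L v (N * B * Nᵀ - ∑ j, (cc (e j) * uu (e j)) • vecMulVec (gcol j) (gcol j)) := by
  have hN' (j : J) : N *ᵥ (cc (e j) • gcol (r j)) = gcol j := by
    rw [mulVec_smul, hN, smul_smul, cc_mul_self_of_unit (he j), one_smul]
  have hu : IsUnit N := by
    rw [← Matrix.mulVec_surjective_iff_isUnit]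
    intro y
    obtain ⟨u, rfl⟩ := ksum_surjective y
    refine ⟨∑ j, u j • cc (e j) • gcol (r j), ?_⟩
    simp only [mulVec_sum, mulVec_smul N (u _), hN', ksum]
  have hdet := (Matrix.isUnit_iff_isUnit_det N).1 hu
  refine hB.monomial hw r he hv (Matrix.mul_nonsing_inv N hdet) fun j => ?_
  rw [← hN' j, mulVec_mulVec, Matrix.nonsing_inv_mul N hdet, one_mulVec]

/-- The complex sign pattern of a frame change. -/
noncomputable def frameUnit (η : Bool) (j : J) : ℂ := if j = some none then (bif η then -1 else 1) else 1

lemma frameUnit_mem (η : Bool) (j : J) : frameUnit η j ∈ units6 := by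
  unfold frameUnit
  split_ifs
  · cases η <;> simp [units6]
  · exact one_mem_units6

lemma cc_frameUnit (η : Bool) (j : J) : cc (frameUnit η j) = frameSign η j := by
  unfold frameUnit frameSign
  split_ifs
  · cases η <;> simp [cc_one, cc_neg (one_mem _), sg]
  · exact cc_one

lemma uu_frameUnit (η : Bool) (j : J) : uu (frameUnit η j) = 0 := by
  unfold frameUnit
  split_ifs
  · cases η <;> simp [uu_one, uu_neg (one_mem _)]
  · exact uu_one

lemma mul_mem_units6 {a b : ℂ} (ha : a ∈ units6) (hb : b ∈ units6) : a * b ∈ units6 := by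
  rw [mem_units6] at *
  exact ⟨mul_mem ha.1 hb.1, by rw [norm_mul, mul_pow, ha.2, hb.2, one_mul]⟩

lemma frameMap_last (d : (Pr × Bool) × (Pr × Bool) × Bool) : frameMap d (some none) = some none := by
  have : frameMat d *ᵥ gcol (some none) = frameSign d.2.2 (some none) • gcol (some none) := by
    ext i
    simp [mulVec, frameMat, gcol, frameSign]
  rw [frameMap, this, colIdx_gcol]

lemma colIdx_gcol' (j : J) : colIdx (gcol j) = j := by
  simpa [frameSign, sg] using colIdx_gcol false j

lemma frameMap_none (d : (Pr × Bool) × (Pr × Bool) × Bool) : frameMap d none = none := by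
  have : frameMat d *ᵥ gcol none = gcol none := by
    ext i
    simp [mulVec, frameMat, gcol]
  rw [frameMap, this, colIdx_gcol']

lemma frameMap_false (d : (Pr × Bool) × (Pr × Bool) × Bool) :
    frameMap d (pl (false, 0) false) = some (some d.1) := by
  have : frameMat d *ᵥ gcol (pl (false, 0) false) = gcol (some (some d.1)) := by
    ext i
    rw [mulVec, dotProduct_four]
    simp [frameMat, gcol, sg]
  rw [frameMap, this, colIdx_gcol']

lemma frameMap_true (d : (Pr × Bool) × (Pr × Bool) × Bool) :
    frameMap d (pl (true, 0) false) = some (some d.2.1) := by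
  have : frameMat d *ᵥ gcol (pl (true, 0) false) = gcol (some (some d.2.1)) := by
    ext i
    rw [mulVec, dotProduct_four]
    simp [frameMat, gcol, sg]
  rw [frameMap, this, colIdx_gcol']

/-- The permutation of positions of a frame change. -/
noncomputable def framePerm (d : (Pr × Bool) × (Pr × Bool) × Bool) : J → J := Function.invFun (frameMap d)

/-- The frame with given parameters. -/
noncomputable def mkFrame (w : J → E14)
    (k : Σ _ : (Pr × Bool) × (Pr × Bool) × Bool, Option (Pr × Bool) → ZMod 3) (j : J) : E14 :=
  (frameUnit k.1.2.2 j * ω ^ (extZero k.2 j).val) • w (framePerm k.1 j)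

/-- The quadratic moment required of the phases of a frame change. -/
@[irreducible] def frameDefect (d : (Pr × Bool) × (Pr × Bool) × Bool) :
    Matrix (Fin 4) (Fin 4) (ZMod 3) := B₀ - frameMat d * B₀ * (frameMat d)ᵀ

/-- The parameters of the frames with a given first vector. -/
def frameParams :
    Set (Σ _ : (Pr × Bool) × (Pr × Bool) × Bool, Option (Pr × Bool) → ZMod 3) :=
  {k | ValidFrame k.1 ∧ qmom (extZero k.2) = frameDefect k.1}

lemma cc_frame (η : Bool) (j : J) (n : ℕ) : cc (frameUnit η j * ω ^ n) = frameSign η j := by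
  rw [cc_mul (mem_units6.1 (frameUnit_mem η j)).1 (ω_pow_mem n), cc_ω_pow, mul_one, cc_frameUnit]

lemma uu_frame (η : Bool) (j : J) (n : ℕ) :
    uu (frameUnit η j * ω ^ n) = -(frameSign η j * n) := by
  rw [uu_mul (mem_units6.1 (frameUnit_mem η j)).1 (ω_pow_mem n), uu_frameUnit, uu_ω_pow,
    cc_frameUnit]
  ring

lemma frameSign_mul_self : ∀ η j, frameSign η j * frameSign η j = 1 := by decide

lemma frameDefect_transpose (d : (Pr × Bool) × (Pr × Bool) × Bool) :
    (frameDefect d)ᵀ = frameDefect d := by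
  have h0 : B₀ᵀ = B₀ := by decide
  rw [frameDefect, transpose_sub, transpose_mul, transpose_mul, transpose_transpose, h0, mul_assoc]

lemma ncard_frameParams : frameParams.ncard = 2916 := by
  have h1 : frameParams = ((Finset.univ.filter ValidFrame).sigma fun d =>
      Finset.univ.filter fun a => momentHom a =
        fun i => frameDefect d (momentPos i).1 (momentPos i).2 : Finset (Σ _ : _, _)) := by
    ext ⟨d, a⟩
    simp only [frameParams, Set.mem_ofPred_eq, Finset.coe_sigma, Set.mem_sigma_iff, Finset.coe_filter,
      Finset.mem_univ, true_and]
    refine and_congr_right fun hd => (momentHom_eq_iff (frameDefect_transpose d) ?_ a).symm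
    rw [frameDefect, Matrix.sub_apply, frameMat_mul_apply, hd.1]
    decide
  rw [h1, Set.ncard_coe_finset, Finset.card_sigma]
  simp only [card_momentHom, Finset.sum_const, card_validFrame, smul_eq_mul, Nat.reduceMul]

lemma OFrame.monomial (F : OFrame L w) (h : GoodLat L X) {e : J → ℂ} (r : Equiv.Perm J)
    (he : ∀ j, e j ∈ units6) (hv : ∀ j, v j = e j • w (r j)) : OFrame L v := by
  refine ⟨fun j => ?_, fun i j => ?_⟩
  · rw [hv]
    exact h.smul_mem _ (mem_units6.1 (he j)).1 _ (F.mem _)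
  · rw [hv, hv, inner_smul_left, inner_smul_right, F.orth]
    by_cases hij : i = j
    · subst hij
      rw [if_pos rfl, if_pos rfl, ← mul_assoc, ← normSq_eq_conj_mul_self, normSq_eq_norm_sq,
        (mem_units6.1 (he i)).2]
      simp
    · rw [if_neg hij, if_neg (r.injective.ne hij)]
      simp

lemma mkFrame_isFrame (h : GoodLat L X) (F : OFrame L w) (hB : HasB L w B₀)
    {k : Σ _ : (Pr × Bool) × (Pr × Bool) × Bool, Option (Pr × Bool) → ZMod 3}
    (hk : k ∈ frameParams) : IsFrame L (mkFrame w k) ∧ mkFrame w k none = w none := by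
  obtain ⟨d, a⟩ := k
  obtain ⟨hd, ha⟩ := hk
  simp only at hd ha
  have hinj := frameMap_injective hd
  have hr (j : J) : framePerm d (frameMap d j) = j := Function.leftInverse_invFun hinj j
  have hr' (j : J) : frameMap d (framePerm d j) = j :=
    Function.rightInverse_invFun (Finite.surjective_of_injective hinj) j
  obtain ⟨r, hrp, hrm⟩ : ∃ r : Equiv.Perm J, (∀ j, r j = framePerm d j) ∧
      ∀ j, r.symm j = frameMap d j := ⟨⟨framePerm d, frameMap d, hr', hr⟩, fun _ => rfl, fun _ => rfl⟩
  obtain ⟨e, hedef⟩ : ∃ e : J → ℂ, ∀ j, e j = frameUnit d.2.2 j * ω ^ (extZero a j).val :=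
    ⟨_, fun _ => rfl⟩
  have hmk (j : J) : mkFrame w ⟨d, a⟩ j = e j • w (r j) := by
    rw [mkFrame, hedef, hrp]
  have he (j : J) : e j ∈ units6 := by
    rw [hedef]
    exact mul_mem_units6 (frameUnit_mem _ _) (ω_pow_mem_units6 _)
  have hsign (j : J) : frameSign d.2.2 (r j) = frameSign d.2.2 j := by
    refine if_congr ⟨fun hj => ?_, fun hj => ?_⟩ rfl rfl
    · rw [← r.symm_apply_apply j, hj, hrm, frameMap_last]
    · rw [hj, ← r.symm_apply_eq.1 ((hrm _).trans (frameMap_last d))]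
  refine ⟨⟨F.monomial h r he hmk, ?_⟩, ?_⟩
  · have := hB.monomial_of_mulVec (v := mkFrame w ⟨d, a⟩) (N := frameMat d)
      (fun x hx j => F.inner_mem h hx j) r he hmk fun j => by
        rw [hedef, cc_frame, hd.2, hsign, ← hrm, r.symm_apply_apply]
    have hq : ∑ j, (cc (e j) * uu (e j)) • vecMulVec (gcol j) (gcol j) = -qmom (extZero a) := by
      rw [qmom, ← Finset.sum_neg_distrib]
      refine Finset.sum_congr rfl fun j _ => ?_
      rw [hedef, cc_frame, uu_frame, mul_neg, ← mul_assoc, frameSign_mul_self, neg_smul, one_mul,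
        ZMod.natCast_val, ZMod.cast_id]
    rwa [hq, ha, frameDefect, sub_neg_eq_add, add_sub_cancel] at this
  · have : framePerm d none = none := by
      rw [← hrp]
      exact (r.symm_apply_eq.1 ((hrm _).trans (frameMap_none d))).symm
    rw [mkFrame, this]
    simp [frameUnit, extZero]

lemma mkFrame_injOn (F : OFrame L w) :
    Set.InjOn (mkFrame w) frameParams := by
  rintro ⟨d, a⟩ hk ⟨d', a'⟩ hk' heq
  have hd : ValidFrame d := hk.1
  have hd' : ValidFrame d' := hk'.1
  have key (j : J) : framePerm d j = framePerm d' j ∧ frameUnit d.2.2 j * ω ^ (extZero a j).val =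
      frameUnit d'.2.2 j * ω ^ (extZero a' j).val := by
    have h1 := congrArg (inner ℂ (w (framePerm d j))) (congrFun heq j)
    have h0 : frameUnit d.2.2 j * ω ^ (extZero a j).val ≠ 0 := fun h0 => by
      have := (mem_units6.1 (mul_mem_units6 (frameUnit_mem d.2.2 j)
        (ω_pow_mem_units6 (extZero a j).val))).2
      rw [h0] at this
      norm_num at this
    simp only [mkFrame, inner_smul_right, F.orth, if_true] at h1
    split_ifs at h1 with hj
    · exact ⟨hj, mul_right_cancel₀ (by norm_num) h1⟩
    · exact absurd h1 (by simpa using h0)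
  have hmap (j : J) : frameMap d j = frameMap d' j := by
    have h1 : framePerm d' (frameMap d j) = j := by
      rw [← (key _).1]; exact Function.leftInverse_invFun (frameMap_injective hd) j
    rw [← h1]
    conv_lhs => rw [h1]
    exact (Function.rightInverse_invFun
      (Finite.surjective_of_injective (frameMap_injective hd')) _).symm
  have hη : d.2.2 = d'.2.2 := by
    have h1 := congrArg cc (key (some none)).2
    rw [cc_frame, cc_frame] at h1
    revert h1
    generalize d.2.2 = x
    generalize d'.2.2 = y
    revert x y
    decide
  have hdd : d = d' := by
    refine Prod.ext ?_ (Prod.ext ?_ hη)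
    · simpa [frameMap_false] using hmap (pl (false, 0) false)
    · simpa [frameMap_true] using hmap (pl (true, 0) false)
  subst hdd
  congr 1
  ext k
  have h1 := congrArg uu (key (some k)).2
  rw [uu_frame, uu_frame, neg_inj, ZMod.natCast_val, ZMod.natCast_val, ZMod.cast_id,
    ZMod.cast_id] at h1
  have h2 := congrArg (frameSign d.2.2 (some k) * ·) h1
  simp only [← mul_assoc, frameSign_mul_self, one_mul] at h2
  exact h2

end FrameCount

section FrameSurj

variable {L : AddSubgroup E14} {X : Finset E14} {v w : J → E14}

lemma exists_some_some_of_perm {r : Equiv.Perm J} (h0 : r none = none) (h1 : r (some none) = some none)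
    (p : Pr × Bool) : ∃ q, r (some (some q)) = some (some p) := by
  rcases hx : r.symm (some (some p)) with _ | _ | q
  · rw [r.symm_apply_eq, h0] at hx; cases hx
  · rw [r.symm_apply_eq, h1] at hx; cases hx
  · exact ⟨q, (r.symm_apply_eq.1 hx).symm⟩

lemma exists_mkFrame_eq (h : GoodLat L X) (F : PreFrame L X w) (hB : HasB L w B₀)
    (hv : IsFrame L v) (hvw : v none = w none) : ∃ k ∈ frameParams, mkFrame w k = v := by
  obtain ⟨e, r, he, he0, heω, hr0, hr1, hve⟩ := hv.1.exists_monomial h F hv.2 hvw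
  obtain ⟨x, hx⟩ := exists_some_some_of_perm hr0 hr1 ((false, 0), false)
  obtain ⟨y, hy⟩ := exists_some_some_of_perm hr0 hr1 ((true, 0), false)
  obtain ⟨η, n₁, he1⟩ : ∃ (η : Bool) (n : ℕ), e (some none) = frameUnit η (some none) * ω ^ n := by
    obtain ⟨n, hn | hn⟩ := units6_eq (he (some none))
    · exact ⟨false, n, by simp [frameUnit, hn]⟩
    · exact ⟨true, n, by simp [frameUnit, hn]⟩
  have hform (j : J) : ∃ n : ℕ, e j = frameUnit η j * ω ^ n := by
    match j with
    | none => exact ⟨0, by simp [frameUnit, he0]⟩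
    | some none => exact ⟨n₁, he1⟩
    | some (some k) =>
      obtain ⟨n, hn⟩ := heω k
      exact ⟨n, by simp [frameUnit, hn]⟩
  obtain ⟨d, hdx, hdy, hdη⟩ : ∃ d : (Pr × Bool) × (Pr × Bool) × Bool, d.1 = x ∧ d.2.1 = y ∧ d.2.2 = η :=
    ⟨(x, y, η), rfl, rfl, rfl⟩
  have hcc (j : J) : cc (e j) = frameSign d.2.2 j := by
    obtain ⟨n, hn⟩ := hform j
    rw [hn, cc_frame, hdη]
  have hsk (k : Pr × Bool) : cc (e (some (some k))) = 1 := by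
    obtain ⟨n, hn⟩ := heω k
    rw [hn, cc_ω_pow]
  have hN (j : J) : frameMat d *ᵥ gcol (r j) = cc (e j) • gcol j := by
    refine dotProduct_eq _ _ fun z => ?_
    rw [dotProduct_comm, dotProduct_comm _ z]
    obtain ⟨u, hu⟩ := ksum_surjective (B₀ *ᵥ z)
    obtain ⟨z', hz', -⟩ := (hB _ _).1 ((inCode_monomial (fun x hx j => F.inner_mem h hx j) r he hve).1
      ((hv.2 _ _).2 ⟨z, rfl, hu⟩))
    have key (j : J) : cc (e j) * word z j = word z' (r j) := by
      simpa using congrFun hz' (r j)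
    have k0 := key none
    have k1 := key (some none)
    have k2 := key (some (some x))
    have k3 := key (some (some y))
    rw [hr0, he0, cc_one, one_mul, word_none z'] at k0
    rw [hr1, word_last z', hcc] at k1
    rw [hx, hsk, word_false] at k2
    rw [hy, hsk, word_true] at k3
    have hz : z' = z ᵥ* frameMat d := by
      ext i
      fin_cases i
      · change z' 0 = z ⬝ᵥ gcol none
        rw [← k0, word]
      · change z' 1 = z ⬝ᵥ (gcol (some (some d.1)) - gcol none)
        rw [dotProduct_sub, hdx, ← word, ← word, k0, ← one_mul (word _ _), k2]
        simp [sg]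
      · change z' 2 = z ⬝ᵥ (gcol (some (some d.2.1)) - gcol none)
        rw [dotProduct_sub, hdy, ← word, ← word, k0, ← one_mul (word _ _), k3]
        simp [sg]
      · change z' 3 = z ⬝ᵥ (sg d.2.2 • gcol (some none))
        rw [dotProduct_smul, smul_eq_mul, ← word, ← k1]
        rfl
    rw [dotProduct_mulVec, ← hz, dotProduct_smul, smul_eq_mul]
    exact (key j).symm
  have hmap (j : J) : frameMap d (r j) = j := by
    rw [frameMap, hN, hcc, colIdx_gcol]
  have hB' := hB.monomial_of_mulVec (fun x hx j => F.inner_mem h hx j) r he hve hN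
  have hBeq := hB'.unique hv.2
  obtain ⟨a, ha⟩ : ∃ a : Option (Pr × Bool) → ZMod 3, ∀ j,
      extZero a j = -(cc (e j) * uu (e j)) := by
    refine ⟨fun k => -(cc (e (some k)) * uu (e (some k))), fun j => ?_⟩
    cases j with
    | none => simp [extZero, he0, uu_one]
    | some k => rfl
  have hq : ∑ j, (cc (e j) * uu (e j)) • vecMulVec (gcol j) (gcol j) = -qmom (extZero a) := by
    rw [qmom, ← Finset.sum_neg_distrib]
    refine Finset.sum_congr rfl fun j _ => ?_
    rw [ha, neg_smul, neg_neg]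
  rw [hq, sub_neg_eq_add] at hBeq
  have hd1 : frameMat d 1 1 * frameMat d 2 2 + frameMat d 1 2 * frameMat d 2 1 = 1 := by
    have := congrFun (congrFun hBeq 1) 2
    rw [Matrix.add_apply, frameMat_mul_apply, qmom_one_two, add_zero] at this
    rw [this]; decide
  have hvalid : ValidFrame d := by
    refine ⟨hd1, fun j => ?_⟩
    obtain ⟨i, rfl⟩ := r.surjective j
    rw [hN, hmap, hcc]
    refine congrArg (· • _) (if_congr ⟨?_, ?_⟩ rfl rfl)
    · rintro rfl; exact hr1
    · intro hi; exact r.injective (hi.trans hr1.symm)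
  have hqd : qmom (extZero a) = frameDefect d := by
    rw [frameDefect, eq_sub_iff_add_eq', hBeq]
  refine ⟨⟨d, a⟩, ⟨hvalid, hqd⟩, funext fun j => ?_⟩
  have hperm : framePerm d j = r j := by
    rw [framePerm]
    conv_lhs => rw [← hmap j]
    exact Function.leftInverse_invFun (frameMap_injective hvalid) _
  have hej : e j = frameUnit d.2.2 j * ω ^ (extZero a j).val := by
    obtain ⟨n, hn⟩ := hform j
    rw [hn, hdη]
    refine congrArg _ (ω_pow_congr ?_)
    have h1 := ha j
    rw [hn, cc_frame, uu_frame, mul_neg, neg_neg, ← mul_assoc, frameSign_mul_self, one_mul] at h1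
    rw [h1, ZMod.val_natCast, Nat.mod_mod]
  rw [mkFrame, hperm, hve, hej]

/-- The number of frames with a given first vector. -/
lemma GoodLat.ncard_frames (h : GoodLat L X) {v₀ : E14} (hv : v₀ ∈ X) :
    {v | IsFrame L v ∧ v none = v₀}.ncard = 2916 := by
  obtain ⟨w, F, rfl, hB⟩ := h.exists_frame hv
  rw [← ncard_frameParams, ← Set.InjOn.ncard_image (mkFrame_injOn F.toOFrame)]
  congr 1
  ext v
  refine ⟨fun hv => exists_mkFrame_eq h F hB hv.1 hv.2, ?_⟩
  rintro ⟨k, hk, rfl⟩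
  exact mkFrame_isFrame h F.toOFrame hB hk

lemma GoodLat.ncard_isFrame (h : GoodLat L X) : {v | IsFrame L v}.ncard = 2 ^ 8 * 3 ^ 7 * 7 * 13 := by
  have hfin (x : E14) (hx : x ∈ X) : {v | IsFrame L v ∧ v none = x}.Finite :=
    Set.finite_of_ncard_ne_zero (by rw [h.ncard_frames hx]; norm_num)
  have hU : {v | IsFrame L v} = ⋃ x ∈ X, {v | IsFrame L v ∧ v none = x} := by
    ext v
    simp only [Set.mem_ofPred_eq, Set.mem_iUnion, exists_prop]
    exact ⟨fun hv => ⟨_, hv.1.mem_X h none, hv, rfl⟩, fun ⟨_, _, hv, _⟩ => hv⟩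
  have hfin' : {v | IsFrame L v}.Finite := by
    rw [hU]; exact X.finite_toSet.biUnion hfin
  rw [Set.ncard_eq_toFinset_card _ hfin', Finset.card_eq_sum_card_fiberwise (f := fun v => v none)
    (t := X) (fun v hv => ((hfin'.mem_toFinset.1 hv).1.mem_X h none))]
  have (x : E14) (hx : x ∈ X) : (hfin'.toFinset.filter fun v => v none = x).card = 2916 := by
    rw [← h.ncard_frames hx, ← Set.ncard_coe_finset]
    congr 1
    ext v
    simp
  rw [Finset.sum_congr rfl this, Finset.sum_const, h.card_X]
  rfl

end FrameSurj

section Automorphisms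

variable {H P : Matrix (Fin 14) (Fin 14) ℂ} {X : Finset E14} {v w : J → E14}

lemma toE_sum {ι : Type*} (s : Finset ι) (c : ι → ℂ) (x : ι → Fin 14 → ℂ) :
    toE P (∑ j ∈ s, c j • x j) = ∑ j ∈ s, c j • toE P (x j) := by
  simp only [toE, mulVec_sum, mulVec_smul, WithLp.toLp_sum, WithLp.toLp_smul]

lemma inGL_of_mul_conjTranspose (hU : IsUnimodular H) {U : Matrix (Fin 14) (Fin 14) ℂ}
    (he : EntriesIn U) (h : U * H * Uᴴ = H) : InGL U := by
  have hd : IsUnit H.det := by simp [hU.2]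
  have h1 : U * (H * Uᴴ * H⁻¹) = 1 := by
    rw [← mul_assoc, ← mul_assoc, h, Matrix.mul_nonsing_inv _ hd]
  refine ⟨he, H * Uᴴ * H⁻¹, ?_, h1, mul_eq_one_comm.1 h1⟩
  have hmul {A B : Matrix (Fin 14) (Fin 14) ℂ} (hA : EntriesIn A) (hB : EntriesIn B) :
      EntriesIn (A * B) := fun i j => by
    rw [Matrix.mul_apply]
    exact sum_mem fun k _ => mul_mem (hA i k) (hB k j)
  exact hmul (hmul hU.1.1 fun i j => star_mem_𝓞 (he j i)) hU.inv_entriesIn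

lemma hprod_conjTranspose_mulVec {U : Matrix (Fin 14) (Fin 14) ℂ} (h : U * H * Uᴴ = H)
    (x y : Fin 14 → ℂ) : hprod H (Uᴴ *ᵥ x) (Uᴴ *ᵥ y) = hprod H x y := by
  rw [hprod, hprod, star_mulVec, conjTranspose_conjTranspose, ← dotProduct_mulVec, mulVec_mulVec,
    mulVec_mulVec, h]

lemma IsFrame.map (hP : H = Pᴴ * P) (hw : IsFrame (latOf P) w) {x : J → Fin 14 → ℂ}
    (hx : ∀ j, toE P (x j) = w j) (hxL : ∀ j, IsLatVec (x j)) {U : Matrix (Fin 14) (Fin 14) ℂ}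
    (hU : InGL U) (h : U * H * Uᴴ = H) : IsFrame (latOf P) fun j => toE P (Uᴴ *ᵥ x j) := by
  obtain ⟨he, V, hV, hUV, hVU⟩ := hU
  have he' : EntriesIn Uᴴ := fun i j => star_mem_𝓞 (he j i)
  have hV' : EntriesIn Vᴴ := fun i j => star_mem_𝓞 (hV j i)
  have hin (j : J) (y : Fin 14 → ℂ) :
      inner ℂ (toE P (Uᴴ *ᵥ x j)) (toE P (Uᴴ *ᵥ y)) = inner ℂ (w j) (toE P y) := by
    rw [← hx, inner_toE hP, inner_toE hP, hprod_conjTranspose_mulVec h]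
  refine ⟨⟨fun j => ⟨_, (hxL j).mulVec he', rfl⟩, fun j k => ?_⟩, fun c u => ?_⟩
  · rw [hin, hx, hw.1.orth]
  · rw [← hw.2]
    constructor
    · rintro ⟨_, ⟨z, hz, rfl⟩, hc⟩
      refine ⟨toE P (Vᴴ *ᵥ z), ⟨_, hz.mulVec hV', rfl⟩, fun j => ?_⟩
      rw [← hin, mulVec_mulVec, ← conjTranspose_mul, hVU, conjTranspose_one, one_mulVec]
      exact hc j
    · rintro ⟨_, ⟨z, hz, rfl⟩, hc⟩
      refine ⟨toE P (Uᴴ *ᵥ z), ⟨_, hz.mulVec he', rfl⟩, fun j => ?_⟩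
      rw [hin]
      exact hc j

lemma IsFrame.sum_smul_mem {L : AddSubgroup E14} (h : GoodLat L X) (hw : IsFrame L w)
    (hv : IsFrame L v) {y : E14} (hy : y ∈ L) : ∑ j, (inner ℂ (w j) y / 3) • v j ∈ L := by
  have hin (k : J) : inner ℂ (v k) (∑ j, (inner ℂ (w j) y / 3) • v j) = inner ℂ (w k) y := by
    simp only [inner_sum, inner_smul_right, hv.1.orth]
    simp
  rw [hv.1.mem_iff h]
  simp only [hin]
  obtain ⟨h1, h2⟩ := (hw.1.mem_iff h).1 hy
  exact ⟨h1, (hv.2 _ _).2 ((hw.2 _ _).1 h2)⟩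

lemma exists_automorphism (hU : IsUnimodular H) (hP : H = Pᴴ * P) (h : GoodLat (latOf P) X)
    (hw : IsFrame (latOf P) w) (hv : IsFrame (latOf P) v) {x : J → Fin 14 → ℂ}
    (hx : ∀ j, toE P (x j) = w j) : ∃ U, (InGL U ∧ U * H * Uᴴ = H) ∧
      (fun j => toE P (Uᴴ *ᵥ x j)) = v := by
  have hφ (i : Fin 14) : ∑ j, (inner ℂ (w j) (toE P (Pi.single i 1)) / 3) • v j ∈ latOf P := by
    refine hw.sum_smul_mem h hv ⟨_, fun k => ?_, rfl⟩
    rw [Pi.single_apply]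
    split_ifs
    exacts [one_mem _, zero_mem _]
  choose a ha ha' using hφ
  let A : Matrix (Fin 14) (Fin 14) ℂ := of fun k i => a i k
  have hA (y : Fin 14 → ℂ) : toE P (A *ᵥ y) = ∑ j, (inner ℂ (w j) (toE P y) / 3) • v j := by
    have h1 : A *ᵥ y = ∑ i, y i • a i := by
      ext k
      simp [A, mulVec, dotProduct, mul_comm]
    have h2 : y = ∑ i, y i • Pi.single i (1 : ℂ) := by
      ext k; simp [Finset.sum_apply, Pi.single_apply]
    rw [h1, toE_sum]
    nth_rewrite 2 [h2]
    rw [toE_sum]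
    simp only [ha', inner_sum, inner_smul_right, Finset.smul_sum, Finset.sum_div, Finset.sum_smul,
      smul_smul, mul_div_assoc]
    exact Finset.sum_comm
  have hAw (j : J) : toE P (A *ᵥ x j) = v j := by
    rw [hA, hx, Finset.sum_eq_single j]
    · rw [hw.1.orth, if_pos rfl, div_self (by norm_num), one_smul]
    · intro k _ hk
      rw [hw.1.orth, if_neg hk, zero_div, zero_smul]
    · simp
  have hH (y z : Fin 14 → ℂ) : hprod H (A *ᵥ y) (A *ᵥ z) = hprod H y z := by
    have hin (k : J) (y : Fin 14 → ℂ) : inner ℂ (v k) (toE P (A *ᵥ y)) = inner ℂ (w k) (toE P y) := by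
      rw [hA]
      simp only [inner_sum, inner_smul_right, hv.1.orth, mul_ite, mul_zero, Finset.sum_ite_eq,
        Finset.mem_univ, if_true]
      exact div_mul_cancel₀ _ (by norm_num)
    rw [← inner_toE hP, ← inner_toE hP, inner_eq_sum_of_gram hv.1.orth,
      inner_eq_sum_of_gram hw.1.orth]
    simp only [hin]
  have hAH : Aᴴ * H * A = H := by
    refine Matrix.ext_of_mulVec_single fun j => dotProduct_eq _ _ fun y => ?_
    have := hH (star y) (Pi.single j 1)
    rw [hprod, hprod, star_mulVec, star_star, ← dotProduct_mulVec, mulVec_mulVec, mulVec_mulVec] at this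
    rw [dotProduct_comm, this, dotProduct_comm]
  have hent : EntriesIn Aᴴ := fun i j => star_mem_𝓞 (ha i j)
  have hAH' : Aᴴ * H * Aᴴᴴ = H := by rw [conjTranspose_conjTranspose, hAH]
  exact ⟨Aᴴ, ⟨inGL_of_mul_conjTranspose hU hent hAH', hAH'⟩,
    funext fun j => by rw [conjTranspose_conjTranspose, hAw]⟩

theorem autCard_eq (hU : IsUnimodular H) (hP : H = Pᴴ * P) (h : GoodLat (latOf P) X) :
    autCard H = 2 ^ 8 * 3 ^ 7 * 7 * 13 := by
  have hd := isUnit_det_of_factor hU hP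
  rw [← h.ncard_isFrame]
  obtain ⟨w, hw⟩ : {v | IsFrame (latOf P) v}.Nonempty := by
    refine Set.nonempty_of_ncard_ne_zero ?_
    rw [h.ncard_isFrame]
    norm_num
  choose x hxL hx using fun j => hw.1.mem j
  refine Nat.card_eq_of_bijective
    (fun U => (⟨_, hw.map hP hx hxL U.2.1 U.2.2⟩ : {v | IsFrame (latOf P) v})) ⟨?_, ?_⟩
  · rintro ⟨U, hU1, hU2⟩ ⟨U', hU1', hU2'⟩ heq
    have hj (j : J) : Uᴴ *ᵥ x j = U'ᴴ *ᵥ x j :=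
      toE_injective hd (congrFun (congrArg Subtype.val heq) j)
    refine Subtype.ext (conjTranspose_injective (Matrix.ext_of_mulVec_single fun i => ?_))
    have hs := eq_sum_of_gram hw.1.orth (toE P (Pi.single i 1))
    simp only [← hx] at hs
    rw [← toE_sum] at hs
    rw [toE_injective hd hs]
    simp only [mulVec_sum, mulVec_smul, hj]
  · rintro ⟨v, hv⟩
    obtain ⟨U, hU', hUv⟩ := exists_automorphism hU hP h hw hv hx
    exact ⟨⟨U, hU'⟩, Subtype.ext hUv⟩

end Automorphisms

section SplittingOff

lemma exists_nat_norm_sq {z : ℂ} (hz : z ∈ 𝓞) : ∃ n : ℕ, ‖z‖ ^ 2 = n := by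
  obtain ⟨k, hk⟩ := exists_int_of_mem_𝓞 (mul_mem (star_mem_𝓞 hz) hz)
    (by rw [← normSq_eq_conj_mul_self, ofReal_im])
  rw [← normSq_eq_conj_mul_self, normSq_eq_norm_sq] at hk
  have hk' : ‖z‖ ^ 2 = (k : ℝ) := by exact_mod_cast hk
  have h0 : 0 ≤ k := by
    have := sq_nonneg ‖z‖
    rw [hk'] at this
    exact_mod_cast this
  exact ⟨k.toNat, by rw [hk']; exact_mod_cast (Int.toNat_of_nonneg h0).symm⟩

instance : IsPrincipalIdealRing 𝓞 where
  principal I := by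
    by_cases hI : I = ⊥
    · rw [hI]; infer_instance
    obtain ⟨b₀, hb₀, hne₀⟩ := Submodule.exists_mem_ne_zero_of_ne_bot hI
    choose N hN using fun z : 𝓞 => exists_nat_norm_sq z.2
    obtain ⟨b, ⟨hb, hne⟩, hmin⟩ :=
      WellFounded.has_min (measure N).wf {b | b ∈ I ∧ b ≠ 0} ⟨b₀, hb₀, hne₀⟩
    refine ⟨b, le_antisymm (fun a ha => ?_) ((Ideal.span_singleton_le_iff_mem I).2 hb)⟩
    have hb' : (b : ℂ) ≠ 0 := by simpa using hne
    obtain ⟨q, hq, hlt⟩ := exists_mem_𝓞_norm_sub_lt ((a : ℂ) / b)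
    have hr : a - ⟨q, hq⟩ * b ∈ I := I.sub_mem ha (I.mul_mem_left _ hb)
    refine Ideal.mem_span_singleton'.2 ⟨⟨q, hq⟩, ?_⟩
    by_contra hcon
    refine hmin _ ⟨hr, fun h0 => hcon (sub_eq_zero.1 h0).symm⟩ ?_
    have h1 : (((a - ⟨q, hq⟩ * b : 𝓞) : ℂ)) = ((a : ℂ) / b - q) * b := by
      push_cast
      field_simp
    have h2 : (N (a - ⟨q, hq⟩ * b) : ℝ) < N b := by
      rw [← hN, ← hN, h1, norm_mul, mul_pow]
      exact mul_lt_of_lt_one_left (by positivity) hlt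
    exact_mod_cast h2

variable {H : Matrix (Fin 14) (Fin 14) ℂ}

/-- A functional on `𝓞¹⁴` with value `1` at `x` extends `x` to a basis by elements of its kernel. -/
lemma exists_basis_of_apply_eq_one (f : (Fin 14 → 𝓞) →ₗ[𝓞] 𝓞) {x : Fin 14 → 𝓞} (hx : f x = 1) :
    ∃ b : Module.Basis (Fin 14) 𝓞 (Fin 14 → 𝓞), b 0 = x ∧ ∀ i, i ≠ 0 → f (b i) = 0 := by
  let φ : (𝓞 × LinearMap.ker f) ≃ₗ[𝓞] (Fin 14 → 𝓞) :=
    LinearEquiv.ofBijective ((LinearMap.toSpanSingleton 𝓞 _ x).coprod (LinearMap.ker f).subtype) <| by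
      refine ⟨(injective_iff_map_eq_zero _).2 ?_, fun y => ⟨(f y, ⟨y - f y • x, ?_⟩), ?_⟩⟩
      · rintro ⟨c, k, hk⟩ h0
        have h0' : c • x + k = 0 := h0
        have hc : c = 0 := by
          have := congrArg f h0'
          rw [map_add, map_smul, hx, LinearMap.mem_ker.1 hk] at this
          simpa using this
        subst hc
        rw [zero_smul, zero_add] at h0'
        simp [h0']
      · rw [LinearMap.mem_ker, map_sub, map_smul, hx]
        simp
      · simp
  have hφ (c : 𝓞) (k : LinearMap.ker f) : φ (c, k) = c • x + k := rfl
  have hrank : Module.finrank 𝓞 (LinearMap.ker f) = 13 := by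
    have := φ.finrank_eq
    rw [Module.finrank_prod, Module.finrank_self, Module.finrank_fin_fun] at this
    omega
  let b₁ := Module.finBasisOfFinrankEq 𝓞 (LinearMap.ker f) hrank
  refine ⟨(((Module.Basis.singleton (Fin 1) 𝓞).prod b₁).map φ).reindex finSumFinEquiv, ?_, fun i hi => ?_⟩
  · have : (finSumFinEquiv (m := 1) (n := 13)).symm 0 = Sum.inl 0 := rfl
    rw [Module.Basis.reindex_apply, this]
    simp [hφ]
  · obtain ⟨j, rfl⟩ := (finSumFinEquiv (m := 1) (n := 13)).surjective i
    rcases j with j | j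
    · exact absurd (Subsingleton.elim j 0 ▸ rfl) hi
    · simp [hφ, LinearMap.mem_ker.1 (b₁ j).2]

lemma decomposable_of_latNorm_eq_one (hU : IsUnimodular H) {x : Fin 14 → ℂ} (hx : IsLatVec x)
    (h1 : latNorm H x = 1) : Decomposable H := by
  let f : (Fin 14 → 𝓞) →ₗ[𝓞] 𝓞 :=
    { toFun := fun y => ⟨hprod H x fun i => y i, hprod_mem hU.1.1 hx fun i => (y i).2⟩
      map_add' := fun y z => Subtype.ext <| by
        change hprod H x ((fun i => (y i : ℂ)) + fun i => (z i : ℂ)) = hprod H x _ + hprod H x _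
        rw [hprod, mulVec_add, dotProduct_add]; rfl
      map_smul' := fun c y => Subtype.ext <| by
        change hprod H x ((c : ℂ) • fun i => (y i : ℂ)) = c * hprod H x _
        rw [hprod, mulVec_smul, dotProduct_smul]; rfl }
  obtain ⟨b, hb0, hb⟩ := exists_basis_of_apply_eq_one f (x := fun i => ⟨x i, hx i⟩) (Subtype.ext h1)
  let B : Matrix (Fin 14) (Fin 14) 𝓞 := (Pi.basisFun 𝓞 (Fin 14)).toMatrix b
  let B' : Matrix (Fin 14) (Fin 14) 𝓞 := b.toMatrix (Pi.basisFun 𝓞 (Fin 14))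
  have hBB : B * B' = 1 := (Pi.basisFun 𝓞 (Fin 14)).toMatrix_mul_toMatrix_flip b
  let ι : 𝓞 →+* ℂ := algebraMap 𝓞 ℂ
  have hc : B.map ι * B'.map ι = 1 := by
    rw [← Matrix.map_mul, hBB, Matrix.map_one _ (map_zero _) (map_one _)]
  have hc' := mul_eq_one_comm.1 hc
  have hent (M : Matrix (Fin 14) (Fin 14) 𝓞) : EntriesIn (M.map ι)ᴴ := fun i j => star_mem_𝓞 (M j i).2
  have hcol (i : Fin 14) : (B.map ι).col i = fun k => ((b i k : 𝓞) : ℂ) := by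
    ext k
    simp [B, ι, Module.Basis.toMatrix_apply]
  have happ (i j : Fin 14) : ((B.map ι)ᴴ * H * (B.map ι)ᴴᴴ) i j =
      hprod H ((B.map ι).col i) ((B.map ι).col j) := by
    rw [conjTranspose_conjTranspose, mul_assoc]
    rfl
  have hz (j : Fin 14) (hj : j ≠ 0) : hprod H ((B.map ι).col 0) ((B.map ι).col j) = 0 := by
    rw [hcol, hcol, hb0]
    exact congrArg Subtype.val (hb j hj)
  refine ⟨_, ⟨(B.map ι)ᴴ, ⟨hent B, (B'.map ι)ᴴ, hent B', ?_, ?_⟩, rfl⟩, 1, one_pos, by norm_num, ?_⟩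
  · rw [← conjTranspose_mul, hc', conjTranspose_one]
  · rw [← conjTranspose_mul, hc, conjTranspose_one]
  · rintro i j (⟨hi, hj⟩ | ⟨hi, hj⟩)
    · obtain rfl : i = 0 := Fin.ext (by simpa using hi)
      rw [happ, hz j (by rintro rfl; simp at hj)]
    · obtain rfl : j = 0 := Fin.ext (by simpa using hj)
      rw [happ, hprod_swap hU.1.2.1, hz i (by rintro rfl; simp at hi), map_zero]

lemma exists_goodLat_of_not_decomposable (hU : IsUnimodular H) {P : Matrix (Fin 14) (Fin 14) ℂ}
    (hP : H = Pᴴ * P) (hd : ¬Decomposable H) (hr : RootFree H) : ∃ X, GoodLat (latOf P) X :=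
  exists_goodLat hU hP
    (fun x hx h1 => hd (decomposable_of_latNorm_eq_one hU hx (by rw [h1, Nat.cast_one])))
    (fun x hx h2 => hr x ⟨hx, by rw [h2, Nat.cast_ofNat]⟩)

end SplittingOff

section Indecomposable

variable {L : AddSubgroup E14} {X : Finset E14} {H P : Matrix (Fin 14) (Fin 14) ℂ}

lemma GoodLat.exists_inner_ne_zero (h : GoodLat L X) {a : E14} (ha : a ≠ 0) :
    ∃ x ∈ X, inner ℂ x a ≠ 0 := by
  by_contra! hcon
  obtain ⟨v₀, hv₀⟩ : X.Nonempty := Finset.card_ne_zero.1 (by rw [h.card_X]; norm_num)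
  obtain ⟨v, F, -, -⟩ := h.exists_frame hv₀
  refine ha ((eq_sum_of_gram F.orth a).trans (Finset.sum_eq_zero fun j _ => ?_))
  rw [hcon _ (F.toOFrame.mem_X h j), zero_div, zero_smul]

lemma GoodLat.not_split (h : GoodLat L X) {W₁ W₂ : Set E14}
    (horth : ∀ x ∈ W₁, ∀ y ∈ W₂, inner ℂ x y = 0) (hcov : ∀ x ∈ X, x ∈ W₁ ∨ x ∈ W₂) {a b : E14}
    (ha : a ∈ W₁) (ha0 : a ≠ 0) (hb : b ∈ W₂) (hb0 : b ≠ 0) : False := by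
  classical
  have horth' : ∀ x ∈ W₂, ∀ y ∈ W₁, inner ℂ x y = 0 := fun x hx y hy => by
    rw [← inner_conj_symm, horth y hy x hx, map_zero]
  obtain ⟨x, hx, hxa⟩ := h.exists_inner_ne_zero ha0
  obtain ⟨y, hy, hyb⟩ := h.exists_inner_ne_zero hb0
  have hx1 : x ∈ W₁ := (hcov x hx).resolve_right fun h2 => hxa (horth' _ h2 _ ha)
  have hy2 : y ∈ W₂ := (hcov y hy).resolve_left fun h1 => hyb (horth _ h1 _ hb)
  have h1 : (X.filter (· ∈ W₁)).card ≤ 6936 := by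
    rw [← (h.card_shells hy).1]
    refine Finset.card_le_card fun z hz => ?_
    rw [Finset.mem_filter] at hz
    simp [shell, hz.1, horth' y hy2 z hz.2]
  have h2 : (X.filter (· ∈ W₂)).card ≤ 6936 := by
    rw [← (h.card_shells hx).1]
    refine Finset.card_le_card fun z hz => ?_
    rw [Finset.mem_filter] at hz
    simp [shell, hz.1, horth x hx1 z hz.2]
  have h3 : X ⊆ X.filter (· ∈ W₁) ∪ X.filter (· ∈ W₂) := fun z hz => by
    rw [Finset.mem_union, Finset.mem_filter, Finset.mem_filter]
    exact (hcov z hz).imp (⟨hz, ·⟩) (⟨hz, ·⟩)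
  have := (Finset.card_le_card h3).trans (Finset.card_union_le _ _)
  rw [h.card_X] at this
  omega

lemma hprod_mulVec_conjTranspose (U : Matrix (Fin 14) (Fin 14) ℂ) (x y : Fin 14 → ℂ) :
    hprod H (Uᴴ *ᵥ x) (Uᴴ *ᵥ y) = hprod (U * H * Uᴴ) x y := by
  rw [hprod, hprod, star_mulVec, conjTranspose_conjTranspose, ← dotProduct_mulVec, mulVec_mulVec,
    mulVec_mulVec]

theorem not_decomposable_of_goodLat (hU : IsUnimodular H) (hP : H = Pᴴ * P)
    (h : GoodLat (latOf P) X) : ¬Decomposable H := by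
  rintro ⟨H', ⟨U, ⟨he, V, hV, hUV, hVU⟩, rfl⟩, k, hk0, hk, hblk⟩
  have hent : EntriesIn Uᴴ := fun i j => star_mem_𝓞 (he j i)
  have hent' : EntriesIn Vᴴ := fun i j => star_mem_𝓞 (hV j i)
  have hVU' : Uᴴ * Vᴴ = 1 := by rw [← conjTranspose_mul, hVU, conjTranspose_one]
  have hUV' : Vᴴ * Uᴴ = 1 := by rw [← conjTranspose_mul, hUV, conjTranspose_one]
  let S (y : Fin 14 → ℂ) : E14 := toE P (Uᴴ *ᵥ y)
  have hS0 {y : Fin 14 → ℂ} (hy : y ≠ 0) : S y ≠ 0 := fun h0 => hy <| by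
    have h1 : S y = toE P 0 := h0.trans (by simp [toE])
    have h2 := toE_injective (isUnit_det_of_factor hU hP) h1
    rw [← one_mulVec y, ← hUV', ← mulVec_mulVec, h2, mulVec_zero]
  have hSL {y : Fin 14 → ℂ} (hy : IsLatVec y) : S y ∈ latOf P := ⟨_, hy.mulVec hent, rfl⟩
  let W₁ : Set E14 := {x | ∃ y, (∀ i : Fin 14, ¬(i : ℕ) < k → y i = 0) ∧ S y = x}
  let W₂ : Set E14 := {x | ∃ y, (∀ i : Fin 14, (i : ℕ) < k → y i = 0) ∧ S y = x}
  have horth : ∀ x ∈ W₁, ∀ y ∈ W₂, inner ℂ x y = 0 := by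
    rintro _ ⟨x, hx, rfl⟩ _ ⟨y, hy, rfl⟩
    rw [inner_toE hP, hprod_mulVec_conjTranspose, hprod, dotProduct]
    refine Finset.sum_eq_zero fun i _ => ?_
    by_cases hi : (i : ℕ) < k
    · rw [mulVec, dotProduct, Finset.sum_eq_zero, mul_zero]
      intro j _
      by_cases hj : (j : ℕ) < k
      · rw [hy j hj, mul_zero]
      · rw [hblk i j (Or.inl ⟨hi, hj⟩), zero_mul]
    · rw [Pi.star_apply, hx i hi, star_zero, zero_mul]
  have hcov : ∀ x ∈ X, x ∈ W₁ ∨ x ∈ W₂ := fun x hx => by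
    obtain ⟨hxL, hx3⟩ := (h.mem_X x).1 hx
    obtain ⟨y', hy', rfl⟩ := hxL
    obtain ⟨y, hy, hy''⟩ : ∃ y, IsLatVec y ∧ Uᴴ *ᵥ y = y' :=
      ⟨Vᴴ *ᵥ y', hy'.mulVec hent', by rw [mulVec_mulVec, hVU', one_mulVec]⟩
    let a : Fin 14 → ℂ := fun i => if (i : ℕ) < k then y i else 0
    let b : Fin 14 → ℂ := fun i => if (i : ℕ) < k then 0 else y i
    have ha : S a ∈ W₁ := ⟨a, fun i hi => if_neg hi, rfl⟩
    have hb : S b ∈ W₂ := ⟨b, fun i hi => if_pos hi, rfl⟩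
    have haL : S a ∈ latOf P := hSL fun i => by
      simp only [a]; split_ifs; exacts [hy i, zero_mem _]
    have hbL : S b ∈ latOf P := hSL fun i => by
      simp only [b]; split_ifs; exacts [zero_mem _, hy i]
    have hab : S a + S b = toE P y' := by
      have : y = a + b := by ext i; simp only [a, b, Pi.add_apply]; split_ifs <;> simp
      rw [← hy'', this, mulVec_add]
      simp [S, toE, mulVec_add]
    have hnorm : ‖S a‖ ^ 2 + ‖S b‖ ^ 2 = 3 := by
      have := norm_add_sq_eq_norm_sq_add_norm_sq_of_inner_eq_zero _ _ (horth _ ha _ hb)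
      rw [hab] at this
      linarith
    by_cases ha0 : S a = 0
    · right; rwa [← hab, ha0, zero_add]
    by_cases hb0 : S b = 0
    · left; rwa [← hab, hb0, add_zero]
    have := h.min _ haL ha0
    have := h.min _ hbL hb0
    linarith
  have hs (i : Fin 14) : (Pi.single i 1 : Fin 14 → ℂ) ≠ 0 := by simp
  refine h.not_split horth hcov (a := S (Pi.single 0 1)) (b := S (Pi.single 13 1))
    ⟨_, fun i hi => ?_, rfl⟩ (hS0 (hs _)) ⟨_, fun i hi => ?_, rfl⟩ (hS0 (hs _))
  · exact Pi.single_eq_of_ne (by rintro rfl; exact hi hk0) _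
  · refine Pi.single_eq_of_ne (by rintro rfl; simp at hi; omega) _

end Indecomposable

section Existence

/-- The columns of the generator matrix of a ternary code of length `14` and dimension `4`. -/
def codeCol : Fin 14 → Fin 4 → ZMod 3 :=
  ![![1, 0, 0, 0],
    ![1, 1, 0, 0],
    ![1, 0, 1, 0],
    ![0, 0, 0, 1],
    ![2, 1, 0, 2],
    ![0, 2, 0, 1],
    ![2, 0, 1, 1],
    ![0, 0, 2, 2],
    ![0, 0, 1, 2],
    ![2, 0, 2, 1],
    ![1, 2, 0, 0],
    ![0, 1, 0, 1],
    ![2, 2, 0, 2],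
    ![1, 0, 2, 0]]

/-- The integral parts of a basis of the lattice obtained from the code. -/
def basisOne : Fin 14 → Fin 14 → ℤ :=
  ![![1, 0, 0, 0, 1, 1, 1, 1, -1, 0, 0, -2, -1, 0],
    ![0, 1, 0, 0, 1, -1, 0, 0, 0, 0, -1, 0, -2, -1],
    ![0, 0, 1, 0, 0, 0, 1, -1, 1, -1, -1, -1, -1, -1],
    ![0, 0, 0, 1, -1, 1, 1, -1, -1, 1, 0, 1, -1, 0],
    ![0, 0, 0, 0, 1, 0, 0, 0, 0, 0, -1, -1, 1, 0],
    ![0, 0, 0, 0, 0, 1, 0, 0, 0, 0, 1, 0, 1, 0],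
    ![0, 0, 0, 0, 0, 0, 1, 0, 0, 0, -1, 1, -1, 1],
    ![0, 0, 0, 0, 0, 0, 0, 1, 0, 0, 1, 1, 0, -1],
    ![0, 0, 0, 0, 0, 0, 0, 0, 1, 0, 1, 0, -1, 1],
    ![0, 0, 0, 0, 0, 0, 0, 0, 0, 1, -1, -1, 0, -1],
    ![0, 0, 0, 0, 0, 0, 0, 0, 0, 0, 3, 0, 0, 0],
    ![0, 0, 0, 0, 0, 0, 0, 0, 0, 0, 0, 3, 0, 0],
    ![0, 0, 0, 0, 0, 0, 0, 0, 0, 0, 0, 0, 3, 0],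
    ![0, 0, 0, 0, 0, 0, 0, 0, 0, 0, 0, 0, 0, 3]]

/-- The coefficients of `ω` in a basis of the lattice obtained from the code. -/
def basisω : Fin 14 → Fin 14 → ℤ :=
  ![![0, 0, 0, 0, 0, 0, 0, 0, 0, 0, -1, 1, 1, -1],
    ![0, 0, 0, 0, 0, 0, 0, 0, 0, 0, 0, 1, 1, 1],
    ![0, 0, 0, 0, 0, 0, 0, 0, 0, 0, 1, 1, 1, 0],
    ![0, 0, 0, 0, 0, 0, 0, 0, 0, 0, 0, 0, 0, 0],
    ![0, 0, 0, 0, 2, 0, 0, 0, 0, 0, -2, -2, 2, 0],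
    ![0, 0, 0, 0, 0, 2, 0, 0, 0, 0, 2, 0, 2, 0],
    ![0, 0, 0, 0, 0, 0, 2, 0, 0, 0, -2, 2, -2, 2],
    ![0, 0, 0, 0, 0, 0, 0, 2, 0, 0, 2, 2, 0, -2],
    ![0, 0, 0, 0, 0, 0, 0, 0, 2, 0, 2, 0, -2, 2],
    ![0, 0, 0, 0, 0, 0, 0, 0, 0, 2, -2, -2, 0, -2],
    ![0, 0, 0, 0, 0, 0, 0, 0, 0, 0, 0, 0, 0, 0],
    ![0, 0, 0, 0, 0, 0, 0, 0, 0, 0, 0, 0, 0, 0],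
    ![0, 0, 0, 0, 0, 0, 0, 0, 0, 0, 0, 0, 0, 0],
    ![0, 0, 0, 0, 0, 0, 0, 0, 0, 0, 0, 0, 0, 0]]

/-- The words of the code belonging to the basis vectors. -/
def basisWord (i : Fin 14) : Fin 4 → ZMod 3 :=
  if i = 0 then ![1, 2, 2, 0] else if i = 1 then ![0, 1, 0, 0] else if i = 2 then ![0, 0, 1, 0]
  else if i = 3 then ![0, 0, 0, 1] else 0

/-- The vectors whose residues modulo `3` are governed by the code. -/
def InStd (y : Fin 14 → ℂ) : Prop :=
  (∀ j, y j ∈ 𝓞) ∧ ∃ z : Fin 4 → ZMod 3, (∀ j, cc (y j) = z ⬝ᵥ codeCol j) ∧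
    ∑ j, uu (y j) • codeCol j = B₀ *ᵥ z

lemma sum_codeCol_mul : ∀ k l, ∑ j, codeCol j k * codeCol j l = 0 := by decide +kernel

lemma sum_dotProduct_smul_codeCol (z : Fin 4 → ZMod 3) :
    ∑ j, (z ⬝ᵥ codeCol j) • codeCol j = 0 := by
  ext l
  simp only [Finset.sum_apply, Pi.smul_apply, smul_eq_mul, dotProduct, Finset.sum_mul]
  rw [Finset.sum_comm]
  refine Finset.sum_eq_zero fun k _ => ?_
  simp only [mul_assoc]
  rw [← Finset.mul_sum, sum_codeCol_mul, mul_zero]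

lemma InStd.zero : InStd 0 :=
  ⟨fun _ => zero_mem _, 0, fun j => by simp [cc_zero], by simp [uu_zero]⟩

lemma InStd.add {y y' : Fin 14 → ℂ} (h : InStd y) (h' : InStd y') : InStd (y + y') := by
  obtain ⟨hm, z, hc, hu⟩ := h
  obtain ⟨hm', z', hc', hu'⟩ := h'
  refine ⟨fun j => add_mem (hm j) (hm' j), z + z', fun j => ?_, ?_⟩
  · rw [Pi.add_apply, cc_add (hm j) (hm' j), hc, hc', add_dotProduct]
  · simp only [Pi.add_apply, uu_add (hm _) (hm' _), add_smul, Finset.sum_add_distrib, hu, hu',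
      mulVec_add]

lemma InStd.smul {y : Fin 14 → ℂ} {w : ℂ} (hw : w ∈ 𝓞) (h : InStd y) : InStd (w • y) := by
  obtain ⟨hm, z, hc, hu⟩ := h
  refine ⟨fun j => mul_mem hw (hm j), cc w • z, fun j => ?_, ?_⟩
  · rw [Pi.smul_apply, smul_eq_mul, cc_mul hw (hm j), hc, smul_dotProduct, smul_eq_mul]
  · simp only [Pi.smul_apply, smul_eq_mul, uu_mul hw (hm _), add_smul, Finset.sum_add_distrib,
      mul_smul, ← Finset.smul_sum, hu, hc, sum_dotProduct_smul_codeCol, smul_zero, add_zero,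
      mulVec_smul]

lemma InStd.sum {ι : Type*} {s : Finset ι} {f : ι → Fin 14 → ℂ} (h : ∀ i ∈ s, InStd (f i)) :
    InStd (∑ i ∈ s, f i) :=
  Finset.sum_induction f InStd (fun _ _ => InStd.add) InStd.zero h

/-- The vectors of the basis. -/
noncomputable def basisVec (i j : Fin 14) : ℂ := basisOne i j + basisω i j * ω

lemma basisVec_mem (i j : Fin 14) : basisVec i j ∈ 𝓞 := mem_𝓞_iff.2 ⟨_, _, rfl⟩

lemma cc_basis : ∀ i j, ((basisOne i j : ZMod 3) + basisω i j) = basisWord i ⬝ᵥ codeCol j := by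
  decide +kernel

lemma uu_basis : ∀ i k, ∑ j, -(basisω i j : ZMod 3) * codeCol j k = (B₀ *ᵥ basisWord i) k := by
  decide +kernel

lemma inStd_basisVec (i : Fin 14) : InStd (basisVec i) := by
  refine ⟨basisVec_mem i, basisWord i, fun j => ?_, ?_⟩
  · rw [basisVec, cc_add_mul_ω, cc_basis]
  · ext k
    simp only [basisVec, uu_add_mul_ω, Finset.sum_apply, Pi.smul_apply, smul_eq_mul, uu_basis]

lemma mnorm_le_norm_sq {z : ℂ} (hz : z ∈ 𝓞) : (mnorm (cc z) (uu z) : ℝ) ≤ ‖z‖ ^ 2 := by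
  obtain ⟨a, b, rfl⟩ := mem_𝓞_iff.1 hz
  rw [norm_sq_add_mul_ω, cc_add_mul_ω, uu_add_mul_ω, mnorm]
  have hpos : 0 ≤ a ^ 2 - a * b + b ^ 2 := by nlinarith [sq_nonneg (a - b), sq_nonneg (a + b)]
  split_ifs with h1 h2
  · exact_mod_cast hpos
  · have h3 : ((a + b : ℤ) : ZMod 3) = 0 := by push_cast; exact h1
    obtain ⟨k, hk⟩ := (ZMod.intCast_zmod_eq_zero_iff_dvd _ 3).1 h3
    have hb : b ≠ 0 := by rintro rfl; simp at h2
    obtain rfl : a = 3 * k - b := by push_cast at hk; linarith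
    have : 0 < b ^ 2 := by positivity
    have : 1 ≤ (3 * k ^ 2 - 3 * k * b + b ^ 2) := by nlinarith [sq_nonneg (2 * k - b)]
    have : 3 ≤ (3 * k - b) ^ 2 - (3 * k - b) * b + b ^ 2 := by nlinarith
    exact_mod_cast this
  · have : a ^ 2 - a * b + b ^ 2 ≠ 0 := by
      intro h0
      have hb : b = 0 := by nlinarith [sq_nonneg (2 * a - b), sq_nonneg b]
      have ha : a = 0 := by subst hb; nlinarith
      simp [ha, hb] at h1
    have : 1 ≤ a ^ 2 - a * b + b ^ 2 := by omega
    exact_mod_cast this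

lemma codeCol_independent : ∀ j k : Fin 14, j ≠ k → ∀ a b : ZMod 3, a ≠ 0 →
    a • codeCol j + b • codeCol k ≠ 0 := by
  decide +kernel

lemma codeWord_weight : ∀ a b c d : ZMod 3, ![a, b, c, d] ≠ 0 →
    9 ≤ (Finset.univ.filter fun j => ![a, b, c, d] ⬝ᵥ codeCol j ≠ 0).card ∨
    6 ≤ (Finset.univ.filter fun j => ![a, b, c, d] ⬝ᵥ codeCol j ≠ 0).card ∧
    ∃ a' b' c' d' : ZMod 3,
      (∀ j, ![a, b, c, d] ⬝ᵥ codeCol j ≠ 0 → ![a', b', c', d'] ⬝ᵥ codeCol j = 0) ∧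
      ![a', b', c', d'] ⬝ᵥ (B₀ *ᵥ ![a, b, c, d]) ≠ 0 := by
  decide +kernel

end Existence

section Existence

lemma codeWord_weight' {z : Fin 4 → ZMod 3} (hz : z ≠ 0) :
    9 ≤ (Finset.univ.filter fun j => z ⬝ᵥ codeCol j ≠ 0).card ∨
    6 ≤ (Finset.univ.filter fun j => z ⬝ᵥ codeCol j ≠ 0).card ∧
    ∃ l : Fin 4 → ZMod 3, (∀ j, z ⬝ᵥ codeCol j ≠ 0 → l ⬝ᵥ codeCol j = 0) ∧ l ⬝ᵥ (B₀ *ᵥ z) ≠ 0 := by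
  have hz' : ![z 0, z 1, z 2, z 3] = z := by ext i; fin_cases i <;> rfl
  have := codeWord_weight (z 0) (z 1) (z 2) (z 3)
  rw [hz'] at this
  exact (this hz).imp_right fun ⟨h6, a, b, c, d, h⟩ => ⟨h6, _, h⟩

lemma nine_le_sum_mnorm_zero {u : Fin 14 → ZMod 3} (hu : ∑ j, u j • codeCol j = 0) (hu0 : u ≠ 0) :
    9 ≤ ∑ j, mnorm 0 (u j) := by
  have hsum : ∑ j, mnorm 0 (u j) = 3 * (Finset.univ.filter fun j => u j ≠ 0).card := by
    rw [Finset.card_filter, Finset.mul_sum]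
    refine Finset.sum_congr rfl fun j _ => ?_
    by_cases h : u j = 0 <;> simp [mnorm, h]
  by_contra! hlt
  have hcard : (Finset.univ.filter fun j => u j ≠ 0).card ≤ 2 := by omega
  obtain ⟨j, hj⟩ := Function.ne_iff.1 hu0
  have hj : u j ≠ 0 := hj
  obtain ⟨k, hkj, hk⟩ : ∃ k, k ≠ j ∧ ∀ i, i ≠ j → i ≠ k → u i = 0 := by
    by_cases hex : ∃ k, k ≠ j ∧ u k ≠ 0
    · obtain ⟨k, hkj, hk0⟩ := hex
      refine ⟨k, hkj, fun i hij hik => ?_⟩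
      by_contra hi
      have : ({i, j, k} : Finset (Fin 14)) ⊆ Finset.univ.filter fun j => u j ≠ 0 := by
        intro m hm
        simp only [Finset.mem_insert, Finset.mem_singleton] at hm
        rw [Finset.mem_filter]
        rcases hm with rfl | rfl | rfl <;> exact ⟨Finset.mem_univ _, ‹_›⟩
      have := Finset.card_le_card this
      rw [Finset.card_eq_three.2 ⟨i, j, k, hij, hik, hkj.symm, rfl⟩] at this
      omega
    · push Not at hex
      obtain ⟨k, hk⟩ := exists_ne j
      exact ⟨k, hk, fun i hi _ => hex i hi⟩
  refine codeCol_independent j k hkj.symm (u j) (u k) hj ?_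
  rw [← hu, ← Finset.sum_subset (Finset.subset_univ {j, k}), Finset.sum_pair hkj.symm]
  intro i _ hi
  rw [Finset.mem_insert, Finset.mem_singleton, not_or] at hi
  rw [hk i hi.1 hi.2, zero_smul]

lemma nine_le_sum_mnorm {z : Fin 4 → ZMod 3} {u : Fin 14 → ZMod 3} (hz : z ≠ 0)
    (hu : ∑ j, u j • codeCol j = B₀ *ᵥ z) : 9 ≤ ∑ j, mnorm (z ⬝ᵥ codeCol j) (u j) := by
  have hle : ∀ c v : ZMod 3, (if c ≠ 0 then 1 else 0) ≤ mnorm c v := by decide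
  rcases codeWord_weight' hz with h9 | ⟨h6, l, hl, hne⟩
  · rw [Finset.card_filter] at h9
    exact h9.trans (Finset.sum_le_sum fun j _ => hle _ _)
  · rw [← hu, dotProduct_sum] at hne
    obtain ⟨j, -, hj⟩ := Finset.exists_ne_zero_of_sum_ne_zero hne
    rw [dotProduct_smul, smul_eq_mul] at hj
    have hzj : z ⬝ᵥ codeCol j = 0 := by
      by_contra h
      exact hj (by rw [hl j h, mul_zero])
    have huj := left_ne_zero_of_mul hj
    rw [Finset.card_filter] at h6
    have h3 : mnorm (z ⬝ᵥ codeCol j) (u j) = 3 := by simp [mnorm, hzj, huj]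
    rw [← Finset.add_sum_erase _ _ (Finset.mem_univ j), h3]
    rw [← Finset.add_sum_erase _ _ (Finset.mem_univ j), if_neg (not_not.2 hzj), zero_add] at h6
    have := h6.trans (Finset.sum_le_sum fun i _ => hle _ (u i))
    omega

lemma InStd.nine_le {y : Fin 14 → ℂ} (h : InStd y) (hy : y ≠ 0) : 9 ≤ ∑ j, ‖y j‖ ^ 2 := by
  obtain ⟨hm, z, hc, hu⟩ := h
  have hle : ((∑ j, mnorm (z ⬝ᵥ codeCol j) (uu (y j)) : ℕ) : ℝ) ≤ ∑ j, ‖y j‖ ^ 2 := by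
    push_cast
    refine Finset.sum_le_sum fun j _ => ?_
    rw [← hc]
    exact mnorm_le_norm_sq (hm j)
  suffices (9 : ℕ) ≤ ∑ j, mnorm (z ⬝ᵥ codeCol j) (uu (y j)) ∨ 9 ≤ ∑ j, ‖y j‖ ^ 2 from
    this.elim (fun h9 => le_trans (by exact_mod_cast h9) hle) id
  by_cases hz : z = 0
  · subst hz
    simp only [zero_dotProduct] at hc ⊢
    rw [mulVec_zero] at hu
    by_cases hu0 : (fun j => uu (y j)) = 0
    · right
      obtain ⟨j, hj⟩ := Function.ne_iff.1 hy
      obtain ⟨n, hn⟩ := exists_nat_norm_sq (div_three_mem (hm j) (hc j) (congrFun hu0 j))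
      have hn0 : n ≠ 0 := by
        rintro rfl
        simp at hn
        exact hj hn
      have h1 : (1 : ℝ) ≤ n := by exact_mod_cast Nat.one_le_iff_ne_zero.2 hn0
      rw [norm_div, div_pow, RCLike.norm_ofNat] at hn
      refine le_trans ?_ (Finset.single_le_sum (f := fun j => ‖y j‖ ^ 2)
        (fun _ _ => by positivity) (Finset.mem_univ j))
      linarith
    · exact Or.inl (nine_le_sum_mnorm_zero hu hu0)
  · exact Or.inl (nine_le_sum_mnorm hz hu)

/-- The matrix whose columns are the basis vectors. -/
noncomputable def codeBasis : Matrix (Fin 14) (Fin 14) ℂ := of fun j i => basisVec i j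

/-- The Gram matrix of the basis. -/
noncomputable def codeGram : Matrix (Fin 14) (Fin 14) ℂ := (1 / 3 : ℂ) • (codeBasisᴴ * codeBasis)

lemma inStd_mulVec {x : Fin 14 → ℂ} (hx : IsLatVec x) : InStd (codeBasis *ᵥ x) := by
  have : codeBasis *ᵥ x = ∑ i, x i • basisVec i := by
    ext j
    simp [mulVec, dotProduct, codeBasis, mul_comm]
  rw [this]
  exact InStd.sum fun i _ => (inStd_basisVec i).smul (hx i)

lemma latNorm_codeGram (x : Fin 14 → ℂ) :
    latNorm codeGram x = ((∑ j, ‖(codeBasis *ᵥ x) j‖ ^ 2 : ℝ) : ℂ) / 3 := by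
  rw [latNorm, codeGram, smul_mulVec, dotProduct_smul, ← mulVec_mulVec, dotProduct_mulVec,
    ← star_mulVec, dotProduct]
  push_cast
  rw [smul_eq_mul, div_mul_eq_mul_div, one_mul]
  simp [conj_mul']

lemma basis_triangular : ∀ i j : Fin 14, j < i → basisOne i j = 0 ∧ basisω i j = 0 := by
  decide +kernel

lemma det_codeBasis : codeBasis.det = -(3 ^ 7) := by
  have hθ : (1 + 2 * ω) ^ 2 = -3 := by linear_combination 4 * ω_sq
  rw [det_of_isLowerTriangular]
  · simp only [codeBasis, of_apply, basisVec, Fin.prod_univ_succ]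
    simp [basisOne, basisω]
    linear_combination 81 * ((1 + 2 * ω) ^ 4 - 3 * (1 + 2 * ω) ^ 2 + 9) * hθ
  · intro j i hij
    rw [OrderDual.toDual_lt_toDual] at hij
    simp [codeBasis, basisVec, basis_triangular i j hij]

lemma three_dvd_basis : ∀ i k : Fin 14,
    (3 ∣ ∑ j, ((basisOne i j - basisω i j) * basisOne k j + basisω i j * basisω k j)) ∧
    3 ∣ ∑ j, ((basisOne i j - basisω i j) * basisω k j - basisω i j * basisOne k j
      + basisω i j * basisω k j) := by
  decide +kernel

lemma entriesIn_codeGram : EntriesIn codeGram := by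
  intro i k
  obtain ⟨⟨m, hm⟩, n, hn⟩ := three_dvd_basis i k
  refine mem_𝓞_iff.2 ⟨m, n, ?_⟩
  have key : (codeBasisᴴ * codeBasis) i k = 3 * (m + n * ω) := by
    rw [mul_add, ← mul_assoc, ← Int.cast_ofNat (R := ℂ) 3, ← Int.cast_mul, ← Int.cast_mul, ← hm, ← hn]
    push_cast
    rw [Finset.sum_mul, ← Finset.sum_add_distrib, mul_apply]
    refine Finset.sum_congr rfl fun j _ => ?_
    simp only [conjTranspose_apply, codeBasis, of_apply, basisVec, RCLike.star_def]
    rw [conj_add_mul_ω]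
    push_cast
    linear_combination -(basisω i j * basisω k j : ℂ) * ω_sq
  rw [codeGram, Matrix.smul_apply, key, smul_eq_mul]
  ring

theorem isUnimodular_codeGram : IsUnimodular codeGram := by
  have hunit : IsUnit codeBasis := by
    rw [isUnit_iff_isUnit_det, det_codeBasis]
    norm_num
  have hpos : codeGram.PosDef :=
    (PosDef.conjTranspose_mul_self _ (mulVec_injective_of_isUnit hunit)).smul
      (by positivity)
  refine ⟨⟨entriesIn_codeGram, hpos.isHermitian, hpos⟩, ?_⟩
  rw [codeGram, det_smul, det_mul, det_conjTranspose, det_codeBasis]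
  norm_num

lemma three_le_latNorm_codeGram {x : Fin 14 → ℂ} (hx : IsLatVec x) (hx0 : x ≠ 0) :
    3 ≤ (latNorm codeGram x).re := by
  have hne : codeBasis *ᵥ x ≠ 0 := fun h =>
    hx0 (eq_zero_of_mulVec_eq_zero (by rw [det_codeBasis]; norm_num) h)
  have := (inStd_mulVec hx).nine_le hne
  rw [latNorm_codeGram]
  norm_cast
  linarith

lemma latNorm_codeGram_ne {n : ℕ} (hn0 : n ≠ 0) (hn : n < 3) {x : Fin 14 → ℂ} (hx : IsLatVec x) :
    latNorm codeGram x ≠ n := by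
  intro h
  by_cases hx0 : x = 0
  · subst hx0
    simp [latNorm] at h
    exact hn0 (by exact_mod_cast h.symm)
  · have := three_le_latNorm_codeGram hx hx0
    rw [h, natCast_re] at this
    have : 3 ≤ n := by exact_mod_cast this
    omega

end Existence

/-- The unique indecomposable unimodular hermitian `𝓞`-lattice of rank 14 without
roots has automorphism group of order `2⁸·3⁷·7·13 = 50948352`. -/
theorem stmt_4 :
    (∃ H : Matrix (Fin 14) (Fin 14) ℂ, IsUnimodular H ∧ ¬ Decomposable H ∧ RootFree H) ∧
    ∀ H : Matrix (Fin 14) (Fin 14) ℂ,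
      IsUnimodular H → ¬ Decomposable H → RootFree H →
      autCard H = 2 ^ 8 * 3 ^ 7 * 7 * 13 := by
  refine ⟨⟨codeGram, isUnimodular_codeGram, ?_, fun x hx => ?_⟩, fun H hU hd hr => ?_⟩
  · obtain ⟨P, hP⟩ := exists_factor isUnimodular_codeGram
    obtain ⟨X, h⟩ := exists_goodLat isUnimodular_codeGram hP
      (fun x => latNorm_codeGram_ne one_ne_zero (by norm_num))
      (fun x => latNorm_codeGram_ne two_ne_zero (by norm_num))
    exact not_decomposable_of_goodLat isUnimodular_codeGram hP h
  · exact latNorm_codeGram_ne two_ne_zero (by norm_num) hx.1 (by exact_mod_cast hx.2)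
  · obtain ⟨P, hP⟩ := exists_factor hU
    obtain ⟨X, h⟩ := exists_goodLat_of_not_decomposable hU hP hd hr
    exact autCard_eq hU hP h
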